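/- There exists a C² function u : ℝ⁸ → ℝ that satisfies the minimal surface equation div(Du / √(1 + |Du|²)) = 0 at every point of ℝ⁸ and is not affine linear. Hence the Bernstein theorem fails in dimension 8. -/

import Mathlib

open scoped RealInnerProductSpace

/-- `j`-th first partial derivative of `u : ℝⁿ → ℝ`. -/
noncomputable def pd {n : ℕ} (u : EuclideanSpace ℝ (Fin n) → ℝ)
    (x : EuclideanSpace ℝ (Fin n)) (j : Fin n) : ℝ :=
  fderiv ℝ u x (EuclideanSpace.single j 1)

/-- Second partial derivative `u_{x_j x_k}` of `u : ℝⁿ → ℝ`. -/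
noncomputable def pd2 {n : ℕ} (u : EuclideanSpace ℝ (Fin n) → ℝ)
    (x : EuclideanSpace ℝ (Fin n)) (j k : Fin n) : ℝ :=
  fderiv ℝ (fun y => fderiv ℝ u y (EuclideanSpace.single j 1)) x (EuclideanSpace.single k 1)

namespace BDG

open MeasureTheory Filter Topology Set Metric
open scoped NNReal ENNReal Gradient ContDiff

/-- The ambient space. -/
abbrev E := EuclideanSpace ℝ (Fin 8)

/-- Area integrand. -/
noncomputable def F (p : E) : ℝ := Real.sqrt (1 + ‖p‖ ^ 2)

/-- Its gradient. -/
noncomputable def DF (p : E) : E := (F p)⁻¹ • p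

lemma F_sq (p : E) : F p ^ 2 = 1 + ‖p‖ ^ 2 := Real.sq_sqrt (by positivity)
lemma F_pos (p : E) : 0 < F p := Real.sqrt_pos.2 (by positivity)
lemma one_le_F (p : E) : 1 ≤ F p := by
  have := F_sq p; have := F_pos p; nlinarith [sq_nonneg ‖p‖]
lemma F_le (p : E) : F p ≤ 1 + ‖p‖ := by
  have := F_sq p; have := F_pos p; nlinarith [norm_nonneg p]
lemma norm_le_F (p : E) : ‖p‖ ≤ F p := by
  have := F_sq p; have := F_pos p; nlinarith [norm_nonneg p]
lemma F_mono {p q : E} (h : ‖p‖ ≤ ‖q‖) : F p ≤ F q :=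
  Real.sqrt_le_sqrt (by gcongr)

lemma norm_DF_le (p : E) : ‖DF p‖ ≤ 1 := by
  rw [DF, norm_smul, norm_inv, Real.norm_of_nonneg (F_pos p).le, inv_mul_le_iff₀ (F_pos p)]
  simpa using norm_le_F p

lemma F_continuous : Continuous F := by unfold F; fun_prop
lemma DF_continuous : Continuous DF :=
  (F_continuous.inv₀ (fun p => (F_pos p).ne')).smul continuous_id

lemma cs_F (p q : E) : 1 + ⟪p, q⟫ ≤ F p * F q := by
  have h1 := F_sq p; have h2 := F_sq q
  have h3 := abs_real_inner_le_norm p q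
  have h4 := le_abs_self ⟪p, q⟫
  have h5 : 1 + ‖p‖ * ‖q‖ ≤ F p * F q := by
    apply le_of_sq_le_sq _ (mul_pos (F_pos p) (F_pos q)).le
    rw [mul_pow, h1, h2]; nlinarith [sq_nonneg (‖p‖ - ‖q‖)]
  linarith

/-- `(F p)⁻¹` pairing. -/
lemma inner_DF (p v : E) : ⟪DF p, v⟫ = ⟪p, v⟫ / F p := by
  rw [DF, real_inner_smul_left]; field_simp

lemma F_convex (p q : E) : F p + ⟪DF p, q - p⟫ ≤ F q := by
  rw [inner_DF, inner_sub_right, real_inner_self_eq_norm_sq]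
  have := cs_F p q; have h1 := F_sq p; have := F_pos p
  rw [← sub_nonneg]
  have : F q - (F p + (⟪p, q⟫ - ‖p‖ ^ 2) / F p) = (F p * F q - 1 - ⟪p, q⟫) / F p := by
    field_simp; linarith
  rw [this]; apply div_nonneg <;> linarith

lemma F_upper (p q : E) : F q ≤ F p + ⟪DF p, q - p⟫ + ‖q - p‖ ^ 2 / 2 := by
  rw [inner_DF, inner_sub_right, real_inner_self_eq_norm_sq, norm_sub_sq_real]
  have h1 := F_sq p; have h2 := F_sq q; have h0 := F_pos p; have h3 := F_pos q
  have h4 := one_le_F p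
  rw [real_inner_comm q p]
  have e : F p + (⟪q, p⟫ - ‖p‖ ^ 2) / F p + (‖q‖ ^ 2 - 2 * ⟪q, p⟫ + ‖p‖ ^ 2) / 2 - F q
    = (F q - F p) ^ 2 / (2 * F p) + (1 - 1 / F p) * ((‖q‖ ^ 2 - 2 * ⟪q, p⟫ + ‖p‖ ^ 2) / 2) := by
    field_simp
    have k1 : ‖q‖ ^ 2 = F q ^ 2 - 1 := by linarith
    have k2 : ‖p‖ ^ 2 = F p ^ 2 - 1 := by linarith
    rw [k1, k2]; ring
  have h5 : 0 ≤ ‖q‖ ^ 2 - 2 * ⟪q, p⟫ + ‖p‖ ^ 2 := by rw [← norm_sub_sq_real]; positivity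
  have h6 : 0 ≤ 1 - 1 / F p := by
    rw [sub_nonneg, div_le_one h0]; exact h4
  have : 0 ≤ (F q - F p) ^ 2 / (2 * F p) := by positivity
  nlinarith [mul_nonneg h6 (div_nonneg h5 (by norm_num : (0:ℝ) ≤ 2))]

/-- Averaged Hessian: `DF p - DF q = A p q (p - q)`. -/
noncomputable def A (p q v : E) : E :=
  ((1 / F p + 1 / F q) / 2) • v - (⟪p + q, v⟫ / (2 * F p * F q * (F p + F q))) • (p + q)

lemma A_spec (p q : E) : DF p - DF q = A p q (p - q) := by
  have h1 := F_sq p; have h2 := F_sq q; have h0 := F_pos p; have h3 := F_pos q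
  have e : ⟪p + q, p - q⟫ = (F p - F q) * (F p + F q) := by
    rw [inner_add_left, inner_sub_right, inner_sub_right, real_inner_self_eq_norm_sq,
      real_inner_self_eq_norm_sq, real_inner_comm p q]; nlinarith
  have e2 : ⟪p + q, p - q⟫ / (2 * F p * F q * (F p + F q)) = (1 / F q - 1 / F p) / 2 := by
    rw [e]; field_simp
  unfold A DF
  rw [e2]; module

lemma A_symm (p q v w : E) : ⟪A p q v, w⟫ = ⟪v, A p q w⟫ := by
  unfold A
  simp only [inner_sub_left, inner_sub_right, real_inner_smul_left, real_inner_smul_right]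
  rw [real_inner_comm v (p + q)]
  ring

lemma inner_A_self (p q v : E) : ⟪A p q v, v⟫ =
    (1 / F p + 1 / F q) / 2 * ‖v‖ ^ 2 - ⟪p + q, v⟫ ^ 2 / (2 * F p * F q * (F p + F q)) := by
  unfold A
  simp only [inner_sub_left, real_inner_smul_left]
  rw [real_inner_self_eq_norm_sq]; ring

lemma A_lower {p q : E} {L : ℝ} (hp : F p ≤ L) (hq : F q ≤ L) (v : E) :
    (1 / L ^ 3) * ‖v‖ ^ 2 ≤ ⟪A p q v, v⟫ := by
  rw [inner_A_self]
  have h1 := F_sq p; have h2 := F_sq q; have h0 := F_pos p; have h3 := F_pos q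
  have hL : 0 < L := h0.trans_le hp
  have c1 : ⟪p + q, v⟫ ^ 2 ≤ ‖p + q‖ ^ 2 * ‖v‖ ^ 2 := by
    rw [← mul_pow, sq_le_sq, abs_of_nonneg (by positivity : 0 ≤ ‖p + q‖ * ‖v‖)]
    exact abs_real_inner_le_norm _ _
  have c2 : ‖p + q‖ ^ 2 ≤ (F p + F q) ^ 2 - 4 := by
    rw [norm_add_sq_real]; have := cs_F p q; nlinarith
  have e : (1 / F p + 1 / F q) / 2 * ‖v‖ ^ 2
      = (F p + F q) ^ 2 * ‖v‖ ^ 2 / (2 * F p * F q * (F p + F q)) := by field_simp; ring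
  rw [e, ← sub_div, le_div_iff₀ (by positivity)]
  have c3 : 2 * F p * F q * (F p + F q) ≤ 4 * L ^ 3 := by
    calc 2 * F p * F q * (F p + F q) ≤ 2 * L * L * (L + L) := by gcongr
      _ = 4 * L ^ 3 := by ring
  calc 1 / L ^ 3 * ‖v‖ ^ 2 * (2 * F p * F q * (F p + F q))
      ≤ 1 / L ^ 3 * ‖v‖ ^ 2 * (4 * L ^ 3) := by gcongr
    _ = 4 * ‖v‖ ^ 2 := by field_simp
    _ ≤ _ := by nlinarith [sq_nonneg ‖v‖]

lemma A_upper (p q v : E) : ‖A p q v‖ ≤ ‖v‖ := by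
  have h1 := F_sq p; have h2 := F_sq q; have h0 := F_pos p; have h3 := F_pos q
  have h4 := one_le_F p; have h5 := one_le_F q
  set a := (1 / F p + 1 / F q) / 2 with ha
  set k := 1 / (2 * F p * F q * (F p + F q)) with hk
  have hk0 : 0 < k := by positivity
  have ha0 : 0 < a := by positivity
  have ha1 : a ≤ 1 := by
    have : 1 / F p ≤ 1 := by rw [div_le_one h0]; exact h4
    have : 1 / F q ≤ 1 := by rw [div_le_one h3]; exact h5
    rw [ha]; linarith
  have c2 : ‖p + q‖ ^ 2 ≤ (F p + F q) ^ 2 := by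
    rw [norm_add_sq_real]; have := cs_F p q; nlinarith
  have e1 : a = k * (F p + F q) ^ 2 := by rw [ha, hk]; field_simp; ring
  have e : A p q v = a • v - (k * ⟪p + q, v⟫) • (p + q) := by
    unfold A; rw [← ha, hk]; congr 2; ring
  have e2 : ‖A p q v‖ ^ 2 = a ^ 2 * ‖v‖ ^ 2 - k * ⟪p + q, v⟫ ^ 2 * (2 * a - k * ‖p + q‖ ^ 2) := by
    rw [e, norm_sub_sq_real, norm_smul, norm_smul, mul_pow, mul_pow, real_inner_smul_left,
      real_inner_smul_right, Real.norm_eq_abs, Real.norm_eq_abs, sq_abs, sq_abs,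
      real_inner_comm (p + q) v]
    ring
  apply le_of_sq_le_sq _ (norm_nonneg v)
  rw [e2]
  have : 0 ≤ 2 * a - k * ‖p + q‖ ^ 2 := by
    have : k * ‖p + q‖ ^ 2 ≤ a := by rw [e1]; gcongr
    linarith
  have : 0 ≤ k * ⟪p + q, v⟫ ^ 2 * (2 * a - k * ‖p + q‖ ^ 2) := by positivity
  have : a ^ 2 * ‖v‖ ^ 2 ≤ 1 * ‖v‖ ^ 2 := by gcongr; nlinarith
  linarith

lemma DF_lip (p q : E) : ‖DF p - DF q‖ ≤ ‖p - q‖ := by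
  rw [A_spec]; exact A_upper p q _

lemma DF_mono {p q : E} {L : ℝ} (hp : F p ≤ L) (hq : F q ≤ L) :
    (1 / L ^ 3) * ‖p - q‖ ^ 2 ≤ ⟪DF p - DF q, p - q⟫ := by
  rw [A_spec]; exact A_lower hp hq _

/-- Strong convexity at midpoints. -/
lemma F_mid {p q : E} {L : ℝ} (hp : F p ≤ L) (hq : F q ≤ L) :
    F ((1 / 2 : ℝ) • (p + q)) + (1 / (8 * L ^ 3)) * ‖p - q‖ ^ 2 ≤ (F p + F q) / 2 := by
  have h1 := F_sq p; have h2 := F_sq q; have h0 := F_pos p; have h3 := F_pos q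
  set m := (1 / 2 : ℝ) • (p + q) with hm
  have hL : 0 < L := h0.trans_le hp
  have c := cs_F p q
  have hn : ‖p - q‖ ^ 2 = F p ^ 2 + F q ^ 2 - 2 - 2 * ⟪p, q⟫ := by
    rw [norm_sub_sq_real]; linarith
  have hmn : F m ^ 2 = ((F p + F q) / 2) ^ 2 - (F p * F q - 1 - ⟪p, q⟫) / 2 := by
    rw [F_sq, hm, norm_smul, mul_pow, norm_add_sq_real]; norm_num; nlinarith
  -- lower bound for the defect
  set d := F p * F q - 1 - ⟪p, q⟫ with hd
  have hd0 : 0 ≤ d := by linarith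
  have hn2 : ‖p - q‖ ^ 2 = (F p - F q) ^ 2 + 2 * d := by rw [hn, hd]; ring
  have hdn : ‖p - q‖ ^ 2 ≤ 2 * L ^ 2 * d := by
    have q1 := one_le_F p; have q2 := one_le_F q
    by_contra hcon
    push Not at hcon
    rw [hn2] at hcon
    -- (Fp-Fq)^2 ≤ ...
    have cs3 := abs_real_inner_le_norm p q
    have cs4 := le_abs_self ⟪p, q⟫
    have dlow : F p * F q - 1 - ‖p‖ * ‖q‖ ≤ d := by rw [hd]; linarith
    have e5 : (F p * F q - 1 - ‖p‖ * ‖q‖) * (F p * F q - 1 + ‖p‖ * ‖q‖) = (F p - F q) ^ 2 := by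
      have : (‖p‖ * ‖q‖) ^ 2 = (F p ^ 2 - 1) * (F q ^ 2 - 1) := by
        rw [mul_pow]; congr 1 <;> linarith
      linear_combination -this
    have e6 : F p * F q - 1 + ‖p‖ * ‖q‖ ≤ 2 * L ^ 2 - 2 := by
      have a1 : F p * F q ≤ L ^ 2 := by
        rw [sq]; exact mul_le_mul hp hq h3.le hL.le
      have a2 : 1 + ‖p‖ * ‖q‖ ≤ F p * F q := by
        apply le_of_sq_le_sq _ (mul_pos h0 h3).le
        rw [mul_pow, h1, h2]; nlinarith [sq_nonneg (‖p‖ - ‖q‖)]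
      linarith
    have e7 : 0 ≤ F p * F q - 1 + ‖p‖ * ‖q‖ := by
      have w1 := mul_nonneg (norm_nonneg p) (norm_nonneg q)
      have w2 := one_le_mul_of_one_le_of_one_le q1 q2
      linarith
    have e8 : (F p - F q) ^ 2 ≤ d * (2 * L ^ 2 - 2) := by
      rw [← e5]; calc _ ≤ d * (F p * F q - 1 + ‖p‖ * ‖q‖) := by gcongr
        _ ≤ _ := by gcongr
    linarith
  have hm0 := F_pos m
  -- (avg - Fm) (avg + Fm) = d/2
  have fac : ((F p + F q) / 2 - F m) * ((F p + F q) / 2 + F m) = d / 2 := by linear_combination -hmn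
  have up : F m ≤ (F p + F q) / 2 := by
    apply le_of_sq_le_sq _ (by positivity); linarith
  have e9 : d / 2 ≤ ((F p + F q) / 2 - F m) * (2 * L) := by
    rw [← fac]; apply mul_le_mul_of_nonneg_left _ (by linarith); linarith
  have : 1 / (8 * L ^ 3) * ‖p - q‖ ^ 2 ≤ d / (4 * L) := by
    calc 1 / (8 * L ^ 3) * ‖p - q‖ ^ 2 ≤ 1 / (8 * L ^ 3) * (2 * L ^ 2 * d) := by gcongr
      _ = _ := by field_simp; ring
  have : d / (4 * L) ≤ (F p + F q) / 2 - F m := by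
    rw [div_le_iff₀ (by positivity)]; linarith
  linarith

end BDG

open scoped RealInnerProductSpace
namespace BDG
open MeasureTheory Filter Topology Set Metric
open scoped NNReal ENNReal Gradient ContDiff

lemma grad_apply (u : E → ℝ) (x v : E) : ⟪∇ u x, v⟫ = fderiv ℝ u x v := inner_gradient_left

lemma grad_eq_of_fderiv {u : E → ℝ} {x g : E} (h : ∀ v, fderiv ℝ u x v = ⟪g, v⟫) : ∇ u x = g :=
  ext_inner_right ℝ fun v => by rw [grad_apply, h]

lemma norm_grad (u : E → ℝ) (x : E) : ‖∇ u x‖ = ‖fderiv ℝ u x‖ := by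
  rw [← toDual_gradient, LinearIsometryEquiv.norm_map]

lemma norm_grad_le {K : ℝ≥0} {u : E → ℝ} (hu : LipschitzWith K u) (x : E) : ‖∇ u x‖ ≤ K := by
  rw [norm_grad]; exact norm_fderiv_le_of_lipschitz ℝ hu

lemma norm_grad_le_on {K : ℝ≥0} {u : E → ℝ} {s : Set E} {x : E} (hs : s ∈ 𝓝 x)
    (hu : LipschitzOnWith K u s) : ‖∇ u x‖ ≤ K := by
  rw [norm_grad]; exact norm_fderiv_le_of_lipschitzOn ℝ hs hu

lemma measurable_grad (u : E → ℝ) : Measurable (∇ u) :=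
  (InnerProductSpace.toDual ℝ E).symm.continuous.measurable.comp (measurable_fderiv ℝ u)

lemma grad_congr {u v : E → ℝ} {U : Set E} (hU : IsOpen U) (h : ∀ x ∈ U, u x = v x) {x : E}
    (hx : x ∈ U) : ∇ u x = ∇ v x :=
  Filter.EventuallyEq.gradient_eq (by filter_upwards [hU.mem_nhds hx] with y hy using h y hy)

lemma grad_const (c : ℝ) (x : E) : ∇ (fun _ => c) x = (0 : E) :=
  grad_eq_of_fderiv (by simp)

lemma grad_add {u v : E → ℝ} {x : E} (hu : DifferentiableAt ℝ u x) (hv : DifferentiableAt ℝ v x) :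
    ∇ (fun y => u y + v y) x = ∇ u x + ∇ v x :=
  grad_eq_of_fderiv fun w => by
    rw [inner_add_left, grad_apply, grad_apply, fderiv_fun_add hu hv]; rfl

lemma grad_sub {u v : E → ℝ} {x : E} (hu : DifferentiableAt ℝ u x) (hv : DifferentiableAt ℝ v x) :
    ∇ (fun y => u y - v y) x = ∇ u x - ∇ v x :=
  grad_eq_of_fderiv fun w => by
    rw [inner_sub_left, grad_apply, grad_apply, fderiv_fun_sub hu hv]; rfl

lemma grad_const_mul {u : E → ℝ} {x : E} (c : ℝ) (hu : DifferentiableAt ℝ u x) :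
    ∇ (fun y => c * u y) x = c • ∇ u x :=
  grad_eq_of_fderiv fun w => by
    rw [real_inner_smul_left, grad_apply, fderiv_const_mul hu]; rfl

lemma grad_neg (u : E → ℝ) (x : E) : ∇ (fun y => - u y) x = - ∇ u x :=
  grad_eq_of_fderiv fun w => by
    rw [inner_neg_left, grad_apply, fderiv_fun_neg]; rfl

lemma grad_add_const (u : E → ℝ) (c : ℝ) (x : E) : ∇ (fun y => u y + c) x = ∇ u x :=
  grad_eq_of_fderiv fun w => by rw [grad_apply, fderiv_add_const]

lemma grad_sub_const (u : E → ℝ) (c : ℝ) (x : E) : ∇ (fun y => u y - c) x = ∇ u x :=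
  grad_eq_of_fderiv fun w => by rw [grad_apply, fderiv_sub_const]

lemma grad_mul {u v : E → ℝ} {x : E} (hu : DifferentiableAt ℝ u x) (hv : DifferentiableAt ℝ v x) :
    ∇ (fun y => u y * v y) x = u x • ∇ v x + v x • ∇ u x :=
  grad_eq_of_fderiv fun w => by
    rw [inner_add_left, real_inner_smul_left, real_inner_smul_left, grad_apply, grad_apply,
      fderiv_fun_mul hu hv]; rfl

lemma grad_comp {u : E → ℝ} {x : E} {f : ℝ → ℝ} {f' : ℝ} (hf : HasDerivAt f f' (u x))
    (hu : DifferentiableAt ℝ u x) : ∇ (fun y => f (u y)) x = f' • ∇ u x :=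
  grad_eq_of_fderiv fun w => by
    have := (hf.comp_hasFDerivAt x hu.hasFDerivAt).fderiv
    rw [real_inner_smul_left, grad_apply]
    change fderiv ℝ (f ∘ u) x w = _
    rw [this]; rfl

lemma grad_translate (u : E → ℝ) (h x : E) : ∇ (fun y => u (y + h)) x = ∇ u (x + h) :=
  grad_eq_of_fderiv fun w => by rw [grad_apply, fderiv_comp_add_right]

lemma grad_affine (u : E → ℝ) (x₀ x : E) (ρ : ℝ) :
    ∇ (fun y => u (x₀ + ρ • y)) x = ρ • ∇ u (x₀ + ρ • x) :=
  grad_eq_of_fderiv fun w => by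
    rw [real_inner_smul_left, grad_apply]
    have h1 : fderiv ℝ (fun y => u (x₀ + ρ • y)) x = ρ • fderiv ℝ (fun z => u (x₀ + z)) (ρ • x) :=
      fderiv_comp_smul (f := fun z => u (x₀ + z)) ρ
    rw [h1, fderiv_comp_add_left]; simp

lemma grad_inner (a : E) (x : E) : ∇ (fun y => ⟪a, y⟫) x = a :=
  grad_eq_of_fderiv fun w => by
    have : HasFDerivAt (fun y : E => ⟪a, y⟫) (innerSL ℝ a) x := (innerSL ℝ a).hasFDerivAt
    rw [this.fderiv]; rfl

lemma ae_diff {K : ℝ≥0} {u : E → ℝ} (hu : LipschitzWith K u) : ∀ᵐ x, DifferentiableAt ℝ u x :=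
  hu.ae_differentiableAt

lemma lip_pos {K : ℝ≥0} {u : E → ℝ} (hu : LipschitzWith K u) :
    LipschitzWith K (fun x => max (u x) 0) := hu.max_const 0

lemma grad_pos_part {f : E → ℝ} {x : E} (hf : DifferentiableAt ℝ f x) :
    ∇ (fun y => max (f y) 0) x = if 0 < f x then ∇ f x else 0 := by
  split_ifs with h
  · apply Filter.EventuallyEq.gradient_eq
    filter_upwards [hf.continuousAt.eventually (lt_mem_nhds h)] with y hy
    exact max_eq_left hy.le
  · apply grad_eq_of_fderiv
    intro v
    have : IsLocalMin (fun y => max (f y) 0) x := by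
      filter_upwards with y
      rw [max_eq_right (not_lt.1 h)]; exact le_max_right _ _
    rw [this.fderiv_eq_zero]; simp

/-- chain rule for positive parts, almost everywhere -/
lemma ae_grad_pos {K : ℝ≥0} {f : E → ℝ} (hf : LipschitzWith K f) :
    ∀ᵐ x, ∇ (fun y => max (f y) 0) x = if 0 < f x then ∇ f x else 0 := by
  filter_upwards [ae_diff hf] with x h1 using grad_pos_part h1

/-- the gradient vanishes a.e. on a zero set -/
lemma ae_grad_zero {K : ℝ≥0} {f : E → ℝ} (hf : LipschitzWith K f) :
    ∀ᵐ x, f x = 0 → ∇ f x = 0 := by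
  have hn : LipschitzWith K (fun x => - f x) := hf.neg
  filter_upwards [ae_diff hf, ae_diff (lip_pos hf), ae_diff (lip_pos hn)] with x h1 h2 h3 h0
  have a := grad_pos_part h1
  have b := grad_pos_part h1.neg
  simp only [h0, neg_zero, lt_irrefl, if_false, Pi.neg_apply] at a b
  have e : f = fun y => max (f y) 0 - max (- f y) 0 := by
    funext y; rcases le_total 0 (f y) with h | h
    · rw [max_eq_left h, max_eq_right (by linarith)]; ring
    · rw [max_eq_right h, max_eq_left (by linarith)]; ring
  rw [e, grad_sub h2 h3, a, b, sub_zero]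

lemma lineDeriv_eq {u : E → ℝ} {x : E} (v : E) (h : DifferentiableAt ℝ u x) :
    lineDeriv ℝ u x v = ⟪∇ u x, v⟫ := by rw [h.lineDeriv_eq_fderiv, grad_apply]

lemma ibp {K L : ℝ≥0} {f g : E → ℝ} (hf : LipschitzWith K f) (hg : LipschitzWith L g)
    (hc : HasCompactSupport g) (v : E) :
    ∫ x, ⟪∇ f x, v⟫ * g x = - ∫ x, ⟪∇ g x, v⟫ * f x := by
  have := hf.integral_lineDeriv_mul_eq (μ := volume) hg hc v
  rw [← integral_neg]
  convert this using 1
  · apply integral_congr_ae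
    filter_upwards [ae_diff hf] with x hx
    rw [lineDeriv_eq v hx]
  · apply integral_congr_ae
    filter_upwards [ae_diff hg] with x hx
    rw [lineDeriv_eq _ hx, inner_neg_right]; ring

lemma hasCompactSupport_of_ball {f : E → ℝ} {R : ℝ} {c : E} (h : ∀ x, x ∉ ball c R → f x = 0) :
    HasCompactSupport f :=
  HasCompactSupport.of_support_subset_isCompact (isCompact_closedBall c R) (by
    intro x hx; by_contra hc
    exact hx (h x fun h' => hc (ball_subset_closedBall h')))

lemma integral_grad_zero {L : ℝ≥0} {g : E → ℝ} (hg : LipschitzWith L g)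
    (hc : HasCompactSupport g) (v : E) : ∫ x, ⟪v, ∇ g x⟫ = 0 := by
  have := ibp (f := fun _ => (1:ℝ)) (LipschitzWith.const' (1:ℝ) : LipschitzWith 0 _) hg hc v
  simp only [grad_const, inner_zero_left, zero_mul, integral_zero, mul_one] at this
  simp_rw [real_inner_comm _ v] at *
  linarith

lemma grad_zero_off {f : E → ℝ} {c : E} {R : ℝ} (h : ∀ x, x ∉ ball c R → f x = 0) {x : E}
    (hx : x ∉ closedBall c R) : ∇ f x = 0 := by
  rw [grad_congr (v := fun _ => 0) (isClosed_closedBall (x := c) (ε := R)).isOpen_compl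
    (fun y hy => h y fun h' => hy (ball_subset_closedBall h')) hx, grad_const]

/-- integrability of bounded functions on bounded sets -/
lemma integrable_bdd {G : Type*} [NormedAddCommGroup G] {f : E → G} {C R : ℝ} {c : E}
    (hm : AEStronglyMeasurable f volume)
    (hb : ∀ x, ‖f x‖ ≤ C) (hs : ∀ x, x ∉ closedBall c R → f x = 0) : Integrable f := by
  have : IntegrableOn f (closedBall c R) :=
    Measure.integrableOn_of_bounded (measure_closedBall_lt_top.ne) hm (M := C)
      (Eventually.of_forall hb)
  exact (integrableOn_iff_integrable_of_support_subset
    (fun x hx => by by_contra h; exact hx (hs x h))).1 this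

lemma integrableOn_bdd {G : Type*} [NormedAddCommGroup G] {f : E → G} {C : ℝ} {s : Set E}
    (hs : Bornology.IsBounded s)
    (hm : AEStronglyMeasurable f volume)
    (hb : ∀ x, ‖f x‖ ≤ C) : IntegrableOn f s :=
  Measure.integrableOn_of_bounded hs.measure_lt_top.ne hm (M := C) (Eventually.of_forall hb)

lemma aesm_grad (u : E → ℝ) : AEStronglyMeasurable (∇ u) volume :=
  (measurable_grad u).aestronglyMeasurable

/-- A weakly divergence-free field on `U`. -/
def DivFree (V : E → E) (U : Set E) : Prop :=
  ∀ (ψ : E → ℝ) (K : ℝ≥0), LipschitzWith K ψ → (∀ x, x ∉ U → ψ x = 0) →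
    ∫ x, ⟪V x, ∇ ψ x⟫ = 0

/-- weak solutions of the minimal surface equation -/
def WS (u : E → ℝ) (U : Set E) : Prop := DivFree (fun x => DF (∇ u x)) U

lemma DivFree.mono {V : E → E} {U U' : Set E} (h : DivFree V U) (hs : U' ⊆ U) : DivFree V U' :=
  fun ψ K hψ h0 => h ψ K hψ fun x hx => h0 x fun hx' => hx (hs hx')

lemma DivFree.congr {V W : E → E} {U : Set E} (h : DivFree V U) (hVW : ∀ x ∈ U, V x = W x) :
    DivFree W U := by
  intro ψ K hψ h0
  rw [← h ψ K hψ h0]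
  apply integral_congr_ae
  filter_upwards [ae_grad_zero hψ] with x hx
  by_cases hU : x ∈ U
  · rw [hVW x hU]
  · rw [hx (h0 x hU)]; simp

lemma WS.congr {u v : E → ℝ} {U : Set E} (hU : IsOpen U) (h : WS u U) (huv : ∀ x ∈ U, u x = v x) :
    WS v U :=
  DivFree.congr h fun x hx => by rw [grad_congr hU huv hx]

end BDG

open scoped RealInnerProductSpace
namespace BDG
open MeasureTheory Filter Topology Set Metric
open scoped NNReal ENNReal Gradient ContDiff

/-- convolution with a scalar kernel -/
noncomputable def conv {G : Type*} [NormedAddCommGroup G] [NormedSpace ℝ G]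
    (k : E → ℝ) (f : E → G) (x : E) : G := ∫ t, k t • f (x - t)

lemma conv_eq {G : Type*} [NormedAddCommGroup G] [NormedSpace ℝ G] (k : E → ℝ) (f : E → G) :
    conv k f = MeasureTheory.convolution k f (ContinuousLinearMap.lsmul ℝ ℝ) volume := by
  funext x; rfl

lemma quasi_sub (x : E) : Measure.QuasiMeasurePreserving (fun t : E => x - t) volume volume :=
  (Measure.measurePreserving_sub_left volume x).quasiMeasurePreserving

lemma conv_hasFDerivAt {K : ℝ≥0} {k : E → ℝ} {f : E → ℝ} (hk : Integrable k)
    (hf : LipschitzWith K f) (x : E) (hi : Integrable (fun t => k t • f (x - t))) :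
    HasFDerivAt (conv k f) (∫ t, k t • fderiv ℝ f (x - t)) x := by
  have hmeas : ∀ y : E, AEStronglyMeasurable (fun t => k t • f (y - t)) volume := fun y =>
    hk.aestronglyMeasurable.smul (hf.continuous.comp (by fun_prop)).aestronglyMeasurable
  have hd : ∀ᵐ t : E, DifferentiableAt ℝ f (x - t) := (quasi_sub x).ae (ae_diff hf)
  refine (hasFDerivAt_integral_of_dominated_loc_of_lip (F := fun y t => k t • f (y - t))
    (F' := fun t => k t • fderiv ℝ f (x - t)) (bound := fun t => ‖k t‖ * K)
    (ball_mem_nhds x one_pos) (Eventually.of_forall hmeas) hi ?_ ?_ ?_ ?_).2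
  · exact hk.aestronglyMeasurable.smul
      (((measurable_fderiv ℝ f).comp (measurable_const.sub measurable_id)).aestronglyMeasurable)
  · filter_upwards with t
    rw [lipschitzOnWith_iff_norm_sub_le]
    intro y _ z _
    rw [← smul_sub, norm_smul]
    calc ‖k t‖ * ‖f (y - t) - f (z - t)‖ ≤ ‖k t‖ * (K * ‖(y - t) - (z - t)‖) := by
          gcongr; exact hf.norm_sub_le _ _
      _ = _ := by simp [mul_assoc]
  · exact hk.norm.mul_const _
  · filter_upwards [hd] with t ht
    have : HasFDerivAt (fun y => f (y - t)) (fderiv ℝ f (x - t)) x := by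
      rw [hasFDerivAt_comp_sub]; exact ht.hasFDerivAt
    exact this.const_mul (k t)

lemma integrable_kernel_fderiv {K : ℝ≥0} {k : E → ℝ} {f : E → ℝ} (hk : Integrable k)
    (hf : LipschitzWith K f) (x : E) : Integrable (fun t => k t • fderiv ℝ f (x - t)) := by
  refine (hk.norm.mul_const (K:ℝ)).mono' (hk.aestronglyMeasurable.smul
      (((measurable_fderiv ℝ f).comp (measurable_const.sub measurable_id)).aestronglyMeasurable)) ?_
  filter_upwards with t
  rw [norm_smul]; gcongr; exact norm_fderiv_le_of_lipschitz ℝ hf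

lemma integrable_kernel_grad {K : ℝ≥0} {k : E → ℝ} {f : E → ℝ} (hk : Integrable k)
    (hf : LipschitzWith K f) (x : E) : Integrable (fun t => k t • ∇ f (x - t)) := by
  refine (hk.norm.mul_const (K:ℝ)).mono' (hk.aestronglyMeasurable.smul
      (((measurable_grad f).comp (measurable_const.sub measurable_id)).aestronglyMeasurable)) ?_
  filter_upwards with t
  rw [norm_smul]; gcongr; exact norm_grad_le hf _

lemma conv_grad {K : ℝ≥0} {k : E → ℝ} {f : E → ℝ} (hk : Integrable k)
    (hf : LipschitzWith K f) (x : E) (hi : Integrable (fun t => k t • f (x - t))) :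
    ∇ (conv k f) x = conv k (∇ f) x := by
  apply grad_eq_of_fderiv
  intro v
  rw [(conv_hasFDerivAt hk hf x hi).fderiv, ContinuousLinearMap.integral_apply
    (integrable_kernel_fderiv hk hf x), conv, real_inner_comm, ← integral_inner (integrable_kernel_grad hk hf x)]
  congr 1; funext t
  rw [real_inner_smul_right, real_inner_comm, grad_apply]; rfl

/-- standard mollifier -/
noncomputable def bump (n : ℕ) : ContDiffBump (0 : E) where
  rIn := 1 / (2 * ((n : ℝ) + 1))
  rOut := 1 / ((n : ℝ) + 1)
  rIn_pos := by positivity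
  rIn_lt_rOut := by
    apply one_div_lt_one_div_of_lt (by positivity); linarith [(n.cast_nonneg : (0:ℝ) ≤ n)]

lemma kernel_cont_int {φ : ContDiffBump (0 : E)} {f : E → ℝ} (hf : Continuous f) (x : E) :
    Integrable (fun t => φ.normed volume t • f (x - t)) :=
  Continuous.integrable_of_hasCompactSupport
    (φ.continuous_normed.smul (hf.comp (by fun_prop))) φ.hasCompactSupport_normed.smul_right

lemma norm_conv_le {G : Type*} [NormedAddCommGroup G] [NormedSpace ℝ G]
    (φ : ContDiffBump (0 : E)) {f : E → G} {C : ℝ} (h : ∀ y, ‖f y‖ ≤ C) (x : E) :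
    ‖conv (φ.normed volume) f x‖ ≤ C := by
  calc ‖conv (φ.normed volume) f x‖ ≤ ∫ t, φ.normed volume t * C := by
        apply norm_integral_le_of_norm_le (φ.integrable_normed.mul_const C)
        filter_upwards with t
        rw [norm_smul, Real.norm_of_nonneg (φ.nonneg_normed t)]
        gcongr
        · exact φ.nonneg_normed t
        · exact h _
    _ = C := by rw [integral_mul_const, φ.integral_normed, one_mul]

lemma conv_lip (φ : ContDiffBump (0 : E)) {K : ℝ≥0} {f : E → ℝ} (hf : LipschitzWith K f) :
    LipschitzWith K (conv (φ.normed volume) f) := by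
  apply LipschitzWith.of_dist_le_mul
  intro x y
  rw [dist_eq_norm, dist_eq_norm]
  have : conv (φ.normed volume) f x - conv (φ.normed volume) f y
      = conv (φ.normed volume) (fun t => f t - f (t - (x - y))) x := by
    unfold conv
    rw [← integral_sub (kernel_cont_int hf.continuous x) (kernel_cont_int hf.continuous y)]
    congr 1; funext t; rw [← smul_sub]; congr 3; abel
  rw [this]
  apply norm_conv_le
  intro t
  simpa using hf.norm_sub_le t (t - (x - y))

lemma smooth_approx {K : ℝ≥0} {f : E → ℝ} (hf : LipschitzWith K f) :
    ∃ fn : ℕ → E → ℝ, (∀ n, ContDiff ℝ ∞ (fn n)) ∧ (∀ n, LipschitzWith K (fn n)) ∧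
      (∀ (n : ℕ) x, |fn n x - f x| ≤ K / ((n : ℝ) + 1)) ∧
      (∀ᵐ x, Tendsto (fun n => ∇ (fn n) x) atTop (𝓝 (∇ f x))) ∧
      (∀ (n : ℕ) x, (∀ y ∈ ball x (1 / ((n : ℝ) + 1)), f y = 0) → fn n x = 0) := by
  have hloc : LocallyIntegrable f volume := hf.continuous.locallyIntegrable
  refine ⟨fun n => conv ((bump n).normed volume) f, fun n => ?_, fun n => conv_lip _ hf, ?_, ?_, ?_⟩
  · beta_reduce; rw [conv_eq]
    exact (bump n).hasCompactSupport_normed.contDiff_convolution_left _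
      (bump n).contDiff_normed hloc
  · intro n x
    beta_reduce; rw [conv_eq, ← Real.dist_eq]
    apply (bump n).dist_normed_convolution_le hf.continuous.aestronglyMeasurable
    intro y hy
    calc dist (f y) (f x) ≤ K * dist y x := hf.dist_le_mul _ _
      _ ≤ K * (1 / ((n : ℝ) + 1)) := by gcongr; exact (mem_ball.1 hy).le
      _ = _ := by ring
  · have hg : LocallyIntegrable (∇ f) volume :=
      (locallyIntegrable_const (K : ℝ)).mono (aesm_grad f)
        (by filter_upwards with x; simpa using norm_grad_le hf x)
    have := ContDiffBump.ae_convolution_tendsto_right_of_locallyIntegrable (φ := bump)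
      (l := atTop) (K := 2) tendsto_one_div_add_atTop_nhds_zero_nat
      (Eventually.of_forall fun n => by
        show 1 / ((n : ℝ) + 1) ≤ 2 * (1 / (2 * ((n : ℝ) + 1)))
        apply le_of_eq; field_simp) hg
    filter_upwards [this] with x hx
    convert hx using 2 with n
    rw [conv_grad (bump n).integrable_normed hf x (kernel_cont_int hf.continuous x), conv_eq]
  · intro n x hx
    beta_reduce; rw [conv_eq, (bump n).normed_convolution_eq_right, hx x (mem_ball_self (by positivity))]
    intro y hy
    rw [hx y hy, hx x (mem_ball_self (by positivity))]

end BDG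

open scoped RealInnerProductSpace
namespace BDG
open MeasureTheory Filter Topology Set Metric
open scoped NNReal ENNReal Gradient ContDiff

lemma const_of_grad_zero {K : ℝ≥0} {f : E → ℝ} (hf : LipschitzWith K f)
    (h : ∀ᵐ x, ∇ f x = 0) (x y : E) : f x = f y := by
  have key : ∀ n : ℕ, conv ((bump n).normed volume) f x = conv ((bump n).normed volume) f y := by
    intro n
    have hi := (bump n).integrable_normed (μ := volume)
    have hd : ∀ z, HasFDerivAt (conv ((bump n).normed volume) f) _ z := fun z =>
      conv_hasFDerivAt hi hf z (kernel_cont_int hf.continuous z)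
    apply is_const_of_fderiv_eq_zero (𝕜 := ℝ) (fun z => (hd z).differentiableAt)
    intro z
    rw [(hd z).fderiv]
    apply integral_eq_zero_of_ae
    have : ∀ᵐ t : E, ∇ f (z - t) = 0 := (quasi_sub z).ae h
    filter_upwards [this] with t ht
    rw [← toDual_gradient, ht]; simp
  have lim : ∀ z, Tendsto (fun n : ℕ => conv ((bump n).normed volume) f z) atTop (𝓝 (f z)) := by
    intro z
    simp_rw [conv_eq]
    exact ContDiffBump.convolution_tendsto_right_of_continuous
      tendsto_one_div_add_atTop_nhds_zero_nat hf.continuous z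
  have l1 := lim x
  simp_rw [key] at l1
  exact tendsto_nhds_unique l1 (lim y)

/-- Sequential compactness for locally equi-Lipschitz, locally bounded sequences. -/
lemma arzela {v : ℕ → E → ℝ}
    (hL : ∀ m : ℕ, ∃ K : ℝ≥0, ∀ᶠ k in atTop, LipschitzOnWith K (v k) (ball 0 m))
    (hB : ∀ m : ℕ, ∃ C : ℝ, ∀ᶠ k in atTop, ∀ x ∈ ball (0 : E) m, |v k x| ≤ C) :
    ∃ (φ : ℕ → ℕ) (w : E → ℝ), StrictMono φ ∧ ∀ x, Tendsto (fun k => v (φ k) x) atTop (𝓝 (w x)) := by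
  set d := TopologicalSpace.denseSeq E
  have hd : DenseRange d := TopologicalSpace.denseRange_denseSeq E
  have hm : ∀ x : E, ∃ m : ℕ, x ∈ ball (0 : E) m := fun x => by
    obtain ⟨m, hm⟩ := exists_nat_gt ‖x‖; exact ⟨m, by simpa using hm⟩
  have hb : ∀ i, ∃ C : ℝ, 0 ≤ C ∧ ∀ᶠ k in atTop, |v k (d i)| ≤ C := by
    intro i
    obtain ⟨m, hm⟩ := hm (d i)
    obtain ⟨C, hC⟩ := hB m
    exact ⟨|C|, abs_nonneg _, hC.mono fun k hk => (hk _ hm).trans (le_abs_self C)⟩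
  choose C hC0 hC using hb
  have hcomp : IsCompact (Set.pi univ fun i => Icc (-C i) (C i)) :=
    isCompact_univ_pi fun i => isCompact_Icc
  obtain ⟨a, -, φ, hφ, hlim⟩ := hcomp.tendsto_subseq
    (x := fun k i => max (-C i) (min (v k (d i)) (C i)))
    (fun k i _ => ⟨le_max_left _ _, max_le (by linarith [hC0 i]) (min_le_right _ _)⟩)
  have hlim' : ∀ i, Tendsto (fun k => v (φ k) (d i)) atTop (𝓝 (a i)) := by
    intro i
    have := (tendsto_pi_nhds.1 hlim) i
    refine this.congr' ?_
    filter_upwards [hφ.tendsto_atTop.eventually (hC i)] with k hk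
    rw [abs_le] at hk
    simp only [Function.comp]
    rw [min_eq_left hk.2, max_eq_right hk.1]
  have hcau : ∀ x, CauchySeq (fun k => v (φ k) x) := by
    intro x
    obtain ⟨m, hm⟩ := hm x
    obtain ⟨K, hK⟩ := hL m
    rw [Metric.cauchySeq_iff']
    intro ε hε
    have hnh : ball x (ε / (4 * (K + 1))) ∩ ball 0 m ∈ 𝓝 x :=
      inter_mem (ball_mem_nhds _ (by positivity)) (isOpen_ball.mem_nhds hm)
    obtain ⟨i, hi⟩ := hd.exists_mem_open isOpen_interior ⟨x, mem_interior_iff_mem_nhds.2 hnh⟩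
    have hi' := interior_subset hi
    have hc := Metric.cauchySeq_iff'.1 (hlim' i).cauchySeq (ε / 4) (by positivity)
    obtain ⟨N, hN⟩ := hc
    obtain ⟨N', hN'⟩ := eventually_atTop.1 (hφ.tendsto_atTop.eventually hK)
    have est : ∀ n ≥ N', dist (v (φ n) x) (v (φ n) (d i)) ≤ ε / 4 := by
      intro n hn
      calc _ ≤ K * dist x (d i) := (hN' n hn).dist_le_mul _ hm _ hi'.2
        _ ≤ (K + 1) * (ε / (4 * (K + 1))) := by
          gcongr
          · linarith
          · rw [dist_comm]; exact (mem_ball.1 hi'.1).le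
        _ = ε / 4 := by field_simp
    refine ⟨max N N', fun n hn => ?_⟩
    have h1 := est n (le_trans (le_max_right _ _) hn)
    have h2 := est (max N N') (le_max_right _ _)
    have h3 := hN n (le_trans (le_max_left _ _) hn)
    have h4 := hN (max N N') (le_max_left _ _)
    rw [dist_comm] at h4 h2
    have t1 := dist_triangle4 (v (φ n) x) (v (φ n) (d i)) (v (φ N) (d i)) (v (φ (max N N')) (d i))
    have t2 := dist_triangle (v (φ n) x) (v (φ (max N N')) (d i)) (v (φ (max N N')) x)
    linarith
  choose w hw using fun x => cauchySeq_tendsto_of_complete (hcau x)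
  exact ⟨φ, w, hφ, hw⟩

lemma lip_of_tendsto {v : ℕ → E → ℝ} {w : E → ℝ} {K : ℝ≥0} (hv : ∀ k, LipschitzWith K (v k))
    (h : ∀ x, Tendsto (fun k => v k x) atTop (𝓝 (w x))) : LipschitzWith K w := by
  apply LipschitzWith.of_dist_le_mul
  intro x y
  exact le_of_tendsto ((h x).dist (h y)) (Eventually.of_forall fun k => (hv k).dist_le_mul x y)

/-- Closure: pointwise convergence plus `L²`-Cauchy gradients. -/
lemma grad_closure {f : ℕ → E → ℝ} {g : E → ℝ} {K : ℝ≥0} (hf : ∀ k, LipschitzWith K (f k))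
    (h : ∀ x, Tendsto (fun k => f k x) atTop (𝓝 (g x))) (c : E) (R : ℝ)
    (hc : ∀ ε > 0, ∃ N, ∀ j ≥ N, ∀ k ≥ N, ∫ x in ball c R, ‖∇ (f j) x - ∇ (f k) x‖ ^ 2 ≤ ε) :
    ∃ φ : ℕ → ℕ, StrictMono φ ∧
      ∀ᵐ x, x ∈ ball c R → Tendsto (fun k => ∇ (f (φ k)) x) atTop (𝓝 (∇ g x)) := by
  have hg := lip_of_tendsto hf h
  set μ := (volume : Measure E).restrict (ball c R) with hμ
  have hfin : IsFiniteMeasure μ := ⟨by simpa [hμ] using measure_ball_lt_top⟩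
  have hmem : ∀ k, MemLp (∇ (f k)) 2 μ := fun k =>
    MemLp.of_bound (measurable_grad _).aestronglyMeasurable K
      (Eventually.of_forall fun x => norm_grad_le (hf k) x)
  have hcs : CauchySeq (fun k => (hmem k).toLp) := by
    rw [Metric.cauchySeq_iff]
    intro ε hε
    obtain ⟨N, hN⟩ := hc ((ε / 2) ^ 2) (by positivity)
    refine ⟨N, fun j hj k hk => ?_⟩
    have h1 : ∫ x, ‖∇ (f j) x - ∇ (f k) x‖ ^ 2 ∂μ ≤ (ε / 2) ^ 2 := hN j hj k hk
    rw [dist_edist, Lp.edist_toLp_toLp, ((hmem j).sub (hmem k)).eLpNorm_eq_integral_rpow_norm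
      (by norm_num) (by norm_num), ENNReal.toReal_ofReal (by positivity)]
    simp only [ENNReal.toReal_ofNat, Real.rpow_two, Pi.sub_apply]
    have h0 : 0 ≤ ∫ x, ‖∇ (f j) x - ∇ (f k) x‖ ^ 2 ∂μ := integral_nonneg fun x => by positivity
    calc _ ≤ ((ε / 2) ^ 2) ^ (2⁻¹ : ℝ) := Real.rpow_le_rpow h0 h1 (by norm_num)
      _ = ε / 2 := by
        rw [← Real.rpow_natCast, ← Real.rpow_mul (by positivity)]; norm_num
      _ < ε := by linarith
  obtain ⟨G, hG⟩ := cauchySeq_tendsto_of_complete hcs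
  have him := tendstoInMeasure_of_tendsto_Lp hG
  obtain ⟨φ, hφ, hae⟩ := him.exists_seq_tendsto_ae
  have hae2 : ∀ᵐ x ∂μ, Tendsto (fun k => ∇ (f (φ k)) x) atTop (𝓝 (G x)) := by
    have : ∀ᵐ x ∂μ, ∀ k, ((hmem k).toLp : E → E) x = ∇ (f k) x :=
      ae_all_iff.2 fun k => (hmem k).coeFn_toLp
    filter_upwards [hae, this] with x h1 h2
    simpa only [h2] using h1
  have hGb : ∀ᵐ x ∂μ, ‖G x‖ ≤ K := by
    filter_upwards [hae2] with x hx
    exact le_of_tendsto hx.norm (Eventually.of_forall fun k => norm_grad_le (hf _) x)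
  refine ⟨φ, hφ, ?_⟩
  have hGint : Integrable G μ := (Integrable.of_bound (Lp.aestronglyMeasurable G) K hGb)
  have hgint : Integrable (∇ g) μ := Integrable.of_bound
      (measurable_grad g).aestronglyMeasurable K (Eventually.of_forall fun x => norm_grad_le hg x)
  have key : ∀ᵐ x, x ∈ ball c R → (G x - ∇ g x) = 0 := by
    apply isOpen_ball.ae_eq_zero_of_integral_contDiff_smul_eq_zero
    · exact IntegrableOn.locallyIntegrableOn (hGint.sub hgint)
    · intro ψ hψ hψc hψs
      obtain ⟨L, hL⟩ := hψ.lipschitzWith_of_hasCompactSupport hψc (by norm_num)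
      have hψ0 : ∀ x, x ∉ ball c R → ψ x = 0 := fun x hx => by
        by_contra h0; exact hx (hψs (subset_tsupport _ h0))
      have e0 : ∫ x, ψ x • (G x - ∇ g x) = ∫ x in ball c R, ψ x • (G x - ∇ g x) := by
        rw [setIntegral_eq_integral_of_forall_compl_eq_zero]
        intro x hx; rw [hψ0 x hx, zero_smul]
      have hψb : ∃ C, ∀ x, ‖ψ x‖ ≤ C := hψ.continuous.bounded_above_of_compact_support hψc
      obtain ⟨C, hC⟩ := hψb
      have i1 : Integrable (fun x => ψ x • G x) μ :=
        hGint.bdd_smul C hψ.continuous.aestronglyMeasurable (Eventually.of_forall hC)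
      have i2 : Integrable (fun x => ψ x • ∇ g x) μ :=
        hgint.bdd_smul C hψ.continuous.aestronglyMeasurable (Eventually.of_forall hC)
      rw [e0]
      apply ext_inner_right ℝ
      intro v
      rw [inner_zero_left]
      have e1 : ⟪∫ x in ball c R, ψ x • (G x - ∇ g x), v⟫
          = (∫ x, ⟪G x, v⟫ * ψ x ∂μ) - ∫ x, ⟪∇ g x, v⟫ * ψ x ∂μ := by
        rw [real_inner_comm, ← integral_inner (by simp_rw [smul_sub]; exact i1.sub i2)]
        rw [← integral_sub]
        · congr 1; funext x
          rw [real_inner_smul_right, inner_sub_right, real_inner_comm, real_inner_comm _ v]; ring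
        · have := i1.inner_const (𝕜 := ℝ) v
          refine this.congr (Eventually.of_forall fun x => ?_)
          simp only [real_inner_smul_left]; ring
        · have := i2.inner_const (𝕜 := ℝ) v
          refine this.congr (Eventually.of_forall fun x => ?_)
          simp only [real_inner_smul_left]; ring
      rw [e1, sub_eq_zero]
      have conv1 : Tendsto (fun k => ∫ x, ⟪∇ (f (φ k)) x, v⟫ * ψ x ∂μ) atTop
          (𝓝 (∫ x, ⟪G x, v⟫ * ψ x ∂μ)) := by
        apply tendsto_integral_of_dominated_convergence (fun _ => K * ‖v‖ * C)
        · intro k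
          exact (((measurable_grad _).inner_const).aestronglyMeasurable).mul
            hψ.continuous.aestronglyMeasurable
        · exact integrable_const _
        · intro k
          filter_upwards with x
          rw [norm_mul]
          gcongr
          · exact (norm_inner_le_norm _ _).trans (by gcongr; exact norm_grad_le (hf _) x)
          · exact hC x
        · filter_upwards [hae2] with x hx
          exact (hx.inner tendsto_const_nhds).mul tendsto_const_nhds
      have full : ∀ u : E → ℝ, ∫ x, ⟪∇ u x, v⟫ * ψ x ∂μ = ∫ x, ⟪∇ u x, v⟫ * ψ x := by
        intro u
        rw [hμ, setIntegral_eq_integral_of_forall_compl_eq_zero]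
        intro x hx; rw [hψ0 x hx, mul_zero]
      have conv2 : Tendsto (fun k => ∫ x, ⟪∇ (f (φ k)) x, v⟫ * ψ x ∂μ) atTop
          (𝓝 (∫ x, ⟪∇ g x, v⟫ * ψ x ∂μ)) := by
        simp_rw [full, ibp (hf _) hL hψc v, ibp hg hL hψc v]
        apply Tendsto.neg
        have hcont : Continuous (fun x => ⟪∇ ψ x, v⟫) := by
          simp_rw [grad_apply]; exact (hψ.continuous_fderiv (by norm_num)).clm_apply continuous_const
        have hgz : ∀ x, x ∉ closedBall c R → ∇ ψ x = 0 := fun x hx => grad_zero_off hψ0 hx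
        -- uniform bound on the ball
        obtain ⟨M, hM⟩ : ∃ M, ∀ k, |f k c| ≤ M := by
          obtain ⟨M, hM⟩ := (h c).norm.bddAbove_range
          exact ⟨M, fun k => hM ⟨k, rfl⟩⟩
        apply tendsto_integral_of_dominated_convergence
          ((closedBall c R).indicator fun _ => L * ‖v‖ * (M + K * |R|))
        · intro k
          exact hcont.aestronglyMeasurable.mul (hf _).continuous.aestronglyMeasurable
        · exact (integrable_indicator_iff measurableSet_closedBall).2
            (integrableOn_const measure_closedBall_lt_top.ne)
        · intro k
          filter_upwards with x
          by_cases hx : x ∈ closedBall c R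
          · rw [indicator_of_mem hx, norm_mul]
            have hR : dist x c ≤ |R| := (mem_closedBall.1 hx).trans (le_abs_self R)
            have : ‖f (φ k) x‖ ≤ M + K * |R| := by
              have h1 := (hf (φ k)).norm_sub_le x c
              have h2 := hM (φ k)
              have h3 : ‖f (φ k) x‖ ≤ ‖f (φ k) x - f (φ k) c‖ + ‖f (φ k) c‖ := by
                simpa using norm_add_le (f (φ k) x - f (φ k) c) (f (φ k) c)
              have h4 : (K:ℝ) * ‖x - c‖ ≤ K * |R| := by
                rw [← dist_eq_norm]; gcongr
              rw [Real.norm_eq_abs (f (φ k) c)] at h3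
              linarith
            gcongr
            exact (norm_inner_le_norm _ _).trans (by gcongr; exact norm_grad_le hL x)
          · rw [indicator_of_notMem hx, hgz x hx]; simp
        · filter_upwards with x
          exact tendsto_const_nhds.mul ((h x).comp hφ.tendsto_atTop)
      exact tendsto_nhds_unique conv1 conv2
  have hae3 := (ae_restrict_iff' measurableSet_ball).1 hae2
  filter_upwards [hae3, key] with x h1 h2 hx
  rw [← sub_eq_zero.1 (h2 hx)]; exact h1 hx

end BDG

open scoped RealInnerProductSpace
namespace BDG
open MeasureTheory Filter Topology Set Metric
open scoped NNReal ENNReal Gradient ContDiff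
open Classical in
/-- gluing Lipschitz functions along a frontier -/
lemma lip_glue {D : Set E} {K : ℝ≥0} {a b : E → ℝ} (ha : LipschitzWith K a)
    (hb : LipschitzWith K b) (hab : ∀ x ∈ frontier D, a x = b x) :
    LipschitzWith K (fun x => if x ∈ D then a x else b x) := by
  have key : ∀ x ∈ D, ∀ y ∉ D, dist (a x) (b y) ≤ K * dist x y := by
    intro x hx y hy
    have hcon : IsPreconnected (segment ℝ x y) := (convex_segment x y).isPreconnected
    obtain ⟨z, hz, hzf⟩ : (segment ℝ x y ∩ frontier D).Nonempty := by
      by_contra hne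
      have hno : ∀ z ∈ segment ℝ x y, z ∉ frontier D := fun z hz hzf => hne ⟨z, hz, hzf⟩
      have hd : ∀ z, z ∈ D → z ∉ frontier D → z ∈ interior D := fun z hz h => by
        by_contra h'; exact h ⟨subset_closure hz, h'⟩
      have hd' : ∀ z, z ∉ D → z ∉ frontier D → z ∈ interior Dᶜ := fun z hz h => by
        rw [interior_compl]; intro h'
        exact h ⟨h', fun h'' => hz (interior_subset h'')⟩
      obtain ⟨z, _, hz1, hz2⟩ := hcon (interior D) (interior Dᶜ) isOpen_interior isOpen_interior
        (fun z hz => by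
          by_cases hzD : z ∈ D
          · exact Or.inl (hd z hzD (hno z hz))
          · exact Or.inr (hd' z hzD (hno z hz)))
        ⟨x, left_mem_segment ℝ x y, hd x hx (hno x (left_mem_segment ℝ x y))⟩
        ⟨y, right_mem_segment ℝ x y, hd' y hy (hno y (right_mem_segment ℝ x y))⟩
      exact interior_subset hz2 (interior_subset hz1)
    calc dist (a x) (b y) ≤ dist (a x) (a z) + dist (b z) (b y) := by
          rw [← hab z hzf]; exact dist_triangle _ _ _
      _ ≤ K * dist x z + K * dist z y := add_le_add (ha.dist_le_mul _ _) (hb.dist_le_mul _ _)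
      _ = K * dist x y := by rw [← mul_add, dist_add_dist_of_mem_segment hz]
  apply LipschitzWith.of_dist_le_mul
  intro x y
  by_cases hx : x ∈ D <;> by_cases hy : y ∈ D <;> simp only [hx, hy, if_true, if_false]
  · exact ha.dist_le_mul _ _
  · exact key x hx y hy
  · rw [dist_comm, dist_comm x]; exact key y hy x hx
  · exact hb.dist_le_mul _ _

/-- Local minimisers among `K`-Lipschitz functions. -/
def LocMin (K : ℝ≥0) (u : E → ℝ) (D : Set E) : Prop :=
  LipschitzWith K u ∧ ∀ v, LipschitzWith K v → (∀ x, x ∉ D → v x = u x) →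
    0 ≤ ∫ x, (F (∇ v x) - F (∇ u x))

lemma F_grad_le {K : ℝ≥0} {u : E → ℝ} (hu : LipschitzWith K u) (x : E) : F (∇ u x) ≤ 1 + K :=
  (F_le _).trans (by gcongr; exact norm_grad_le hu x)

lemma ae_grad_eq {K : ℝ≥0} {u v : E → ℝ} (hu : LipschitzWith K u) (hv : LipschitzWith K v) :
    ∀ᵐ x, v x = u x → ∇ v x = ∇ u x := by
  have h : LipschitzWith (K + K) (fun x => v x - u x) := hv.sub hu
  filter_upwards [ae_grad_zero h, ae_diff hu, ae_diff hv] with x h1 h2 h3 h0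
  have := h1 (by simp [h0])
  rw [grad_sub h3 h2] at this
  exact sub_eq_zero.1 this

lemma integrable_bdd_ae {G : Type*} [NormedAddCommGroup G] {f : E → G} {C : ℝ} {D : Set E}
    (hD : Bornology.IsBounded D) (hm : AEStronglyMeasurable f volume)
    (hb : ∀ x, ‖f x‖ ≤ C) (hs : ∀ᵐ x, x ∉ D → f x = 0) : Integrable f := by
  obtain ⟨R, hR⟩ := hD.subset_closedBall 0
  have h1 : Integrable ((closedBall 0 R).indicator f) :=
    (integrable_indicator_iff measurableSet_closedBall).2
      (integrableOn_bdd isBounded_closedBall hm hb)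
  refine h1.congr ?_
  filter_upwards [hs] with x hx
  by_cases h : x ∈ closedBall 0 R
  · rw [indicator_of_mem h]
  · rw [indicator_of_notMem h, hx fun h' => h (hR h')]

lemma F_grad_meas (u : E → ℝ) : AEStronglyMeasurable (fun x => F (∇ u x)) volume :=
  (F_continuous.measurable.comp (measurable_grad u)).aestronglyMeasurable

lemma DF_grad_meas (u : E → ℝ) : AEStronglyMeasurable (fun x => DF (∇ u x)) volume :=
  (DF_continuous.measurable.comp (measurable_grad u)).aestronglyMeasurable

lemma int_diff {K : ℝ≥0} {u v : E → ℝ} {D : Set E} (hD : Bornology.IsBounded D)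
    (hu : LipschitzWith K u) (hv : LipschitzWith K v) (h : ∀ x, x ∉ D → v x = u x) :
    Integrable (fun x => F (∇ v x) - F (∇ u x)) := by
  apply integrable_bdd_ae hD ((F_grad_meas v).sub (F_grad_meas u)) (C := 1 + K)
  · intro x
    have h1 := F_grad_le hu x; have h2 := F_grad_le hv x
    have h3 := F_pos (∇ u x); have h4 := F_pos (∇ v x)
    simp only [Pi.sub_apply]
    rw [Real.norm_eq_abs, abs_le]; constructor <;> linarith
  · filter_upwards [ae_grad_eq hu hv] with x hx hD
    simp [hx (h x hD)]

lemma lip_half {K : ℝ≥0} {u v : E → ℝ} (hu : LipschitzWith K u) (hv : LipschitzWith K v) :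
    LipschitzWith K (fun x => (1 / 2 : ℝ) * (u x + v x)) := by
  apply LipschitzWith.of_dist_le_mul
  intro x y
  have h1 := hu.dist_le_mul x y; have h2 := hv.dist_le_mul x y
  rw [Real.dist_eq] at *
  have e : 1 / 2 * (u x + v x) - 1 / 2 * (u y + v y) = (1 / 2) * ((u x - u y) + (v x - v y)) := by ring
  rw [e, abs_mul, abs_of_pos (by norm_num : (0:ℝ) < 1 / 2)]
  have := abs_add_le (u x - u y) (v x - v y)
  linarith

lemma grad_half {u v : E → ℝ} {x : E} (hu : DifferentiableAt ℝ u x) (hv : DifferentiableAt ℝ v x) :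
    ∇ (fun x => (1 / 2 : ℝ) * (u x + v x)) x = (1 / 2 : ℝ) • (∇ u x + ∇ v x) := by
  rw [grad_const_mul _ (hu.fun_add hv), grad_add hu hv]

open Classical in
lemma compare {D : Set E} (hDb : Bornology.IsBounded D) (hDo : IsOpen D) {K : ℝ≥0} {u v : E → ℝ}
    (hu : LocMin K u D) (hv : LocMin K v D) (hfr : ∀ x ∈ frontier D, u x ≤ v x) :
    ∀ x ∈ D, u x ≤ v x := by
  set f : E → ℝ := fun x => if x ∈ D then max (u x - v x) 0 else 0 with hf
  set w1 : E → ℝ := fun x => if x ∈ D then min (u x) (v x) else u x with hw1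
  set w2 : E → ℝ := fun x => if x ∈ D then max (u x) (v x) else v x with hw2
  have fl : LipschitzWith (K + K) f := by
    apply lip_glue (lip_pos (hu.1.sub hv.1)) ((LipschitzWith.const (0:ℝ)).weaken (by simp))
    intro x hx; exact max_eq_right (by simpa using hfr x hx)
  have l1 : LipschitzWith K w1 := by
    apply lip_glue (by simpa using hu.1.min hv.1) hu.1
    intro x hx; exact min_eq_left (hfr x hx)
  have l2 : LipschitzWith K w2 := by
    apply lip_glue (by simpa using hu.1.max hv.1) hv.1
    intro x hx; exact max_eq_right (hfr x hx)
  have e1 : ∀ x, w1 x = u x - f x := by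
    intro x; simp only [hw1, hf]; split_ifs
    · rcases le_total (u x) (v x) with h | h
      · rw [min_eq_left h, max_eq_right (by linarith)]; ring
      · rw [min_eq_right h, max_eq_left (by linarith)]; ring
    · ring
  have e2 : ∀ x, w2 x = v x + f x := by
    intro x; simp only [hw2, hf]; split_ifs
    · rcases le_total (u x) (v x) with h | h
      · rw [max_eq_right h, max_eq_right (by linarith)]; ring
      · rw [max_eq_left h, max_eq_left (by linarith)]; ring
    · ring
  have hf0 : ∀ x, x ∉ D → f x = 0 := fun x hx => by simp [hf, hx]
  have m1 := hu.2 _ (lip_half hu.1 l1) (fun x hx => by simp only [e1, hf0 x hx]; ring)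
  have m2 := hv.2 _ (lip_half hv.1 l2) (fun x hx => by simp only [e2, hf0 x hx]; ring)
  have i1 := int_diff hDb hu.1 (lip_half hu.1 l1) (fun x hx => by simp only [e1, hf0 x hx]; ring)
  have i2 := int_diff hDb hv.1 (lip_half hv.1 l2) (fun x hx => by simp only [e2, hf0 x hx]; ring)
  have m3 := add_nonneg m1 m2
  rw [← integral_add i1 i2] at m3
  set c : ℝ := 1 / (4 * (1 + (K:ℝ)) ^ 3) with hc
  have hc0 : 0 < c := by positivity
  have pt : ∀ᵐ x, (F (∇ (fun x => (1 / 2 : ℝ) * (u x + w1 x)) x) - F (∇ u x)) +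
      (F (∇ (fun x => (1 / 2 : ℝ) * (v x + w2 x)) x) - F (∇ v x)) ≤ - (c * ‖∇ f x‖ ^ 2) := by
    filter_upwards [ae_diff hu.1, ae_diff hv.1, ae_diff fl, ae_diff l1, ae_diff l2,
      ae_grad_zero fl] with x d1 d2 d3 d4 d5 h0
    have g1 : ∇ w1 x = ∇ u x - ∇ f x := by
      rw [← grad_sub d1 d3]; congr 1; funext y; exact e1 y
    have g2 : ∇ w2 x = ∇ v x + ∇ f x := by
      rw [← grad_add d2 d3]; congr 1; funext y; exact e2 y
    rw [grad_half d1 d4, grad_half d2 d5, g1, g2]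
    by_cases hx : f x = 0
    · rw [h0 hx]; simp only [sub_zero, add_zero, norm_zero]
      rw [← two_smul ℝ, ← two_smul ℝ (∇ v x), smul_smul, smul_smul]; norm_num
    · have hxD : x ∈ D := by by_contra h; exact hx (hf0 x h)
      have hpos : 0 < u x - v x := by
        by_contra h; apply hx; simp only [hf, hxD, if_true]; exact max_eq_right (not_lt.1 h)
      have hfg : ∇ f x = ∇ u x - ∇ v x := by
        rw [← grad_sub d1 d2]
        apply Filter.EventuallyEq.gradient_eq
        filter_upwards [hDo.mem_nhds hxD,
          (hu.1.continuous.sub hv.1.continuous).continuousAt.eventually (lt_mem_nhds hpos)] with y h1 h2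
        simp only [hf, h1, if_true]; exact max_eq_left (by simpa using h2.le)
      rw [hfg]
      have a1 : ∇ u x + (∇ u x - (∇ u x - ∇ v x)) = ∇ u x + ∇ v x := by abel
      have a2 : ∇ v x + (∇ v x + (∇ u x - ∇ v x)) = ∇ u x + ∇ v x := by abel
      rw [a1, a2]
      have := F_mid (F_grad_le hu.1 x) (F_grad_le hv.1 x)
      have hcc : c = 2 * (1 / (8 * (1 + (K:ℝ)) ^ 3)) := by rw [hc]; field_simp; norm_num
      rw [hcc]
      nlinarith
  have ifg : Integrable (fun x => ‖∇ f x‖ ^ 2) := by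
    apply integrable_bdd_ae hDb ((aesm_grad f).norm.pow 2) (C := ((K + K : ℝ≥0) : ℝ) ^ 2)
    · intro x
      rw [Pi.pow_apply, norm_pow, norm_norm]; gcongr; exact norm_grad_le fl x
    · filter_upwards [ae_grad_zero fl] with x hx hD
      simp [hx (hf0 x hD)]
  have m4 : ∫ x, ‖∇ f x‖ ^ 2 ≤ 0 := by
    have := m3.trans (integral_mono_ae (i1.add i2) (ifg.const_mul c).neg pt)
    rw [show (∫ x, (-fun x => c * ‖∇ f x‖ ^ 2) x) = - (c * ∫ x, ‖∇ f x‖ ^ 2) by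
      rw [← integral_const_mul, ← integral_neg]; rfl] at this
    nlinarith
  have m5 : ∫ x, ‖∇ f x‖ ^ 2 = 0 := le_antisymm m4 (integral_nonneg fun x => by positivity)
  rw [integral_eq_zero_iff_of_nonneg (fun x => by positivity) ifg] at m5
  have hz : ∀ᵐ x, ∇ f x = 0 := by
    filter_upwards [m5] with x hx; simpa using hx
  intro x hx
  obtain ⟨R, hR⟩ := hDb.subset_ball 0
  obtain ⟨y, hy⟩ : ∃ y : E, y ∉ D := by
    obtain ⟨y, hy⟩ := NormedSpace.exists_lt_norm ℝ E R
    exact ⟨y, fun h => by have := hR h; simp at this; linarith⟩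
  have := const_of_grad_zero fl hz x y
  rw [hf0 y hy] at this
  simp only [hf, hx, if_true] at this
  linarith [le_max_left (u x - v x) 0]

lemma LocMin.mono {K : ℝ≥0} {u : E → ℝ} {D D' : Set E} (h : LocMin K u D) (hs : D' ⊆ D) :
    LocMin K u D' :=
  ⟨h.1, fun v hv h0 => h.2 v hv fun x hx => h0 x fun hx' => hx (hs hx')⟩

lemma LocMin.add_const {K : ℝ≥0} {u : E → ℝ} {D : Set E} (h : LocMin K u D) (c : ℝ) :
    LocMin K (fun x => u x + c) D := by
  refine ⟨by simpa using h.1.add (LipschitzWith.const c), fun v hv h0 => ?_⟩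
  have := h.2 (fun x => v x + (-c)) (by simpa using hv.add (LipschitzWith.const (-c)))
    (fun x hx => by rw [h0 x hx]; ring)
  simpa only [grad_add_const] using this

lemma LocMin.translate {K : ℝ≥0} {u : E → ℝ} {D : Set E} (h : LocMin K u D) (a : E) :
    LocMin K (fun x => u (x + a)) {x | x + a ∈ D} := by
  have tr : ∀ (w : E → ℝ) (b : E), LipschitzWith K w → LipschitzWith K (fun x => w (x + b)) := by
    intro w b hw
    exact LipschitzWith.of_dist_le_mul fun x y => by
      simpa using hw.dist_le_mul (x + b) (y + b)
  refine ⟨tr u a h.1, fun v hv h0 => ?_⟩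
  have := h.2 (fun x => v (x + (-a))) (tr v _ hv)
    (fun x hx => by
      have := h0 (x + -a) (by simpa using hx)
      simpa using this)
  simp only [grad_translate] at this ⊢
  rw [← integral_add_right_eq_self _ a] at this
  simpa using this

lemma LocMin.neg {K : ℝ≥0} {u : E → ℝ} {D : Set E} (h : LocMin K u D) :
    LocMin K (fun x => - u x) D := by
  have hF : ∀ p : E, F (-p) = F p := fun p => by simp [F]
  refine ⟨h.1.neg, fun v hv h0 => ?_⟩
  have := h.2 (fun x => - v x) hv.neg (fun x hx => by rw [h0 x hx]; ring)
  simpa only [grad_neg, hF] using this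

lemma grad_isometry (u : E → ℝ) (σ : E ≃ₗᵢ[ℝ] E) (x : E) :
    ∇ (fun y => u (σ y)) x = σ.symm (∇ u (σ x)) := by
  apply grad_eq_of_fderiv
  intro v
  have := σ.toContinuousLinearEquiv.comp_right_fderiv (f := u) (x := x)
  rw [← σ.inner_map_map, LinearIsometryEquiv.apply_symm_apply, grad_apply]
  change fderiv ℝ (u ∘ σ.toContinuousLinearEquiv) x v = _
  rw [this]; rfl

lemma LocMin.isometry {K : ℝ≥0} {u : E → ℝ} {D : Set E} (h : LocMin K u D) (σ : E ≃ₗᵢ[ℝ] E)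
    (hD : ∀ x, σ x ∈ D ↔ x ∈ D) :
    LocMin K (fun x => u (σ x)) D := by
  have tr : ∀ (w : E → ℝ) (τ : E ≃ₗᵢ[ℝ] E), LipschitzWith K w → LipschitzWith K (fun x => w (τ x)) := by
    intro w τ hw
    have := hw.comp τ.lipschitz; rw [mul_one] at this; exact this
  have hF : ∀ (τ : E ≃ₗᵢ[ℝ] E) (p : E), F (τ p) = F p := fun τ p => by simp [F]
  refine ⟨tr u σ h.1, fun v hv h0 => ?_⟩
  have := h.2 (fun x => v (σ.symm x)) (tr v _ hv)
    (fun x hx => by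
      have := h0 (σ.symm x) (by rw [← hD]; simpa using hx)
      simpa using this)
  simp only [grad_isometry, hF] at this ⊢
  have mp : MeasurePreserving σ (volume : Measure E) volume := σ.measurePreserving
  rw [← mp.integral_comp σ.toMeasurableEquiv.measurableEmbedding] at this
  simpa using this

lemma LocMin.affine {K : ℝ≥0} {D : Set E} (hDb : Bornology.IsBounded D) (a : E) (c : ℝ)
    (ha : ‖a‖ ≤ K) : LocMin K (fun x => ⟪a, x⟫ + c) D := by
  have hl : LipschitzWith K (fun x : E => ⟪a, x⟫ + c) := by
    apply LipschitzWith.of_dist_le_mul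
    intro x y
    rw [Real.dist_eq, dist_eq_norm]
    have : ⟪a, x⟫ + c - (⟪a, y⟫ + c) = ⟪a, x - y⟫ := by rw [inner_sub_right]; ring
    rw [this]
    exact (abs_real_inner_le_norm _ _).trans (by gcongr)
  have hg : ∀ x, ∇ (fun x : E => ⟪a, x⟫ + c) x = a := fun x => by rw [grad_add_const, grad_inner]
  refine ⟨hl, fun v hv h0 => ?_⟩
  have hw : LipschitzWith (K + K) (fun x => v x - (⟪a, x⟫ + c)) := hv.sub hl
  obtain ⟨R, hR⟩ := hDb.subset_ball 0
  have hcs : HasCompactSupport (fun x => v x - (⟪a, x⟫ + c)) :=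
    hasCompactSupport_of_ball (c := 0) (R := R) fun x hx => by
      rw [h0 x fun h => hx (hR h)]; ring
  have hz := integral_grad_zero hw hcs (DF a)
  rw [← hz]
  apply integral_mono_ae _ (int_diff hDb hl hv h0)
  · filter_upwards [ae_diff hv, ae_diff hl] with x d1 d2
    rw [grad_sub d1 d2, hg]
    have := F_convex a (∇ v x)
    linarith
  · apply integrable_bdd_ae hDb (C := 1 * (K + K : ℝ≥0))
    · exact aestronglyMeasurable_const.inner (aesm_grad _)
    · intro x
      refine (norm_inner_le_norm _ _).trans ?_
      gcongr
      · exact norm_DF_le a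
      · exact norm_grad_le hw x
    · filter_upwards [ae_grad_zero hw] with x hx hD
      rw [hx (by rw [h0 x hD]; ring)]; simp

/-- Euler-Lagrange -/
lemma LocMin.ws {K K₀ : ℝ≥0} {u : E → ℝ} {D : Set E} (hDb : Bornology.IsBounded D)
    (h : LocMin K u D) (h0 : LipschitzWith K₀ u) (hK : K₀ < K) : WS u D := by
  intro ψ L hψ hψ0
  set a := ∫ x, ⟪DF (∇ u x), ∇ ψ x⟫ with ha
  set b := ∫ x, ‖∇ ψ x‖ ^ 2 with hb
  have ib : Integrable (fun x => ‖∇ ψ x‖ ^ 2) := by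
    apply integrable_bdd_ae hDb ((aesm_grad ψ).norm.pow 2) (C := (L : ℝ) ^ 2)
    · intro x
      rw [Pi.pow_apply, norm_pow, norm_norm]; gcongr; exact norm_grad_le hψ x
    · filter_upwards [ae_grad_zero hψ] with x hx hD
      simp [hx (hψ0 x hD)]
  have ia : Integrable (fun x => ⟪DF (∇ u x), ∇ ψ x⟫) := by
    apply integrable_bdd_ae hDb (C := 1 * L)
    · exact (DF_grad_meas u).inner (aesm_grad _)
    · intro x
      refine (norm_inner_le_norm _ _).trans ?_
      gcongr
      · exact norm_DF_le _
      · exact norm_grad_le hψ x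
    · filter_upwards [ae_grad_zero hψ] with x hx hD
      simp [hx (hψ0 x hD)]
  set δ : ℝ := (K - K₀) / (L + 1) with hδ
  have hK' : (K₀ : ℝ) < K := by exact_mod_cast hK
  have hδ0 : 0 < δ := div_pos (by linarith) (by positivity)
  have main : ∀ t : ℝ, |t| ≤ δ → 0 ≤ t * a + t ^ 2 / 2 * b := by
    intro t ht
    have hl : LipschitzWith K (fun x => u x + t * ψ x) := by
      apply LipschitzWith.of_dist_le_mul
      intro x y
      have h1 := h0.dist_le_mul x y; have h2 := hψ.dist_le_mul x y
      rw [Real.dist_eq] at *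
      have e : u x + t * ψ x - (u y + t * ψ y) = (u x - u y) + t * (ψ x - ψ y) := by ring
      rw [e]
      have h3 : |t| * L ≤ K - K₀ := by
        calc |t| * L ≤ δ * (L + 1) := by gcongr; linarith
          _ = _ := by rw [hδ]; field_simp
      calc _ ≤ |u x - u y| + |t * (ψ x - ψ y)| := abs_add_le _ _
        _ ≤ K₀ * dist x y + |t| * (L * dist x y) := by rw [abs_mul]; gcongr
        _ = (K₀ + |t| * L) * dist x y := by ring
        _ ≤ K * dist x y := by gcongr; linarith
    have hz : ∀ x, x ∉ D → u x + t * ψ x = u x := fun x hx => by rw [hψ0 x hx]; ring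
    have h1 := h.2 _ hl hz
    refine h1.trans ?_
    rw [ha, hb, ← integral_const_mul, ← integral_const_mul, ← integral_add (ia.const_mul _) (ib.const_mul _)]
    apply integral_mono_ae (int_diff hDb h.1 hl hz) ((ia.const_mul _).add (ib.const_mul _))
    filter_upwards [ae_diff h0, ae_diff hψ] with x d1 d2
    simp only [Pi.add_apply]
    rw [grad_add d1 (d2.const_mul t), grad_const_mul t d2]
    have := F_upper (∇ u x) (∇ u x + t • ∇ ψ x)
    rw [add_sub_cancel_left, real_inner_smul_right, norm_smul, mul_pow, Real.norm_eq_abs, sq_abs] at this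
    linarith
  have hb0 : 0 ≤ b := integral_nonneg fun x => by positivity
  by_contra hne
  -- choose t small with sign opposite to a
  set s := min δ (|a| / (b + 1)) with hs
  have ha0 : 0 < |a| := abs_pos.2 hne
  have hs0 : 0 < s := lt_min hδ0 (by positivity)
  have hs1 : s * (b + 1) ≤ |a| := by
    rw [← le_div_iff₀ (by positivity)]; exact min_le_right _ _
  have k : 0 ≤ - (s * |a|) + s ^ 2 / 2 * b := by
    rcases le_total 0 a with h1 | h1
    · have := main (-s) (by rw [abs_neg, abs_of_pos hs0]; exact min_le_left _ _)
      rw [abs_of_nonneg h1]; linarith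
    · have := main s (by rw [abs_of_pos hs0]; exact min_le_left _ _)
      rw [abs_of_nonpos h1]; linarith
  nlinarith [mul_pos hs0 ha0, mul_le_mul_of_nonneg_left hs1 hs0.le]

end BDG

open scoped RealInnerProductSpace
namespace BDG
open MeasureTheory Filter Topology Set Metric
open scoped NNReal ENNReal Gradient ContDiff

lemma int_diff_abs_le {K : ℝ≥0} {u v : E → ℝ} {R : ℝ} 
    (hu : LipschitzWith K u) (hv : LipschitzWith K v) (h : ∀ x, x ∉ ball (0:E) R → v x = u x) :
    |∫ x, (F (∇ v x) - F (∇ u x))| ≤ (1 + K) * volume.real (ball (0:E) R) := by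
  have h1 : ∫ x, (F (∇ v x) - F (∇ u x)) = ∫ x in ball (0:E) R, (F (∇ v x) - F (∇ u x)) := by
    rw [← integral_indicator measurableSet_ball]
    apply integral_congr_ae
    filter_upwards [ae_grad_eq hu hv] with x hx
    by_cases hR : x ∈ ball (0:E) R
    · rw [indicator_of_mem hR]
    · rw [indicator_of_notMem hR, hx (h x hR), sub_self]
  rw [h1, ← Real.norm_eq_abs]
  apply norm_setIntegral_le_of_norm_le_const measure_ball_lt_top
  intro x _
  have h1 := F_grad_le hu x; have h2 := F_grad_le hv x
  have h3 := F_pos (∇ u x); have h4 := F_pos (∇ v x)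
  rw [Real.norm_eq_abs, abs_le]; constructor <;> linarith

/-- existence of minimisers among `K`-Lipschitz functions -/
lemma exists_min {D : Set E} (hDb : Bornology.IsBounded D) {K : ℝ≥0} {φ : E → ℝ}
    (hφ : LipschitzWith K φ) : ∃ u, LocMin K u D ∧ ∀ x, x ∉ D → u x = φ x := by
  obtain ⟨R, hR⟩ := hDb.subset_ball 0
  set S : Set (E → ℝ) := {v | LipschitzWith K v ∧ ∀ x, x ∉ D → v x = φ x} with hS
  set I : (E → ℝ) → ℝ := fun v => ∫ x, (F (∇ v x) - F (∇ φ x)) with hI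
  have hbdd : BddBelow (I '' S) := by
    refine ⟨-((1 + K) * volume.real (ball (0:E) R)), ?_⟩
    rintro _ ⟨v, hv, rfl⟩
    exact (abs_le.1 (int_diff_abs_le hφ hv.1 fun x hx => hv.2 x fun h => hx (hR h))).1
  have hne : (I '' S).Nonempty := ⟨_, φ, ⟨hφ, fun _ _ => rfl⟩, rfl⟩
  set m := sInf (I '' S) with hm
  have hmin : ∀ v ∈ S, m ≤ I v := fun v hv => csInf_le hbdd ⟨v, hv, rfl⟩
  have hseq : ∀ n : ℕ, ∃ v ∈ S, I v < m + 1 / ((n:ℝ) + 1) := by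
    intro n
    obtain ⟨_, ⟨v, hv, rfl⟩, h⟩ := exists_lt_of_csInf_lt hne
      (show sInf (I '' S) < m + 1 / ((n:ℝ) + 1) by
        have : (0:ℝ) < 1 / ((n:ℝ) + 1) := by positivity
        linarith)
    exact ⟨v, hv, h⟩
  choose v hvS hvI using hseq
  have hIntg : ∀ w ∈ S, Integrable (fun x => F (∇ w x) - F (∇ φ x)) := fun w hw =>
    int_diff hDb hφ hw.1 hw.2
  set c : ℝ := 1 / (8 * (1 + (K:ℝ)) ^ 3) with hc
  have hc0 : 0 < c := by positivity
  have hcau : ∀ j k, c * ∫ x, ‖∇ (v j) x - ∇ (v k) x‖ ^ 2 ≤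
      (1 / ((j:ℝ) + 1) + 1 / ((k:ℝ) + 1)) / 2 := by
    intro j k
    have hz : (fun x => (1 / 2 : ℝ) * (v j x + v k x)) ∈ S :=
      ⟨lip_half (hvS j).1 (hvS k).1, fun x hx => by simp only [(hvS j).2 x hx, (hvS k).2 x hx]; ring⟩
    have i1 := hIntg _ hz
    have i2 := hIntg _ (hvS j)
    have i3 := hIntg _ (hvS k)
    have i4 : Integrable (fun x => ‖∇ (v j) x - ∇ (v k) x‖ ^ 2) := by
      apply integrable_bdd_ae hDb (((aesm_grad (v j)).sub (aesm_grad (v k))).norm.pow 2)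
        (C := ((K : ℝ) + K) ^ 2)
      · intro x
        rw [Pi.pow_apply, norm_pow, norm_norm]; gcongr
        exact (norm_sub_le _ _).trans (add_le_add (norm_grad_le (hvS j).1 x) (norm_grad_le (hvS k).1 x))
      · filter_upwards [ae_grad_eq (hvS k).1 (hvS j).1] with x hx hD
        simp [hx (by rw [(hvS j).2 x hD, (hvS k).2 x hD])]
    have hh : ∫ x, ((F (∇ (fun x => (1 / 2 : ℝ) * (v j x + v k x)) x) - F (∇ φ x)) +
        c * ‖∇ (v j) x - ∇ (v k) x‖ ^ 2) ≤
        ∫ x, ((1/2 : ℝ) * (F (∇ (v j) x) - F (∇ φ x)) + (1/2 : ℝ) * (F (∇ (v k) x) - F (∇ φ x))) := by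
      apply integral_mono_ae (i1.add (i4.const_mul c)) ((i2.const_mul _).add (i3.const_mul _))
      filter_upwards [ae_diff (hvS j).1, ae_diff (hvS k).1] with x d1 d2
      have := F_mid (F_grad_le (hvS j).1 x) (F_grad_le (hvS k).1 x)
      simp only [Pi.add_apply]
      rw [grad_half d1 d2]
      linarith
    rw [integral_add i1 (i4.const_mul c), integral_add (i2.const_mul _) (i3.const_mul _),
      integral_const_mul, integral_const_mul, integral_const_mul] at hh
    have h1 := hmin _ hz
    have h2 := hvI j; have h3 := hvI k
    simp only [hI] at h1 h2 h3
    linarith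
  obtain ⟨y0, hy0⟩ : ∃ y : E, y ∉ D := by
    obtain ⟨y, hy⟩ := NormedSpace.exists_lt_norm ℝ E R
    exact ⟨y, fun h => by have := hR h; simp at this; linarith⟩
  obtain ⟨ι, w, hι, hw⟩ := arzela (v := v) (fun m => ⟨K, Eventually.of_forall fun k =>
      (hvS k).1.lipschitzOnWith⟩) (fun m => ⟨|φ y0| + K * (m + ‖y0‖), Eventually.of_forall fun k x hx => by
        have h1 := (hvS k).1.dist_le_mul x y0
        rw [(hvS k).2 y0 hy0, Real.dist_eq, dist_eq_norm] at h1
        have h2 : ‖x - y0‖ ≤ m + ‖y0‖ := (norm_sub_le _ _).trans (by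
          have : ‖x‖ < m := by simpa using hx
          linarith)
        have h3 : (K:ℝ) * ‖x - y0‖ ≤ K * (m + ‖y0‖) := by gcongr
        have h4 := abs_add_le (φ y0) (v k x - φ y0)
        rw [add_sub_cancel] at h4
        linarith⟩)
  have hwS : w ∈ S := by
    refine ⟨lip_of_tendsto (fun k => (hvS (ι k)).1) hw, fun x hx => ?_⟩
    refine tendsto_nhds_unique (hw x) ?_
    simp only [(hvS _).2 x hx]
    exact tendsto_const_nhds
  obtain ⟨κ, hκ, hlim⟩ := grad_closure (fun k => (hvS (ι k)).1) hw 0 R (by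
    intro ε hε
    obtain ⟨N, hN⟩ := exists_nat_gt (1 / (c * ε))
    refine ⟨N, fun j hj k hk => ?_⟩
    have hkey : ∀ i ≥ N, 1 / ((ι i:ℝ) + 1) ≤ c * ε := by
      intro i hi
      have : (N:ℝ) ≤ ι i := by exact_mod_cast hi.trans (hι.id_le i)
      rw [div_le_iff₀ (by positivity)]
      rw [div_lt_iff₀ (by positivity)] at hN
      have : (N:ℝ) * (c * ε) ≤ ((ι i:ℝ) + 1) * (c * ε) := by gcongr; linarith
      linarith
    have h1 := hcau (ι j) (ι k)
    have h2 := hkey j hj; have h3 := hkey k hk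
    have h4 : ∫ x in ball 0 R, ‖∇ (v (ι j)) x - ∇ (v (ι k)) x‖ ^ 2 ≤
        ∫ x, ‖∇ (v (ι j)) x - ∇ (v (ι k)) x‖ ^ 2 := by
      apply setIntegral_le_integral
      · apply integrable_bdd_ae hDb (((aesm_grad (v (ι j))).sub (aesm_grad (v (ι k)))).norm.pow 2)
          (C := ((K : ℝ) + K) ^ 2)
        · intro x
          rw [Pi.pow_apply, norm_pow, norm_norm]; gcongr
          exact (norm_sub_le _ _).trans (add_le_add (norm_grad_le (hvS _).1 x) (norm_grad_le (hvS _).1 x))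
        · filter_upwards [ae_grad_eq (hvS (ι k)).1 (hvS (ι j)).1] with x hx hD
          simp [hx (by rw [(hvS _).2 x hD, (hvS _).2 x hD])]
      · exact Eventually.of_forall fun x => by positivity
    refine h4.trans ?_
    by_contra hcon
    push Not at hcon
    have := mul_lt_mul_of_pos_left hcon hc0
    linarith)
  have hIlim : Tendsto (fun k => I (v (ι (κ k)))) atTop (𝓝 (I w)) := by
    apply tendsto_integral_of_dominated_convergence ((ball (0:E) R).indicator fun _ => 1 + (K:ℝ))
    · intro k; exact (F_grad_meas _).sub (F_grad_meas _)
    · exact (integrable_indicator_iff measurableSet_ball).2 (integrableOn_const measure_ball_lt_top.ne)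
    · intro k
      filter_upwards [ae_grad_eq hφ (hvS (ι (κ k))).1] with x hx
      by_cases hxR : x ∈ ball (0:E) R
      · rw [indicator_of_mem hxR]
        have h1 := F_grad_le hφ x; have h2 := F_grad_le (hvS (ι (κ k))).1 x
        have h3 := F_pos (∇ φ x); have h4 := F_pos (∇ (v (ι (κ k))) x)
        rw [Real.norm_eq_abs, abs_le]; constructor <;> linarith
      · rw [indicator_of_notMem hxR, hx ((hvS _).2 x fun h => hxR (hR h))]; simp
    · have hall : ∀ᵐ x, ∀ k, v (ι (κ k)) x = φ x → ∇ (v (ι (κ k))) x = ∇ φ x :=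
        ae_all_iff.2 fun k => ae_grad_eq hφ (hvS _).1
      filter_upwards [hlim, hall, ae_grad_eq hφ hwS.1] with x h1 h2 h3
      by_cases hxR : x ∈ ball (0:E) R
      · exact ((F_continuous.tendsto _).comp (h1 hxR)).sub_const _
      · have hxD : x ∉ D := fun h => hxR (hR h)
        rw [h3 (hwS.2 x hxD)]
        simp only [h2 _ ((hvS _).2 x hxD)]
        exact tendsto_const_nhds
  have hIw : I w ≤ m := by
    have h2 : Tendsto (fun k : ℕ => m + 1 / ((k:ℝ) + 1)) atTop (𝓝 (m + 0)) :=
      tendsto_const_nhds.add tendsto_one_div_add_atTop_nhds_zero_nat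
    rw [add_zero] at h2
    refine le_of_tendsto_of_tendsto' hIlim h2 fun k => (hvI _).le.trans ?_
    have : (k:ℝ) ≤ ι (κ k) := by exact_mod_cast (hκ.id_le k).trans (hι.id_le _)
    gcongr
  refine ⟨w, ⟨hwS.1, fun z hz hzw => ?_⟩, hwS.2⟩
  have hzS : z ∈ S := ⟨hz, fun x hx => by rw [hzw x hx, hwS.2 x hx]⟩
  have h1 : I z - I w = ∫ x, (F (∇ z x) - F (∇ w x)) := by
    simp only [hI]
    rw [← integral_sub (hIntg z hzS) (hIntg w hwS)]
    congr 1; funext x; ring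
  rw [← h1]
  linarith [hmin z hzS]

/-- the reflection in the last four coordinates -/
noncomputable def J : E ≃ₗᵢ[ℝ] E :=
  LinearIsometryEquiv.piLpCongrRight 2
    (fun i : Fin 8 => if i < 4 then LinearIsometryEquiv.refl ℝ ℝ else LinearIsometryEquiv.neg ℝ)

/-- the swap of the two blocks of coordinates -/
noncomputable def sw : E ≃ₗᵢ[ℝ] E :=
  LinearIsometryEquiv.piLpCongrLeft 2 ℝ ℝ (Equiv.addRight (4 : Fin 8))

lemma J_apply (x : E) (i : Fin 8) : J x i = if i < 4 then x i else - x i := by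
  simp only [J, LinearIsometryEquiv.piLpCongrRight_apply]
  split_ifs <;> simp

lemma sw_apply (x : E) (i : Fin 8) : sw x i = x (i - 4) := by
  simp [sw, sub_eq_add_neg]

lemma J_symm (x y : E) : ⟪J x, y⟫ = ⟪x, J y⟫ := by
  rw [PiLp.inner_apply, PiLp.inner_apply]
  apply Finset.sum_congr rfl
  intro i _
  simp only [J_apply]
  split_ifs <;> simp

lemma J_J (x : E) : J (J x) = x := by
  ext i
  simp only [J_apply]
  split_ifs <;> simp

/-- the quadratic form `r² - s²` -/
noncomputable def g (x : E) : ℝ := ⟪J x, x⟫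

lemma g_sw (x : E) : g (sw x) = - g x := by
  simp only [g, PiLp.inner_apply, J_apply, sw_apply]
  simp [Fin.sum_univ_eight]
  simp [show -(4:Fin 8) = 4 by decide,
    show (1:Fin 8) - 4 = 5 by decide, show (2:Fin 8) - 4 = 6 by decide, show (3:Fin 8) - 4 = 7 by decide,
    show (5:Fin 8) - 4 = 1 by decide, show (6:Fin 8) - 4 = 2 by decide, show (7:Fin 8) - 4 = 3 by decide]
  ring

lemma abs_g_le (x : E) : |g x| ≤ ‖x‖ ^ 2 := by
  have := abs_real_inner_le_norm (J x) x
  rw [LinearIsometryEquiv.norm_map] at this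
  simpa [g, sq] using this

lemma g_expand (x y : E) : g x = g y + 2 * ⟪J y, x - y⟫ + g (x - y) := by
  have h : ⟪x, J y⟫ = ⟪J y, x⟫ := real_inner_comm _ _
  have h2 := J_symm x y
  simp only [g, map_sub, inner_sub_left, inner_sub_right]
  linarith

/-- Solutions of the Dirichlet problem on balls. -/
lemma exists_uR (R : ℝ) (hR : 0 < R) : ∃ (u : E → ℝ) (K : ℝ≥0), LipschitzWith K u ∧
    WS u (ball 0 R) ∧ (∀ x ∈ sphere (0:E) R, u x = R * g x) ∧
    (∀ A : E ≃ₗᵢ[ℝ] E, (∀ y, g (A y) = - g y) → ∀ x ∈ ball (0:E) R, u (A x) = - u x) := by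
  set D : Set E := ball 0 R with hD
  have hDb : Bornology.IsBounded D := isBounded_ball
  set K0 : ℝ≥0 := ⟨4 * R ^ 2, by positivity⟩ with hK0
  have hK0' : (K0 : ℝ) = 4 * R ^ 2 := rfl
  set K : ℝ≥0 := K0 + 1 with hK
  have hKK : (K0 : ℝ) ≤ K := by rw [hK]; push_cast; linarith
  have hq : LipschitzOnWith K0 (fun x => R * g x) (closedBall 0 R) := by
    apply LipschitzOnWith.of_dist_le_mul
    intro x hx y hy
    rw [mem_closedBall_zero_iff] at hx hy
    rw [Real.dist_eq, dist_eq_norm, hK0']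
    have h1 : g x - g y = ⟪J (x + y), x - y⟫ := by
      have h2 := J_symm x y
      have h : ⟪x, J y⟫ = ⟪J y, x⟫ := real_inner_comm _ _
      simp only [g, map_add, inner_add_left, inner_sub_right]
      linarith
    rw [← mul_sub, h1, abs_mul, abs_of_pos hR]
    have h2 := abs_real_inner_le_norm (J (x + y)) (x - y)
    rw [LinearIsometryEquiv.norm_map] at h2
    have h3 : ‖x + y‖ * ‖x - y‖ ≤ (2 * R) * ‖x - y‖ := by
      gcongr; exact (norm_add_le _ _).trans (by linarith)
    have h4 : R * |⟪J (x + y), x - y⟫| ≤ R * ((2 * R) * ‖x - y‖) := by gcongr; linarith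
    have : 0 ≤ R ^ 2 * ‖x - y‖ := by positivity
    nlinarith
  obtain ⟨φ, hφ, hφq⟩ := hq.extend_real
  have hφK : LipschitzWith K φ := hφ.weaken (by exact_mod_cast hKK)
  obtain ⟨u, hu, huφ⟩ := exists_min (D := D) hDb hφK
  have hfr : frontier D = sphere 0 R := frontier_ball 0 hR.ne'
  have hsph : ∀ x ∈ sphere (0:E) R, u x = R * g x := by
    intro x hx
    rw [huφ x (by rw [hD]; simp at hx ⊢; linarith), ← hφq (sphere_subset_closedBall hx)]
  have hDo : IsOpen D := isOpen_ball
  -- boundary estimate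
  have hbd : ∀ y ∈ sphere (0:E) R, ∀ x ∈ closedBall (0:E) R, |u x - u y| ≤ K0 * ‖x - y‖ := by
    intro y hy x hx
    have hyn : ‖y‖ = R := by simpa using hy
    have quad : ∀ z ∈ sphere (0:E) R, ‖z - y‖ ^ 2 = - 2 * ⟪y, z - y⟫ := by
      intro z hz
      have hzn : ‖z‖ = R := by simpa using hz
      rw [norm_sub_sq_real, inner_sub_right, real_inner_self_eq_norm_sq, hzn, hyn, real_inner_comm]
      ring
    have slope : ∀ ε : ℝ, |ε| ≤ 1 → ‖R • ((2:ℝ) • J y + (2 * ε) • y)‖ ≤ K0 := by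
      intro ε hε
      rw [norm_smul, Real.norm_eq_abs, abs_of_pos hR, hK0']
      have := norm_add_le ((2:ℝ) • J y) ((2 * ε) • y)
      rw [norm_smul, norm_smul, LinearIsometryEquiv.norm_map, hyn, Real.norm_eq_abs, Real.norm_eq_abs,
        abs_mul, abs_two] at this
      have h2 : 2 * |ε| * R ≤ 2 * 1 * R := by gcongr
      nlinarith
    have aff : ∀ (ε : ℝ) (z : E), R * (g y + 2 * ⟪J y, z - y⟫ + 2 * ε * ⟪y, z - y⟫) =
        ⟪R • ((2:ℝ) • J y + (2 * ε) • y), z⟫ + (R * g y - ⟪R • ((2:ℝ) • J y + (2 * ε) • y), y⟫) := by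
      intro ε z
      simp only [inner_smul_left, inner_add_left, inner_sub_right, RCLike.conj_to_real]
      ring
    have upper : ∀ z ∈ D, u z ≤ R * (g y + 2 * ⟪J y, z - y⟫ + 2 * (-1) * ⟪y, z - y⟫) := by
      intro z hz
      rw [aff]
      refine compare hDb hDo hu (LocMin.affine hDb _ _ ((slope (-1) (by simp)).trans hKK)) ?_ z hz
      intro z hz
      rw [hfr] at hz
      rw [← aff, hsph z hz, g_expand z y]
      have h1 := quad z hz
      have h2 := (abs_le.1 (abs_g_le (z - y))).2
      gcongr; linarith
    have lower : ∀ z ∈ D, R * (g y + 2 * ⟪J y, z - y⟫ + 2 * 1 * ⟪y, z - y⟫) ≤ u z := by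
      intro z hz
      rw [aff]
      refine compare hDb hDo (LocMin.affine hDb _ _ ((slope 1 (by simp)).trans hKK)) hu ?_ z hz
      intro z hz
      rw [hfr] at hz
      rw [← aff, hsph z hz, g_expand z y]
      have h1 := quad z hz
      have h2 := (abs_le.1 (abs_g_le (z - y))).1
      gcongr; linarith
    have bnd : ∀ (ε : ℝ) (z : E), |ε| ≤ 1 → |R * (g y + 2 * ⟪J y, z - y⟫ + 2 * ε * ⟪y, z - y⟫) - R * g y|
        ≤ K0 * ‖z - y‖ := by
      intro ε z hε
      have : R * (g y + 2 * ⟪J y, z - y⟫ + 2 * ε * ⟪y, z - y⟫) - R * g y =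
          ⟪R • ((2:ℝ) • J y + (2 * ε) • y), z - y⟫ := by
        simp only [inner_smul_left, inner_add_left, RCLike.conj_to_real]
        ring
      rw [this]
      refine (abs_real_inner_le_norm _ _).trans ?_
      gcongr; exact slope ε hε
    rw [hsph y hy]
    rcases eq_or_lt_of_le (show ‖x‖ ≤ R by simpa using hx) with h | h
    · have hxs : x ∈ sphere (0:E) R := by simpa using h
      rw [hsph x hxs]
      have := hq.dist_le_mul x hx y (sphere_subset_closedBall hy)
      rwa [Real.dist_eq, dist_eq_norm] at this
    · have hxD : x ∈ D := by simpa [hD] using h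
      have h1 := upper x hxD; have h2 := lower x hxD
      have h3 := (abs_le.1 (bnd (-1) x (by simp))).2
      have h4 := (abs_le.1 (bnd 1 x (by simp))).1
      rw [abs_le]; constructor <;> linarith
  -- interior estimate
  have hIntg : ∀ h : E, ∀ x, x ∈ D → x + h ∈ D → u (x + h) ≤ u x + K0 * ‖h‖ := by
    intro h x hx hxh
    have hset : {z : E | z + h ∈ D} = ball (-h) R := by
      ext z; simp [hD, dist_eq_norm]
    have hfr2 : frontier {z : E | z + h ∈ D} = sphere (-h) R := by rw [hset]; exact frontier_ball _ hR.ne'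
    have hcl : closure {z : E | z + h ∈ D} ⊆ closedBall (-h) R := by
      rw [hset]; exact closure_ball_subset_closedBall
    have hcl' : closure D ⊆ closedBall 0 R := closure_ball_subset_closedBall
    refine compare (D := D ∩ {z | z + h ∈ D}) (hDb.subset inter_subset_left)
      (hDo.inter (by rw [hset]; exact isOpen_ball)) ((hu.translate h).mono inter_subset_right)
      ((hu.mono inter_subset_left).add_const _) ?_ x ⟨hx, hxh⟩
    intro z hz
    rcases frontier_inter_subset _ _ hz with ⟨h1, h2⟩ | ⟨h1, h2⟩
    · rw [hfr] at h1
      have h3 : z + h ∈ closedBall (0:E) R := by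
        have := hcl h2; simpa [dist_eq_norm] using this
      have := (abs_le.1 (hbd z h1 (z + h) h3)).2
      rw [add_sub_cancel_left] at this
      linarith
    · rw [hfr2] at h2
      have h3 : z + h ∈ sphere (0:E) R := by simpa [dist_eq_norm] using h2
      have := (abs_le.1 (hbd (z + h) h3 z (hcl' h1))).1
      rw [show z - (z + h) = -h by abel, norm_neg] at this
      linarith
  have hLon : LipschitzOnWith K0 u (closedBall 0 R) := by
    apply LipschitzOnWith.of_dist_le_mul
    intro x hx y hy
    rw [Real.dist_eq, dist_eq_norm]
    rcases eq_or_lt_of_le (show ‖x‖ ≤ R by simpa using hx) with h | h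
    · rw [abs_sub_comm, norm_sub_rev]
      exact hbd x (by simpa using h) y hy
    rcases eq_or_lt_of_le (show ‖y‖ ≤ R by simpa using hy) with h' | h'
    · exact hbd y (by simpa using h') x hx
    have hxD : x ∈ D := by simpa [hD] using h
    have hyD : y ∈ D := by simpa [hD] using h'
    have h1 := hIntg (y - x) x hxD (by simpa using hyD)
    have h2 := hIntg (x - y) y hyD (by simpa using hxD)
    rw [add_sub_cancel] at h1 h2
    rw [norm_sub_rev] at h1
    rw [abs_le]; constructor <;> linarith
  obtain ⟨a, ha, hau⟩ := hLon.extend_real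
  classical
  have hglue := lip_glue (D := D) ha hφ (by
    intro x hx
    rw [hfr] at hx
    rw [← hau (sphere_subset_closedBall hx), hsph x hx, ← hφq (sphere_subset_closedBall hx)])
  have huL : LipschitzWith K0 u := by
    have : u = fun x => if x ∈ D then a x else φ x := by
      funext x
      split_ifs with h
      · exact hau (ball_subset_closedBall h)
      · exact huφ x h
    rw [this]; exact hglue
  have hws : WS u D := hu.ws hDb huL (by rw [hK]; exact lt_add_of_pos_right _ one_pos)
  refine ⟨u, K0, huL, hws, hsph, fun A hA => ?_⟩
  have hswD : ∀ x, A x ∈ D ↔ x ∈ D := fun x => by simp [hD]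
  have hsw := hu.isometry A hswD
  have hneg := hu.neg
  have hbdr : ∀ x ∈ frontier D, u (A x) = - u x := by
    intro x hx
    rw [hfr] at hx
    rw [hsph x hx, hsph (A x) (by simpa using hx), hA]; ring
  exact fun x hx => le_antisymm
    (compare hDb hDo hsw hneg (fun x hx => (hbdr x hx).le) x hx)
    (compare hDb hDo hneg hsw (fun x hx => (hbdr x hx).ge) x hx)

end BDG

open scoped RealInnerProductSpace
namespace BDG
open MeasureTheory Filter Topology Set Metric
open scoped NNReal ENNReal Gradient ContDiff

lemma eLpNorm_two {G : Type*} [NormedAddCommGroup G] {f : E → G}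
    (hm : AEStronglyMeasurable f volume) (hi : Integrable (fun x => ‖f x‖ ^ 2)) :
    eLpNorm f 2 volume = ENNReal.ofReal (√(∫ x, ‖f x‖ ^ 2)) := by
  have : MemLp f 2 volume := (memLp_two_iff_integrable_sq_norm hm).2 hi
  rw [this.eLpNorm_eq_integral_rpow_norm (by norm_num) (by norm_num), Real.sqrt_eq_rpow]
  norm_num

lemma sobolev_lip : ∃ C : ℝ≥0, ∀ (f : E → ℝ) (K : ℝ≥0) (R : ℝ), LipschitzWith K f →
    (∀ x, x ∉ ball (0:E) R → f x = 0) →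
    eLpNorm f ((8/3 : ℝ≥0) : ℝ≥0∞) volume ≤ C * eLpNorm (∇ f) 2 volume := by
  refine ⟨eLpNormLESNormFDerivOfEqInnerConst (volume : Measure E) ((2:ℝ≥0):ℝ), ?_⟩
  intro f K R hf hR
  obtain ⟨fn, hsm, hlip, happ, hgr, hloc⟩ := smooth_approx hf
  have hsupp : ∀ n x, x ∉ ball (0:E) (R + 1) → fn n x = 0 := by
    intro n x hx
    apply hloc
    intro y hy
    apply hR
    intro hy'
    apply hx
    rw [mem_ball_zero_iff] at hy' ⊢
    rw [mem_ball_iff_norm] at hy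
    have h1 : (1:ℝ) / ((n:ℝ) + 1) ≤ 1 := by
      rw [div_le_one (by positivity)]; linarith [Nat.cast_nonneg (α := ℝ) n]
    have h2 : ‖x‖ ≤ ‖y‖ + ‖y - x‖ := by
      have := norm_sub_le y (y - x); simpa using this
    linarith
  have hsupp0 : ∀ x, x ∉ ball (0:E) (R + 1) → f x = 0 := fun x hx => hR x fun h => hx (ball_subset_ball (by linarith) h)
  have hIntg : ∀ (h : E → ℝ), LipschitzWith K h → (∀ x, x ∉ ball (0:E) (R + 1) → h x = 0) →
      Integrable (fun x => ‖∇ h x‖ ^ 2) := by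
    intro h hh h0
    apply integrable_bdd_ae isBounded_ball ((aesm_grad h).norm.pow 2) (C := (K:ℝ) ^ 2) (D := ball (0:E) (R + 1))
    · intro x
      rw [Pi.pow_apply, norm_pow, norm_norm]; gcongr; exact norm_grad_le hh x
    · filter_upwards [ae_grad_zero hh] with x hx hD
      simp [hx (h0 x hD)]
  have h1 : ∀ n, eLpNorm (fn n) ((8/3 : ℝ≥0) : ℝ≥0∞) volume ≤
      eLpNormLESNormFDerivOfEqInnerConst (volume : Measure E) ((2:ℝ≥0):ℝ) * eLpNorm (∇ (fn n)) 2 volume := by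
    intro n
    have := eLpNorm_le_eLpNorm_fderiv_of_eq_inner (F' := ℝ) (μ := (volume : Measure E)) (u := fn n) ((hsm n).of_le (by simp))
      (hasCompactSupport_of_ball (hsupp n)) (p := 2) (p' := 8/3) (by norm_num)
      (by simp) (by simp; norm_num)
    refine this.trans (le_of_eq ?_)
    congr 1
    apply eLpNorm_congr_norm_ae
    exact Eventually.of_forall fun x => (norm_grad _ _).symm
  have h2 : Tendsto (fun n => eLpNorm (∇ (fn n)) 2 volume) atTop (𝓝 (eLpNorm (∇ f) 2 volume)) := by
    rw [eLpNorm_two (aesm_grad f) (hIntg f hf hsupp0)]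
    simp only [fun n => eLpNorm_two (aesm_grad (fn n)) (hIntg (fn n) (hlip n) (hsupp n))]
    apply (ENNReal.continuous_ofReal.tendsto _).comp
    apply (Real.continuous_sqrt.tendsto _).comp
    apply tendsto_integral_of_dominated_convergence ((ball (0:E) (R+1)).indicator fun _ => (K:ℝ) ^ 2)
    · intro n; exact (aesm_grad _).norm.pow 2
    · exact (integrable_indicator_iff measurableSet_ball).2 (integrableOn_const measure_ball_lt_top.ne)
    · intro n
      filter_upwards [ae_grad_zero (hlip n)] with x hx
      by_cases hxR : x ∈ ball (0:E) (R+1)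
      · rw [indicator_of_mem hxR, norm_pow, norm_norm]; gcongr; exact norm_grad_le (hlip n) x
      · rw [indicator_of_notMem hxR, hx (hsupp n x hxR)]; simp
    · filter_upwards [hgr] with x hx
      exact (hx.norm).pow 2
  have h3 : eLpNorm f ((8/3 : ℝ≥0) : ℝ≥0∞) volume ≤ liminf (fun n => eLpNorm (fn n) ((8/3 : ℝ≥0) : ℝ≥0∞) volume) atTop := by
    apply Lp.eLpNorm_lim_le_liminf_eLpNorm (fun n => (hlip n).continuous.aestronglyMeasurable)
    refine Eventually.of_forall fun x => ?_
    rw [tendsto_iff_norm_sub_tendsto_zero]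
    refine squeeze_zero (fun n => norm_nonneg _) (fun n => happ n x) ?_
    have := tendsto_one_div_add_atTop_nhds_zero_nat (𝕜 := ℝ) |>.const_mul (K:ℝ)
    simpa [div_eq_mul_inv] using this
  refine h3.trans ?_
  have h4 : Tendsto (fun n => (eLpNormLESNormFDerivOfEqInnerConst (volume : Measure E) ((2:ℝ≥0):ℝ) : ℝ≥0∞) * eLpNorm (∇ (fn n)) 2 volume) atTop (𝓝 (eLpNormLESNormFDerivOfEqInnerConst (volume : Measure E) ((2:ℝ≥0):ℝ) * eLpNorm (∇ f) 2 volume)) :=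
    ENNReal.Tendsto.const_mul h2 (Or.inr (by simp))
  rw [← h4.liminf_eq]
  exact liminf_le_liminf (Eventually.of_forall h1)

lemma faber_krahn : ∃ C : ℝ, 0 < C ∧ ∀ (f : E → ℝ) (K : ℝ≥0) (R : ℝ) (S : Set E), LipschitzWith K f →
    (∀ x, x ∉ ball (0:E) R → f x = 0) → MeasurableSet S → S ⊆ ball (0:E) R → (∀ x, x ∉ S → f x = 0) →
    ∫ x, f x ^ 2 ≤ C * (volume.real S) ^ (1/4 : ℝ) * ∫ x, ‖∇ f x‖ ^ 2 := by
  obtain ⟨C, hC⟩ := sobolev_lip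
  refine ⟨(C : ℝ) ^ 2 + 1, by positivity, ?_⟩
  intro f K R S hf hR hS hSR hS0
  have hb : ∃ B : ℝ, ∀ x, ‖f x‖ ≤ B := (hasCompactSupport_of_ball hR).exists_bound_of_continuous hf.continuous
  obtain ⟨B, hB⟩ := hb
  have i1 : Integrable (fun x => ‖f x‖ ^ 2) := by
    apply integrable_bdd_ae isBounded_ball (hf.continuous.aestronglyMeasurable.norm.pow 2) (C := B ^ 2) (D := ball (0:E) R)
    · intro x
      rw [Pi.pow_apply, norm_pow, norm_norm]; gcongr; exact hB x
    · exact Eventually.of_forall fun x hx => by simp [hR x hx]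
  have i2 : Integrable (fun x => ‖∇ f x‖ ^ 2) := by
    apply integrable_bdd_ae isBounded_ball ((aesm_grad f).norm.pow 2) (C := (K:ℝ) ^ 2) (D := ball (0:E) R)
    · intro x
      rw [Pi.pow_apply, norm_pow, norm_norm]; gcongr; exact norm_grad_le hf x
    · filter_upwards [ae_grad_zero hf] with x hx hD
      simp [hx (hR x hD)]
  have hfin : volume S ≠ ⊤ := (measure_mono hSR).trans_lt measure_ball_lt_top |>.ne
  have h1 : eLpNorm f 2 volume ≤ eLpNorm f ((8/3 : ℝ≥0) : ℝ≥0∞) volume * volume S ^ (1/8 : ℝ) := by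
    have hsub : Function.support f ⊆ S := fun x hx => by by_contra h; exact hx (hS0 x h)
    rw [← eLpNorm_restrict_eq_of_support_subset (p := 2) hsub,
      ← eLpNorm_restrict_eq_of_support_subset (p := ((8/3 : ℝ≥0) : ℝ≥0∞)) hsub]
    have := eLpNorm_le_eLpNorm_mul_rpow_measure_univ (μ := volume.restrict S) (f := f) (p := 2) (q := ((8/3 : ℝ≥0) : ℝ≥0∞))
      (by rw [show (2:ℝ≥0∞) = ((2:ℝ≥0) : ℝ≥0∞) by simp, ENNReal.coe_le_coe]; rw [le_div_iff₀ (by norm_num)]; norm_num) hf.continuous.aestronglyMeasurable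
    refine this.trans (le_of_eq ?_)
    simp
    norm_num
  have h2 := h1.trans (mul_le_mul_left (hC f K R hf hR) _)
  rw [eLpNorm_two hf.continuous.aestronglyMeasurable i1, eLpNorm_two (aesm_grad f) i2] at h2
  have h3 := ENNReal.toReal_mono (by finiteness) h2
  rw [ENNReal.toReal_mul, ENNReal.toReal_mul, ENNReal.toReal_ofReal (by positivity), ENNReal.toReal_ofReal (by positivity),
    ← ENNReal.toReal_rpow] at h3
  have h4 := pow_le_pow_left₀ (by positivity) h3 2
  rw [mul_pow, mul_pow, Real.sq_sqrt (integral_nonneg fun x => by positivity), Real.sq_sqrt (integral_nonneg fun x => by positivity),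
    ← Real.rpow_natCast ((volume S).toReal ^ _), ← Real.rpow_mul (by positivity)] at h4
  simp only [Real.norm_eq_abs, sq_abs] at h4
  refine h4.trans ?_
  have h5 : 0 ≤ ∫ x, ‖∇ f x‖ ^ 2 := integral_nonneg fun x => by positivity
  have : (1 / 8 : ℝ) * ((2:ℕ) : ℝ) = 1 / 4 := by norm_num
  rw [this]
  have h6 : 0 ≤ (volume.real S) ^ (1/4:ℝ) := by positivity
  simp only [ENNReal.coe_toReal]
  change (C:ℝ) ^ 2 * _ * (volume.real S) ^ (1/4:ℝ) ≤ _
  nlinarith [mul_nonneg h5 h6]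

end BDG

open scoped RealInnerProductSpace
namespace BDG
open MeasureTheory Filter Topology Set Metric
open scoped NNReal ENNReal Gradient ContDiff

lemma lintegral_dilate {H : E → ℝ≥0∞} (hH : Measurable H) (a : E) {t : ℝ} (ht : 1 / 2 ≤ t) :
    ∫⁻ y, H (a + t • y) ≤ 2 ^ 8 * ∫⁻ z, H z := by
  have ht0 : t ≠ 0 := by linarith
  have h1 : ∫⁻ y, H (a + t • y) = ∫⁻ y, H (a + y) ∂(Measure.map (t • ·) (volume : Measure E)) := by
    exact (lintegral_map (f := fun y => H (a + y)) (hH.comp (measurable_const_add a))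
      (measurable_const_smul t)).symm
  rw [h1, Measure.map_addHaar_smul _ ht0, lintegral_smul_measure, lintegral_add_left_eq_self, smul_eq_mul]
  gcongr
  rw [show (2:ℝ≥0∞) ^ 8 = ENNReal.ofReal (2 ^ 8) by
    rw [ENNReal.ofReal_pow (by norm_num)]; simp]
  apply ENNReal.ofReal_le_ofReal
  simp only [finrank_euclideanSpace, Fintype.card_fin]
  have : (1/2:ℝ) ^ 8 ≤ t ^ 8 := by gcongr
  rw [abs_of_nonneg (by positivity)]
  calc (t ^ 8)⁻¹ ≤ ((1/2:ℝ) ^ 8)⁻¹ := by gcongr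
    _ = 2 ^ 8 := by norm_num

lemma poincare_smooth {K : ℝ≥0} {f : E → ℝ} (hf : ContDiff ℝ ∞ f) :
    ∫⁻ x in ball (0:E) 1, ∫⁻ y in ball (0:E) 1, ‖f y - f x‖ₑ ≤
      2 ^ 9 * volume (ball (0:E) 1) * ∫⁻ z in ball (0:E) 1, ‖∇ f z‖ₑ := by
  set B := ball (0:E) 1 with hB
  set H : E → ℝ≥0∞ := B.indicator (fun z => ‖∇ f z‖ₑ) with hH
  have hHm : Measurable H := (measurable_grad f).enorm.indicator measurableSet_ball
  have hd : Differentiable ℝ f := hf.differentiable (by simp)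
  have hgc : Continuous (∇ f) := by
    have h1 : Continuous (fderiv ℝ f) := hf.continuous_fderiv (by simp)
    exact (InnerProductSpace.toDual ℝ E).symm.continuous.comp h1
  have step1 : ∀ x ∈ B, ∀ y ∈ B, ‖f y - f x‖ₑ ≤ ∫⁻ t in Ioc (0:ℝ) 1, 2 * H (x + t • (y - x)) := by
    intro x hx y hy
    have hder : ∀ t : ℝ, HasDerivAt (fun t : ℝ => f (x + t • (y - x))) ⟪∇ f (x + t • (y - x)), y - x⟫ t := by
      intro t
      have h1 : HasDerivAt (fun t : ℝ => x + t • (y - x)) (y - x) t := by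
        simpa using ((hasDerivAt_id t).smul_const (y - x)).const_add x
      have := (hd (x + t • (y - x))).hasFDerivAt.comp_hasDerivAt t h1
      rw [grad_apply]; exact this
    have hc : Continuous (fun t : ℝ => ⟪∇ f (x + t • (y - x)), y - x⟫) := by fun_prop
    have h2 := intervalIntegral.integral_eq_sub_of_hasDerivAt (fun t _ => hder t)
      (hc.intervalIntegrable 0 1)
    simp only [one_smul, zero_smul, add_zero, add_sub_cancel] at h2
    rw [← h2, intervalIntegral.integral_of_le zero_le_one]
    refine (enorm_integral_le_lintegral_enorm _).trans ?_
    apply setLIntegral_mono (by fun_prop)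
    intro t ht
    have hmem : x + t • (y - x) ∈ B := by
      have := (convex_ball (0:E) 1) hx hy (a := 1 - t) (b := t) (by linarith [ht.2]) ht.1.le (by ring)
      convert this using 1
      module
    rw [hH, indicator_of_mem hmem]
    have h3 : ‖y - x‖ ≤ 2 := by
      have := norm_sub_le y x
      have h4 : ‖x‖ < 1 := by simpa [hB] using hx
      have h5 : ‖y‖ < 1 := by simpa [hB] using hy
      linarith
    have h6 : ‖⟪∇ f (x + t • (y - x)), y - x⟫‖ ≤ 2 * ‖∇ f (x + t • (y - x))‖ := by
      refine (norm_inner_le_norm _ _).trans ?_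
      rw [mul_comm]; gcongr
    rw [← ofReal_norm, ← ofReal_norm]
    calc ENNReal.ofReal ‖⟪∇ f (x + t • (y - x)), y - x⟫‖
        ≤ ENNReal.ofReal (2 * ‖∇ f (x + t • (y - x))‖) := ENNReal.ofReal_le_ofReal h6
      _ = 2 * ENNReal.ofReal ‖∇ f (x + t • (y - x))‖ := by
        rw [ENNReal.ofReal_mul (by norm_num), ENNReal.ofReal_ofNat]
  have step2 : ∀ t : ℝ, ∫⁻ x in B, ∫⁻ y in B, 2 * H (x + t • (y - x)) ≤ 2 * (volume B * (2 ^ 8 * ∫⁻ z, H z)) := by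
    intro t
    rcases le_total (1/2) t with ht | ht
    · have : ∀ x, ∫⁻ y in B, 2 * H (x + t • (y - x)) ≤ 2 * (2 ^ 8 * ∫⁻ z, H z) := by
        intro x
        rw [lintegral_const_mul _ (by fun_prop)]
        gcongr
        refine (setLIntegral_le_lintegral _ _).trans ?_
        refine le_trans (le_of_eq ?_) (lintegral_dilate hHm (x - t • x) ht)
        congr 1; funext y; congr 1; module
      calc _ ≤ ∫⁻ x in B, 2 * (2 ^ 8 * ∫⁻ z, H z) := lintegral_mono this
        _ = _ := by rw [lintegral_const, Measure.restrict_apply_univ]; ring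
    · have hm : Measurable (Function.uncurry fun x y : E => 2 * H (x + t • (y - x))) := by
        simp only [Function.uncurry_def]; fun_prop
      rw [lintegral_lintegral_swap hm.aemeasurable]
      have : ∀ y, ∫⁻ x in B, 2 * H (x + t • (y - x)) ≤ 2 * (2 ^ 8 * ∫⁻ z, H z) := by
        intro y
        rw [lintegral_const_mul _ (by fun_prop)]
        gcongr
        refine (setLIntegral_le_lintegral _ _).trans ?_
        refine le_trans (le_of_eq ?_) (lintegral_dilate hHm (t • y) (t := 1 - t) (by linarith))
        congr 1; funext x; congr 1; module
      calc _ ≤ ∫⁻ x in B, 2 * (2 ^ 8 * ∫⁻ z, H z) := lintegral_mono this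
        _ = _ := by rw [lintegral_const, Measure.restrict_apply_univ]; ring
  have hHi : ∫⁻ z, H z = ∫⁻ z in B, ‖∇ f z‖ₑ := lintegral_indicator measurableSet_ball _
  calc ∫⁻ x in B, ∫⁻ y in B, ‖f y - f x‖ₑ
      ≤ ∫⁻ x in B, ∫⁻ y in B, ∫⁻ t in Ioc (0:ℝ) 1, 2 * H (x + t • (y - x)) := by
        apply setLIntegral_mono' measurableSet_ball
        intro x hx
        apply setLIntegral_mono' measurableSet_ball
        intro y hy
        exact step1 x hx y hy
    _ = ∫⁻ x in B, ∫⁻ t in Ioc (0:ℝ) 1, ∫⁻ y in B, 2 * H (x + t • (y - x)) := by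
        congr 1; funext x
        rw [lintegral_lintegral_swap]
        apply Measurable.aemeasurable
        simp only [Function.uncurry_def]; fun_prop
    _ = ∫⁻ t in Ioc (0:ℝ) 1, ∫⁻ x in B, ∫⁻ y in B, 2 * H (x + t • (y - x)) := by
        rw [lintegral_lintegral_swap]
        apply Measurable.aemeasurable
        simp only [Function.uncurry_def]
        apply Measurable.lintegral_prod_right' (f := fun p : (E × ℝ) × E => 2 * H (p.1.1 + p.1.2 • (p.2 - p.1.1)))
        fun_prop
    _ ≤ ∫⁻ t in Ioc (0:ℝ) 1, 2 * (volume B * (2 ^ 8 * ∫⁻ z, H z)) := lintegral_mono step2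
    _ = 2 ^ 9 * volume B * ∫⁻ z in B, ‖∇ f z‖ₑ := by
        rw [lintegral_const, Measure.restrict_apply_univ, hHi]
        simp; ring

lemma poincare_lip {K : ℝ≥0} {f : E → ℝ} (hf : LipschitzWith K f) :
    ∫⁻ x in ball (0:E) 1, ∫⁻ y in ball (0:E) 1, ‖f y - f x‖ₑ ≤
      2 ^ 9 * volume (ball (0:E) 1) * ∫⁻ z in ball (0:E) 1, ‖∇ f z‖ₑ := by
  set B := ball (0:E) 1 with hB
  have hBf : volume B ≠ ⊤ := measure_ball_lt_top.ne
  obtain ⟨fn, hsm, hlip, happ, hgr, hloc⟩ := smooth_approx hf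
  have hb : ∀ n : ℕ, ∫⁻ x in B, ∫⁻ y in B, ‖f y - f x‖ₑ ≤
      2 ^ 9 * volume B * (∫⁻ z in B, ‖∇ (fn n) z‖ₑ) + ENNReal.ofReal (2 * (K / ((n:ℝ) + 1))) * volume B * volume B := by
    intro n
    have pt : ∀ x y, ‖f y - f x‖ₑ ≤ ‖fn n y - fn n x‖ₑ + ENNReal.ofReal (2 * (K / ((n:ℝ) + 1))) := by
      intro x y
      rw [← ofReal_norm, ← ofReal_norm, ← ENNReal.ofReal_add (by positivity) (by positivity)]
      apply ENNReal.ofReal_le_ofReal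
      have h1 := happ n x; have h2 := happ n y
      rw [abs_le] at h1 h2
      rw [Real.norm_eq_abs, Real.norm_eq_abs]
      have h3 := neg_abs_le (fn n y - fn n x); have h4 := le_abs_self (fn n y - fn n x)
      rw [abs_le]; constructor <;> linarith
    have cn : Continuous (fn n) := (hlip n).continuous
    calc _ ≤ ∫⁻ x in B, ∫⁻ y in B, (‖fn n y - fn n x‖ₑ + ENNReal.ofReal (2 * (K / ((n:ℝ) + 1)))) := by
          apply lintegral_mono; intro x; apply lintegral_mono; intro y; exact pt x y
      _ = ∫⁻ x in B, ((∫⁻ y in B, ‖fn n y - fn n x‖ₑ) + ENNReal.ofReal (2 * (K / ((n:ℝ) + 1))) * volume B) := by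
          congr 1; funext x
          rw [lintegral_add_right _ measurable_const, lintegral_const, Measure.restrict_apply_univ]
      _ = (∫⁻ x in B, (∫⁻ y in B, ‖fn n y - fn n x‖ₑ)) + ENNReal.ofReal (2 * (K / ((n:ℝ) + 1))) * volume B * volume B := by
          rw [lintegral_add_right _ measurable_const, lintegral_const, Measure.restrict_apply_univ]
      _ ≤ _ := by gcongr; exact poincare_smooth (K := K) (hsm n)
  have lim1 : Tendsto (fun n => ∫⁻ z in B, ‖∇ (fn n) z‖ₑ) atTop (𝓝 (∫⁻ z in B, ‖∇ f z‖ₑ)) := by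
    apply tendsto_lintegral_of_dominated_convergence (fun _ => ENNReal.ofReal K)
    · intro n; exact (measurable_grad _).enorm
    · intro n
      refine Eventually.of_forall fun x => ?_
      show ‖∇ (fn n) x‖ₑ ≤ ENNReal.ofReal K
      rw [← ofReal_norm]; exact ENNReal.ofReal_le_ofReal (norm_grad_le (hlip n) x)
    · rw [lintegral_const, Measure.restrict_apply_univ]
      exact ENNReal.mul_ne_top (by simp) hBf
    · apply ae_restrict_of_ae
      filter_upwards [hgr] with x hx
      exact (continuous_enorm.tendsto _).comp hx
  have lim2 : Tendsto (fun n : ℕ => ENNReal.ofReal (2 * (K / ((n:ℝ) + 1))) * volume B * volume B) atTop (𝓝 (0 * volume B * volume B)) := by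
    apply ENNReal.Tendsto.mul_const _ (Or.inr hBf)
    apply ENNReal.Tendsto.mul_const _ (Or.inr hBf)
    have h0 := (tendsto_one_div_add_atTop_nhds_zero_nat (𝕜 := ℝ)).const_mul (2 * (K:ℝ))
    rw [mul_zero] at h0
    have := (ENNReal.continuous_ofReal.tendsto 0).comp h0
    rw [ENNReal.ofReal_zero] at this
    refine this.congr fun n => ?_
    simp only [Function.comp]
    congr 1; ring
  have lim := (ENNReal.Tendsto.const_mul lim1 (a := 2 ^ 9 * volume B) (Or.inr (by finiteness))).add lim2
  simp only [zero_mul, add_zero] at lim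
  exact ge_of_tendsto' lim hb

lemma poincare : ∃ C : ℝ, 0 < C ∧ ∀ (v : E → ℝ) (K : ℝ≥0) (b : ℝ), LipschitzWith K v →
    (∀ x, |v x| ≤ b) → volume.real (ball (0:E) 1) / 2 ≤ volume.real {x ∈ ball (0:E) 1 | v x = 0} →
    ∫ x in ball (0:E) 1, v x ^ 2 ≤ C * ∫ x in ball (0:E) 1, ‖∇ v x‖ ^ 2 := by
  set B := ball (0:E) 1 with hB
  have hBf : volume B ≠ ⊤ := measure_ball_lt_top.ne
  have hB0 : 0 < volume.real B := by
    rw [Measure.real, ENNReal.toReal_pos_iff]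
    exact ⟨measure_ball_pos _ _ one_pos, measure_ball_lt_top⟩
  refine ⟨2 ^ 22, by positivity, ?_⟩
  intro v K b hv hb hS
  set S := {x ∈ B | v x = 0} with hSdef
  have hSm : MeasurableSet S := measurableSet_ball.inter (hv.continuous.measurable (measurableSet_singleton 0))
  have hSB : S ⊆ B := fun x hx => hx.1
  have hb0 : 0 ≤ b := (abs_nonneg _).trans (hb 0)
  have hv2 : LipschitzWith (K * (2 * b.toNNReal)) (fun x => v x ^ 2) := by
    apply LipschitzWith.of_dist_le_mul
    intro x y
    have h1 := hv.dist_le_mul x y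
    rw [Real.dist_eq] at *
    rw [sq_sub_sq, abs_mul]
    push_cast
    rw [Real.coe_toNNReal b hb0]
    have h2 : |v x + v y| ≤ 2 * b := (abs_add_le _ _).trans (by linarith [hb x, hb y])
    calc |v x + v y| * |v x - v y| ≤ (2 * b) * (K * dist x y) := by gcongr
      _ = _ := by ring
  have h1 := poincare_lip hv2
  have hbn : ∀ x, ‖v x‖ ≤ b := hb
  -- lower bound
  have h2 : volume S * ∫⁻ y in B, ‖v y ^ 2‖ₑ ≤ 2 ^ 9 * volume B * ∫⁻ z in B, ‖∇ (fun x => v x ^ 2) z‖ₑ := by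
    refine le_trans ?_ h1
    calc volume S * ∫⁻ y in B, ‖v y ^ 2‖ₑ = ∫⁻ x in S, ∫⁻ y in B, ‖v y ^ 2‖ₑ := by
          rw [lintegral_const, Measure.restrict_apply_univ, mul_comm]
      _ = ∫⁻ x in S, ∫⁻ y in B, ‖v y ^ 2 - v x ^ 2‖ₑ := by
          apply setLIntegral_congr_fun hSm
          intro x hx
          simp [hx.2]
      _ ≤ _ := lintegral_mono_set hSB
  have i0 : IntegrableOn (fun x => v x ^ 2) B := by
    apply integrableOn_bdd isBounded_ball (C := b ^ 2)
    · exact (hv.continuous.pow 2).aestronglyMeasurable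
    · intro x; rw [norm_pow]; gcongr; exact hb x
  have i1 : IntegrableOn (fun x => ‖∇ (fun x => v x ^ 2) x‖) B := by
    apply integrableOn_bdd isBounded_ball (C := K * (2 * b.toNNReal))
    · exact (aesm_grad _).norm
    · intro x; rw [norm_norm]; have := norm_grad_le hv2 x; push_cast at this; exact this
  have i2 : IntegrableOn (fun x => ‖∇ v x‖ ^ 2) B := by
    apply integrableOn_bdd isBounded_ball (C := (K:ℝ) ^ 2)
    · exact (aesm_grad _).norm.pow 2
    · intro x; rw [norm_pow, norm_norm]; gcongr; exact norm_grad_le hv x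
  have e0 : ∫⁻ y in B, ‖v y ^ 2‖ₑ = ENNReal.ofReal (∫ y in B, v y ^ 2) := by
    rw [ofReal_integral_eq_lintegral_ofReal i0 (Eventually.of_forall fun x => by positivity)]
    congr 1; funext y
    rw [← ofReal_norm, Real.norm_of_nonneg (by positivity)]
  have e1 : ∫⁻ z in B, ‖∇ (fun x => v x ^ 2) z‖ₑ = ENNReal.ofReal (∫ z in B, ‖∇ (fun x => v x ^ 2) z‖) := by
    rw [ofReal_integral_eq_lintegral_ofReal i1 (Eventually.of_forall fun x => by positivity)]
    congr 1; funext y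
    rw [ofReal_norm]
  rw [e0, e1] at h2
  have h3 := ENNReal.toReal_mono (by finiteness) h2
  simp only [ENNReal.toReal_mul, ENNReal.toReal_pow, ENNReal.toReal_ofNat] at h3
  rw [ENNReal.toReal_ofReal (integral_nonneg fun x => by positivity), ENNReal.toReal_ofReal (integral_nonneg fun x => by positivity)] at h3
  change volume.real S * _ ≤ 2 ^ 9 * volume.real B * _ at h3
  set P := ∫ y in B, v y ^ 2 with hP
  set Q := ∫ z in B, ‖∇ (fun x => v x ^ 2) z‖ with hQ
  set G := ∫ z in B, ‖∇ v z‖ ^ 2 with hG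
  have hP0 : 0 ≤ P := integral_nonneg fun x => by positivity
  have h4 : P ≤ 2 ^ 10 * Q := by
    have : volume.real B / 2 * P ≤ 2 ^ 9 * volume.real B * Q := (by gcongr : volume.real B / 2 * P ≤ volume.real S * P).trans h3
    have h5 : volume.real B * P ≤ volume.real B * (2 ^ 10 * Q) := by linarith
    exact le_of_mul_le_mul_left h5 hB0
  have h5 : 2 ^ 10 * Q ≤ (1/2) * P + 2 ^ 21 * G := by
    rw [hQ, hP, hG, ← integral_const_mul, ← integral_const_mul, ← integral_const_mul, ← integral_add (i0.const_mul _) (i2.const_mul _)]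
    apply integral_mono_ae (i1.const_mul _) ((i0.const_mul _).add (i2.const_mul _))
    apply ae_restrict_of_ae
    filter_upwards [ae_diff hv] with x hx
    have : ∇ (fun x => v x ^ 2) x = (2 * v x) • ∇ v x := by
      have := grad_comp (f := fun s => s ^ 2) (hasDerivAt_pow 2 (v x)) hx
      simpa using this
    simp only [Pi.add_apply]
    rw [this, norm_smul, Real.norm_eq_abs, abs_mul, abs_two]
    have h6 := sq_nonneg (|v x| - 2 ^ 11 * ‖∇ v x‖)
    have h7 := sq_abs (v x)
    nlinarith
  linarith

end BDG

open scoped RealInnerProductSpace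
namespace BDG
open MeasureTheory Filter Topology Set Metric
open scoped NNReal ENNReal Gradient ContDiff

lemma lip_mul {K L : ℝ≥0} {f g : E → ℝ} {a b : ℝ} (hf : LipschitzWith K f) (hg : LipschitzWith L g)
    (ha : ∀ x, |f x| ≤ a) (hb : ∀ x, |g x| ≤ b) :
    LipschitzWith (a.toNNReal * L + b.toNNReal * K) (fun x => f x * g x) := by
  have ha0 : 0 ≤ a := (abs_nonneg _).trans (ha 0)
  have hb0 : 0 ≤ b := (abs_nonneg _).trans (hb 0)
  apply LipschitzWith.of_dist_le_mul
  intro x y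
  have h1 := hf.dist_le_mul x y
  have h2 := hg.dist_le_mul x y
  rw [Real.dist_eq] at *
  push_cast
  rw [Real.coe_toNNReal a ha0, Real.coe_toNNReal b hb0]
  have : f x * g x - f y * g y = f x * (g x - g y) + g y * (f x - f y) := by ring
  rw [this]
  calc |f x * (g x - g y) + g y * (f x - f y)| ≤ |f x * (g x - g y)| + |g y * (f x - f y)| := abs_add_le _ _
    _ = |f x| * |g x - g y| + |g y| * |f x - f y| := by rw [abs_mul, abs_mul]
    _ ≤ a * (L * dist x y) + b * (K * dist x y) := by gcongr; exacts [ha x, hb y]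
    _ = _ := by ring

lemma lip_inv {K : ℝ≥0} {W : E → ℝ} {ε : ℝ} (hε : 0 < ε) (hW : LipschitzWith K W) (h : ∀ x, ε ≤ W x) :
    LipschitzWith (K / (ε ^ 2).toNNReal) (fun x => (W x)⁻¹) := by
  apply LipschitzWith.of_dist_le_mul
  intro x y
  have h1 := hW.dist_le_mul x y
  rw [Real.dist_eq] at *
  push_cast
  rw [Real.coe_toNNReal _ (by positivity)]
  have hx : 0 < W x := hε.trans_le (h x)
  have hy : 0 < W y := hε.trans_le (h y)
  rw [inv_sub_inv hx.ne' hy.ne', abs_div, abs_sub_comm, abs_of_pos (mul_pos hx hy), div_mul_eq_mul_div]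
  gcongr
  rw [pow_two]; gcongr; exacts [h x, h y]

lemma lip_log {K : ℝ≥0} {W : E → ℝ} {ε : ℝ} (hε : 0 < ε) (hW : LipschitzWith K W) (h : ∀ x, ε ≤ W x) :
    LipschitzWith (K / ε.toNNReal) (fun x => Real.log (W x)) := by
  apply LipschitzWith.of_le_add_mul
  intro x y
  have h1 := hW.dist_le_mul x y
  rw [Real.dist_eq] at h1
  push_cast
  rw [Real.coe_toNNReal _ hε.le]
  have hx : 0 < W x := hε.trans_le (h x)
  have hy : 0 < W y := hε.trans_le (h y)
  have h2 := Real.log_le_sub_one_of_pos (div_pos hx hy)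
  rw [Real.log_div hx.ne' hy.ne'] at h2
  have h3 : W x / W y - 1 ≤ K / ε * dist x y := by
    rw [div_sub_one hy.ne', div_mul_eq_mul_div]
    exact div_le_div₀ (by positivity) ((le_abs_self _).trans h1) hε (h y)
  linarith

/-- An elliptic pair on `U`. -/
structure EPair (lam : ℝ) (w : E → ℝ) (V : E → E) (U : Set E) : Prop where
  lip : ∃ K, LipschitzWith K w
  meas : AEStronglyMeasurable V volume
  bdd : ∃ C, ∀ x, ‖V x‖ ≤ C
  ell : ∀ᵐ x, x ∈ U → ‖V x‖ ≤ ‖∇ w x‖ ∧ lam * ‖∇ w x‖ ^ 2 ≤ ⟪V x, ∇ w x⟫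
  div : DivFree V U

/-- logarithmic Caccioppoli inequality -/
lemma log_cacc {lam : ℝ} (hlam : 0 < lam) {W : E → ℝ} {V : E → E} {U : Set E}
    (hp : EPair lam W V U) {ε : ℝ} (hε : 0 < ε) (hW : ∀ x, ε ≤ W x) (hU : Bornology.IsBounded U)
    {η f : E → ℝ} {L M : ℝ≥0} {a b : ℝ} (hη : LipschitzWith L η) (hηa : ∀ x, |η x| ≤ a)
    (hη0 : ∀ x, x ∉ U → η x = 0) (hf : LipschitzWith M f) (hfb : ∀ x, |f x| ≤ b)
    {Z S : E → ℝ} (hZ : Integrable Z) (hS : Integrable (fun x => S x * ‖∇ η x‖ ^ 2))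
    (H : ∀ᵐ x, ∃ χ : ℝ, 0 ≤ χ + f x ∧ 0 ≤ f x ∧ 0 ≤ S x ∧ ∇ f x = χ • (-(W x)⁻¹ • ∇ W x) ∧ f x ^ 2 ≤ S x * (χ + f x) ∧
      Z x ≤ η x ^ 2 * (χ + f x) * ((W x)⁻¹ * ‖∇ W x‖) ^ 2) :
    ∫ x, Z x ≤ 4 / lam ^ 2 * ∫ x, S x * ‖∇ η x‖ ^ 2 := by
  obtain ⟨⟨K, hWl⟩, hVm, ⟨C, hVC⟩, hell, hdiv⟩ := hp
  have hWi : ∀ x, |(W x)⁻¹| ≤ ε⁻¹ := fun x => by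
    have := hε.trans_le (hW x)
    rw [abs_of_pos (by positivity)]
    exact inv_anti₀ hε (hW x)
  have l1 := lip_mul hη hη hηa hηa
  have b1 : ∀ x, |η x * η x| ≤ a * a := fun x => by
    rw [abs_mul]; exact mul_le_mul (hηa x) (hηa x) (abs_nonneg _) ((abs_nonneg _).trans (hηa 0))
  have l2 := lip_mul hf (lip_inv hε hWl hW) hfb hWi
  have b2 : ∀ x, |f x * (W x)⁻¹| ≤ b * ε⁻¹ := fun x => by
    rw [abs_mul]; exact mul_le_mul (hfb x) (hWi x) (abs_nonneg _) ((abs_nonneg _).trans (hfb 0))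
  have l3 := lip_mul l1 l2 b1 b2
  have key := hdiv _ _ l3 (fun x hx => by simp [hη0 x hx])
  have hgz := ae_grad_zero hη
  have pt : ∀ᵐ x, ⟪V x, ∇ (fun x => η x * η x * (f x * (W x)⁻¹)) x⟫ ≤
      - (lam / 2 * Z x) + 2 / lam * (S x * ‖∇ η x‖ ^ 2) := by
    filter_upwards [hell, H, ae_diff hη, ae_diff hf, ae_diff hWl, hgz] with x h1 h2 dη df dW hz
    obtain ⟨χ, hχ, hf0, hS0, hgf, hfS, hZx⟩ := h2
    have hWx : 0 < W x := hε.trans_le (hW x)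
    have dWi : DifferentiableAt ℝ (fun y => (W y)⁻¹) x := dW.inv hWx.ne'
    have gWi : ∇ (fun y => (W y)⁻¹) x = (-(W x ^ 2)⁻¹) • ∇ W x :=
      grad_comp (f := fun s => s⁻¹) (hasDerivAt_inv hWx.ne') dW
    rw [grad_mul (dη.fun_mul dη) (df.fun_mul dWi), grad_mul dη dη, grad_mul df dWi, gWi, hgf]
    by_cases hxU : x ∈ U
    · obtain ⟨e1, e2⟩ := h1 hxU
      simp only [inner_add_right, inner_smul_right, inner_neg_right]
      set t := (W x)⁻¹ with ht
      have ht0 : 0 < t := by positivity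
      set g := ‖∇ W x‖
      set q := ⟪V x, ∇ W x⟫
      have hc : |⟪V x, ∇ η x⟫| ≤ g * ‖∇ η x‖ :=
        (abs_real_inner_le_norm _ _).trans (by gcongr)
      have hI : 2 * |η x| * (f x * t) * (g * ‖∇ η x‖) ≤ lam / 2 * (η x ^ 2 * (χ + f x) * (t * g) ^ 2) + 2 / lam * (S x * ‖∇ η x‖ ^ 2) := by
        set A := |η x| * (t * g) with hA
        set B := ‖∇ η x‖ with hB
        have hA0 : 0 ≤ A := by positivity
        have hB0 : 0 ≤ B := by positivity
        have hs : f x * A * B ≤ √(χ + f x) * A * (√(S x) * B) := by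
          have : f x ≤ √(χ + f x) * √(S x) := by
            rw [← Real.sqrt_mul hχ]; apply Real.le_sqrt_of_sq_le; linarith
          calc f x * A * B ≤ (√(χ + f x) * √(S x)) * A * B := by gcongr
            _ = _ := by ring
        have r1 := Real.sq_sqrt hχ
        have r2 := Real.sq_sqrt hS0
        have : 2 * (√(χ + f x) * A * (√(S x) * B)) ≤ lam / 2 * (√(χ + f x) * A) ^ 2 + 2 / lam * (√(S x) * B) ^ 2 := by
          have h := sq_nonneg (lam * (√(χ + f x) * A) - 2 * (√(S x) * B))
          have e : lam / 2 * (√(χ + f x) * A) ^ 2 + 2 / lam * (√(S x) * B) ^ 2 - 2 * (√(χ + f x) * A * (√(S x) * B)) = (lam * (√(χ + f x) * A) - 2 * (√(S x) * B)) ^ 2 / (2 * lam) := by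
            field_simp; ring
          have : 0 ≤ (lam * (√(χ + f x) * A) - 2 * (√(S x) * B)) ^ 2 / (2 * lam) := by positivity
          linarith
        rw [mul_pow, mul_pow _ B, r1, r2, hA, mul_pow, sq_abs] at this
        calc 2 * |η x| * (f x * t) * (g * B) = 2 * (f x * A * B) := by rw [hA]; ring
          _ ≤ _ := by
            refine (mul_le_mul_of_nonneg_left hs zero_le_two).trans (this.trans (le_of_eq ?_))
            ring
      have hJ : η x * ⟪V x, ∇ η x⟫ ≤ |η x| * (g * ‖∇ η x‖) :=
        (le_abs_self _).trans (by rw [abs_mul]; gcongr)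
      have hft : 0 ≤ f x * t := by positivity
      have hJ2 := mul_le_mul_of_nonneg_left hJ hft
      have hq : η x ^ 2 * (χ + f x) * t ^ 2 * (lam * g ^ 2) ≤ η x ^ 2 * (χ + f x) * t ^ 2 * q := by
        gcongr
      have e3 : (W x ^ 2)⁻¹ = t ^ 2 := by rw [ht, inv_pow]
      rw [e3]
      nlinarith [mul_le_mul_of_nonneg_left hZx hlam.le]
    · have z1 := hη0 x hxU
      have z2 := hz z1
      rw [z1, z2]
      rw [z1] at hZx
      simp at hZx ⊢
      nlinarith
  have iL : Integrable (fun x => ⟪V x, ∇ (fun x => η x * η x * (f x * (W x)⁻¹)) x⟫) := by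
    have hC0 : 0 ≤ C := (norm_nonneg _).trans (hVC 0)
    apply integrable_bdd_ae hU (hVm.inner (aesm_grad _))
    · intro x
      refine (norm_inner_le_norm _ _).trans (mul_le_mul (hVC x) (norm_grad_le l3 x) (norm_nonneg _) hC0)
    · filter_upwards [ae_grad_zero l3] with x hx hxU
      rw [hx (by simp [hη0 x hxU]), inner_zero_right]
  have := integral_mono_ae iL ((hZ.const_mul (lam / 2)).neg.add (hS.const_mul (2 / lam))) pt
  have e := integral_add (hZ.const_mul (lam / 2)).neg (hS.const_mul (2 / lam))
  simp only [Pi.neg_apply] at e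
  rw [integral_neg, integral_const_mul, integral_const_mul] at e
  rw [key] at this
  have this := this.trans (le_of_eq e)
  have h3 : lam / 2 * ∫ x, Z x ≤ 2 / lam * ∫ x, S x * ‖∇ η x‖ ^ 2 := by linarith
  have h4 : 2 / lam * (lam / 2 * ∫ x, Z x) ≤ 2 / lam * (2 / lam * ∫ x, S x * ‖∇ η x‖ ^ 2) := by gcongr
  calc ∫ x, Z x = 2 / lam * (lam / 2 * ∫ x, Z x) := by field_simp
    _ ≤ _ := h4
    _ = _ := by field_simp; ring

end BDG

open scoped RealInnerProductSpace
namespace BDG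
open MeasureTheory Filter Topology Set Metric
open scoped NNReal ENNReal Gradient ContDiff

lemma cutoff {r R : ℝ} (h : r < R) : ∃ η : E → ℝ, LipschitzWith (1 / (R - r)).toNNReal η ∧
    (∀ x, 0 ≤ η x) ∧ (∀ x, η x ≤ 1) ∧ (∀ x, ‖x‖ ≤ r → η x = 1) ∧ (∀ x, x ∉ ball (0:E) R → η x = 0) := by
  have hp : 0 < R - r := by linarith
  refine ⟨fun x => max (min (1 / (R - r) * (R - ‖x‖)) 1) 0, ?_, fun x => le_max_right _ _,
    fun x => max_le (min_le_right _ _) zero_le_one, ?_, ?_⟩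
  · refine (LipschitzWith.min_const ?_ 1).max_const 0
    apply LipschitzWith.of_dist_le_mul
    intro x y
    rw [Real.dist_eq, ← mul_sub, abs_mul, abs_of_pos (by positivity), Real.coe_toNNReal _ (by positivity)]
    gcongr
    rw [sub_sub_sub_cancel_left, dist_eq_norm, norm_sub_rev]
    exact abs_norm_sub_norm_le _ _
  · intro x hx
    have : 1 ≤ 1 / (R - r) * (R - ‖x‖) := by
      rw [one_div_mul_eq_div, one_le_div hp]; linarith
    simp only [min_eq_right this]; norm_num
  · intro x hx
    have hx : R ≤ ‖x‖ := by simpa using hx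
    apply max_eq_right
    apply (min_le_left _ _).trans
    exact mul_nonpos_of_nonneg_of_nonpos (by positivity) (by linarith)

lemma sup_step : ∃ C : ℝ, 0 < C ∧ ∀ (v : E → ℝ) (K : ℝ≥0) (b c : ℝ), 0 ≤ c → LipschitzWith K v →
    (∀ x, v x ≤ b) →
    (∀ k : ℝ, 0 ≤ k → ∀ (η : E → ℝ) (L : ℝ≥0), LipschitzWith L η → (∀ x, |η x| ≤ 1) →
      (∀ x, x ∉ ball (0:E) 1 → η x = 0) →
      ∫ x, η x ^ 2 * ‖∇ (fun y => max (v y - k) 0) x‖ ^ 2 ≤ c * ∫ x, (max (v x - k) 0) ^ 2 * ‖∇ η x‖ ^ 2) →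
    ∀ (k l r R : ℝ), 0 ≤ k → k < l → 0 < r → r < R → R ≤ 1 →
    ∃ s : ℝ, 0 ≤ s ∧ s ^ 4 * (l - k) ^ 2 ≤ ∫ x in ball (0:E) R, (max (v x - k) 0) ^ 2 ∧
      ∫ x in ball (0:E) r, (max (v x - l) 0) ^ 2 ≤
        C * (1 + c) * s / (R - r) ^ 2 * ∫ x in ball (0:E) R, (max (v x - k) 0) ^ 2 := by
  obtain ⟨C, hC, hFK⟩ := faber_krahn
  refine ⟨2 * C, by positivity, ?_⟩
  intro v K b c hc hv hvb hcac k l r R hk hkl hr hrR hR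
  set f : E → ℝ := fun x => max (v x - l) 0 with hf
  set f0 : E → ℝ := fun x => max (v x - k) 0 with hf0
  have lf : LipschitzWith K f := by
    apply lip_pos; simpa using hv.sub (LipschitzWith.const l)
  have lf0 : LipschitzWith K f0 := by
    apply lip_pos; simpa using hv.sub (LipschitzWith.const k)
  have fn : ∀ x, 0 ≤ f x := fun x => le_max_right _ _
  have f0n : ∀ x, 0 ≤ f0 x := fun x => le_max_right _ _
  have fle : ∀ x, f x ≤ f0 x := fun x => max_le_max_right _ (by linarith)
  set b' := max (b - k) 0 with hb'
  have hb'0 : 0 ≤ b' := le_max_right _ _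
  have f0b : ∀ x, f0 x ≤ b' := fun x => max_le_max_right _ (by linarith [hvb x])
  have fb : ∀ x, |f x| ≤ b' := fun x => by rw [abs_of_nonneg (fn x)]; exact (fle x).trans (f0b x)
  obtain ⟨η, lη, η0, η1, ηr, ηR⟩ := cutoff hrR
  have ηa : ∀ x, |η x| ≤ 1 := fun x => by rw [abs_of_nonneg (η0 x)]; exact η1 x
  have lηf := lip_mul lη lf ηa fb
  set S : Set E := {x ∈ ball (0:E) R | 0 < f x} with hS
  have hSm : MeasurableSet S := measurableSet_ball.inter (measurableSet_lt measurable_const lf.continuous.measurable)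
  have hSb : S ⊆ ball (0:E) R := fun x hx => hx.1
  have fk := hFK (fun x => η x * f x) _ R S lηf (fun x hx => by simp [ηR x hx]) hSm hSb (by
    intro x hx
    by_cases h : x ∈ ball (0:E) R
    · have : f x = 0 := le_antisymm (not_lt.1 fun h' => hx ⟨h, h'⟩) (fn x)
      simp [this]
    · simp [ηR x h])
  set s := (volume.real S) ^ (1/4 : ℝ) with hs
  have hs0 : 0 ≤ s := by positivity
  have hs4 : s ^ 4 = volume.real S := by
    rw [hs, ← Real.rpow_natCast, ← Real.rpow_mul (by positivity)]; norm_num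
  set Y := ∫ x in ball (0:E) R, f0 x ^ 2 with hY
  have iY : IntegrableOn (fun x => f0 x ^ 2) (ball (0:E) R) := by
    apply integrableOn_bdd isBounded_ball (C := b' ^ 2) (lf0.continuous.pow 2).aestronglyMeasurable
    intro x; rw [Pi.pow_apply, norm_pow, Real.norm_of_nonneg (f0n x)]; gcongr; exact f0b x
  refine ⟨s, hs0, ?_, ?_⟩
  · rw [hs4]
    calc volume.real S * (l - k) ^ 2 = ∫ x in S, (l - k) ^ 2 := by
          rw [setIntegral_const, smul_eq_mul]
      _ ≤ ∫ x in S, f0 x ^ 2 := by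
          apply setIntegral_mono_on (integrableOn_const (by
            exact ((measure_mono hSb).trans_lt measure_ball_lt_top).ne)) (iY.mono_set hSb) hSm
          intro x hx
          have h1 : 0 < f x := hx.2
          have h2 : l < v x := by
            by_contra h; rw [hf] at h1; simp only at h1; rw [max_eq_right (by linarith)] at h1; exact lt_irrefl _ h1
          have h3 : l - k ≤ f0 x := le_trans (by linarith) (le_max_left _ _)
          gcongr
      _ ≤ Y := setIntegral_mono_set iY (Eventually.of_forall fun x => by positivity) (HasSubset.Subset.eventuallyLE hSb)
  · have hKη : (((1 / (R - r)).toNNReal : ℝ≥0) : ℝ) = 1 / (R - r) := Real.coe_toNNReal _ (by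
      have : 0 < R - r := by linarith
      positivity)
    have gz := ae_grad_zero lη
    have iG : Integrable (fun x => f0 x ^ 2 * ‖∇ η x‖ ^ 2) := by
      apply integrable_bdd_ae (isBounded_ball (x := (0:E)) (r := R)) (C := b' ^ 2 * (1 / (R - r)) ^ 2)
      · exact (lf0.continuous.pow 2).aestronglyMeasurable.mul ((aesm_grad _).norm.pow 2)
      · intro x; rw [norm_mul, norm_pow, norm_pow, norm_norm, Real.norm_of_nonneg (f0n x)]
        have := norm_grad_le lη x
        rw [hKη] at this
        gcongr; exact f0b x
      · filter_upwards [gz] with x hx hxR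
        rw [hx (ηR x hxR)]; simp
    have iG' : Integrable (fun x => f x ^ 2 * ‖∇ η x‖ ^ 2) := by
      refine iG.mono' ((lf.continuous.pow 2).aestronglyMeasurable.mul ((aesm_grad _).norm.pow 2)) ?_
      filter_upwards with x
      rw [Real.norm_of_nonneg (by positivity)]
      gcongr; exact fle x
    have iH : Integrable (fun x => η x ^ 2 * ‖∇ f x‖ ^ 2) := by
      apply integrable_bdd_ae (isBounded_ball (x := (0:E)) (r := R)) (C := 1 ^ 2 * (K:ℝ) ^ 2)
      · exact (lη.continuous.pow 2).aestronglyMeasurable.mul ((aesm_grad _).norm.pow 2)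
      · intro x; rw [norm_mul, norm_pow, norm_pow, norm_norm]
        gcongr; exacts [ηa x, norm_grad_le lf x]
      · filter_upwards with x hxR
        rw [ηR x hxR]; simp
    have hG : ∫ x, f x ^ 2 * ‖∇ η x‖ ^ 2 ≤ 1 / (R - r) ^ 2 * Y := by
      calc ∫ x, f x ^ 2 * ‖∇ η x‖ ^ 2 = ∫ x in ball (0:E) R, f x ^ 2 * ‖∇ η x‖ ^ 2 := by
            symm; apply setIntegral_eq_integral_of_ae_compl_eq_zero
            filter_upwards [gz] with x hx hxR
            rw [hx (ηR x hxR)]; simp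
        _ ≤ ∫ x in ball (0:E) R, 1 / (R - r) ^ 2 * f0 x ^ 2 := by
            apply integral_mono iG'.integrableOn (iY.const_mul _)
            intro x
            have := norm_grad_le lη x
            rw [hKη] at this
            have h2 : ‖∇ η x‖ ^ 2 ≤ (1 / (R - r)) ^ 2 := by gcongr
            rw [div_pow, one_pow] at h2
            have h3 : f x ^ 2 ≤ f0 x ^ 2 := by gcongr; exact fle x
            simp only
            rw [mul_comm]
            exact mul_le_mul h2 h3 (by positivity) (by positivity)
        _ = _ := by rw [integral_const_mul]
    have hcc := hcac l (by linarith) η _ lη ηa (fun x hx => ηR x fun h => hx (ball_subset_ball hR h))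
    have hgr : ∫ x, ‖∇ (fun x => η x * f x) x‖ ^ 2 ≤ 2 * (∫ x, η x ^ 2 * ‖∇ f x‖ ^ 2) + 2 * ∫ x, f x ^ 2 * ‖∇ η x‖ ^ 2 := by
      rw [← integral_const_mul, ← integral_const_mul, ← integral_add (iH.const_mul 2) (iG'.const_mul 2)]
      apply integral_mono_of_nonneg (Eventually.of_forall fun x => by positivity) ((iH.const_mul 2).add (iG'.const_mul 2))
      filter_upwards [ae_diff lη, ae_diff lf] with x h1 h2
      rw [grad_mul h1 h2]
      simp only [Pi.add_apply]
      have h3 := norm_add_le (η x • ∇ f x) (f x • ∇ η x)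
      rw [norm_smul, norm_smul, Real.norm_of_nonneg (η0 x), Real.norm_of_nonneg (fn x)] at h3
      have h4 : ‖η x • ∇ f x + f x • ∇ η x‖ ^ 2 ≤ (η x * ‖∇ f x‖ + f x * ‖∇ η x‖) ^ 2 := by gcongr
      nlinarith [sq_nonneg (η x * ‖∇ f x‖ - f x * ‖∇ η x‖)]
    have hlow : ∫ x in ball (0:E) r, f x ^ 2 ≤ ∫ x, (η x * f x) ^ 2 := by
      calc ∫ x in ball (0:E) r, f x ^ 2 = ∫ x in ball (0:E) r, (η x * f x) ^ 2 := by
            apply setIntegral_congr_fun measurableSet_ball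
            intro x hx
            have : ‖x‖ ≤ r := by simpa using (mem_ball_zero_iff.1 hx).le
            simp only
            rw [ηr x this, one_mul]
        _ ≤ _ := by
            apply setIntegral_le_integral _ (Eventually.of_forall fun x => by positivity)
            apply integrable_bdd_ae (isBounded_ball (x := (0:E)) (r := R)) (C := (1 * b') ^ 2)
            · exact (lηf.continuous.pow 2).aestronglyMeasurable
            · intro x; rw [norm_pow, norm_mul]; gcongr; exacts [ηa x, fb x]
            · filter_upwards with x hxR
              rw [ηR x hxR]; simp
    have hfin : ∫ x, ‖∇ (fun x => η x * f x) x‖ ^ 2 ≤ 2 * (1 + c) * (1 / (R - r) ^ 2 * Y) := by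
      have : c * ∫ x, f x ^ 2 * ‖∇ η x‖ ^ 2 ≤ c * (1 / (R - r) ^ 2 * Y) := by gcongr
      have h5 : ∫ x, η x ^ 2 * ‖∇ f x‖ ^ 2 ≤ c * ∫ x, f x ^ 2 * ‖∇ η x‖ ^ 2 := hcc
      nlinarith
    calc ∫ x in ball (0:E) r, f x ^ 2 ≤ C * s * ∫ x, ‖∇ (fun x => η x * f x) x‖ ^ 2 := hlow.trans fk
      _ ≤ C * s * (2 * (1 + c) * (1 / (R - r) ^ 2 * Y)) := by gcongr
      _ = _ := by ring

/-- De Giorgi's sup bound -/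
lemma sup_lemma (c A : ℝ) (hc : 0 ≤ c) (hA : 0 ≤ A) : ∃ k : ℝ, 0 < k ∧
    ∀ (v : E → ℝ) (K : ℝ≥0) (b : ℝ), LipschitzWith K v → (∀ x, v x ≤ b) →
    (∀ k : ℝ, 0 ≤ k → ∀ (η : E → ℝ) (L : ℝ≥0), LipschitzWith L η → (∀ x, |η x| ≤ 1) →
      (∀ x, x ∉ ball (0:E) 1 → η x = 0) →
      ∫ x, η x ^ 2 * ‖∇ (fun y => max (v y - k) 0) x‖ ^ 2 ≤ c * ∫ x, (max (v x - k) 0) ^ 2 * ‖∇ η x‖ ^ 2) →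
    ∫ x in ball (0:E) 1, (max (v x) 0) ^ 2 ≤ A →
    ∀ x ∈ ball (0:E) (1/2), v x ≤ k := by
  obtain ⟨C, hC, hstep⟩ := sup_step
  set C0 := C * (1 + c) * 16 with hC0
  have hC00 : 0 < C0 := by positivity
  set k := √(4 * A * C0 ^ 4 * 1024 ^ 4 + 1) with hk
  have hk0 : 0 < k := by positivity
  have hk2 : k ^ 2 = 4 * A * C0 ^ 4 * 1024 ^ 4 + 1 := Real.sq_sqrt (by positivity)
  refine ⟨k, hk0, ?_⟩
  intro v K b hv hvb hcac hvA
  set kk : ℕ → ℝ := fun j => k * (1 - (1/2) ^ j) with hkk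
  set rr : ℕ → ℝ := fun j => 1/2 + (1/2) ^ (j+1) with hrr
  set Y : ℕ → ℝ := fun j => ∫ x in ball (0:E) (rr j), (max (v x - kk j) 0) ^ 2 with hY
  have hYb : ∀ j, Y j ≤ A * (1/1024) ^ j := by
    intro j
    induction j with
    | zero =>
      have e1 : kk 0 = 0 := by simp [hkk]
      have e2 : rr 0 = 1 := by norm_num [hrr]
      simp only [hY, e1, e2, sub_zero, pow_zero, mul_one]; exact hvA
    | succ j ih =>
      have p1 : (1/2:ℝ) ^ j ≤ 1 := pow_le_one₀ (by norm_num) (by norm_num)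
      have p0 : 0 < (1/2:ℝ) ^ j := by positivity
      have ekk : kk (j+1) - kk j = k * (1/2) ^ j / 2 := by simp only [hkk, pow_succ]; ring
      have err : rr j - rr (j+1) = (1/2) ^ j / 4 := by simp only [hrr, pow_succ]; ring
      obtain ⟨s, hs0, hs1, hs2⟩ := hstep v K b c hc hv hvb hcac (kk j) (kk (j+1)) (rr (j+1)) (rr j)
        (by simp only [hkk]; apply mul_nonneg hk0.le; linarith)
        (by have : 0 < k * (1/2) ^ j / 2 := by positivity
            linarith) (by simp only [hrr]; positivity)
        (by linarith [err])
        (by simp only [hrr, pow_succ]; linarith)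
      rw [ekk] at hs1
      rw [err] at hs2
      change s ^ 4 * _ ≤ Y j at hs1
      change Y (j+1) ≤ _ * Y j at hs2
      have hYj : 0 ≤ Y j := integral_nonneg fun x => by positivity
      have hq : C0 * s * 4 ^ j ≤ 1/1024 := by
        apply le_of_pow_le_pow_left₀ (n := 4) (by norm_num) (by norm_num)
        have h4 : (4:ℝ) ^ j * (1/2) ^ j * (1/2) ^ j = 1 := by
          rw [← mul_pow, ← mul_pow]; norm_num
        have h1024 : (1/1024:ℝ) ^ j = ((1/2) ^ j) ^ 10 := by
          rw [← pow_mul, mul_comm, pow_mul]; norm_num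
        have ht : (4:ℝ) ^ j = ((1/2) ^ j)⁻¹ ^ 2 := by
          have : 0 < (1/2:ℝ) ^ j := by positivity
          field_simp
          linarith
        rw [h1024] at ih
        rw [ht]
        set t := (1/2:ℝ) ^ j with htd
        have h6 : s ^ 4 * k ^ 2 ≤ 4 * A * t ^ 8 := by
          have : s ^ 4 * k ^ 2 * t ^ 2 ≤ 4 * A * t ^ 8 * t ^ 2 := by nlinarith
          exact le_of_mul_le_mul_right this (by positivity)
        have h7 : (C0 * s * t⁻¹ ^ 2) ^ 4 = C0 ^ 4 * s ^ 4 / t ^ 8 := by field_simp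
        rw [h7, div_le_iff₀ (by positivity)]
        have h8 : C0 ^ 4 * (s ^ 4 * k ^ 2) ≤ C0 ^ 4 * (4 * A * t ^ 8) := by gcongr
        have h9 : C0 ^ 4 * s ^ 4 * k ^ 2 ≤ (1/1024) ^ 4 * t ^ 8 * k ^ 2 := by
          rw [hk2]
          have : 0 < t ^ 8 := by positivity
          rw [hk2] at h8
          nlinarith
        exact le_of_mul_le_mul_right h9 (by positivity)
      calc Y (j+1) ≤ C * (1 + c) * s / ((1/2) ^ j / 4) ^ 2 * Y j := hs2
        _ = C0 * s * 4 ^ j * Y j := by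
          congr 1
          have h4 : (4:ℝ) ^ j * ((1/2) ^ j) ^ 2 = 1 := by
            rw [← pow_mul, mul_comm j, pow_mul, ← mul_pow]; norm_num
          rw [div_pow, hC0, div_eq_iff (by positivity)]
          linear_combination (-(C * (1+c) * s)) * h4
        _ ≤ 1/1024 * (A * (1/1024) ^ j) := by gcongr
        _ = _ := by rw [pow_succ]; ring
  have lf : LipschitzWith K (fun x => max (v x - k) 0) := by
    apply lip_pos; simpa using hv.sub (LipschitzWith.const k)
  have iAll : ∀ l r : ℝ, IntegrableOn (fun x => (max (v x - l) 0) ^ 2) (ball (0:E) r) := by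
    intro l r
    apply integrableOn_bdd isBounded_ball (C := (max (b - l) 0) ^ 2)
    · exact (((hv.continuous.sub continuous_const).max continuous_const).pow 2).aestronglyMeasurable
    · intro x; rw [norm_pow, Real.norm_of_nonneg (le_max_right _ _)]; gcongr; exact hvb x
  have hI : ∫ x in ball (0:E) (1/2), (max (v x - k) 0) ^ 2 ≤ 0 := by
    have hlim : Tendsto (fun j : ℕ => A * (1/1024:ℝ) ^ j) atTop (𝓝 (A * 0)) :=
      (tendsto_pow_atTop_nhds_zero_of_lt_one (by norm_num) (by norm_num)).const_mul A
    rw [mul_zero] at hlim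
    apply ge_of_tendsto' hlim
    intro j
    refine le_trans ?_ (hYb j)
    have hsub : ball (0:E) (1/2) ⊆ ball (0:E) (rr j) := ball_subset_ball (by
      simp only [hrr]; have : 0 < (1/2:ℝ) ^ (j+1) := by positivity
      linarith)
    calc _ ≤ ∫ x in ball (0:E) (1/2), (max (v x - kk j) 0) ^ 2 := by
          apply integral_mono (iAll _ _) (iAll _ _)
          intro x
          have : kk j ≤ k := by
            simp only [hkk]; have : 0 < (1/2:ℝ) ^ j := by positivity
            nlinarith
          have h3 : max (v x - k) 0 ≤ max (v x - kk j) 0 := max_le_max_right _ (by linarith)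
          exact pow_le_pow_left₀ (le_max_right _ _) h3 2
      _ ≤ _ := setIntegral_mono_set (iAll _ _) (Eventually.of_forall fun x => by positivity) (HasSubset.Subset.eventuallyLE hsub)
  intro x hx
  by_contra hlt
  push Not at hlt
  have hz : (fun x => (max (v x - k) 0) ^ 2) =ᵐ[volume.restrict (ball (0:E) (1/2))] 0 :=
    (setIntegral_eq_zero_iff_of_nonneg_ae (Eventually.of_forall fun x => by positivity) (iAll _ _)).1
      (le_antisymm hI (integral_nonneg fun x => by positivity))
  have hopen : IsOpen (ball (0:E) (1/2) ∩ {x | k < v x}) :=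
    isOpen_ball.inter (isOpen_lt continuous_const hv.continuous)
  have hpos := hopen.measure_pos volume ⟨x, hx, hlt⟩
  have h0 : volume (ball (0:E) (1/2) ∩ {x | k < v x}) = 0 := by
    rw [Filter.EventuallyEq, ae_restrict_iff' measurableSet_ball, ae_iff] at hz
    refine measure_mono_null ?_ hz
    intro y hy
    simp only [mem_setOf_eq, Classical.not_imp]
    refine ⟨hy.1, ?_⟩
    have : 0 < max (v y - k) 0 := lt_max_of_lt_left (by have := hy.2; simp only [mem_setOf_eq] at this; linarith)
    exact (pow_pos this 2).ne'
  exact hpos.ne' h0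

end BDG

open scoped RealInnerProductSpace
namespace BDG
open MeasureTheory Filter Topology Set Metric
open scoped NNReal ENNReal Gradient ContDiff

lemma osc_half (lam : ℝ) (hlam : 0 < lam) : ∃ θ : ℝ, 0 < θ ∧ θ < 1/2 ∧
    ∀ (w : E → ℝ) (V : E → E), EPair lam w V (ball 0 2) → (∀ x ∈ ball (0:E) 2, 0 ≤ w x ∧ w x ≤ 1) →
    volume.real (ball (0:E) 1) / 2 ≤ volume.real {x ∈ ball (0:E) 1 | 1/2 ≤ w x} →
    ∀ x ∈ ball (0:E) (1/2), θ ≤ w x := by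
  obtain ⟨Cp, hCp, hpoin⟩ := poincare
  set G0 := 4 / lam ^ 2 * volume.real (ball (0:E) 2) with hG0
  obtain ⟨k, hk, hsup⟩ := sup_lemma (4 / lam ^ 2) (Cp * G0) (by positivity) (by positivity)
  refine ⟨Real.exp (-k) / 2, by positivity, by
    have : Real.exp (-k) < Real.exp 0 := Real.exp_lt_exp.2 (by linarith)
    rw [Real.exp_zero] at this
    linarith, ?_⟩
  intro w V hp hw hvol x hx
  have main : ∀ ε : ℝ, 0 < ε → Real.exp (-k) / 2 ≤ w x + ε := by
    intro ε hε
    set W : E → ℝ := fun y => max (min (w y) 1) 0 + ε with hWd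
    have hWw : ∀ y ∈ ball (0:E) 2, W y = w y + ε := by
      intro y hy
      simp only [hWd, min_eq_left (hw y hy).2, max_eq_left (hw y hy).1]
    have hgW : ∀ y ∈ ball (0:E) 2, ∇ W y = ∇ w y := by
      intro y hy
      rw [grad_congr isOpen_ball hWw hy, grad_add_const]
    obtain ⟨K, hK⟩ := hp.lip
    have lW : LipschitzWith K W := by
      simpa using ((hK.min_const 1).max_const 0).add (LipschitzWith.const ε)
    have hWε : ∀ y, ε ≤ W y := fun y => by simp [hWd]
    have hW1 : ∀ y, W y ≤ 1 + ε := fun y => by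
      simp only [hWd]; gcongr; exact max_le (min_le_right _ _) zero_le_one
    have hpW : EPair lam W V (ball 0 2) := by
      refine ⟨⟨K, lW⟩, hp.meas, hp.bdd, ?_, hp.div⟩
      filter_upwards [hp.ell] with y hy hy2
      rw [hgW y hy2]; exact hy hy2
    set v : E → ℝ := fun y => - Real.log (W y) - Real.log 2 with hvd
    have lv : LipschitzWith (K / ε.toNNReal) v := by
      simpa using (lip_log hε lW hWε).neg.sub (LipschitzWith.const (Real.log 2))
    set b := max |Real.log ε| |Real.log (1 + ε)| + Real.log 2 with hb
    have hl2 : 0 < Real.log 2 := Real.log_pos (by norm_num)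
    have hvb : ∀ y, |v y| ≤ b := by
      intro y
      have h1 : Real.log ε ≤ Real.log (W y) := Real.log_le_log hε (hWε y)
      have h2 : Real.log (W y) ≤ Real.log (1 + ε) := Real.log_le_log (hε.trans_le (hWε y)) (hW1 y)
      have h3 := abs_le_max_abs_abs h1 h2
      calc |v y| ≤ |-Real.log (W y)| + |Real.log 2| := abs_sub _ _
        _ ≤ b := by rw [abs_neg, abs_of_pos hl2, hb]; linarith
    have hgv : ∀ᵐ y, ∇ v y = -(W y)⁻¹ • ∇ W y := by
      filter_upwards [ae_diff lW] with y hy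
      have h0 : W y ≠ 0 := (hε.trans_le (hWε y)).ne'
      simp only [hvd]
      rw [grad_sub_const]
      exact grad_comp (f := fun s => - Real.log s) (Real.hasDerivAt_log h0).neg hy
    -- energy
    obtain ⟨η, lη, η0, η1, ηr, ηR⟩ := cutoff (show (1:ℝ) < 2 by norm_num)
    have ηa : ∀ x, |η x| ≤ 1 := fun x => by rw [abs_of_nonneg (η0 x)]; exact η1 x
    have hK1 : ∀ y, ‖∇ η y‖ ≤ 1 := by
      intro y; have := norm_grad_le lη y
      rw [Real.coe_toNNReal _ (by norm_num)] at this; norm_num at this; exact this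
    have gz := ae_grad_zero lη
    have iη : Integrable (fun x => (fun _ => (1:ℝ)) x * ‖∇ η x‖ ^ 2) := by
      simp only [one_mul]
      apply integrable_bdd_ae (isBounded_ball (x := (0:E)) (r := 2)) (C := 1 ^ 2)
      · exact (aesm_grad _).norm.pow 2
      · intro y; rw [norm_pow, norm_norm]; gcongr; exact hK1 y
      · filter_upwards [gz] with y hy hyR
        rw [hy (ηR y hyR)]; simp
    have hE0 : ∫ y in ball (0:E) 1, ‖∇ v y‖ ^ 2 ≤ G0 := by
      have iZ : Integrable (fun y => η y ^ 2 * ‖∇ v y‖ ^ 2) := by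
        apply integrable_bdd_ae (isBounded_ball (x := (0:E)) (r := 2)) (C := 1 ^ 2 * ((K / ε.toNNReal : ℝ≥0) : ℝ) ^ 2)
        · exact (lη.continuous.pow 2).aestronglyMeasurable.mul ((aesm_grad _).norm.pow 2)
        · intro y; rw [norm_mul, norm_pow, norm_pow, norm_norm]
          gcongr; exacts [ηa y, norm_grad_le lv y]
        · filter_upwards with y hy
          rw [ηR y hy]; simp
      have hc := log_cacc hlam hpW hε hWε isBounded_ball lη ηa ηR
        (f := fun _ => (1:ℝ)) (LipschitzWith.const 1) (b := 1) (by simp) (Z := fun y => η y ^ 2 * ‖∇ v y‖ ^ 2) (S := fun _ => 1)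
        iZ iη (by
          filter_upwards [hgv] with y hy
          have hWy : 0 < W y := hε.trans_le (hWε y)
          refine ⟨0, by norm_num, by norm_num, by norm_num, by rw [grad_const, zero_smul], by norm_num, ?_⟩
          rw [hy, norm_smul, norm_neg, Real.norm_of_nonneg (by positivity)]
          simp)
      have e1 : ∫ y in ball (0:E) 1, ‖∇ v y‖ ^ 2 = ∫ y in ball (0:E) 1, η y ^ 2 * ‖∇ v y‖ ^ 2 := by
        apply setIntegral_congr_fun measurableSet_ball
        intro y hy
        have : ‖y‖ ≤ 1 := (mem_ball_zero_iff.1 hy).le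
        simp only
        rw [ηr y this]; ring
      have e2 : ∫ y in ball (0:E) 1, η y ^ 2 * ‖∇ v y‖ ^ 2 ≤ ∫ y, η y ^ 2 * ‖∇ v y‖ ^ 2 :=
        setIntegral_le_integral iZ (Eventually.of_forall fun y => by positivity)
      have e3 : ∫ y, (fun _ => (1:ℝ)) y * ‖∇ η y‖ ^ 2 ≤ volume.real (ball (0:E) 2) := by
        calc ∫ y, (fun _ => (1:ℝ)) y * ‖∇ η y‖ ^ 2 = ∫ y in ball (0:E) 2, (fun _ => (1:ℝ)) y * ‖∇ η y‖ ^ 2 := by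
              symm; apply setIntegral_eq_integral_of_ae_compl_eq_zero
              filter_upwards [gz] with y hy hyR
              rw [hy (ηR y hyR)]; simp
          _ ≤ ∫ y in ball (0:E) 2, (1:ℝ) := by
              apply integral_mono iη.integrableOn (integrableOn_const (measure_ball_lt_top (x := (0:E)) (r := 2)).ne)
              intro y
              have := hK1 y
              simp only [one_mul]
              exact pow_le_one₀ (norm_nonneg _) this
          _ = _ := by rw [setIntegral_const, smul_eq_mul, mul_one]
      calc _ ≤ _ := e1.le.trans (e2.trans hc)
        _ ≤ _ := by rw [hG0]; gcongr
    have lvp : LipschitzWith (K / ε.toNNReal) (fun y => max (v y) 0) := lip_pos lv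
    have hE1 : ∫ y in ball (0:E) 1, (max (v y) 0) ^ 2 ≤ Cp * G0 := by
      have h1 := hpoin (fun y => max (v y) 0) _ b lvp (by
        intro y
        rw [abs_of_nonneg (le_max_right _ _)]
        exact max_le ((le_abs_self _).trans (hvb y)) ((abs_nonneg _).trans (hvb y))) (by
        refine hvol.trans (measureReal_mono ?_ ?_)
        · intro y hy
          refine ⟨hy.1, ?_⟩
          have h2 : 1/2 ≤ W y := by
            rw [hWw y (ball_subset_ball (by norm_num) hy.1)]; linarith [hy.2]
          have h3 : Real.log (1/2) ≤ Real.log (W y) := Real.log_le_log (by norm_num) h2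
          rw [one_div, Real.log_inv] at h3
          apply max_eq_right
          simp only [hvd]; linarith
        · exact ((measure_mono fun y hy => hy.1).trans_lt (measure_ball_lt_top (x := (0:E)) (r := 1))).ne)
      refine h1.trans ?_
      gcongr
      refine le_trans ?_ hE0
      have ii : ∀ {f : E → ℝ}, LipschitzWith (K / ε.toNNReal) f → IntegrableOn (fun y => ‖∇ f y‖ ^ 2) (ball (0:E) 1) := by
        intro f hf
        apply integrableOn_bdd isBounded_ball (C := ((K / ε.toNNReal : ℝ≥0) : ℝ) ^ 2) ((aesm_grad _).norm.pow 2)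
        intro y; rw [Pi.pow_apply, norm_pow, norm_norm]; gcongr; exact norm_grad_le hf y
      apply integral_mono_ae (ii lvp) (ii lv)
      apply ae_restrict_of_ae
      filter_upwards [ae_grad_pos lv] with y hy
      rw [hy]
      split_ifs
      · exact le_rfl
      · simp
    have hres := hsup v _ b lv (fun y => (le_abs_self _).trans (hvb y)) (by
      intro l hl ζ L lζ ζa ζ0
      have lvl : LipschitzWith (K / ε.toNNReal) (fun y => v y - l) := by
        simpa using lv.sub (LipschitzWith.const l)
      have lf := lip_pos lvl
      have fb : ∀ y, |max (v y - l) 0| ≤ b := fun y => by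
        rw [abs_of_nonneg (le_max_right _ _)]
        exact max_le (by linarith [(le_abs_self _).trans (hvb y)]) ((abs_nonneg _).trans (hvb y))
      have gz := ae_grad_zero lζ
      apply log_cacc hlam hpW hε hWε isBounded_ball lζ ζa (fun y hy => ζ0 y fun h => hy (ball_subset_ball (by norm_num) h))
        lf fb
      · apply integrable_bdd_ae (isBounded_ball (x := (0:E)) (r := 1)) (C := 1 ^ 2 * ((K / ε.toNNReal : ℝ≥0) : ℝ) ^ 2)
        · exact (lζ.continuous.pow 2).aestronglyMeasurable.mul ((aesm_grad _).norm.pow 2)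
        · intro y; rw [norm_mul, norm_pow, norm_pow, norm_norm]
          gcongr; exacts [ζa y, norm_grad_le lf y]
        · filter_upwards with y hy
          rw [ζ0 y hy]; simp
      · apply integrable_bdd_ae (isBounded_ball (x := (0:E)) (r := 1)) (C := b ^ 2 * (L : ℝ) ^ 2)
        · exact (lf.continuous.pow 2).aestronglyMeasurable.mul ((aesm_grad _).norm.pow 2)
        · intro y; rw [norm_mul, norm_pow, norm_pow, norm_norm]
          gcongr; exacts [fb y, norm_grad_le lζ y]
        · filter_upwards [gz] with y hy hyR
          rw [hy (ζ0 y hyR)]; simp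
      · filter_upwards [hgv, ae_grad_pos lvl] with y h1 h2
        have hWy : 0 < W y := hε.trans_le (hWε y)
        have f0 : 0 ≤ max (v y - l) 0 := le_max_right _ _
        rw [h2, grad_sub_const]
        by_cases hpos : 0 < v y - l
        · refine ⟨1, by linarith, f0, by positivity, ?_, ?_, ?_⟩
          · rw [if_pos hpos, h1, one_smul]
          · nlinarith [mul_nonneg f0 (sq_nonneg (max (v y - l) 0))]
          · rw [if_pos hpos, h1, norm_smul, norm_neg, Real.norm_of_nonneg (by positivity)]
            have : 0 ≤ ζ y ^ 2 * max (v y - l) 0 * ((W y)⁻¹ * ‖∇ W y‖) ^ 2 := by positivity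
            nlinarith
        · have f00 : max (v y - l) 0 = 0 := max_eq_right (not_lt.1 hpos)
          refine ⟨0, by linarith, f0, by positivity, ?_, ?_, ?_⟩
          · rw [if_neg hpos, zero_smul]
          · rw [f00]; norm_num
          · rw [if_neg hpos, f00]; simp) hE1 x hx
    have hx2 : x ∈ ball (0:E) 2 := ball_subset_ball (by norm_num) hx
    have hWx : 0 < W x := hε.trans_le (hWε x)
    rw [← hWw x hx2]
    have h5 : -k ≤ Real.log (2 * W x) := by
      rw [Real.log_mul (by norm_num) hWx.ne']; simp only [hvd] at hres; linarith
    have h6 := (Real.le_log_iff_exp_le (by positivity)).1 h5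
    linarith
  exact le_of_forall_pos_le_add main

lemma osc_unit (lam : ℝ) (hlam : 0 < lam) : ∃ θ : ℝ, 0 < θ ∧ θ < 1/2 ∧
    ∀ (w : E → ℝ) (V : E → E), EPair lam w V (ball 0 2) → (∀ x ∈ ball (0:E) 2, 0 ≤ w x ∧ w x ≤ 1) →
    (∀ x ∈ ball (0:E) (1/2), θ ≤ w x) ∨ (∀ x ∈ ball (0:E) (1/2), w x ≤ 1 - θ) := by
  obtain ⟨θ, h0, h1, h⟩ := osc_half lam hlam
  refine ⟨θ, h0, h1, ?_⟩
  intro w V hp hw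
  by_cases hv : volume.real (ball (0:E) 1) / 2 ≤ volume.real {x ∈ ball (0:E) 1 | 1/2 ≤ w x}
  · exact Or.inl (h w V hp hw hv)
  · right
    obtain ⟨K, hK⟩ := hp.lip
    have hg : ∀ x, ∇ (fun y => 1 - w y) x = - ∇ w x := by
      intro x
      rw [← grad_neg, ← grad_add_const (fun y => - w y) 1]
      congr 1; funext y; ring
    have := h (fun y => 1 - w y) (fun y => - V y) ⟨⟨K, by simpa using (LipschitzWith.const (1:ℝ)).sub hK⟩,
      hp.meas.neg, by simpa using hp.bdd, by
        filter_upwards [hp.ell] with x hx hxU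
        rw [hg, norm_neg, norm_neg, inner_neg_neg]; exact hx hxU, by
        intro ψ L hψ hψ0
        simp only [inner_neg_left]
        rw [integral_neg, hp.div ψ L hψ hψ0, neg_zero]⟩
      (fun x hx => ⟨by linarith [(hw x hx).2], by linarith [(hw x hx).1]⟩) (by
        push Not at hv
        have hcov : volume.real (ball (0:E) 1) ≤ volume.real {x ∈ ball (0:E) 1 | 1/2 ≤ w x} +
            volume.real {x ∈ ball (0:E) 1 | 1/2 ≤ 1 - w x} := by
          refine le_trans (measureReal_mono ?_ ?_) (measureReal_union_le _ _)
          · intro x hx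
            rcases le_total (1/2) (w x) with h | h
            · exact Or.inl ⟨hx, h⟩
            · exact Or.inr ⟨hx, by linarith⟩
          · refine ((measure_mono ?_).trans_lt (measure_ball_lt_top (x := (0:E)) (r := 1))).ne
            rintro y (hy | hy) <;> exact hy.1
        linarith)
    intro x hx
    linarith [this x hx]

end BDG

open scoped RealInnerProductSpace
namespace BDG
open MeasureTheory Filter Topology Set Metric
open scoped NNReal ENNReal Gradient ContDiff

lemma quasi_affine (x₀ : E) {ρ : ℝ} (hρ : ρ ≠ 0) :
    Measure.QuasiMeasurePreserving (fun y : E => x₀ + ρ • y) volume volume := by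
  refine ⟨by fun_prop, ?_⟩
  have h1 : Measure.QuasiMeasurePreserving (fun y : E => ρ • y) volume volume := by
    refine ⟨by fun_prop, ?_⟩
    rw [Measure.map_addHaar_smul _ hρ]
    exact Measure.smul_absolutelyContinuous
  exact ((measurePreserving_add_left volume x₀).quasiMeasurePreserving.comp h1).absolutelyContinuous

lemma integral_affine (H : E → ℝ) (x₀ : E) (ρ : ℝ) :
    ∫ y, H (x₀ + ρ • y) = |(ρ ^ Module.finrank ℝ E)⁻¹| * ∫ z, H z := by
  rw [Measure.integral_comp_smul volume (fun z => H (x₀ + z)) ρ, integral_add_left_eq_self, smul_eq_mul]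

lemma DivFree.affine {V : E → E} {x₀ : E} {ρ r : ℝ} (hρ : 0 < ρ) (h : DivFree V (ball x₀ (r * ρ))) :
    DivFree (fun y => V (x₀ + ρ • y)) (ball 0 r) := by
  intro ψ K hψ h0
  set φ : E → ℝ := fun z => ψ (-(ρ⁻¹ • x₀) + ρ⁻¹ • z) with hφ
  have hφl : LipschitzWith (K * ρ⁻¹.toNNReal) φ := by
    apply LipschitzWith.of_dist_le_mul
    intro x y
    refine (hψ.dist_le_mul _ _).trans (le_of_eq ?_)
    rw [dist_add_left, dist_smul₀, Real.norm_of_nonneg (by positivity)]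
    push_cast
    rw [Real.coe_toNNReal _ (by positivity)]; ring
  have := h φ _ hφl (by
    intro z hz
    apply h0
    intro hz'
    apply hz
    rw [mem_ball_zero_iff] at hz'
    rw [mem_ball, dist_eq_norm]
    have e : z - x₀ = ρ • (-(ρ⁻¹ • x₀) + ρ⁻¹ • z) := by
      rw [smul_add, smul_neg, smul_smul, smul_smul, mul_inv_cancel₀ hρ.ne', one_smul, one_smul]; abel
    rw [e, norm_smul, Real.norm_of_nonneg hρ.le, mul_comm]
    gcongr)
  have e2 := integral_affine (fun z => ⟪V z, ∇ φ z⟫) x₀ ρ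
  rw [this, mul_zero] at e2
  have e3 : ∀ y, ⟪V (x₀ + ρ • y), ∇ φ (x₀ + ρ • y)⟫ = ρ⁻¹ * ⟪V (x₀ + ρ • y), ∇ ψ y⟫ := by
    intro y
    rw [hφ, grad_affine, inner_smul_right]
    congr 3
    rw [smul_add, smul_smul, inv_mul_cancel₀ hρ.ne', one_smul]; abel
  simp only [e3] at e2
  rw [integral_const_mul] at e2
  exact (mul_eq_zero.1 e2).resolve_left (by positivity)

lemma EPair.scale {lam : ℝ} {w : E → ℝ} {V : E → E} {x₀ : E} {ρ c : ℝ} (d : ℝ) (hρ : 0 < ρ) (hc : 0 < c)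
    (h : EPair lam w V (ball x₀ (2 * ρ))) :
    EPair lam (fun y => c * (w (x₀ + ρ • y) - d)) (fun y => (c * ρ) • V (x₀ + ρ • y)) (ball 0 2) := by
  obtain ⟨⟨K, hK⟩, hm, ⟨C, hC⟩, hell, hdiv⟩ := h
  have hmem : ∀ y, y ∈ ball (0:E) 2 → x₀ + ρ • y ∈ ball x₀ (2 * ρ) := by
    intro y hy
    rw [mem_ball_zero_iff] at hy
    rw [mem_ball, dist_eq_norm, add_sub_cancel_left, norm_smul, Real.norm_of_nonneg hρ.le, mul_comm]
    gcongr
  refine ⟨⟨c.toNNReal * (K * ρ.toNNReal), ?_⟩, ?_, ⟨c * ρ * C, ?_⟩, ?_, ?_⟩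
  · apply LipschitzWith.of_dist_le_mul
    intro x y
    have := hK.dist_le_mul (x₀ + ρ • x) (x₀ + ρ • y)
    rw [dist_add_left, dist_smul₀, Real.norm_of_nonneg hρ.le] at this
    rw [Real.dist_eq] at *
    push_cast
    rw [Real.coe_toNNReal _ hρ.le, Real.coe_toNNReal _ hc.le, ← mul_sub, abs_mul, abs_of_pos hc, sub_sub_sub_cancel_right]
    calc _ ≤ c * (K * (ρ * dist x y)) := by gcongr
      _ = _ := by ring
  · exact (hm.comp_quasiMeasurePreserving (quasi_affine x₀ hρ.ne')).const_smul (c * ρ)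
  · intro y
    rw [norm_smul, Real.norm_of_nonneg (by positivity)]
    gcongr; exact hC _
  · filter_upwards [(quasi_affine x₀ hρ.ne').ae hell, (quasi_affine x₀ hρ.ne').ae (ae_diff hK)] with y hy hd hyU
    have hd' : DifferentiableAt ℝ (fun y => w (x₀ + ρ • y) - d) y := by
      apply DifferentiableAt.sub_const
      exact DifferentiableAt.comp y (f := fun y => x₀ + ρ • y) (g := w) hd (by fun_prop)
    have hg : ∇ (fun y => c * (w (x₀ + ρ • y) - d)) y = (c * ρ) • ∇ w (x₀ + ρ • y) := by
      rw [grad_const_mul c hd', grad_sub_const, grad_affine, smul_smul]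
    obtain ⟨h1, h2⟩ := hy (hmem y hyU)
    rw [hg]
    have hcρ : 0 < c * ρ := by positivity
    simp only [norm_smul, Real.norm_of_nonneg hcρ.le, inner_smul_left, inner_smul_right]
    refine ⟨by gcongr, ?_⟩
    have := mul_le_mul_of_nonneg_left h2 (sq_nonneg (c * ρ))
    simp only [RCLike.conj_to_real]
    nlinarith
  · intro ψ L hψ h0
    have := (hdiv.affine hρ) ψ L hψ h0
    simp only [real_inner_smul_left]
    rw [integral_const_mul, this, mul_zero]

lemma EPair.mono {lam : ℝ} {w : E → ℝ} {V : E → E} {U U' : Set E} (h : EPair lam w V U) (hs : U' ⊆ U) :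
    EPair lam w V U' :=
  ⟨h.lip, h.meas, h.bdd, by filter_upwards [h.ell] with x hx hxU using hx (hs hxU), h.div.mono hs⟩

lemma holder_pair (lam : ℝ) (hlam : 0 < lam) : ∃ α : ℝ, 0 < α ∧ α < 1 ∧
    ∀ (w : E → ℝ) (V : E → E) (x₀ : E) (r a b : ℝ), 0 < r → EPair lam w V (ball x₀ r) →
    (∀ x ∈ ball x₀ r, a ≤ w x ∧ w x ≤ b) →
    ∀ x ∈ ball x₀ r, |w x - w x₀| ≤ 2 * (‖x - x₀‖ / r) ^ α * (b - a) := by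
  obtain ⟨θ, hθ0, hθ1, hosc⟩ := osc_unit lam hlam
  have l4 : 0 < Real.log 4 := Real.log_pos (by norm_num)
  set α := - Real.log (1 - θ) / Real.log 4 with hα
  have h4α : (1/4:ℝ) ^ α = 1 - θ := by
    rw [Real.rpow_def_of_pos (by norm_num), hα, one_div, Real.log_inv]
    rw [show -Real.log 4 * (-Real.log (1 - θ) / Real.log 4) = Real.log (1 - θ) by field_simp]
    exact Real.exp_log (by linarith)
  have hα0 : 0 < α := div_pos (neg_pos.2 (Real.log_neg (by linarith) (by linarith))) l4
  refine ⟨α, hα0, ?_, ?_⟩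
  · by_contra h
    push Not at h
    have : (1/4:ℝ) ^ α ≤ (1/4:ℝ) ^ (1:ℝ) := Real.rpow_le_rpow_of_exponent_ge (by norm_num) (by norm_num) h
    rw [h4α, Real.rpow_one] at this
    linarith
  intro w V x₀ r a b hr hp hw x hx
  have hx0 : x₀ ∈ ball x₀ r := mem_ball_self hr
  have hab : 0 ≤ b - a := by linarith [hw x₀ hx0]
  have step : ∀ n : ℕ, ∃ a' b' : ℝ, b' - a' ≤ (1 - θ) ^ n * (b - a) ∧ ∀ y ∈ ball x₀ (r * (1/4) ^ n), a' ≤ w y ∧ w y ≤ b' := by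
    intro n
    induction n with
    | zero => exact ⟨a, b, by simp, by simpa using hw⟩
    | succ n ih =>
      obtain ⟨a', b', h1, h2⟩ := ih
      set ρ := r * (1/4) ^ n / 2 with hρ
      have hρ0 : 0 < ρ := by positivity
      have e2 : r * (1/4) ^ n = 2 * ρ := by rw [hρ]; ring
      have e3 : r * (1/4) ^ (n+1) = ρ / 2 := by rw [hρ, pow_succ]; ring
      rw [e2] at h2
      rw [e3]
      have hsub : ball x₀ (ρ / 2) ⊆ ball x₀ (2 * ρ) := ball_subset_ball (by linarith)
      have hab' : a' ≤ b' := by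
        have := h2 x₀ (mem_ball_self (by linarith)); linarith
      rcases hab'.eq_or_lt with heq | hlt
      · refine ⟨a', b', ?_, fun y hy => h2 y (hsub hy)⟩
        rw [heq, sub_self]
        have : 0 < 1 - θ := by linarith
        positivity
      · have hp' : EPair lam w V (ball x₀ (2 * ρ)) := hp.mono (ball_subset_ball (by
          rw [← e2]
          have : (1/4:ℝ) ^ n ≤ 1 := pow_le_one₀ (by norm_num) (by norm_num)
          nlinarith))
        set c := (b' - a')⁻¹ with hc
        have hc0 : 0 < c := inv_pos.2 (by linarith)
        have hcc : c * (b' - a') = 1 := inv_mul_cancel₀ (by linarith)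
        have key := hosc _ _ (hp'.scale a' hρ0 hc0) (by
          intro y hy
          have hy' : x₀ + ρ • y ∈ ball x₀ (2 * ρ) := by
            rw [mem_ball_zero_iff] at hy
            rw [mem_ball, dist_eq_norm, add_sub_cancel_left, norm_smul, Real.norm_of_nonneg hρ0.le, mul_comm]
            gcongr
          obtain ⟨h3, h4⟩ := h2 _ hy'
          refine ⟨mul_nonneg hc0.le (by linarith), ?_⟩
          rw [← hcc]; gcongr)
        have back : ∀ y ∈ ball x₀ (ρ / 2), ∃ z ∈ ball (0:E) (1/2), x₀ + ρ • z = y := by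
          intro y hy
          refine ⟨ρ⁻¹ • (y - x₀), ?_, ?_⟩
          · rw [mem_ball_zero_iff, norm_smul, Real.norm_of_nonneg (by positivity)]
            rw [mem_ball, dist_eq_norm] at hy
            calc ρ⁻¹ * ‖y - x₀‖ < ρ⁻¹ * (ρ / 2) := by gcongr
              _ = 1/2 := by field_simp
          · rw [smul_smul, mul_inv_cancel₀ hρ0.ne', one_smul]; abel
        have hlen : (1 - θ) * (b' - a') ≤ (1 - θ) ^ (n+1) * (b - a) := by
          rw [pow_succ]
          have : 0 < 1 - θ := by linarith
          nlinarith
        rcases key with key | key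
        · refine ⟨a' + θ * (b' - a'), b', by linarith, fun y hy => ⟨?_, (h2 y (hsub hy)).2⟩⟩
          obtain ⟨z, hz, rfl⟩ := back y hy
          have := key z hz
          have h5 : θ * (b' - a') ≤ c * (w (x₀ + ρ • z) - a') * (b' - a') := by gcongr
          have h6 : c * (w (x₀ + ρ • z) - a') * (b' - a') = (w (x₀ + ρ • z) - a') := by
            linear_combination (w (x₀ + ρ • z) - a') * hcc
          linarith
        · refine ⟨a', b' - θ * (b' - a'), by linarith, fun y hy => ⟨(h2 y (hsub hy)).1, ?_⟩⟩
          obtain ⟨z, hz, rfl⟩ := back y hy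
          have := key z hz
          have h5 : c * (w (x₀ + ρ • z) - a') * (b' - a') ≤ (1 - θ) * (b' - a') := by gcongr
          have h6 : c * (w (x₀ + ρ • z) - a') * (b' - a') = (w (x₀ + ρ • z) - a') := by
            linear_combination (w (x₀ + ρ • z) - a') * hcc
          linarith
  by_cases hxx : x = x₀
  · subst hxx
    simp only [sub_self, abs_zero]
    positivity
  have ht0 : 0 < ‖x - x₀‖ / r := div_pos (norm_pos_iff.2 (sub_ne_zero.2 hxx)) hr
  have ht1 : ‖x - x₀‖ / r ≤ 1 := by
    rw [div_le_one hr]; rw [mem_ball, dist_eq_norm] at hx; exact hx.le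
  obtain ⟨n, hn1, hn2⟩ := exists_nat_pow_near_of_lt_one ht0 ht1 (show (0:ℝ) < 1/4 by norm_num) (by norm_num)
  -- pass to slightly larger ball when needed
  obtain ⟨a', b', h1, h2⟩ := step n
  have hcl : ∀ y ∈ closedBall x₀ (r * (1/4) ^ n), y ∈ ball x₀ r → |w y - w x₀| ≤ b' - a' := by
    intro y hy _
    obtain ⟨K, hK⟩ := hp.lip
    have hr' : 0 < r * (1/4) ^ n := by positivity
    rw [← closure_ball _ hr'.ne'] at hy
    have hclos : IsClosed {y | |w y - w x₀| ≤ b' - a'} :=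
      isClosed_le ((hK.continuous.sub continuous_const).abs) continuous_const
    refine closure_minimal ?_ hclos hy
    intro z hz
    have h3 := h2 z hz
    have h4 := h2 x₀ (mem_ball_self hr')
    simp only [mem_setOf_eq, abs_le]
    constructor <;> linarith
  have h3 : |w x - w x₀| ≤ b' - a' := by
    apply hcl x _ hx
    rw [mem_closedBall, dist_eq_norm]
    rw [div_le_iff₀ hr] at hn2
    linarith
  have h5 : (1 - θ) ^ (n + 1) ≤ (‖x - x₀‖ / r) ^ α := by
    rw [← h4α, ← Real.rpow_natCast, ← Real.rpow_mul (by norm_num), mul_comm, Real.rpow_mul (by norm_num), Real.rpow_natCast]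
    exact Real.rpow_le_rpow (by positivity) hn1.le hα0.le
  have h6 : (1 - θ) ^ n ≤ 2 * (1 - θ) ^ (n+1) := by
    rw [pow_succ]
    have : 0 < (1 - θ) ^ n := pow_pos (by linarith) n
    nlinarith
  calc |w x - w x₀| ≤ (1 - θ) ^ n * (b - a) := h3.trans h1
    _ ≤ 2 * (‖x - x₀‖ / r) ^ α * (b - a) := by
      apply mul_le_mul_of_nonneg_right _ hab
      linarith

end BDG

open scoped RealInnerProductSpace
namespace BDG
open MeasureTheory Filter Topology Set Metric
open scoped NNReal ENNReal Gradient ContDiff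

lemma DivFree.translate {V : E → E} {z : E} {R : ℝ} (h : E) (hV : DivFree V (ball z R)) :
    DivFree (fun y => V (y + h)) (ball (z - h) R) := by
  intro ψ K hψ h0
  have := hV (fun y => ψ (y + (-h))) K ?_ ?_
  · rw [← integral_add_right_eq_self _ h] at this
    rw [← this]
    congr 1; funext y
    rw [grad_translate]; simp
  · apply LipschitzWith.of_dist_le_mul
    intro x y
    have := hψ.dist_le_mul (x + -h) (y + -h)
    simpa using this
  · intro x hx
    apply h0
    intro h1; apply hx
    rw [mem_ball, dist_eq_norm] at h1 ⊢
    convert h1 using 2; abel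

lemma dq_pair {K : ℝ≥0} {u : E → ℝ} (hu : LipschitzWith K u) {z : E} {R : ℝ}
    (hw : WS u (ball z R)) {h : E} (hh : h ≠ 0) :
    EPair (1 / (1 + (K:ℝ)) ^ 3) (fun x => ‖h‖⁻¹ * (u (x + h) - u x))
      (fun x => ‖h‖⁻¹ • (DF (∇ u (x + h)) - DF (∇ u x))) (ball z (R - ‖h‖)) := by
  have hpos : 0 < ‖h‖ := norm_pos_iff.2 hh
  have ht : LipschitzWith K (fun x => u (x + h)) := by
    apply LipschitzWith.of_dist_le_mul
    intro x y
    simpa using hu.dist_le_mul (x + h) (y + h)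
  have hm1 : AEStronglyMeasurable (fun x => DF (∇ u (x + h))) volume := by
    have := DF_grad_meas (fun x => u (x + h))
    simp only [grad_translate] at this; exact this
  refine ⟨⟨‖h‖⁻¹.toNNReal * (K + K), ?_⟩, ?_, ⟨‖h‖⁻¹ * 2, ?_⟩, ?_, ?_⟩
  · apply LipschitzWith.of_dist_le_mul
    intro x y
    have := (ht.sub hu).dist_le_mul x y
    rw [Real.dist_eq] at *
    rw [← mul_sub, abs_mul, abs_of_pos (by positivity : 0 < ‖h‖⁻¹)]
    push_cast
    rw [Real.coe_toNNReal _ (by positivity), mul_assoc]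
    gcongr
    simpa using this
  · exact (hm1.sub (DF_grad_meas u)).const_smul (‖h‖⁻¹)
  · intro x
    rw [norm_smul, Real.norm_of_nonneg (by positivity)]
    gcongr
    calc _ ≤ ‖DF (∇ u (x + h))‖ + ‖DF (∇ u x)‖ := norm_sub_le _ _
      _ ≤ 1 + 1 := add_le_add (norm_DF_le _) (norm_DF_le _)
      _ = 2 := by norm_num
  · filter_upwards [ae_diff hu, ae_diff ht] with x h1 h2 _
    have e : ∇ (fun x => ‖h‖⁻¹ * (u (x + h) - u x)) x = ‖h‖⁻¹ • (∇ u (x + h) - ∇ u x) := by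
      rw [grad_const_mul _ (h2.fun_sub h1), grad_sub h2 h1, grad_translate]
    rw [e, A_spec]
    set v := ∇ u (x + h) - ∇ u x
    constructor
    · rw [norm_smul, norm_smul]; gcongr; exact A_upper _ _ _
    · rw [norm_smul, real_inner_smul_left, real_inner_smul_right, mul_pow, norm_inv, norm_norm]
      have := A_lower (F_grad_le hu (x + h)) (F_grad_le hu x) v
      have h3 : 0 < ‖h‖⁻¹ := by positivity
      calc _ = ‖h‖⁻¹ * (‖h‖⁻¹ * (1 / (1 + (K:ℝ)) ^ 3 * ‖v‖ ^ 2)) := by ring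
        _ ≤ _ := by gcongr
  · have h1 : DivFree (fun x => DF (∇ u (x + h))) (ball z (R - ‖h‖)) := by
      refine DivFree.mono (DivFree.translate h hw) ?_
      intro x hx
      rw [mem_ball, dist_eq_norm] at *
      calc ‖x - (z - h)‖ = ‖(x - z) + h‖ := by congr 1; abel
        _ ≤ ‖x - z‖ + ‖h‖ := norm_add_le _ _
        _ < R := by linarith
    have h2 : DivFree (fun x => DF (∇ u x)) (ball z (R - ‖h‖)) :=
      DivFree.mono hw (ball_subset_ball (by linarith))
    intro ψ L hψ h0
    have e1 := h1 ψ L hψ h0; have e2 := h2 ψ L hψ h0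
    have hIntg : ∀ W : E → E, AEStronglyMeasurable W volume → (∀ x, ‖W x‖ ≤ 1) →
        Integrable (fun x => ⟪W x, ∇ ψ x⟫) := by
      intro W hW hb
      refine integrable_bdd (c := z) (R := R - ‖h‖) (C := L) (hW.inner (aesm_grad ψ)) ?_ ?_
      · intro x
        calc _ ≤ ‖W x‖ * ‖∇ ψ x‖ := norm_inner_le_norm _ _
          _ ≤ 1 * L := by gcongr; exact hb x; exact norm_grad_le hψ x
          _ = L := one_mul _
      · intro x hx
        rw [grad_zero_off h0 hx, inner_zero_right]
    simp_rw [real_inner_smul_left, inner_sub_left]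
    rw [integral_const_mul, integral_sub (hIntg _ hm1 fun x => norm_DF_le _)
      (hIntg _ (DF_grad_meas u) fun x => norm_DF_le _), e1, e2]
    simp

lemma second_diff (K : ℝ≥0) : ∃ α : ℝ, 0 < α ∧ α < 1 ∧ ∀ (u : E → ℝ) (z : E) (R : ℝ), 0 < R →
    LipschitzWith K u → WS u (ball z R) → ∃ C, 0 ≤ C ∧ ∀ x ∈ ball z (R / 8), ∀ y ∈ ball z (R / 8),
      ∀ h : E, ‖h‖ < R / 2 → |u (x + h) - u x - (u (y + h) - u y)| ≤ C * ‖h‖ * ‖x - y‖ ^ α := by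
  obtain ⟨α, h0, h1, hα⟩ := holder_pair (1 / (1 + (K:ℝ)) ^ 3) (by positivity)
  refine ⟨α, h0, h1, fun u z R hR hu hw => ⟨4 * K * (4 / R) ^ α, by positivity, ?_⟩⟩
  intro x hx y hy h hh
  rcases eq_or_ne h 0 with rfl | hne
  · simp
  have hpos : 0 < ‖h‖ := norm_pos_iff.2 hne
  have hp := dq_pair hu hw hne
  have hsub : ball y (R / 4) ⊆ ball z (R - ‖h‖) := by
    apply ball_subset_ball'
    rw [mem_ball] at hy; linarith
  have hb : ∀ x, |‖h‖⁻¹ * (u (x + h) - u x)| ≤ K := by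
    intro x
    have := hu.dist_le_mul (x + h) x
    rw [Real.dist_eq, dist_eq_norm, add_sub_cancel_left] at this
    rw [abs_mul, abs_of_pos (by positivity : 0 < ‖h‖⁻¹), inv_mul_le_iff₀ hpos]; linarith
  have hxy : x ∈ ball y (R / 4) := by
    rw [mem_ball] at *
    have := dist_triangle_right x y z; linarith
  have := hα _ _ y (R / 4) (-K) K (by positivity) (hp.mono hsub) (fun x _ => abs_le.1 (hb x)) x hxy
  rw [← mul_sub, abs_mul, abs_of_pos (by positivity : 0 < ‖h‖⁻¹), inv_mul_le_iff₀ hpos] at this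
  refine this.trans (le_of_eq ?_)
  rw [show ‖x - y‖ / (R / 4) = (4 / R) * ‖x - y‖ by field_simp, Real.mul_rpow (by positivity) (by positivity)]
  ring

lemma c1alpha (K : ℝ≥0) : ∃ α : ℝ, 0 < α ∧ α < 1 ∧ ∀ (u : E → ℝ) (z : E) (R : ℝ), 0 < R →
    LipschitzWith K u → WS u (ball z R) → (∀ x ∈ ball z (R / 8), DifferentiableAt ℝ u x) ∧
    ∃ C, 0 ≤ C ∧ ∀ x ∈ ball z (R / 8), ∀ y ∈ ball z (R / 8), ‖∇ u x - ∇ u y‖ ≤ C * ‖x - y‖ ^ α := by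
  obtain ⟨α, h0, h1, hα⟩ := second_diff K
  refine ⟨α, h0, h1, fun u z R hR hu hw => ?_⟩
  obtain ⟨C, hC, hd⟩ := hα u z R hR hu hw
  have hdiff : ∀ x ∈ ball z (R / 8), DifferentiableAt ℝ u x := by
    intro x hx
    have hdense : Dense {y | DifferentiableAt ℝ u y} := by
      have := ae_diff hu
      exact Measure.dense_of_ae this
    have hex : ∀ n : ℕ, ∃ y, DifferentiableAt ℝ u y ∧ y ∈ ball z (R / 8) ∧ ‖x - y‖ < 1 / ((n:ℝ) + 1) := by
      intro n
      obtain ⟨y, hy, hy2⟩ := hdense.inter_open_nonempty (ball z (R / 8) ∩ ball x (1 / ((n:ℝ) + 1)))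
        (isOpen_ball.inter isOpen_ball) ⟨x, hx, mem_ball_self (by positivity)⟩
      exact ⟨y, hy2, hy.1, by rw [← dist_eq_norm, dist_comm]; exact hy.2⟩
    choose y hyd hyb hyx using hex
    obtain ⟨p, -, φ, hφ, hp⟩ := tendsto_subseq_of_bounded (isBounded_closedBall (x := (0:E)) (r := K))
      (x := fun n => ∇ u (y n)) (fun n => by rw [mem_closedBall_zero_iff]; exact norm_grad_le hu _)
    have hyt : Tendsto (fun n => ‖x - y n‖) atTop (𝓝 0) :=
      squeeze_zero (fun n => norm_nonneg _) (fun n => (hyx n).le) tendsto_one_div_add_atTop_nhds_zero_nat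
    have hyt2 : Tendsto (fun n => C * ‖x - y n‖ ^ α) atTop (𝓝 0) := by
      have := (hyt.rpow_const (p := α) (Or.inr h0.le)).const_mul C
      simpa [Real.zero_rpow h0.ne'] using this
    have : HasFDerivAt u (innerSL ℝ p) x := by
      rw [hasFDerivAt_iff_isLittleO_nhds_zero, Asymptotics.isLittleO_iff]
      intro ε hε
      have e1 := (hyt2.comp hφ.tendsto_atTop).eventually (gt_mem_nhds (by positivity : 0 < ε / 3))
      have e2 := (tendsto_iff_norm_sub_tendsto_zero.1 hp).eventually (gt_mem_nhds (by positivity : 0 < ε / 3))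
      obtain ⟨n, h3, h4⟩ := (e1.and e2).exists
      have h5 := hasFDerivAt_iff_isLittleO_nhds_zero.1 (hyd (φ n)).hasFDerivAt
      rw [Asymptotics.isLittleO_iff] at h5
      have h6 := h5 (by positivity : 0 < ε / 3)
      filter_upwards [h6, ball_mem_nhds (0:E) (by positivity : 0 < R / 2)] with h h7 h8
      rw [mem_ball_zero_iff] at h8
      have h9 := hd x hx (y (φ n)) (hyb _) h h8
      rw [Real.norm_eq_abs, ← grad_apply] at h7
      have h10 : |⟪∇ u (y (φ n)) - p, h⟫| ≤ ε / 3 * ‖h‖ :=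
        (abs_real_inner_le_norm _ _).trans (by gcongr; exact h4.le)
      have h11 : C * ‖h‖ * ‖x - y (φ n)‖ ^ α ≤ ε / 3 * ‖h‖ := by
        have : C * ‖x - y (φ n)‖ ^ α ≤ ε / 3 := h3.le
        calc _ = (C * ‖x - y (φ n)‖ ^ α) * ‖h‖ := by ring
          _ ≤ _ := by gcongr
      rw [inner_sub_left] at h10
      rw [Real.norm_eq_abs, innerSL_apply_apply]
      rw [abs_le] at *
      constructor <;> linarith
    exact this.differentiableAt
  refine ⟨hdiff, C, hC, ?_⟩
  intro x hx y hy
  have key : ∀ v : E, |⟪∇ u x - ∇ u y, v⟫| ≤ C * ‖v‖ * ‖x - y‖ ^ α := by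
    intro v
    have l1 := (hdiff x hx).hasFDerivAt.hasLineDerivAt v
    have l2 := (hdiff y hy).hasFDerivAt.hasLineDerivAt v
    have l3 := (HasDerivAt.sub l1 l2).tendsto_slope_zero_right
    have l4 := l3.abs
    rw [← grad_apply, ← grad_apply, ← inner_sub_left] at l4
    refine le_of_tendsto l4 ?_
    have hev : ∀ᶠ t : ℝ in 𝓝[>] 0, t * ‖v‖ < R / 2 := by
      have : Tendsto (fun t : ℝ => t * ‖v‖) (𝓝[>] 0) (𝓝 (0 * ‖v‖)) :=
        (tendsto_id.mono_left nhdsWithin_le_nhds).mul_const _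
      rw [zero_mul] at this
      exact this.eventually (gt_mem_nhds (by positivity))
    filter_upwards [hev, self_mem_nhdsWithin] with t ht ht0
    have ht0 : 0 < t := ht0
    have := hd x hx y hy (t • v) (by rw [norm_smul, Real.norm_of_nonneg ht0.le]; exact ht)
    rw [norm_smul, Real.norm_of_nonneg ht0.le] at this
    simp only [Pi.sub_apply, zero_add, zero_smul, add_zero, smul_eq_mul]
    rw [abs_mul, abs_of_pos (by positivity : 0 < t⁻¹), inv_mul_le_iff₀ ht0]
    calc _ = |u (x + t • v) - u x - (u (y + t • v) - u y)| := by congr 1; ring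
      _ ≤ _ := this
      _ = _ := by ring
  have := key (∇ u x - ∇ u y)
  rw [real_inner_self_eq_norm_sq, abs_of_nonneg (by positivity)] at this
  by_contra hcon
  push Not at hcon
  have h5 : 0 < ‖∇ u x - ∇ u y‖ := lt_of_le_of_lt (by positivity) hcon
  nlinarith

end BDG

open scoped RealInnerProductSpace
namespace BDG
open MeasureTheory Filter Topology Set Metric
open scoped NNReal ENNReal Gradient ContDiff

/-- `φ` is twice differentiable at `0` with second derivative `c`. -/
def Two (φ : ℝ → ℝ) (c : ℝ) : Prop :=
  ∃ φ' : ℝ → ℝ, (∀ᶠ t in 𝓝 0, HasDerivAt φ (φ' t) t) ∧ HasDerivAt φ' c 0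

lemma Two.add {φ ψ : ℝ → ℝ} {c d : ℝ} (h : Two φ c) (k : Two ψ d) :
    Two (fun t => φ t + ψ t) (c + d) := by
  obtain ⟨f, h1, h2⟩ := h; obtain ⟨g, h3, h4⟩ := k
  refine ⟨fun t => f t + g t, ?_, h2.add h4⟩
  filter_upwards [h1, h3] with t a b using a.add b

lemma Two.const_mul {φ : ℝ → ℝ} {c : ℝ} (a : ℝ) (h : Two φ c) :
    Two (fun t => a * φ t) (a * c) := by
  obtain ⟨f, h1, h2⟩ := h
  refine ⟨fun t => a * f t, ?_, h2.const_mul a⟩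
  filter_upwards [h1] with t b using b.const_mul a

lemma Two.sub {φ ψ : ℝ → ℝ} {c d : ℝ} (h : Two φ c) (k : Two ψ d) :
    Two (fun t => φ t - ψ t) (c - d) := by
  obtain ⟨f, h1, h2⟩ := h; obtain ⟨g, h3, h4⟩ := k
  refine ⟨fun t => f t - g t, ?_, h2.sub h4⟩
  filter_upwards [h1, h3] with t a b using a.sub b

lemma Two.congr {φ ψ : ℝ → ℝ} {c : ℝ} (h : Two φ c) (k : ∀ t, φ t = ψ t) : Two ψ c := by
  have : φ = ψ := funext k
  rwa [← this]

lemma two_quad (a b c : ℝ) : Two (fun t => a + b * t + c * t ^ 2) (2 * c) := by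
  refine ⟨fun t => b + 2 * c * t, Eventually.of_forall fun t => ?_, ?_⟩
  · have := (((hasDerivAt_id t).const_mul b).const_add a).add (((hasDerivAt_id t).pow 2).const_mul c)
    refine this.congr_deriv ?_
    simp; ring
  · have := ((hasDerivAt_id (0:ℝ)).const_mul (2 * c)).const_add b
    refine this.congr_deriv ?_
    simp

lemma Two.le_of_max {φ : ℝ → ℝ} {c : ℝ} (h : Two φ c) (hm : IsLocalMax φ 0) : c ≤ 0 := by
  obtain ⟨f, h1, h2⟩ := h
  by_contra hc
  push Not at hc
  have e1 : deriv φ =ᶠ[𝓝 0] f := by filter_upwards [h1] with t ht using ht.deriv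
  have e2 : deriv (deriv φ) 0 = c := by rw [e1.deriv_eq, h2.deriv]
  have hmin := isLocalMin_of_deriv_deriv_pos (by rw [e2]; exact hc) hm.deriv_eq_zero
    h1.self_of_nhds.continuousAt
  have e3 : φ =ᶠ[𝓝 0] fun _ => φ 0 := by
    filter_upwards [hm, hmin] with t a b using le_antisymm a b
  have e4 : f =ᶠ[𝓝 0] fun _ => 0 := by
    filter_upwards [h1, e3.eventuallyEq_nhds] with t a b
    have := a.deriv
    rw [b.deriv_eq] at this
    simpa using this.symm
  have := h2.congr_of_eventuallyEq e4.symm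
  have h5 := this.unique (hasDerivAt_const (0:ℝ) (0:ℝ))
  linarith

lemma Two.ge_of_min {φ : ℝ → ℝ} {c : ℝ} (h : Two φ c) (hm : IsLocalMin φ 0) : 0 ≤ c := by
  have := (h.const_mul (-1)).le_of_max (by simpa using hm.neg)
  linarith

/-- Hessian. -/
noncomputable def D2 (f : E → ℝ) (x : E) : E →L[ℝ] E →L[ℝ] ℝ := fderiv ℝ (fderiv ℝ f) x

lemma two_line {f : E → ℝ} {x : E} (hf : ContDiffAt ℝ 2 f x) (w : E) :
    Two (fun t : ℝ => f (x + t • w)) (D2 f x w w) := by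
  have hl : Tendsto (fun t : ℝ => x + t • w) (𝓝 0) (𝓝 x) := by
    have : Continuous (fun t : ℝ => x + t • w) := by fun_prop
    simpa using this.tendsto 0
  have hline : ∀ t : ℝ, HasDerivAt (fun t : ℝ => x + t • w) w t := fun t => by
    simpa using ((hasDerivAt_id t).smul_const w).const_add x
  refine ⟨fun t => fderiv ℝ f (x + t • w) w, ?_, ?_⟩
  · have h1 : ∀ᶠ y in 𝓝 x, DifferentiableAt ℝ f y := by
      filter_upwards [hf.eventually (by simp)] with y hy using hy.differentiableAt (by simp)
    filter_upwards [hl.eventually h1] with t ht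
    exact ht.hasFDerivAt.comp_hasDerivAt t (hline t)
  · have h1 : DifferentiableAt ℝ (fderiv ℝ f) x :=
      (hf.fderiv_right (m := 1) (by norm_num)).differentiableAt (by simp)
    have h2 : HasFDerivAt (fderiv ℝ f) (D2 f x) (x + (0:ℝ) • w) := by
      simpa [D2] using h1.hasFDerivAt
    have h3 := h2.comp_hasDerivAt (0:ℝ) (hline 0)
    exact h3.clm_apply (hasDerivAt_const 0 w) |>.congr_deriv (by simp)

/-- coordinate vectors -/
noncomputable def ee (i : Fin 8) : E := EuclideanSpace.single i 1

/-- the minimal surface operator on Hessians -/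
noncomputable def T (p : E) (H : E →L[ℝ] E →L[ℝ] ℝ) : ℝ :=
  (1 + ‖p‖ ^ 2) * ∑ i, H (ee i) (ee i) - H p p

lemma norm_ee (i : Fin 8) : ‖ee i‖ = 1 := by simp [ee]

lemma inner_ee (x : E) (i : Fin 8) : ⟪x, ee i⟫ = x i := by
  simp [ee, EuclideanSpace.inner_single_right]

lemma sum_ee (p : E) : ∑ i, p i • ee i = p := by
  ext j
  simp [ee, Finset.sum_apply, Pi.single_apply]

lemma norm_sq_eq (p : E) : ‖p‖ ^ 2 = ∑ i, p i ^ 2 := by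
  rw [EuclideanSpace.norm_sq_eq]; simp

/-- rotation directions -/
noncomputable def qq (p : E) (i j : Fin 8) : E := p i • ee j - p j • ee i

lemma T_decomp (p : E) (H : E →L[ℝ] E →L[ℝ] ℝ) :
    T p H = ∑ i, H (ee i) (ee i) + (1 / 2) * ∑ i, ∑ j, H (qq p i j) (qq p i j) := by
  have hp : H p p = ∑ i, ∑ j, p i * p j * H (ee i) (ee j) := by
    conv_lhs => rw [← sum_ee p]
    simp only [map_sum, ContinuousLinearMap.sum_apply, map_smul, ContinuousLinearMap.smul_apply,
      smul_eq_mul, Finset.mul_sum]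
    rw [Finset.sum_comm]
    exact Finset.sum_congr rfl fun i _ => Finset.sum_congr rfl fun j _ => by ring
  have hq : ∀ i j, H (qq p i j) (qq p i j) = p i ^ 2 * H (ee j) (ee j) + p j ^ 2 * H (ee i) (ee i)
      - p i * p j * H (ee i) (ee j) - p j * p i * H (ee j) (ee i) := by
    intro i j
    simp only [qq, map_sub, ContinuousLinearMap.sub_apply, map_smul, ContinuousLinearMap.smul_apply,
      smul_eq_mul]
    ring
  simp only [hq, Finset.sum_add_distrib, Finset.sum_sub_distrib]
  have e1 : ∑ i, ∑ j, p i ^ 2 * H (ee j) (ee j) = ‖p‖ ^ 2 * ∑ i, H (ee i) (ee i) := by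
    rw [norm_sq_eq, Finset.sum_mul_sum]
  have e2 : ∑ i, ∑ j, p j ^ 2 * H (ee i) (ee i) = ‖p‖ ^ 2 * ∑ i, H (ee i) (ee i) := by
    rw [Finset.sum_comm, e1]
  have e3 : ∑ i, ∑ j, p j * p i * H (ee j) (ee i) = H p p := by
    rw [Finset.sum_comm, hp]
  rw [e1, e2, e3, ← hp, T]
  ring

lemma norm_qq (p : E) : ∑ i, ∑ j, ‖qq p i j‖ ^ 2 = 14 * ‖p‖ ^ 2 := by
  have h : ∀ i j, ‖qq p i j‖ ^ 2 = p i ^ 2 + p j ^ 2 - 2 * (if i = j then p i ^ 2 else 0) := by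
    intro i j
    rw [qq, norm_sub_sq_real, norm_smul, norm_smul, norm_ee, norm_ee, real_inner_smul_left,
      real_inner_smul_right, inner_ee, Real.norm_eq_abs, Real.norm_eq_abs, mul_one, mul_one, sq_abs, sq_abs]
    by_cases hij : i = j
    · subst hij; simp [ee]; ring
    · simp [ee, hij]
  simp only [h, Finset.sum_add_distrib, Finset.sum_sub_distrib, ← Finset.mul_sum]
  simp [norm_sq_eq]
  rw [← Finset.mul_sum]; ring

lemma grad_est {f : E → ℝ} (hf : ContDiff ℝ 2 f) (p x₀ : E) {R M K : ℝ} (hR : 0 < R)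
    (hM : ∀ x ∈ closedBall x₀ R, |f x| ≤ M) (hK : ∀ x ∈ closedBall x₀ R, |T p (D2 f x)| ≤ K)
    (m : Fin 8) : |fderiv ℝ f x₀ (ee m)| ≤ R * K + 56 * (1 + ‖p‖ ^ 2) * M / R := by
  have hM0 : 0 ≤ M := (abs_nonneg _).trans (hM x₀ (mem_closedBall_self hR.le))
  have hK0 : 0 ≤ K := (abs_nonneg _).trans (hK x₀ (mem_closedBall_self hR.le))
  set P := ‖p‖ ^ 2 with hP
  have hP0 : 0 ≤ P := by positivity
  set a := 8 * M / R ^ 2 with ha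
  have ha0 : 0 ≤ a := by positivity
  have haM : a * R ^ 2 = 8 * M := by rw [ha]; field_simp
  have key : ∀ g : E → ℝ, ContDiff ℝ 2 g → (∀ x ∈ closedBall x₀ R, |g x| ≤ M) →
      (∀ x ∈ closedBall x₀ R, |T p (D2 g x)| ≤ K) → ∀ ε > 0, ∀ s ∈ Icc 0 (R / 2),
      g (x₀ + s • ee m) - g (x₀ - s • ee m) ≤ (K + 7 * a * (1 + P) + ε) * s * (R - s) := by
    intro g hg hM hK ε hε s₁ hs₁
    set B := K + 7 * a * (1 + P) + ε with hB
    have hBa : a ≤ B := by nlinarith [mul_nonneg ha0 hP0]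
    have hB0 : 0 < B := by positivity
    set Φ : E × ℝ → ℝ := fun z => g (x₀ + z.1 + z.2 • ee m) - g (x₀ + z.1 - z.2 • ee m)
      - a * ‖z.1‖ ^ 2 - B * z.2 * (R - z.2) with hΦ
    have hgc := hg.continuous
    have hΦc : Continuous Φ := by fun_prop
    obtain ⟨⟨x, s⟩, ⟨hx, hs⟩, hmax⟩ := ((isCompact_closedBall (0:E) (R / 2)).prod
      (isCompact_Icc (a := (0:ℝ)) (b := R / 2))).exists_isMaxOn
      ⟨((0:E), (0:ℝ)), mem_closedBall_self (by positivity), by simp; positivity⟩ hΦc.continuousOn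
    rw [mem_closedBall_zero_iff] at hx
    change ‖x‖ ≤ R / 2 at hx
    change s ∈ Icc 0 (R / 2) at hs
    have hin : ∀ c : ℝ, |c| ≤ R / 2 → ∀ x : E, ‖x‖ ≤ R / 2 → x₀ + x + c • ee m ∈ closedBall x₀ R := by
      intro c hc x hx
      rw [mem_closedBall, dist_eq_norm]
      calc ‖x₀ + x + c • ee m - x₀‖ = ‖x + c • ee m‖ := by congr 1; abel
        _ ≤ ‖x‖ + ‖c • ee m‖ := norm_add_le _ _
        _ ≤ R := by rw [norm_smul, norm_ee, Real.norm_eq_abs]; linarith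
    have hin2 : ∀ c : ℝ, |c| ≤ R / 2 → ∀ x : E, ‖x‖ ≤ R / 2 → x₀ + x - c • ee m ∈ closedBall x₀ R := by
      intro c hc x hx
      have := hin (-c) (by rwa [abs_neg]) x hx
      rwa [neg_smul, ← sub_eq_add_neg] at this
    suffices hle : Φ (x, s) ≤ 0 by
      have h1 : Φ (0, s₁) ≤ Φ (x, s) := hmax ⟨mem_closedBall_self (by positivity), hs₁⟩
      have h2 : Φ (0, s₁) = g (x₀ + s₁ • ee m) - g (x₀ - s₁ • ee m) - B * s₁ * (R - s₁) := by
        simp [hΦ]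
      linarith
    by_contra hpos
    push Not at hpos
    have hsabs : |s| ≤ R / 2 := by rw [abs_of_nonneg hs.1]; exact hs.2
    have hg1 := abs_le.1 (hM _ (hin s hsabs x hx))
    have hg2 := abs_le.1 (hM _ (hin2 s hsabs x hx))
    have hval : Φ (x, s) = g (x₀ + x + s • ee m) - g (x₀ + x - s • ee m)
      - a * ‖x‖ ^ 2 - B * s * (R - s) := rfl
    have hs0 : 0 < s := by
      rcases hs.1.eq_or_lt with h | h
      · exfalso
        rw [hval, ← h] at hpos
        simp at hpos
        nlinarith [sq_nonneg ‖x‖]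
      · exact h
    have hsR : s < R / 2 := by
      rcases hs.2.eq_or_lt with h | h
      · exfalso
        rw [hval] at hpos
        have : B * s * (R - s) = B * R ^ 2 / 4 := by rw [h]; ring
        have h3 : a * R ^ 2 ≤ B * R ^ 2 := by gcongr
        nlinarith [sq_nonneg ‖x‖, mul_nonneg ha0 (sq_nonneg ‖x‖)]
      · exact h
    have hxR : ‖x‖ < R / 2 := by
      rcases hx.eq_or_lt with h | h
      · exfalso
        rw [hval] at hpos
        have : a * ‖x‖ ^ 2 = a * R ^ 2 / 4 := by rw [h]; ring
        have h3 : 0 ≤ B * s * (R - s) := mul_nonneg (by positivity) (by linarith)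
        nlinarith
      · exact h
    have hloc : IsLocalMax Φ (x, s) := by
      apply hmax.isLocalMax
      exact prod_mem_nhds (closedBall_mem_nhds_of_mem (by rwa [mem_ball_zero_iff])) (Icc_mem_nhds hs0 hsR)
    have hdir : ∀ (w : E) (c : ℝ), D2 g (x₀ + x + s • ee m) (w + c • ee m) (w + c • ee m)
        - D2 g (x₀ + x - s • ee m) (w - c • ee m) (w - c • ee m) - 2 * a * ‖w‖ ^ 2 + 2 * B * c ^ 2 ≤ 0 := by
      intro w c
      have t1 := two_line (hg.contDiffAt (x := x₀ + x + s • ee m)) (w + c • ee m)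
      have t2 := two_line (hg.contDiffAt (x := x₀ + x - s • ee m)) (w - c • ee m)
      have t3 := two_quad (a * ‖x‖ ^ 2 + B * s * (R - s)) (2 * a * ⟪x, w⟫ + B * c * (R - 2 * s))
        (a * ‖w‖ ^ 2 - B * c ^ 2)
      have t4 : Two (fun t : ℝ => Φ (x + t • w, s + t * c)) _ := ((t1.sub t2).sub t3).congr (by
        intro t
        simp only [hΦ]
        have n1 : ‖x + t • w‖ ^ 2 = ‖x‖ ^ 2 + 2 * t * ⟪x, w⟫ + t ^ 2 * ‖w‖ ^ 2 := by
          rw [norm_add_sq_real, norm_smul, real_inner_smul_right, mul_pow, Real.norm_eq_abs, sq_abs]; ring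
        have n2 : x₀ + (x + t • w) + (s + t * c) • ee m = x₀ + x + s • ee m + t • (w + c • ee m) := by
          module
        have n3 : x₀ + (x + t • w) - (s + t * c) • ee m = x₀ + x - s • ee m + t • (w - c • ee m) := by
          module
        rw [n1, n2, n3]; ring)
      have hl : Tendsto (fun t : ℝ => (x + t • w, s + t * c)) (𝓝 0) (𝓝 (x, s)) := by
        have : Continuous (fun t : ℝ => (x + t • w, s + t * c)) := by fun_prop
        simpa using this.tendsto 0
      have t5 : IsLocalMax (fun t : ℝ => Φ (x + t • w, s + t * c)) 0 := by
        have := hl.eventually hloc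
        simpa [IsLocalMax, IsMaxFilter] using this
      have := t4.le_of_max t5
      linarith
    set H₁ := D2 g (x₀ + x + s • ee m) with hH1
    set H₂ := D2 g (x₀ + x - s • ee m) with hH2
    have s1 : ∑ i, (H₁ (ee i) (ee i) - H₂ (ee i) (ee i)) ≤ ∑ i, (2 * a - if i = m then 2 * a + 2 * B else 0) := by
      apply Finset.sum_le_sum
      intro i _
      by_cases him : i = m
      · subst him
        have := hdir 0 1
        simp at this ⊢
        linarith
      · have := hdir (ee i) 0
        simp [norm_ee] at this
        simp [him]; linarith
    have s2 : ∑ i, ∑ j, (H₁ (qq p i j) (qq p i j) - H₂ (qq p i j) (qq p i j)) ≤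
        ∑ i, ∑ j, (2 * a * ‖qq p i j‖ ^ 2) := by
      apply Finset.sum_le_sum; intro i _
      apply Finset.sum_le_sum; intro j _
      have := hdir (qq p i j) 0
      simp at this ⊢
      linarith
    simp only [← Finset.mul_sum, norm_qq] at s2
    simp only [Finset.sum_sub_distrib] at s1 s2
    simp only [Finset.sum_ite_eq', Finset.sum_const, Finset.card_univ, Fintype.card_fin, Finset.mem_univ,
      if_true, nsmul_eq_mul] at s1
    have k1 := abs_le.1 (hK _ (hin s hsabs x hx))
    have k2 := abs_le.1 (hK _ (hin2 s hsabs x hx))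
    rw [T_decomp] at k1 k2
    push_cast at s1
    rw [← hP] at s2
    nlinarith
  have hderiv : ∀ g : E → ℝ, ContDiff ℝ 2 g → (∀ x ∈ closedBall x₀ R, |g x| ≤ M) →
      (∀ x ∈ closedBall x₀ R, |T p (D2 g x)| ≤ K) →
      fderiv ℝ g x₀ (ee m) ≤ R * K + 56 * (1 + P) * M / R := by
    intro g hg hM hK
    have h1 : ∀ ε > 0, 2 * fderiv ℝ g x₀ (ee m) ≤ (K + 7 * a * (1 + P) + ε) * R := by
      intro ε hε
      have hd := (hg.differentiable (by simp) x₀).hasFDerivAt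
      have l1 := hd.hasLineDerivAt (ee m)
      have l2 := hd.hasLineDerivAt (-ee m)
      have l3 := (HasDerivAt.sub l1 l2).tendsto_slope_zero_right
      rw [map_neg, sub_neg_eq_add, ← two_mul] at l3
      refine le_of_tendsto l3 ?_
      filter_upwards [Ioo_mem_nhdsGT (show (0:ℝ) < R / 2 by positivity)] with t ht
      have := key g hg hM hK ε hε t ⟨ht.1.le, ht.2.le⟩
      simp only [Pi.sub_apply, zero_add, zero_smul, add_zero, smul_eq_mul, smul_neg, neg_zero, add_zero, sub_self, sub_zero]
      rw [inv_mul_le_iff₀ ht.1, ← sub_eq_add_neg]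
      have h5 : 0 ≤ (K + 7 * a * (1 + P) + ε) * (t * t) := by have := ht.1; positivity
      nlinarith
    have h2 : 2 * fderiv ℝ g x₀ (ee m) ≤ (K + 7 * a * (1 + P)) * R := by
      by_contra hc
      push Not at hc
      have := h1 ((2 * fderiv ℝ g x₀ (ee m) - (K + 7 * a * (1 + P)) * R) / (2 * R)) (div_pos (by linarith) (by positivity))
      rw [add_mul, div_mul_eq_mul_div, mul_div_mul_right _ _ hR.ne'] at this
      linarith
    have h3 : 7 * a * (1 + P) * R = 56 * (1 + P) * M / R := by rw [ha]; field_simp; ring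
    have h4 : 0 ≤ 56 * (1 + P) * M / R := by positivity
    nlinarith [mul_nonneg hR.le hK0]
  rw [abs_le']
  refine ⟨hderiv f hf hM hK, ?_⟩
  have hn : ∀ x, D2 (fun y => - f y) x = - D2 f x := by
    intro x
    have : fderiv ℝ (fun y => - f y) = fun y => - fderiv ℝ f y := by funext y; rw [fderiv_fun_neg]
    rw [D2, this, fderiv_fun_neg]; rfl
  have := hderiv (fun y => - f y) hf.neg (by simpa using hM) (by
    intro x hx
    rw [hn]
    have : T p (-D2 f x) = - T p (D2 f x) := by simp [T]; ring
    rw [this, abs_neg]; exact hK x hx)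
  rwa [fderiv_fun_neg] at this

end BDG

open scoped RealInnerProductSpace
namespace BDG
open MeasureTheory Filter Topology Set Metric
open scoped NNReal ENNReal Gradient ContDiff

/-- smooth kernels supported in a ball -/
structure Ker (κ : E → ℝ) (τ : ℝ) : Prop where
  smooth : ContDiff ℝ ∞ κ
  supp : tsupport κ ⊆ closedBall 0 τ

/-- directional derivative -/
noncomputable def dd (e : E) (f : E → ℝ) : E → ℝ := fun t => fderiv ℝ f t e

lemma Ker.cs {κ : E → ℝ} {τ : ℝ} (h : Ker κ τ) : HasCompactSupport κ :=
  HasCompactSupport.of_support_subset_isCompact (isCompact_closedBall 0 τ)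
    ((subset_tsupport κ).trans h.supp)

lemma Ker.zero {κ : E → ℝ} {τ : ℝ} (h : Ker κ τ) {t : E} (ht : t ∉ closedBall (0:E) τ) : κ t = 0 :=
  image_eq_zero_of_notMem_tsupport fun h' => ht (h.supp h')

lemma Ker.dd {κ : E → ℝ} {τ : ℝ} (h : Ker κ τ) (e : E) : Ker (dd e κ) τ := by
  constructor
  · exact (h.smooth.fderiv_right (m := ∞) (by norm_num)).clm_apply contDiff_const
  · refine subset_trans ?_ h.supp
    refine subset_trans ?_ (tsupport_fderiv_subset ℝ (f := κ))
    apply closure_mono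
    intro t ht h0
    apply ht
    simp [BDG.dd, h0]

lemma Ker.lip {κ : E → ℝ} {τ : ℝ} (h : Ker κ τ) : ∃ L, LipschitzWith L κ :=
  ContDiff.lipschitzWith_of_hasCompactSupport h.cs (h.smooth.of_le (n := ∞) (m := 1) (by simp)) (by simp)

lemma Ker.integrable {κ : E → ℝ} {τ : ℝ} (h : Ker κ τ) : Integrable κ :=
  h.smooth.continuous.integrable_of_hasCompactSupport h.cs

lemma Ker.grad_cont {κ : E → ℝ} {τ : ℝ} (h : Ker κ τ) : Continuous (∇ κ) :=
  (InnerProductSpace.toDual ℝ E).symm.continuous.comp (h.smooth.continuous_fderiv (by simp))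

lemma Ker.grad_zero {κ : E → ℝ} {τ : ℝ} (h : Ker κ τ) {t : E} (ht : t ∉ closedBall (0:E) τ) : ∇ κ t = 0 := by
  apply grad_eq_of_fderiv
  intro v
  rw [fderiv_of_notMem_tsupport ℝ fun h' => ht (h.supp h')]; simp

lemma Ker.grad_cs {κ : E → ℝ} {τ : ℝ} (h : Ker κ τ) : HasCompactSupport (∇ κ) :=
  HasCompactSupport.of_support_subset_isCompact (isCompact_closedBall 0 τ) (by
    intro t ht; by_contra h'; exact ht (h.grad_zero h'))

lemma Ker.grad_int {κ : E → ℝ} {τ : ℝ} (h : Ker κ τ) : Integrable (∇ κ) :=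
  h.grad_cont.integrable_of_hasCompactSupport h.grad_cs

lemma dd_eq (e : E) (f : E → ℝ) (t : E) : dd e f t = ⟪∇ f t, e⟫ := (grad_apply _ _ _).symm

lemma conv_dd {κ : E → ℝ} {τ : ℝ} (h : Ker κ τ) {f : E → ℝ} (hf : LocallyIntegrable f) (x v : E) :
    fderiv ℝ (conv κ f) x v = conv (dd v κ) f x := by
  rw [conv_eq]
  have h1 := h.cs.hasFDerivAt_convolution_left (ContinuousLinearMap.lsmul ℝ ℝ) (μ := volume)
    (h.smooth.of_le (by simp)) hf x
  rw [h1.fderiv, convolution_def, ContinuousLinearMap.integral_apply]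
  · rfl
  · have := (h.cs.fderiv (𝕜 := ℝ)).convolutionExists_left ((ContinuousLinearMap.lsmul ℝ ℝ).precompL E)
      (μ := volume) (h.smooth.continuous_fderiv (by simp)) hf x
    exact this

lemma conv_smooth {κ : E → ℝ} {τ : ℝ} (h : Ker κ τ) {f : E → ℝ} (hf : LocallyIntegrable f) :
    ContDiff ℝ ∞ (conv κ f) := by
  rw [conv_eq]
  exact h.cs.contDiff_convolution_left _ h.smooth hf

lemma ker_cont_int {κ : E → ℝ} {τ : ℝ} (h : Ker κ τ) {f : E → ℝ} (hf : Continuous f) (x : E) :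
    Integrable (fun t => κ t • f (x - t)) :=
  Continuous.integrable_of_hasCompactSupport
    (h.smooth.continuous.smul (hf.comp (by fun_prop))) h.cs.smul_right

lemma locint_grad {K : ℝ≥0} {u : E → ℝ} (hu : LipschitzWith K u) (w : E) :
    LocallyIntegrable (fun y => ⟪∇ u y, w⟫) := by
  have hm : AEStronglyMeasurable (fun y => ⟪∇ u y, w⟫) volume :=
    (aesm_grad u).inner aestronglyMeasurable_const
  have : LocallyIntegrable (fun _ : E => (K:ℝ) * ‖w‖) (volume : Measure E) := locallyIntegrable_const _
  refine this.mono hm (Eventually.of_forall fun y => ?_)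
  refine (norm_inner_le_norm _ _).trans ?_
  rw [Real.norm_of_nonneg (by positivity)]
  gcongr
  exact norm_grad_le hu y

lemma conv_dd_grad {κ : E → ℝ} {τ : ℝ} (h : Ker κ τ) {K : ℝ≥0} {u : E → ℝ} (hu : LipschitzWith K u)
    (x w : E) : fderiv ℝ (conv κ u) x w = conv κ (fun y => ⟪∇ u y, w⟫) x := by
  rw [(conv_hasFDerivAt h.integrable hu x (ker_cont_int h hu.continuous x)).fderiv,
    ContinuousLinearMap.integral_apply (integrable_kernel_fderiv h.integrable hu x), conv]
  congr 1; funext t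
  rw [grad_apply]; rfl

lemma D2_apply {f : E → ℝ} {x : E} (hf : ContDiffAt ℝ 2 f x) (v w : E) :
    D2 f x v w = fderiv ℝ (fun y => fderiv ℝ f y w) x v := by
  have h1 : DifferentiableAt ℝ (fderiv ℝ f) x :=
    (hf.fderiv_right (m := 1) (by norm_num)).differentiableAt (by simp)
  rw [fderiv_clm_apply h1 (differentiableAt_const w)]
  simp [D2]

lemma conv_D2 {κ : E → ℝ} {τ : ℝ} (h : Ker κ τ) {K : ℝ≥0} {u : E → ℝ} (hu : LipschitzWith K u)
    (x v w : E) : D2 (conv κ u) x v w = ∫ t, ⟪∇ κ t, v⟫ * ⟪∇ u (x - t), w⟫ := by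
  rw [D2_apply ((conv_smooth h hu.continuous.locallyIntegrable).of_le (by norm_cast)).contDiffAt]
  have : (fun y => fderiv ℝ (conv κ u) y w) = conv κ (fun y => ⟪∇ u y, w⟫) := by
    funext y; exact conv_dd_grad h hu y w
  rw [this, conv_dd h (locint_grad hu w), conv]
  congr 1; funext t
  rw [dd_eq, smul_eq_mul]

lemma ker_int {κ : E → ℝ} {τ : ℝ} (h : Ker κ τ) {W : E → E} (hW : AEStronglyMeasurable W volume) {C : ℝ}
    (hC : ∀ t, ‖W t‖ ≤ C) : Integrable (fun t => ⟪∇ κ t, W t⟫) := by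
  refine (h.grad_int.norm.mul_const C).mono' (h.grad_cont.aestronglyMeasurable.inner hW) ?_
  filter_upwards with t
  refine (norm_inner_le_norm _ _).trans ?_
  gcongr; exact hC t

lemma grad_sub_meas (u : E → ℝ) (x : E) : Measurable (fun t => ∇ u (x - t)) :=
  (measurable_grad u).comp (measurable_const.sub measurable_id)

lemma conv_T {κ : E → ℝ} {τ : ℝ} (h : Ker κ τ) {K : ℝ≥0} {u : E → ℝ} (hu : LipschitzWith K u)
    (x p : E) : T p (D2 (conv κ u) x) = F p ^ 3 * ∫ t, ⟪∇ κ t, A p p (∇ u (x - t))⟫ := by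
  have hi : ∀ v w : E, Integrable (fun t => ⟪∇ κ t, v⟫ * ⟪∇ u (x - t), w⟫) := by
    intro v w
    have hm : AEStronglyMeasurable (fun t => ⟪∇ u (x - t), w⟫ • v) volume :=
      ((grad_sub_meas u x).aestronglyMeasurable.inner aestronglyMeasurable_const).smul_const v
    have := ker_int h hm (C := K * ‖w‖ * ‖v‖) (by
      intro t
      rw [norm_smul]; gcongr
      refine (norm_inner_le_norm _ _).trans ?_
      gcongr; exact norm_grad_le hu _)
    refine this.congr (Eventually.of_forall fun t => ?_)
    simp only [real_inner_smul_right]; ring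
  simp only [T, conv_D2 h hu]
  rw [← integral_finset_sum _ (fun i _ => hi _ _), ← integral_const_mul, ← integral_sub
    ((integrable_finset_sum _ fun i _ => hi _ _).const_mul _) (hi _ _), ← integral_const_mul]
  congr 1; funext t
  have hs : ∑ i, ⟪∇ κ t, ee i⟫ * ⟪∇ u (x - t), ee i⟫ = ⟪∇ κ t, ∇ u (x - t)⟫ := by
    simp only [inner_ee]
    rw [PiLp.inner_apply]
    exact Finset.sum_congr rfl fun i _ => by simp [mul_comm]
  rw [hs, A, inner_sub_right, real_inner_smul_right, real_inner_smul_right, ← F_sq]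
  have := F_pos p
  rw [← two_smul ℝ p, real_inner_smul_left, real_inner_smul_right, real_inner_comm _ p]
  field_simp
  ring

lemma conv_weak {κ : E → ℝ} {τ : ℝ} (h : Ker κ τ) {u : E → ℝ} {U : Set E} (hw : WS u U) {x : E}
    (hx : closedBall x τ ⊆ U) : ∫ t, ⟪∇ κ t, DF (∇ u (x - t))⟫ = 0 := by
  obtain ⟨L, hL⟩ := h.lip
  have hψ : LipschitzWith L (fun y => κ (x - y)) := by
    apply LipschitzWith.of_dist_le_mul
    intro a b
    have := hL.dist_le_mul (x - a) (x - b)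
    rwa [dist_sub_left] at this
  have := hw _ L hψ (by
    intro y hy
    apply h.zero
    intro hc; apply hy; apply hx
    rw [mem_closedBall_zero_iff] at hc
    rw [mem_closedBall, dist_comm, dist_eq_norm]; exact hc)
  have hg : ∀ y, ∇ (fun y => κ (x - y)) y = - ∇ κ (x - y) := by
    intro y
    apply grad_eq_of_fderiv
    intro v
    have hd := (h.smooth.differentiable (by simp) (x - y)).hasFDerivAt
    have h2 : HasFDerivAt (fun y : E => x - y) (-ContinuousLinearMap.id ℝ E) y :=
      (hasFDerivAt_id y).const_sub x
    have h3 := hd.comp y h2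
    have h4 : fderiv ℝ (fun y => κ (x - y)) y = _ := h3.fderiv
    rw [h4, inner_neg_left, grad_apply]
    simp
  rw [← integral_sub_left_eq_self _ volume x] at this
  simp only [hg, sub_sub_cancel, inner_neg_right, integral_neg, neg_eq_zero] at this
  simp_rw [real_inner_comm] at this ⊢
  exact this

lemma N_bound (p q : E) : ‖A p p (q - p) - (DF q - DF p)‖ ≤ 4 * ‖q - p‖ ^ 2 := by
  set v := q - p with hv
  have hq : q = p + v := by rw [hv]; abel
  have h1 := F_sq p; have h2 := F_sq q; have h0 := F_pos p; have h3 := F_pos q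
  have g1 := one_le_F p; have g2 := one_le_F q
  have hpF := norm_le_F p
  set a := F p; set b := F q
  set s := 1 / (a * b * (a + b)) with hs
  set s₀ := 1 / (2 * a ^ 3) with hs0
  have hs_pos : 0 < s := by positivity
  have hD : b ^ 2 - a ^ 2 = 2 * ⟪p, v⟫ + ‖v‖ ^ 2 := by
    rw [h1, h2, hq, norm_add_sq_real]; ring
  have hlip : |b - a| ≤ ‖v‖ := by
    have e1 : |b - a| * (b + a) ≤ ‖v‖ * (b + a) := by
      rw [← abs_of_pos (show 0 < b + a by positivity), ← abs_mul]
      have e2 : (b - a) * (b + a) = ⟪v, p + q⟫ := by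
        rw [hq, inner_add_right, inner_add_right, real_inner_self_eq_norm_sq, real_inner_comm p v]; linarith
      rw [e2]
      refine (abs_real_inner_le_norm _ _).trans ?_
      rw [abs_of_pos (show 0 < b + a by positivity)]
      gcongr
      refine (norm_add_le _ _).trans ?_
      have := norm_le_F q
      linarith
    exact le_of_mul_le_mul_right e1 (by positivity)
  have hN : A p p v - (DF q - DF p) = ((b ^ 2 - a ^ 2) * s) • v + (‖v‖ ^ 2 * s + 2 * ⟪p, v⟫ * (s - s₀)) • p := by
    have e3 : (b:ℝ)⁻¹ = a⁻¹ - (b ^ 2 - a ^ 2) * s := by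
      rw [hs]; field_simp; ring
    have e4 : A p p v = a⁻¹ • v - (2 * ⟪p, v⟫ * s₀) • p := by
      simp only [A]
      rw [← two_smul ℝ p, real_inner_smul_left, smul_smul]
      congr 2
      · change (1 / a + 1 / a) / 2 = _
        field_simp; norm_num
      · change 2 * ⟪p, v⟫ / (2 * a * a * (a + a)) * 2 = _
        rw [hs0]; field_simp; ring
    have e5 : DF q = (b:ℝ)⁻¹ • q := rfl
    have e6 : DF p = (a:ℝ)⁻¹ • p := rfl
    rw [e4, e5, e6, e3, hq, hD]
    module
  rw [hN]
  have b1 : |(b ^ 2 - a ^ 2) * s| ≤ ‖v‖ := by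
    have : (b ^ 2 - a ^ 2) * s = (b - a) / (a * b) := by rw [hs]; field_simp; ring
    rw [this, abs_div, abs_of_pos (show 0 < a * b by positivity)]
    refine (div_le_self (abs_nonneg _) ?_).trans hlip
    nlinarith
  have b2 : s * a ≤ 1 := by
    rw [hs, div_mul_eq_mul_div, div_le_one (by positivity)]
    nlinarith [mul_pos h0 h3]
  have b3 : |s - s₀| * a ^ 2 ≤ ‖v‖ := by
    have : s - s₀ = (a - b) * ((2 * a + b) / (2 * a ^ 3 * b * (a + b))) := by
      rw [hs, hs0]; field_simp; ring
    rw [this, abs_mul, abs_sub_comm, abs_of_pos (show 0 < (2 * a + b) / (2 * a ^ 3 * b * (a + b)) by positivity)]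
    have : (2 * a + b) / (2 * a ^ 3 * b * (a + b)) * a ^ 2 ≤ 1 := by
      rw [div_mul_eq_mul_div, div_le_one (by positivity)]
      have : (2 * a + b) ≤ 2 * a * b * (a + b) := by
        nlinarith [mul_pos h0 h3, mul_le_mul g1 g2 zero_le_one h0.le, mul_nonneg (sub_nonneg.2 g1) (sub_nonneg.2 g2)]
      nlinarith [mul_le_mul_of_nonneg_right this (sq_nonneg a)]
    nlinarith [abs_nonneg (b - a)]
  have b4 : |⟪p, v⟫| ≤ a * ‖v‖ := (abs_real_inner_le_norm _ _).trans (by gcongr)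
  calc _ ≤ ‖((b ^ 2 - a ^ 2) * s) • v‖ + ‖(‖v‖ ^ 2 * s + 2 * ⟪p, v⟫ * (s - s₀)) • p‖ := norm_add_le _ _
    _ ≤ ‖v‖ * ‖v‖ + (‖v‖ ^ 2 * s + 2 * (a * ‖v‖) * |s - s₀|) * a := by
        rw [norm_smul, norm_smul, Real.norm_eq_abs, Real.norm_eq_abs]
        gcongr
        refine (abs_add_le _ _).trans ?_
        rw [abs_of_nonneg (show 0 ≤ ‖v‖ ^ 2 * s by positivity), abs_mul, abs_mul, abs_two]
        gcongr
    _ = ‖v‖ * ‖v‖ + ‖v‖ ^ 2 * (s * a) + 2 * ‖v‖ * (|s - s₀| * a ^ 2) := by ring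
    _ ≤ ‖v‖ * ‖v‖ + ‖v‖ ^ 2 * 1 + 2 * ‖v‖ * ‖v‖ := by gcongr
    _ = 4 * ‖v‖ ^ 2 := by ring

/-- `L¹` norm of the gradient of a kernel -/
noncomputable def I1 (κ : E → ℝ) : ℝ := ∫ t, ‖∇ κ t‖

lemma conv_T_bound {κ : E → ℝ} {τ : ℝ} (h : Ker κ τ) {K : ℝ≥0} {u : E → ℝ} (hu : LipschitzWith K u)
    {U : Set E} (hw : WS u U) {x p : E} (hx : closedBall x τ ⊆ U) {d : ℝ}
    (hd : ∀ y ∈ closedBall x τ, ‖∇ u y - p‖ ≤ d) :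
    |T p (D2 (conv κ u) x)| ≤ F p ^ 3 * (4 * d ^ 2 * I1 κ) := by
  have hF := F_pos p
  rw [conv_T h hu, abs_mul, abs_of_pos (by positivity)]
  gcongr
  obtain ⟨L, hL⟩ := h.lip
  have hA : Continuous (fun v => A p p v) := by unfold A; fun_prop
  have i1 : Integrable (fun t => ⟪∇ κ t, A p p (∇ u (x - t))⟫) :=
    ker_int h (hA.measurable.comp (grad_sub_meas u x)).aestronglyMeasurable (C := K) (fun t =>
      (A_upper _ _ _).trans (norm_grad_le hu _))
  have i2 : Integrable (fun t => ⟪∇ κ t, DF (∇ u (x - t))⟫) :=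
    ker_int h (DF_continuous.measurable.comp (grad_sub_meas u x)).aestronglyMeasurable (C := 1) (fun t =>
      norm_DF_le _)
  have i3 : Integrable (fun t => ⟪∇ κ t, A p p p - DF p⟫) :=
    ker_int h aestronglyMeasurable_const (C := ‖A p p p - DF p‖) (fun t => le_rfl)
  have z1 := conv_weak h hw hx
  have z2 : ∫ t, ⟪∇ κ t, A p p p - DF p⟫ = 0 := by
    have := integral_grad_zero hL h.cs (A p p p - DF p)
    simp_rw [real_inner_comm] at this ⊢
    exact this
  have e : ∫ t, ⟪∇ κ t, A p p (∇ u (x - t))⟫ =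
      ∫ t, ⟪∇ κ t, A p p (∇ u (x - t) - p) - (DF (∇ u (x - t)) - DF p)⟫ := by
    have : ∀ t, ⟪∇ κ t, A p p (∇ u (x - t) - p) - (DF (∇ u (x - t)) - DF p)⟫ =
        ⟪∇ κ t, A p p (∇ u (x - t))⟫ - ⟪∇ κ t, DF (∇ u (x - t))⟫ - ⟪∇ κ t, A p p p - DF p⟫ := by
      intro t
      have : A p p (∇ u (x - t) - p) = A p p (∇ u (x - t)) - A p p p := by
        simp only [A, inner_sub_right]; module
      rw [this]
      simp only [inner_sub_right]; ring
    simp_rw [this]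
    have j1 := integral_sub (i1.sub i2) i3
    have j2 := integral_sub i1 i2
    simp only [Pi.sub_apply] at j1
    rw [j1, j2, z1, z2]; ring
  rw [e, ← Real.norm_eq_abs, I1, ← integral_const_mul]
  apply norm_integral_le_of_norm_le (h.grad_int.norm.const_mul _)
  filter_upwards with t
  by_cases ht : t ∈ closedBall (0:E) τ
  · refine (norm_inner_le_norm _ _).trans ?_
    rw [mul_comm]
    gcongr
    refine (N_bound _ _).trans ?_
    gcongr
    apply hd
    rw [mem_closedBall_zero_iff] at ht
    rw [mem_closedBall, dist_eq_norm]; simpa using ht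
  · rw [h.grad_zero ht]; simp

end BDG

open scoped RealInnerProductSpace
namespace BDG
open MeasureTheory Filter Topology Set Metric
open scoped NNReal ENNReal Gradient ContDiff

/-- the standard kernel -/
noncomputable def kb : E → ℝ := (bump 0).normed volume

lemma kb_ker : Ker kb 1 := by
  refine ⟨(bump 0).contDiff_normed, ?_⟩
  rw [kb, (bump 0).tsupport_normed_eq]
  simp [bump]

lemma kb_nonneg (t : E) : 0 ≤ kb t := (bump 0).nonneg_normed t

lemma kb_int : ∫ t, kb t = 1 := (bump 0).integral_normed

/-- rescaled kernels -/
noncomputable def Sc (τ : ℝ) (κ : E → ℝ) : E → ℝ := fun t => (τ⁻¹) ^ 8 * κ (τ⁻¹ • t)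

lemma Sc_ker {κ : E → ℝ} (h : Ker κ 1) {τ : ℝ} (hτ : 0 < τ) : Ker (Sc τ κ) τ := by
  constructor
  · exact contDiff_const.mul (h.smooth.comp (contDiff_const_smul _))
  · apply closure_minimal _ isClosed_closedBall
    intro t ht
    by_contra hc
    apply ht
    have : τ⁻¹ • t ∉ closedBall (0:E) 1 := by
      rw [mem_closedBall_zero_iff, norm_smul, Real.norm_of_nonneg (by positivity)] at *
      intro h'; apply hc
      rwa [inv_mul_le_iff₀ hτ, mul_one] at h'
    simp [Sc, h.zero this]

lemma Sc_dd {κ : E → ℝ} {ρ : ℝ} (h : Ker κ ρ) (τ : ℝ) (e : E) :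
    dd e (Sc τ κ) = fun t => τ⁻¹ * Sc τ (dd e κ) t := by
  funext t
  have h2 : HasFDerivAt (fun t : E => τ⁻¹ • t) (τ⁻¹ • ContinuousLinearMap.id ℝ E) t :=
    (hasFDerivAt_id t).const_smul (τ⁻¹)
  have h1 := (h.smooth.differentiable (by simp) (τ⁻¹ • t)).hasFDerivAt
  have h3 := (h1.comp t h2).const_mul ((τ⁻¹) ^ 8)
  have h4 : fderiv ℝ (Sc τ κ) t = _ := h3.fderiv
  simp only [dd, h4, Sc]
  simp
  ring

lemma integral_Sc (H : E → ℝ) {τ : ℝ} (hτ : 0 < τ) : ∫ t, (τ⁻¹) ^ 8 * H (τ⁻¹ • t) = ∫ t, H t := by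
  rw [integral_const_mul]
  have := integral_affine H 0 τ⁻¹
  simp only [zero_add] at this
  rw [this, finrank_euclideanSpace_fin, abs_of_pos (by positivity)]
  field_simp

lemma integral_Sc_abs (κ : E → ℝ) {τ : ℝ} (hτ : 0 < τ) : ∫ t, |Sc τ κ t| = ∫ t, |κ t| := by
  rw [← integral_Sc (fun t => |κ t|) hτ]
  congr 1; funext t
  rw [Sc, abs_mul, abs_of_pos (by positivity)]

lemma grad_Sc {κ : E → ℝ} {ρ : ℝ} (h : Ker κ ρ) (τ : ℝ) (t : E) :
    ∇ (Sc τ κ) t = ((τ⁻¹) ^ 8 * τ⁻¹) • ∇ κ (τ⁻¹ • t) := by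
  apply grad_eq_of_fderiv
  intro v
  have := congrFun (Sc_dd h τ v) t
  simp only [dd, Sc] at this
  rw [this, real_inner_smul_left, grad_apply]; ring

lemma I1_Sc {κ : E → ℝ} {ρ : ℝ} (h : Ker κ ρ) {τ : ℝ} (hτ : 0 < τ) : I1 (Sc τ κ) = τ⁻¹ * I1 κ := by
  rw [I1, I1, ← integral_Sc (fun t => ‖∇ κ t‖) hτ, ← integral_const_mul]
  congr 1; funext t
  rw [grad_Sc h, norm_smul, Real.norm_of_nonneg (by positivity)]; ring

lemma I1_smul {κ : E → ℝ} {ρ : ℝ} (h : Ker κ ρ) {c : ℝ} (hc : 0 ≤ c) : I1 (fun t => c * κ t) = c * I1 κ := by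
  rw [I1, I1, ← integral_const_mul]
  congr 1; funext t
  rw [grad_const_mul c (h.smooth.differentiable (by simp) t), norm_smul, Real.norm_of_nonneg hc]

lemma I1_nonneg (κ : E → ℝ) : 0 ≤ I1 κ := integral_nonneg fun _ => norm_nonneg _

lemma I1_dd {κ : E → ℝ} (h : Ker κ 1) {τ : ℝ} (hτ : 0 < τ) (e : E) :
    I1 (dd e (Sc τ κ)) = τ⁻¹ ^ 2 * I1 (dd e κ) := by
  rw [Sc_dd h, I1_smul (Sc_ker (h.dd e) hτ) (by positivity), I1_Sc (h.dd e) hτ]; ring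

lemma dd_const_mul {κ : E → ℝ} {ρ : ℝ} (h : Ker κ ρ) (c : ℝ) (e : E) :
    dd e (fun t => c * κ t) = fun t => c * dd e κ t := by
  funext t
  simp only [dd_eq]
  rw [grad_const_mul c (h.smooth.differentiable (by simp) t), real_inner_smul_left]

lemma I1_dd2 {κ : E → ℝ} (h : Ker κ 1) {τ : ℝ} (hτ : 0 < τ) (e e' : E) :
    I1 (dd e' (dd e (Sc τ κ))) = τ⁻¹ ^ 3 * I1 (dd e' (dd e κ)) := by
  have h1 := Sc_ker (h.dd e) hτ
  rw [Sc_dd h, dd_const_mul h1, I1_smul (h1.dd e') (by positivity), I1_dd (h.dd e) hτ]; ring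

lemma integral_dd {κ : E → ℝ} {τ : ℝ} (h : Ker κ τ) (e : E) : ∫ t, dd e κ t = 0 := by
  obtain ⟨L, hL⟩ := h.lip
  have := integral_grad_zero hL h.cs e
  rw [← this]
  congr 1; funext t
  rw [dd_eq, real_inner_comm]

lemma int_dd_abs {κ : E → ℝ} (h : Ker κ 1) {τ : ℝ} (hτ : 0 < τ) (e : E) :
    ∫ t, |dd e (Sc τ κ) t| = τ⁻¹ * ∫ t, |dd e κ t| := by
  rw [Sc_dd h, ← integral_Sc_abs (dd e κ) hτ, ← integral_const_mul]
  congr 1; funext t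
  rw [abs_mul, abs_of_pos (by positivity)]

lemma conv_bound {κ : E → ℝ} {τ : ℝ} (h : Ker κ τ) {f : E → ℝ} {x : E} {M : ℝ}
    (hM : ∀ y ∈ closedBall x τ, |f y| ≤ M) : |conv κ f x| ≤ M * ∫ t, |κ t| := by
  rw [conv, ← Real.norm_eq_abs, ← integral_const_mul]
  apply norm_integral_le_of_norm_le (h.integrable.abs.const_mul _)
  filter_upwards with t
  by_cases ht : t ∈ closedBall (0:E) τ
  · rw [norm_smul, Real.norm_eq_abs, Real.norm_eq_abs, mul_comm]
    gcongr
    apply hM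
    rw [mem_closedBall_zero_iff] at ht
    rw [mem_closedBall, dist_eq_norm]; simpa using ht
  · rw [h.zero ht]; simp

lemma ker_loc_int {κ : E → ℝ} {τ : ℝ} (h : Ker κ τ) {f : E → ℝ} (hf : LocallyIntegrable f) (x : E) :
    Integrable (fun t => κ t • f (x - t)) :=
  h.cs.convolutionExists_left (ContinuousLinearMap.lsmul ℝ ℝ) (μ := volume) h.smooth.continuous hf x

lemma conv_sub_const {κ : E → ℝ} {τ : ℝ} (h : Ker κ τ) {f : E → ℝ} (hf : LocallyIntegrable f) (c : ℝ) (x : E) :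
    conv κ (fun y => f y - c) x = conv κ f x - c * ∫ t, κ t := by
  simp only [conv, smul_sub]
  rw [integral_sub (ker_loc_int h hf x)]
  · congr 1
    simp only [smul_eq_mul]
    rw [integral_mul_const, mul_comm]
  · simpa using h.integrable.mul_const c

lemma Sc_kb_int {τ : ℝ} (hτ : 0 < τ) : ∫ t, Sc τ kb t = 1 := by
  rw [← kb_int, ← integral_Sc kb hτ]; rfl

lemma Sc_kb_abs {τ : ℝ} (hτ : 0 < τ) : ∫ t, |Sc τ kb t| = 1 := by
  rw [integral_Sc_abs kb hτ, ← kb_int]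
  congr 1; funext t; exact abs_of_nonneg (kb_nonneg t)

lemma conv_near {τ : ℝ} (hτ : 0 < τ) {f : E → ℝ} (hf : LocallyIntegrable f) {x : E} {c M : ℝ}
    (hM : ∀ y ∈ closedBall x τ, |f y - c| ≤ M) : |conv (Sc τ kb) f x - c| ≤ M := by
  have h := Sc_ker kb_ker hτ
  have := conv_bound h hM
  rwa [conv_sub_const h hf, Sc_kb_int hτ, Sc_kb_abs hτ, mul_one, mul_one] at this

lemma grad_norm_le_ee (f : E → ℝ) (x : E) {B : ℝ} (h : ∀ m, |fderiv ℝ f x (ee m)| ≤ B) :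
    ‖fderiv ℝ f x‖ ≤ 8 * B := by
  have hB : 0 ≤ B := (abs_nonneg _).trans (h 0)
  apply ContinuousLinearMap.opNorm_le_bound _ (by positivity)
  intro v
  conv_lhs => rw [← sum_ee v, map_sum]
  calc _ ≤ ∑ i : Fin 8, ‖fderiv ℝ f x (v i • ee i)‖ := norm_sum_le _ _
    _ ≤ ∑ i : Fin 8, B * ‖v‖ := by
        apply Finset.sum_le_sum
        intro i _
        rw [map_smul, norm_smul, mul_comm]
        gcongr
        · exact h i
        · exact PiLp.norm_apply_le v i
    _ = 8 * B * ‖v‖ := by simp; ring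

lemma conv_comm {κ κ' : E → ℝ} {τ τ' : ℝ} (h : Ker κ τ) (h' : Ker κ' τ') {f : E → ℝ} (hf : Measurable f)
    {C : ℝ} (hC : ∀ y, |f y| ≤ C) (x : E) : conv κ (conv κ' f) x = conv κ' (conv κ f) x := by
  simp only [conv, ← integral_smul]
  rw [integral_integral_swap]
  · congr 1; funext t; congr 1; funext s
    rw [smul_comm, sub_right_comm]
  · have h1 : Integrable (fun z : E × E => κ z.1 * κ' z.2) (volume.prod volume) :=
      h.integrable.mul_prod h'.integrable
    refine (h1.norm.mul_const C).mono' ?_ ?_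
    · apply Measurable.aestronglyMeasurable
      have := h.smooth.continuous.measurable
      have := h'.smooth.continuous.measurable
      unfold Function.uncurry
      fun_prop
    · filter_upwards with z
      simp only [Function.uncurry, smul_eq_mul, norm_mul]
      rw [← mul_assoc]
      gcongr
      exact hC _

lemma telescope {G : ℝ → E → ℝ} {τ₀ r C δ : ℝ} {z : E} (hδ : 0 < δ) (hδ1 : δ ≤ 1)
    (hτr : τ₀ ≤ r / 2) (hC : 0 ≤ C) (hsm : ∀ τ > 0, Differentiable ℝ (G τ))
    (hg : ∀ τ, 0 < τ → τ ≤ τ₀ → ∀ x ∈ ball z r, ‖fderiv ℝ (G τ) x‖ ≤ C * τ ^ (δ - 1))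
    (hcomm : ∀ σ > 0, ∀ τ > 0, ∀ x, conv (Sc σ kb) (G τ) x = conv (Sc τ kb) (G σ) x) :
    ∃ C', 0 ≤ C' ∧ ∀ τ, 0 < τ → τ ≤ τ₀ → ∀ x ∈ ball z (r / 2), ∀ n : ℕ,
      |G τ x - G (τ / 2 ^ n) x| ≤ C' * τ ^ δ := by
  have step : ∀ τ, 0 < τ → τ ≤ τ₀ → ∀ x ∈ ball z (r / 2), |G τ x - G (τ / 2) x| ≤ 3 * C * τ ^ δ := by
    intro τ hτ hττ x hx
    have hxr : closedBall x τ ⊆ ball z r := by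
      intro y hy
      rw [mem_closedBall] at hy; rw [mem_ball] at hx ⊢
      have := dist_triangle y x z; linarith
    have osc : ∀ σ, 0 < σ → σ ≤ τ₀ → ∀ ρ, 0 < ρ → ρ ≤ τ →
        |conv (Sc ρ kb) (G σ) x - G σ x| ≤ C * σ ^ (δ - 1) * ρ := by
      intro σ hσ hσ0 ρ hρ hρτ
      apply conv_near hρ (hsm σ hσ).continuous.locallyIntegrable
      intro y hy
      have h1 := (convex_ball z r).norm_image_sub_le_of_norm_fderiv_le (𝕜 := ℝ) (f := G σ)
        (fun w _ => hsm σ hσ w) (fun w hw => hg σ hσ hσ0 w hw) (hxr (mem_closedBall_self hτ.le))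
        (hxr (closedBall_subset_closedBall hρτ hy))
      rw [Real.norm_eq_abs] at h1
      refine h1.trans ?_
      gcongr
      rwa [← dist_eq_norm]
    have o1 := osc τ hτ hττ (τ / 2) (by positivity) (by linarith)
    have o2 := osc (τ / 2) (by positivity) (by linarith) τ hτ le_rfl
    rw [hcomm (τ / 2) (by positivity) τ hτ x] at o1
    have e1 : τ ^ (δ - 1) * τ = τ ^ δ := by
      rw [← Real.rpow_add_one hτ.ne']; congr 1; ring
    have e2 : (τ / 2) ^ (δ - 1) ≤ 2 * τ ^ (δ - 1) := by
      rw [Real.div_rpow hτ.le (by norm_num), div_le_iff₀ (by positivity)]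
      have : (1:ℝ) ≤ 2 * 2 ^ (δ - 1) := by
        have : (2:ℝ) * 2 ^ (δ - 1) = 2 ^ δ := by
          rw [mul_comm, ← Real.rpow_add_one (by norm_num)]; congr 1; ring
        rw [this]
        exact Real.one_le_rpow (by norm_num) hδ.le
      have hp : 0 < τ ^ (δ - 1) := by positivity
      nlinarith
    have e3 : C * (τ / 2) ^ (δ - 1) * τ ≤ 2 * (C * τ ^ δ) := by
      rw [← e1]
      calc _ ≤ C * (2 * τ ^ (δ - 1)) * τ := by gcongr
        _ = _ := by ring
    have e4 : C * τ ^ (δ - 1) * (τ / 2) = C * τ ^ δ / 2 := by rw [← e1]; ring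
    have e5 : 0 ≤ C * τ ^ δ := by positivity
    rw [abs_le] at *
    constructor <;> linarith
  set q : ℝ := 2 ^ (-δ) with hq
  have hq1 : q < 1 := Real.rpow_lt_one_of_one_lt_of_neg (by norm_num) (by linarith)
  have hq0 : 0 < q := by positivity
  set D := 3 * C / (1 - q) with hD
  have hDq : D * (1 - q) = 3 * C := by rw [hD]; field_simp [(by linarith : (1 - q) ≠ 0)]
  have hD0 : 0 ≤ D := div_nonneg (by positivity) (by linarith)
  refine ⟨D, hD0, ?_⟩
  intro τ hτ hττ x hx n
  have hind : ∀ n : ℕ, |G τ x - G (τ / 2 ^ n) x| ≤ D * τ ^ δ * (1 - q ^ n) := by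
    intro n
    induction n with
    | zero => simp
    | succ n ih =>
      have h1 := step (τ / 2 ^ n) (by positivity) ((div_le_self hτ.le (one_le_pow₀ (by norm_num))).trans hττ) x hx
      have e1 : (τ / 2 ^ n) ^ δ = τ ^ δ * q ^ n := by
        rw [Real.div_rpow hτ.le (by positivity), hq, ← Real.rpow_natCast, ← Real.rpow_natCast,
          ← Real.rpow_mul (by norm_num), ← Real.rpow_mul (by norm_num), div_eq_mul_inv,
          ← Real.rpow_neg (by norm_num)]
        congr 2; ring
      rw [e1, div_div, ← pow_succ] at h1
      calc _ ≤ |G τ x - G (τ / 2 ^ n) x| + |G (τ / 2 ^ n) x - G (τ / 2 ^ (n + 1)) x| := abs_sub_le _ _ _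
        _ ≤ D * τ ^ δ * (1 - q ^ n) + 3 * C * (τ ^ δ * q ^ n) := add_le_add ih h1
        _ = D * τ ^ δ * (1 - q ^ (n + 1)) := by rw [← hDq]; ring
  refine (hind n).trans ?_
  have h5 : 0 ≤ q ^ n := by positivity
  have h6 : 0 ≤ D * τ ^ δ := by positivity
  nlinarith

lemma step_est {K : ℝ≥0} {u : E → ℝ} (hu : LipschitzWith K u) {z : E} {r α C : ℝ}
    (hw : WS u (ball z r)) (hα : 0 < α) (hC : 0 ≤ C)
    (hh : ∀ x ∈ ball z r, ∀ y ∈ ball z r, ‖∇ u x - ∇ u y‖ ≤ C * ‖x - y‖ ^ α)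
    {κ : E → ℝ} {τ R : ℝ} (hκ : Ker κ τ) (hR : 0 < R) (hτR : τ ≤ R) (hRr : R ≤ r / 4) {x : E}
    (hx : x ∈ ball z (r / 4)) {M c : ℝ} (hM : ∀ y ∈ closedBall x R, |conv κ u y - c| ≤ M) (m : Fin 8) :
    |fderiv ℝ (conv κ u) x (ee m)| ≤ R * ((1 + K) ^ 3 * (4 * (C * (2 * R) ^ α) ^ 2 * I1 κ))
      + 56 * (1 + (K:ℝ) ^ 2) * M / R := by
  have hin : closedBall x (2 * R) ⊆ ball z r := by
    intro y hy
    rw [mem_closedBall] at hy; rw [mem_ball] at hx ⊢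
    have := dist_triangle y x z; linarith
  have hM0 : 0 ≤ M := (abs_nonneg _).trans (hM x (mem_closedBall_self hR.le))
  have hsm := conv_smooth hκ hu.continuous.locallyIntegrable
  have hsm2 : ContDiff ℝ 2 (conv κ u) := hsm.of_le (by norm_cast)
  have hT : ∀ y ∈ closedBall x R, |T (∇ u x) (D2 (fun y => conv κ u y - c) y)| ≤
      (1 + K) ^ 3 * (4 * (C * (2 * R) ^ α) ^ 2 * I1 κ) := by
    intro y hy
    have e : D2 (fun y => conv κ u y - c) y = D2 (conv κ u) y := by
      have : fderiv ℝ (fun y => conv κ u y - c) = fderiv ℝ (conv κ u) := by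
        funext w; rw [fderiv_sub_const]
      rw [D2, this, D2]
    have hsub : closedBall y τ ⊆ closedBall x (2 * R) := by
      apply closedBall_subset_closedBall'
      rw [mem_closedBall] at hy; linarith
    rw [e]
    refine (conv_T_bound hκ hu hw (hsub.trans hin) (d := C * (2 * R) ^ α) ?_).trans ?_
    · intro w hw'
      have hwx := hsub hw'
      refine (hh w (hin hwx) x (hin (mem_closedBall_self (by positivity)))).trans ?_
      gcongr
      rwa [← dist_eq_norm]
    · have := F_grad_le hu x
      have h0 := F_pos (∇ u x)
      have := I1_nonneg κ
      gcongr
  have := grad_est (f := fun y => conv κ u y - c) (hsm2.sub contDiff_const) (∇ u x) x hR hM hT m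
  rw [fderiv_sub_const] at this
  refine this.trans ?_
  gcongr
  exact norm_grad_le hu x

end BDG

open scoped RealInnerProductSpace
namespace BDG
open MeasureTheory Filter Topology Set Metric
open scoped NNReal ENNReal Gradient ContDiff

/-- Components of the gradient. -/
noncomputable def gi (u : E → ℝ) (i : Fin 8) : E → ℝ := fun y => ⟪∇ u y, ee i⟫

lemma gi_locint {K : ℝ≥0} {u : E → ℝ} (hu : LipschitzWith K u) (i : Fin 8) : LocallyIntegrable (gi u i) :=
  locint_grad hu _

lemma gi_meas (u : E → ℝ) (i : Fin 8) : Measurable (gi u i) :=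
  (measurable_grad u).inner_const

lemma gi_diff (u : E → ℝ) (i : Fin 8) (x y : E) : |gi u i x - gi u i y| ≤ ‖∇ u x - ∇ u y‖ := by
  rw [gi, gi, ← inner_sub_left]
  refine (abs_real_inner_le_norm _ _).trans ?_
  rw [norm_ee, mul_one]

lemma gi_bdd {K : ℝ≥0} {u : E → ℝ} (hu : LipschitzWith K u) (i : Fin 8) (y : E) : |gi u i y| ≤ K := by
  refine (abs_real_inner_le_norm _ _).trans ?_
  rw [norm_ee, mul_one]; exact norm_grad_le hu y

lemma norm_le_sum_abs (p : E) : ‖p‖ ≤ ∑ i, |p i| := by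
  conv_lhs => rw [← sum_ee p]
  refine (norm_sum_le _ _).trans ?_
  apply Finset.sum_le_sum; intro i _
  rw [norm_smul, norm_ee, mul_one, Real.norm_eq_abs]

lemma conv_kb_dd {K : ℝ≥0} {u : E → ℝ} (hu : LipschitzWith K u) {τ : ℝ} (hτ : 0 < τ) (i : Fin 8) :
    conv (dd (ee i) (Sc τ kb)) u = conv (Sc τ kb) (gi u i) := by
  funext y
  rw [← conv_dd (Sc_ker kb_ker hτ) hu.continuous.locallyIntegrable, conv_dd_grad (Sc_ker kb_ker hτ) hu]
  rfl

lemma hold_grad {K : ℝ≥0} {u : E → ℝ} (hu : LipschitzWith K u) {z : E} {r α C θ : ℝ}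
    (hw : WS u (ball z r)) (hα : 0 < α) (hα1 : α ≤ 1) (hC : 0 ≤ C)
    (hh : ∀ x ∈ ball z r, ∀ y ∈ ball z r, ‖∇ u x - ∇ u y‖ ≤ C * ‖x - y‖ ^ α)
    (hθ : θ = 2 / (2 + α)) (i : Fin 8) :
    ∃ B, 0 ≤ B ∧ ∀ τ, 0 < τ → τ ≤ 1 → τ ^ θ ≤ r / 4 → ∀ x ∈ ball z (r / 4),
      ‖fderiv ℝ (conv (Sc τ kb) (gi u i)) x‖ ≤ B * τ ^ (θ * (α - 1)) := by
  have hI := I1_nonneg (dd (ee i) kb)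
  refine ⟨8 * ((1 + K) ^ 3 * (4 * (C * 2 ^ α) ^ 2 * I1 (dd (ee i) kb)) + 56 * (1 + (K:ℝ) ^ 2) * (C * 2 ^ α)),
    by positivity, ?_⟩
  intro τ hτ hτ1 hτr x hx
  have hθ1 : θ ≤ 1 := by rw [hθ, div_le_one (by linarith)]; linarith
  have hR : 0 < τ ^ θ := by positivity
  have hτR : τ ≤ τ ^ θ := by
    conv_lhs => rw [← Real.rpow_one τ]
    exact Real.rpow_le_rpow_of_exponent_ge hτ hτ1 hθ1
  rw [mul_assoc]
  apply grad_norm_le_ee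
  intro m
  have hin : closedBall x (2 * τ ^ θ) ⊆ ball z r := by
    intro y hy
    rw [mem_closedBall] at hy; rw [mem_ball] at hx ⊢
    have := dist_triangle y x z; linarith
  have h1 := step_est hu hw hα hC hh (Sc_ker kb_ker hτ |>.dd (ee i)) hR hτR hτr hx
    (M := C * (2 * τ ^ θ) ^ α) (c := gi u i x) (by
      intro y hy
      rw [conv_kb_dd hu hτ]
      apply conv_near hτ (gi_locint hu i)
      intro w hw'
      have hwx : w ∈ closedBall x (2 * τ ^ θ) := by
        rw [mem_closedBall] at *
        have := dist_triangle w y x; linarith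
      refine (gi_diff u i w x).trans ((hh w (hin hwx) x (hin (mem_closedBall_self (by positivity)))).trans ?_)
      gcongr
      rwa [← dist_eq_norm]) m
  rw [conv_kb_dd hu hτ] at h1
  refine h1.trans (le_of_eq ?_)
  rw [I1_dd kb_ker hτ, Real.mul_rpow (by norm_num) hR.le]
  have e1 : τ ^ θ * ((τ ^ θ) ^ α) ^ 2 * τ⁻¹ ^ 2 = τ ^ (θ * (α - 1)) := by
    rw [← Real.rpow_mul hτ.le, ← Real.rpow_natCast, ← Real.rpow_mul hτ.le, ← Real.rpow_add hτ,
      ← Real.rpow_neg_one, ← Real.rpow_natCast, ← Real.rpow_mul hτ.le, ← Real.rpow_add hτ]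
    congr 1
    have : θ * (2 + α) = 2 := by rw [hθ]; field_simp
    push_cast; linear_combination this
  have e2 : (τ ^ θ) ^ α / τ ^ θ = τ ^ (θ * (α - 1)) := by
    rw [← Real.rpow_mul hτ.le, ← Real.rpow_sub hτ]; congr 1; ring
  calc _ = (1 + (K:ℝ)) ^ 3 * (4 * (C * 2 ^ α) ^ 2 * I1 (dd (ee i) kb)) * (τ ^ θ * ((τ ^ θ) ^ α) ^ 2 * τ⁻¹ ^ 2)
      + 56 * (1 + (K:ℝ) ^ 2) * (C * 2 ^ α) * ((τ ^ θ) ^ α / τ ^ θ) := by ring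
    _ = _ := by rw [e1, e2]; ring

lemma conv_tendsto {K : ℝ≥0} {u : E → ℝ} (hu : LipschitzWith K u) {z : E} {r α C : ℝ}
    (hα : 0 < α) (hC : 0 ≤ C)
    (hh : ∀ x ∈ ball z r, ∀ y ∈ ball z r, ‖∇ u x - ∇ u y‖ ≤ C * ‖x - y‖ ^ α) (i : Fin 8) {x : E}
    {τ : ℝ} (hτ : 0 < τ) (hx : closedBall x τ ⊆ ball z r) :
    Tendsto (fun n : ℕ => conv (Sc (τ / 2 ^ n) kb) (gi u i) x) atTop (𝓝 (gi u i x)) := by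
  rw [tendsto_iff_norm_sub_tendsto_zero]
  have h0 : Tendsto (fun n : ℕ => τ / 2 ^ n) atTop (𝓝 0) := by
    have := (tendsto_pow_atTop_nhds_zero_of_lt_one (r := (1/2:ℝ)) (by norm_num) (by norm_num)).const_mul τ
    rw [mul_zero] at this
    refine this.congr fun n => ?_
    rw [div_pow, one_pow]; ring
  have h1 : Tendsto (fun n : ℕ => C * (τ / 2 ^ n) ^ α) atTop (𝓝 0) := by
    have := (h0.rpow_const (p := α) (Or.inr hα.le)).const_mul C
    rwa [Real.zero_rpow hα.ne', mul_zero] at this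
  refine squeeze_zero (fun _ => norm_nonneg _) (fun n => ?_) h1
  have hn : 0 < τ / 2 ^ n := by positivity
  have hn' : τ / 2 ^ n ≤ τ := div_le_self hτ.le (one_le_pow₀ (by norm_num))
  apply conv_near hn (gi_locint hu i)
  intro w hw
  refine (gi_diff u i w x).trans ((hh w (hx (closedBall_subset_closedBall hn' hw)) x
    (hx (mem_closedBall_self hτ.le))).trans ?_)
  gcongr
  rwa [← dist_eq_norm]

lemma hold_comp {K : ℝ≥0} {u : E → ℝ} (hu : LipschitzWith K u) {z : E} {r α C θ : ℝ} (hr : 0 < r)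
    (hw : WS u (ball z r)) (hα : 0 < α) (hα1 : α ≤ 1) (hC : 0 ≤ C)
    (hh : ∀ x ∈ ball z r, ∀ y ∈ ball z r, ‖∇ u x - ∇ u y‖ ≤ C * ‖x - y‖ ^ α)
    (hθ : θ = 2 / (2 + α)) :
    ∃ r', 0 < r' ∧ r' ≤ r ∧ ∀ i, ∃ C', 0 ≤ C' ∧ ∀ x ∈ ball z r', ∀ y ∈ ball z r',
      |gi u i x - gi u i y| ≤ C' * ‖x - y‖ ^ (1 - θ * (1 - α)) := by
  have hθ0 : 0 < θ := by rw [hθ]; positivity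
  have hθ1 : θ ≤ 1 := by rw [hθ, div_le_one (by linarith)]; linarith
  set δ := 1 - θ * (1 - α) with hδ
  have hδ1 : δ ≤ 1 := by
    have : 0 ≤ θ * (1 - α) := mul_nonneg hθ0.le (by linarith)
    linarith
  have hδ0 : 0 < δ := by
    have : θ * (1 - α) ≤ 1 * (1 - α) := mul_le_mul_of_nonneg_right hθ1 (by linarith)
    linarith
  set τ₀ : ℝ := min (min 1 (r / 8)) ((r / 4) ^ (1 / θ)) with hτ₀
  have hτ₀0 : 0 < τ₀ := by positivity
  have t1 : τ₀ ≤ 1 := (min_le_left _ _).trans (min_le_left _ _)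
  have t2 : τ₀ ≤ r / 8 := (min_le_left _ _).trans (min_le_right _ _)
  have t3 : ∀ τ, 0 < τ → τ ≤ τ₀ → τ ^ θ ≤ r / 4 := by
    intro τ h1 h2
    calc _ ≤ ((r / 4) ^ (1 / θ)) ^ θ := Real.rpow_le_rpow h1.le (h2.trans (min_le_right _ _)) hθ0.le
      _ = r / 4 := by rw [← Real.rpow_mul (by positivity)]; rw [one_div, inv_mul_cancel₀ hθ0.ne', Real.rpow_one]
  refine ⟨min (r / 8) (τ₀ / 2), by positivity, (min_le_left _ _).trans (by linarith), fun i => ?_⟩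
  obtain ⟨B, hB0, hB⟩ := hold_grad hu hw hα hα1 hC hh hθ i
  have hsm : ∀ τ > 0, ContDiff ℝ ∞ (conv (Sc τ kb) (gi u i)) := fun τ h => conv_smooth (Sc_ker kb_ker h) (gi_locint hu i)
  obtain ⟨C', hC', ht⟩ := telescope (G := fun τ => conv (Sc τ kb) (gi u i)) (τ₀ := τ₀) (r := r / 4) (C := B) (δ := δ)
    (z := z) hδ0 hδ1 (by linarith) hB0 (fun τ h => (hsm τ h).differentiable (by simp))
    (fun τ h1 h2 x hx => by
      have := hB τ h1 (h2.trans t1) (t3 τ h1 h2) x hx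
      have e : δ - 1 = θ * (α - 1) := by rw [hδ]; ring
      rw [e]; exact this)
    (fun σ hσ τ hτ x => conv_comm (Sc_ker kb_ker hσ) (Sc_ker kb_ker hτ) (gi_meas u i) (gi_bdd hu i) x)
  refine ⟨2 * C' + B, by positivity, ?_⟩
  have hlim : ∀ τ, 0 < τ → τ ≤ τ₀ → ∀ x ∈ ball z (r / 4 / 2), |conv (Sc τ kb) (gi u i) x - gi u i x| ≤ C' * τ ^ δ := by
    intro τ h1 h2 x hx
    have hl := conv_tendsto hu hα hC hh i (x := x) h1 (by
      intro y hy
      rw [mem_closedBall] at hy; rw [mem_ball] at hx ⊢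
      have := dist_triangle y x z; linarith)
    exact le_of_tendsto ((tendsto_const_nhds.sub hl).abs) (Eventually.of_forall fun n => ht τ h1 h2 x hx n)
  intro x hx y hy
  rcases eq_or_ne x y with rfl | hne
  · simp; positivity
  have hd : 0 < ‖x - y‖ := norm_pos_iff.2 (sub_ne_zero.2 hne)
  have hdτ : ‖x - y‖ ≤ τ₀ := by
    rw [← dist_eq_norm]
    have h1 := mem_ball.1 (ball_subset_ball (min_le_right _ _) hx)
    have h2 := mem_ball.1 (ball_subset_ball (min_le_right _ _) hy)
    have := dist_triangle_right x y z
    linarith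
  have hx' : x ∈ ball z (r / 4 / 2) := ball_subset_ball ((min_le_left _ _).trans (by linarith)) hx
  have hy' : y ∈ ball z (r / 4 / 2) := ball_subset_ball ((min_le_left _ _).trans (by linarith)) hy
  have a1 := hlim _ hd hdτ x hx'
  have a2 := hlim _ hd hdτ y hy'
  have a3 := (convex_ball z (r / 4)).norm_image_sub_le_of_norm_fderiv_le (𝕜 := ℝ)
    (f := conv (Sc ‖x - y‖ kb) (gi u i)) (fun w _ => ((hsm _ hd).differentiable (by simp)) w)
    (fun w hw => hB _ hd (hdτ.trans t1) (t3 _ hd hdτ) w hw) (ball_subset_ball (by linarith) hy')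
    (ball_subset_ball (by linarith) hx')
  have e1 : ‖x - y‖ ^ (θ * (α - 1)) * ‖x - y‖ = ‖x - y‖ ^ δ := by
    rw [← Real.rpow_add_one hd.ne']; congr 1; rw [hδ]; ring
  rw [mul_assoc, e1, Real.norm_eq_abs] at a3
  rw [abs_le] at *
  constructor <;> linarith

lemma hold_step {K : ℝ≥0} {u : E → ℝ} (hu : LipschitzWith K u) {z : E} {r α C θ : ℝ} (hr : 0 < r)
    (hw : WS u (ball z r)) (hα : 0 < α) (hα1 : α ≤ 1) (hC : 0 ≤ C)
    (hh : ∀ x ∈ ball z r, ∀ y ∈ ball z r, ‖∇ u x - ∇ u y‖ ≤ C * ‖x - y‖ ^ α)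
    (hθ : θ = 2 / (2 + α)) :
    ∃ r', 0 < r' ∧ r' ≤ r ∧ ∃ C', 0 ≤ C' ∧ ∀ x ∈ ball z r', ∀ y ∈ ball z r',
      ‖∇ u x - ∇ u y‖ ≤ C' * ‖x - y‖ ^ (1 - θ * (1 - α)) := by
  obtain ⟨r', h1, h2, h3⟩ := hold_comp hu hr hw hα hα1 hC hh hθ
  choose C' hC' h4 using h3
  refine ⟨r', h1, h2, ∑ i, C' i, Finset.sum_nonneg fun i _ => hC' i, fun x hx y hy => ?_⟩
  refine (norm_le_sum_abs _).trans ?_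
  rw [Finset.sum_mul]
  apply Finset.sum_le_sum
  intro i _
  have := h4 i x hx y hy
  rwa [gi, gi, ← inner_sub_left, inner_ee] at this

lemma rpow_weaken {a b d : ℝ} (hd : 0 ≤ d) (hd2 : d ≤ 2) (ha : 0 < a) (hab : a ≤ b) (hb : b ≤ 1) :
    d ^ b ≤ 2 * d ^ a := by
  rcases hd.eq_or_lt with rfl | hd
  · rw [Real.zero_rpow (by linarith), Real.zero_rpow ha.ne']; norm_num
  have : d ^ b = d ^ (b - a) * d ^ a := by rw [← Real.rpow_add hd]; congr 1; ring
  rw [this]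
  gcongr
  rcases le_total d 1 with h | h
  · exact (Real.rpow_le_one hd.le h (by linarith)).trans (by norm_num)
  · calc d ^ (b - a) ≤ d ^ (1:ℝ) := Real.rpow_le_rpow_of_exponent_le h (by linarith)
      _ ≤ 2 := by simpa using hd2

/-- `C^{1,9/10}` near the centre. -/
lemma hold_high {K : ℝ≥0} {u : E → ℝ} (hu : LipschitzWith K u) {z : E} {r α C : ℝ} (hr : 0 < r)
    (hw : WS u (ball z r)) (hα : 0 < α) (hα1 : α ≤ 1) (hC : 0 ≤ C)
    (hh : ∀ x ∈ ball z r, ∀ y ∈ ball z r, ‖∇ u x - ∇ u y‖ ≤ C * ‖x - y‖ ^ α) :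
    ∃ r', 0 < r' ∧ r' ≤ r ∧ ∃ C', 0 ≤ C' ∧ ∀ x ∈ ball z r', ∀ y ∈ ball z r',
      ‖∇ u x - ∇ u y‖ ≤ C' * ‖x - y‖ ^ (9/10 : ℝ) := by
  set q : ℝ := 2 / (2 + α) with hq
  have hq0 : 0 < q := by positivity
  have hq1 : q < 1 := by rw [hq, div_lt_one (by positivity)]; linarith
  have key : ∀ n : ℕ, ∃ β, α ≤ β ∧ β ≤ 1 ∧ 1 - β ≤ q ^ n ∧ ∃ r', 0 < r' ∧ r' ≤ r ∧ ∃ C', 0 ≤ C' ∧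
      ∀ x ∈ ball z r', ∀ y ∈ ball z r', ‖∇ u x - ∇ u y‖ ≤ C' * ‖x - y‖ ^ β := by
    intro n
    induction n with
    | zero => exact ⟨α, le_rfl, hα1, by simp; linarith, r, hr, le_rfl, C, hC, hh⟩
    | succ n ih =>
      obtain ⟨β, b1, b2, b3, r', r1, r2, C', c1, h⟩ := ih
      obtain ⟨r'', s1, s2, C'', d1, h'⟩ := hold_step hu r1 (hw.mono (ball_subset_ball r2)) (hα.trans_le b1) b2 c1 h rfl
      have e1 : 2 / (2 + β) ≤ q := by rw [hq]; gcongr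
      have e0 : 0 ≤ 2 / (2 + β) := by have := hα.trans_le b1; positivity
      have e2 : 2 / (2 + β) * (1 - β) ≤ q * (1 - β) := mul_le_mul_of_nonneg_right e1 (by linarith)
      have e3 : q * (1 - β) ≤ q * q ^ n := mul_le_mul_of_nonneg_left b3 hq0.le
      have e4 : q * (1 - β) ≤ 1 * (1 - β) := mul_le_mul_of_nonneg_right hq1.le (by linarith)
      have e5 : 0 ≤ 2 / (2 + β) * (1 - β) := mul_nonneg e0 (by linarith)
      exact ⟨_, by linarith, by linarith, by rw [pow_succ']; linarith, r'', s1, s2.trans r2, C'', d1, h'⟩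
  obtain ⟨n, hn⟩ := exists_pow_lt_of_lt_one (show (0:ℝ) < 1/10 by norm_num) hq1
  obtain ⟨β, b1, b2, b3, r', r1, r2, C', c1, h⟩ := key n
  refine ⟨min r' 1, by positivity, (min_le_left _ _).trans r2, C' * 2, by positivity, fun x hx y hy => ?_⟩
  refine (h x (ball_subset_ball (min_le_left _ _) hx) y (ball_subset_ball (min_le_left _ _) hy)).trans ?_
  rw [mul_assoc]
  gcongr
  apply rpow_weaken (norm_nonneg _) _ (by norm_num) (by linarith) b2
  rw [← dist_eq_norm]
  have h1 := mem_ball.1 (ball_subset_ball (min_le_right _ _) hx)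
  have h2 := mem_ball.1 (ball_subset_ball (min_le_right _ _) hy)
  have := dist_triangle_right x y z
  linarith

end BDG

open scoped RealInnerProductSpace
namespace BDG
open MeasureTheory Filter Topology Set Metric
open scoped NNReal ENNReal Gradient ContDiff

/-- second-order approximations -/
noncomputable def G2 (u : E → ℝ) (i j : Fin 8) (τ : ℝ) : E → ℝ := conv (dd (ee j) (Sc τ kb)) (gi u i)

lemma G2_eq {K : ℝ≥0} {u : E → ℝ} (hu : LipschitzWith K u) (i j : Fin 8) {τ : ℝ} (hτ : 0 < τ) (x : E) :
    G2 u i j τ x = fderiv ℝ (conv (Sc τ kb) (gi u i)) x (ee j) := by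
  rw [conv_dd (Sc_ker kb_ker hτ) (gi_locint hu i)]; rfl

lemma G2_eq' {K : ℝ≥0} {u : E → ℝ} (hu : LipschitzWith K u) (i j : Fin 8) {τ : ℝ} (hτ : 0 < τ) :
    conv (dd (ee j) (dd (ee i) (Sc τ kb))) u = G2 u i j τ := by
  funext x
  rw [← conv_dd ((Sc_ker kb_ker hτ).dd _) hu.continuous.locallyIntegrable, conv_kb_dd hu hτ, G2_eq hu i j hτ]

lemma conv_bounded {κ : E → ℝ} {τ : ℝ} (h : Ker κ τ) {f : E → ℝ} {M : ℝ}
    (hM : ∀ y, |f y| ≤ M) (x : E) : |conv κ f x| ≤ M * ∫ t, |κ t| :=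
  conv_bound h fun y _ => hM y

lemma G2_comm {K : ℝ≥0} {u : E → ℝ} (hu : LipschitzWith K u) (i j : Fin 8) {σ τ : ℝ} (hσ : 0 < σ)
    (hτ : 0 < τ) (x : E) : conv (Sc σ kb) (G2 u i j τ) x = conv (Sc τ kb) (G2 u i j σ) x := by
  have hs := Sc_ker kb_ker hσ
  have ht := Sc_ker kb_ker hτ
  have l1 : ∀ {ρ : ℝ}, 0 < ρ → LocallyIntegrable (conv (Sc ρ kb) (gi u i)) := fun h =>
    (conv_smooth (Sc_ker kb_ker h) (gi_locint hu i)).continuous.locallyIntegrable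
  unfold G2
  rw [conv_comm hs (ht.dd _) (gi_meas u i) (gi_bdd hu i), conv_comm ht (hs.dd _) (gi_meas u i) (gi_bdd hu i),
    ← conv_dd ht (l1 hσ), ← conv_dd hs (l1 hτ)]
  congr 2
  funext y
  exact conv_comm ht hs (gi_meas u i) (gi_bdd hu i) y

lemma G2_grad {K : ℝ≥0} {u : E → ℝ} (hu : LipschitzWith K u) {z : E} {r C : ℝ}
    (hw : WS u (ball z r)) (hC : 0 ≤ C)
    (hh : ∀ x ∈ ball z r, ∀ y ∈ ball z r, ‖∇ u x - ∇ u y‖ ≤ C * ‖x - y‖ ^ (9/10:ℝ)) (i j : Fin 8) :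
    ∃ B, 0 ≤ B ∧ ∀ τ, 0 < τ → τ ≤ 1 → τ ^ (4/5:ℝ) ≤ r / 4 → ∀ x ∈ ball z (r / 4),
      ‖fderiv ℝ (G2 u i j τ) x‖ ≤ B * τ ^ ((1/10:ℝ) - 1) := by
  have hI := I1_nonneg (dd (ee j) (dd (ee i) kb))
  have hI' : 0 ≤ ∫ t, |dd (ee j) kb t| := integral_nonneg fun _ => abs_nonneg _
  refine ⟨8 * ((1 + K) ^ 3 * (4 * (C * 2 ^ (9/10:ℝ)) ^ 2 * I1 (dd (ee j) (dd (ee i) kb))) +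
    56 * (1 + (K:ℝ) ^ 2) * (C * ∫ t, |dd (ee j) kb t|)), by positivity, ?_⟩
  intro τ hτ hτ1 hτr x hx
  have hR : 0 < τ ^ (4/5:ℝ) := by positivity
  have hτR : τ ≤ τ ^ (4/5:ℝ) := by
    conv_lhs => rw [← Real.rpow_one τ]
    exact Real.rpow_le_rpow_of_exponent_ge hτ hτ1 (by norm_num)
  rw [mul_assoc]
  apply grad_norm_le_ee
  intro m
  have hin : closedBall x (2 * τ ^ (4/5:ℝ)) ⊆ ball z r := by
    intro y hy
    rw [mem_closedBall] at hy; rw [mem_ball] at hx ⊢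
    have := dist_triangle y x z; linarith
  have hk := Sc_ker kb_ker hτ
  have h1 := step_est hu hw (by norm_num) hC hh ((hk.dd (ee i)).dd (ee j)) hR hτR hτr hx
    (M := C * τ ^ (9/10:ℝ) * (τ⁻¹ * ∫ t, |dd (ee j) kb t|)) (c := 0) (by
      intro y hy
      rw [G2_eq' hu i j hτ, sub_zero, ← int_dd_abs kb_ker hτ]
      have e := conv_sub_const (hk.dd (ee j)) (gi_locint hu i) (gi u i y) y
      rw [integral_dd hk, mul_zero, sub_zero] at e
      rw [G2, ← e]
      apply conv_bound (hk.dd (ee j))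
      intro w hw'
      have hyx : y ∈ closedBall x (2 * τ ^ (4/5:ℝ)) := closedBall_subset_closedBall (by linarith) hy
      have hwx : w ∈ closedBall x (2 * τ ^ (4/5:ℝ)) := by
        rw [mem_closedBall] at *
        have := dist_triangle w y x; linarith
      refine (gi_diff u i w y).trans ((hh w (hin hwx) y (hin hyx)).trans ?_)
      gcongr
      rwa [← dist_eq_norm]) m
  rw [G2_eq' hu i j hτ] at h1
  refine h1.trans ?_
  rw [I1_dd2 kb_ker hτ, Real.mul_rpow (by norm_num) hR.le]
  have e1 : τ ^ (4/5:ℝ) * ((τ ^ (4/5:ℝ)) ^ (9/10:ℝ)) ^ 2 * τ⁻¹ ^ 3 ≤ τ ^ ((1/10:ℝ) - 1) := by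
    rw [← Real.rpow_mul hτ.le, ← Real.rpow_natCast, ← Real.rpow_mul hτ.le, ← Real.rpow_add hτ,
      ← Real.rpow_neg_one, ← Real.rpow_natCast, ← Real.rpow_mul hτ.le, ← Real.rpow_add hτ]
    apply Real.rpow_le_rpow_of_exponent_ge hτ hτ1
    norm_num
  have e2 : τ ^ (9/10:ℝ) * τ⁻¹ / τ ^ (4/5:ℝ) = τ ^ ((1/10:ℝ) - 1) := by
    rw [← Real.rpow_neg_one, ← Real.rpow_add hτ, ← Real.rpow_sub hτ]; congr 1; norm_num
  calc _ = (1 + (K:ℝ)) ^ 3 * (4 * (C * 2 ^ (9/10:ℝ)) ^ 2 * I1 (dd (ee j) (dd (ee i) kb))) * (τ ^ (4/5:ℝ) * ((τ ^ (4/5:ℝ)) ^ (9/10:ℝ)) ^ 2 * τ⁻¹ ^ 3)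
      + 56 * (1 + (K:ℝ) ^ 2) * (C * ∫ t, |dd (ee j) kb t|) * (τ ^ (9/10:ℝ) * τ⁻¹ / τ ^ (4/5:ℝ)) := by ring
    _ ≤ (1 + (K:ℝ)) ^ 3 * (4 * (C * 2 ^ (9/10:ℝ)) ^ 2 * I1 (dd (ee j) (dd (ee i) kb))) * τ ^ ((1/10:ℝ) - 1)
      + 56 * (1 + (K:ℝ) ^ 2) * (C * ∫ t, |dd (ee j) kb t|) * (τ ^ (9/10:ℝ) * τ⁻¹ / τ ^ (4/5:ℝ)) := by gcongr
    _ = _ := by rw [e2]; ring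

lemma clm_norm_le_ee (L : E →L[ℝ] ℝ) {B : ℝ} (h : ∀ m, |L (ee m)| ≤ B) : ‖L‖ ≤ 8 * B := by
  have := grad_norm_le_ee (fun x => L x) 0 (B := B) (by rw [ContinuousLinearMap.fderiv]; exact h)
  rwa [ContinuousLinearMap.fderiv] at this

/-- the gradient components are `C¹` -/
lemma gi_c1 {K : ℝ≥0} {u : E → ℝ} (hu : LipschitzWith K u) {z : E} {r C : ℝ} (hr : 0 < r)
    (hw : WS u (ball z r)) (hC : 0 ≤ C)
    (hh : ∀ x ∈ ball z r, ∀ y ∈ ball z r, ‖∇ u x - ∇ u y‖ ≤ C * ‖x - y‖ ^ (9/10:ℝ)) :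
    ∃ r', 0 < r' ∧ r' ≤ r ∧ ∃ τ₀, 0 < τ₀ ∧ τ₀ ≤ r / 8 ∧ ∀ i, ∃ L : E → E →L[ℝ] ℝ, ContinuousOn L (ball z r') ∧
      ∀ x ∈ ball z r', HasFDerivAt (gi u i) (L x) x ∧
      Tendsto (fun n : ℕ => fderiv ℝ (conv (Sc (τ₀ / 2 ^ n) kb) (gi u i)) x) atTop (𝓝 (L x)) := by
  set τ₀ : ℝ := min (min 1 (r / 8)) ((r / 4) ^ (5/4:ℝ)) with hτ₀
  have hτ₀0 : 0 < τ₀ := by positivity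
  have t1 : τ₀ ≤ 1 := (min_le_left _ _).trans (min_le_left _ _)
  have t2 : τ₀ ≤ r / 8 := (min_le_left _ _).trans (min_le_right _ _)
  have t3 : ∀ τ, 0 < τ → τ ≤ τ₀ → τ ^ (4/5:ℝ) ≤ r / 4 := by
    intro τ h1 h2
    calc _ ≤ ((r / 4) ^ (5/4:ℝ)) ^ (4/5:ℝ) := Real.rpow_le_rpow h1.le (h2.trans (min_le_right _ _)) (by norm_num)
      _ = r / 4 := by rw [← Real.rpow_mul (by positivity)]; norm_num
  refine ⟨r / 4 / 2, by positivity, by linarith, τ₀, hτ₀0, t2, fun i => ?_⟩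
  have hsm : ∀ τ > 0, ContDiff ℝ ∞ (conv (Sc τ kb) (gi u i)) := fun τ h => conv_smooth (Sc_ker kb_ker h) (gi_locint hu i)
  have hT : ∀ j, ∃ C', 0 ≤ C' ∧ ∀ τ, 0 < τ → τ ≤ τ₀ → ∀ x ∈ ball z (r / 4 / 2), ∀ n : ℕ,
      |G2 u i j τ x - G2 u i j (τ / 2 ^ n) x| ≤ C' * τ ^ (1/10:ℝ) := by
    intro j
    obtain ⟨B, hB0, hB⟩ := G2_grad hu hw hC hh i j
    exact telescope (G := G2 u i j) (by norm_num) (by norm_num) (by linarith) hB0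
      (fun τ h => (conv_smooth ((Sc_ker kb_ker h).dd _) (gi_locint hu i)).differentiable (by simp))
      (fun τ h1 h2 x hx => hB τ h1 (h2.trans t1) (t3 τ h1 h2) x hx)
      (fun σ hσ τ hτ x => G2_comm hu i j hσ hτ x)
  choose C' hC' hT using hT
  set D := ∑ j, C' j with hD
  have hCD : ∀ j, C' j ≤ D := fun j => Finset.single_le_sum (fun j _ => hC' j) (Finset.mem_univ j)
  have hD0 : 0 ≤ D := (hC' 0).trans (hCD 0)
  set τ : ℕ → ℝ := fun n => τ₀ / 2 ^ n with hτ
  have hτ0 : ∀ n, 0 < τ n := fun n => by positivity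
  have hτ1 : ∀ n, τ n ≤ τ₀ := fun n => div_le_self hτ₀0.le (one_le_pow₀ (by norm_num))
  have hτ2 : ∀ n m, τ (n + m) = τ n / 2 ^ m := fun n m => by simp only [hτ]; rw [pow_add, div_div]
  have hτl : Tendsto τ atTop (𝓝 0) := by
    have := (tendsto_pow_atTop_nhds_zero_of_lt_one (r := (1/2:ℝ)) (by norm_num) (by norm_num)).const_mul τ₀
    rw [mul_zero] at this
    refine this.congr fun n => ?_
    rw [div_pow, one_pow]; simp only [hτ]; ring
  set f : ℕ → E → E →L[ℝ] ℝ := fun n x => fderiv ℝ (conv (Sc (τ n) kb) (gi u i)) x with hf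
  have hb : Tendsto (fun n => 8 * (D * τ n ^ (1/10:ℝ))) atTop (𝓝 0) := by
    have := ((hτl.rpow_const (p := (1/10:ℝ)) (Or.inr (by norm_num))).const_mul D).const_mul 8
    rwa [Real.zero_rpow (by norm_num), mul_zero, mul_zero] at this
  have hfd : ∀ x ∈ ball z (r / 4 / 2), ∀ n m, ‖f n x - f (n + m) x‖ ≤ 8 * (D * τ n ^ (1/10:ℝ)) := by
    intro x hx n m
    apply clm_norm_le_ee
    intro j
    simp only [hf, ContinuousLinearMap.sub_apply]
    rw [← G2_eq hu i j (hτ0 _), ← G2_eq hu i j (hτ0 _), hτ2]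
    refine (hT j (τ n) (hτ0 n) (hτ1 n) x hx m).trans ?_
    have := hτ0 n
    gcongr
    exact hCD j
  have hlim : ∀ x ∈ ball z (r / 4 / 2), ∃ L, Tendsto (fun n => f n x) atTop (𝓝 L) := by
    intro x hx
    apply cauchySeq_tendsto_of_complete
    apply cauchySeq_of_le_tendsto_0' _ _ hb
    intro n m hnm
    obtain ⟨k, rfl⟩ := Nat.exists_eq_add_of_le hnm
    rw [dist_eq_norm]
    exact hfd x hx n k
  choose! L hL using hlim
  have hun : TendstoUniformlyOn f L atTop (ball z (r / 4 / 2)) := by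
    rw [Metric.tendstoUniformlyOn_iff]
    intro ε hε
    filter_upwards [hb.eventually (gt_mem_nhds hε)] with n hn x hx
    refine lt_of_le_of_lt ?_ hn
    rw [dist_comm, dist_eq_norm]
    have h1 : Tendsto (fun m => ‖f n x - f (n + m) x‖) atTop (𝓝 ‖f n x - L x‖) :=
      (tendsto_const_nhds.sub ((hL x hx).comp (tendsto_add_atTop_nat n |>.congr fun m => by ring))).norm
    exact le_of_tendsto h1 (Eventually.of_forall fun m => hfd x hx n m)
  refine ⟨L, ?_, fun x hx => ⟨?_, hL x hx⟩⟩
  · apply hun.continuousOn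
    apply Frequently.of_forall
    intro n
    exact ((hsm _ (hτ0 n)).continuous_fderiv (by simp)).continuousOn
  · refine hasFDerivAt_of_tendstoUniformlyOn isOpen_ball hun
      (f := fun n => conv (Sc (τ n) kb) (gi u i)) (fun n y _ => ?_) (fun y hy => ?_) hx
    · exact ((hsm _ (hτ0 n)).differentiable (by simp) y).hasFDerivAt
    · apply conv_tendsto hu (by norm_num) hC hh i hτ₀0
      intro w hw
      rw [mem_closedBall] at hw; rw [mem_ball] at hy ⊢
      have := dist_triangle w y z; linarith

lemma fderiv_eq_sum (u : E → ℝ) (y : E) : fderiv ℝ u y = ∑ i, gi u i y • innerSL ℝ (ee i) := by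
  ext v
  rw [← grad_apply]
  conv_lhs => rw [← sum_ee (∇ u y)]
  simp only [sum_inner, inner_smul_left, gi, inner_ee]
  simp

lemma T_tendsto {p : E} {H : ℕ → E →L[ℝ] E →L[ℝ] ℝ} {H' : E →L[ℝ] E →L[ℝ] ℝ}
    (h : ∀ v i, Tendsto (fun n => H n v (ee i)) atTop (𝓝 (H' v (ee i)))) :
    Tendsto (fun n => T p (H n)) atTop (𝓝 (T p H')) := by
  have e : ∀ Q : E →L[ℝ] E →L[ℝ] ℝ, Q p p = ∑ i, p i * Q p (ee i) := by
    intro Q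
    conv_lhs => rw [← sum_ee p]
    rw [map_sum]
    simp only [map_smul, smul_eq_mul]
    conv_rhs => rw [← sum_ee p]
    simp [sum_ee]
  unfold T
  simp only [e]
  exact ((tendsto_finset_sum _ fun i _ => h _ i).const_mul _).sub
    (tendsto_finset_sum _ fun i _ => (h _ i).const_mul _)

/-- Interior regularity. -/
theorem regularity {K : ℝ≥0} {u : E → ℝ} (hu : LipschitzWith K u) {U : Set E} (hU : IsOpen U)
    (hw : WS u U) {z : E} (hz : z ∈ U) : ContDiffAt ℝ 2 u z ∧ T (∇ u z) (D2 u z) = 0 := by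
  obtain ⟨α, hα, hα1, hc⟩ := c1alpha K
  obtain ⟨R, hR, hRU⟩ := Metric.isOpen_iff.1 hU z hz
  obtain ⟨hd, C, hC, hh⟩ := hc u z R hR hu (hw.mono hRU)
  obtain ⟨r, hr, hrR, C', hC', hh'⟩ := hold_high hu (r := R / 8) (by positivity)
    (hw.mono ((ball_subset_ball (by linarith)).trans hRU)) hα hα1.le hC hh
  have hwr : WS u (ball z r) := hw.mono ((ball_subset_ball (by linarith)).trans hRU)
  obtain ⟨s, hs, hsr, τ₀, ht0, htr, hL⟩ := gi_c1 hu hr hwr hC' hh'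
  choose L hLc hLd using hL
  have hdu : DifferentiableOn ℝ u (ball z s) := fun x hx =>
    (hd x (ball_subset_ball (by linarith) hx)).differentiableWithinAt
  have hg1 : ∀ i, ContDiffOn ℝ 1 (gi u i) (ball z s) := by
    intro i
    rw [show (1 : WithTop ℕ∞) = 0 + 1 by norm_num, contDiffOn_succ_iff_fderiv_of_isOpen isOpen_ball]
    refine ⟨fun x hx => (hLd i x hx).1.differentiableAt.differentiableWithinAt, by simp, ?_⟩
    rw [contDiffOn_zero]
    exact (hLc i).congr fun x hx => (hLd i x hx).1.fderiv
  have hcd : ContDiffOn ℝ 2 u (ball z s) := by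
    rw [show (2 : WithTop ℕ∞) = 1 + 1 by norm_num, contDiffOn_succ_iff_fderiv_of_isOpen isOpen_ball]
    refine ⟨hdu, by simp, ?_⟩
    have : fderiv ℝ u = fun y => ∑ i, gi u i y • innerSL ℝ (ee i) := funext (fderiv_eq_sum u)
    rw [this]
    exact ContDiffOn.sum fun i _ => (hg1 i).smul contDiffOn_const
  have hzs : z ∈ ball z s := mem_ball_self hs
  have hcz : ContDiffAt ℝ 2 u z := hcd.contDiffAt (isOpen_ball.mem_nhds hzs)
  refine ⟨hcz, ?_⟩
  set τ : ℕ → ℝ := fun n => τ₀ / 2 ^ n with hτ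
  have hτ0 : ∀ n, 0 < τ n := fun n => by positivity
  have hτ1 : ∀ n, τ n ≤ τ₀ := fun n => div_le_self ht0.le (one_le_pow₀ (by norm_num))
  have hτl : Tendsto τ atTop (𝓝 0) := by
    have := (tendsto_pow_atTop_nhds_zero_of_lt_one (r := (1/2:ℝ)) (by norm_num) (by norm_num)).const_mul τ₀
    rw [mul_zero] at this
    refine this.congr fun n => ?_
    rw [div_pow, one_pow]; simp only [hτ]; ring
  have hlim : Tendsto (fun n => T (∇ u z) (D2 (conv (Sc (τ n) kb) u) z)) atTop (𝓝 (T (∇ u z) (D2 u z))) := by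
    apply T_tendsto
    intro v i
    have e1 : D2 u z v (ee i) = L i z v := by
      rw [D2_apply hcz]
      have : (fun y => fderiv ℝ u y (ee i)) = gi u i := by funext y; rw [← grad_apply]; rfl
      rw [this, (hLd i z hzs).1.fderiv]
    rw [e1]
    have e2 : ∀ n, D2 (conv (Sc (τ n) kb) u) z v (ee i) = fderiv ℝ (conv (Sc (τ n) kb) (gi u i)) z v := by
      intro n
      have hk := Sc_ker kb_ker (hτ0 n)
      rw [D2_apply ((conv_smooth hk hu.continuous.locallyIntegrable).of_le (by norm_cast)).contDiffAt]
      congr 2; funext y; exact conv_dd_grad hk hu y (ee i)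
    simp only [e2]
    exact ((ContinuousLinearMap.apply ℝ ℝ v).continuous.tendsto _).comp (hLd i z hzs).2
  have hb : Tendsto (fun n => F (∇ u z) ^ 3 * (4 * C' ^ 2 * I1 kb * τ n ^ (4/5:ℝ))) atTop (𝓝 0) := by
    have := ((hτl.rpow_const (p := (4/5:ℝ)) (Or.inr (by norm_num))).const_mul (4 * C' ^ 2 * I1 kb)).const_mul (F (∇ u z) ^ 3)
    rwa [Real.zero_rpow (by norm_num), mul_zero, mul_zero] at this
  have h0 : Tendsto (fun n => T (∇ u z) (D2 (conv (Sc (τ n) kb) u) z)) atTop (𝓝 0) := by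
    apply squeeze_zero_norm _ hb
    intro n
    have h1 : closedBall z (τ n) ⊆ ball z r := closedBall_subset_ball (by have := hτ1 n; linarith)
    have := conv_T_bound (Sc_ker kb_ker (hτ0 n)) hu hwr h1 (p := ∇ u z) (d := C' * τ n ^ (9/10:ℝ)) (by
      intro y hy
      refine (hh' y (h1 hy) z (mem_ball_self hr)).trans ?_
      gcongr
      rwa [← dist_eq_norm])
    rw [Real.norm_eq_abs]
    refine this.trans (le_of_eq ?_)
    rw [I1_Sc kb_ker (hτ0 n)]
    have e1 : (τ n ^ (9/10:ℝ)) ^ 2 * (τ n)⁻¹ = τ n ^ (4/5:ℝ) := by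
      rw [← Real.rpow_natCast, ← Real.rpow_mul (hτ0 n).le, ← Real.rpow_neg_one, ← Real.rpow_add (hτ0 n)]
      norm_num
    rw [← e1]; ring
  exact tendsto_nhds_unique hlim h0

end BDG

open scoped RealInnerProductSpace
namespace BDG
open MeasureTheory Filter Topology Set Metric
open scoped NNReal ENNReal Gradient ContDiff

lemma cd_fderiv {f : E → ℝ} {x : E} (hf : ContDiffAt ℝ 2 f x) : DifferentiableAt ℝ (fderiv ℝ f) x :=
  (hf.fderiv_right (m := 1) (by norm_num)).differentiableAt (by simp)

lemma cd_diff {f : E → ℝ} {x : E} (hf : ContDiffAt ℝ 2 f x) : DifferentiableAt ℝ f x :=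
  hf.differentiableAt (by simp)

lemma cd_ev {f : E → ℝ} {x : E} (hf : ContDiffAt ℝ 2 f x) : ∀ᶠ y in 𝓝 x, ContDiffAt ℝ 2 f y :=
  hf.eventually (by simp)

lemma D2_cont {f : E → ℝ} {x : E} (hf : ContDiffAt ℝ 2 f x) : ContinuousAt (D2 f) x :=
  ((hf.fderiv_right (m := 1) (by norm_num)).fderiv_right (m := 0) (by norm_num)).continuousAt

lemma grad_cont {f : E → ℝ} {x : E} (hf : ContDiffAt ℝ 2 f x) : ContinuousAt (∇ f) x :=
  (InnerProductSpace.toDual ℝ E).symm.continuous.continuousAt.comp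
    (hf.fderiv_right (m := 1) (by norm_num)).continuousAt

lemma D2_congr {f g : E → ℝ} {x : E} (h : f =ᶠ[𝓝 x] g) : D2 f x = D2 g x := by
  unfold D2
  exact (h.fderiv).fderiv_eq

lemma D2_add {f g : E → ℝ} {x : E} (hf : ContDiffAt ℝ 2 f x) (hg : ContDiffAt ℝ 2 g x) :
    D2 (fun y => f y + g y) x = D2 f x + D2 g x := by
  have : fderiv ℝ (fun y => f y + g y) =ᶠ[𝓝 x] fun y => fderiv ℝ f y + fderiv ℝ g y := by
    filter_upwards [cd_ev hf, cd_ev hg] with y h1 h2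
    exact fderiv_fun_add (cd_diff h1) (cd_diff h2)
  rw [D2, this.fderiv_eq]
  exact fderiv_fun_add (cd_fderiv hf) (cd_fderiv hg)

lemma D2_mul {f g : E → ℝ} {x : E} (hf : ContDiffAt ℝ 2 f x) (hg : ContDiffAt ℝ 2 g x) (v w : E) :
    D2 (fun y => f y * g y) x v w = f x * D2 g x v w + g x * D2 f x v w
      + fderiv ℝ f x v * fderiv ℝ g x w + fderiv ℝ g x v * fderiv ℝ f x w := by
  have : fderiv ℝ (fun y => f y * g y) =ᶠ[𝓝 x] fun y => f y • fderiv ℝ g y + g y • fderiv ℝ f y := by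
    filter_upwards [cd_ev hf, cd_ev hg] with y h1 h2
    exact fderiv_fun_mul (cd_diff h1) (cd_diff h2)
  have h1 := (cd_diff hf).hasFDerivAt.fun_smul (cd_fderiv hg).hasFDerivAt
  have h2 := (cd_diff hg).hasFDerivAt.fun_smul (cd_fderiv hf).hasFDerivAt
  rw [D2, this.fderiv_eq, (h1.fun_add h2).fderiv]
  simp [D2]
  ring

lemma D2_comp {φ : E → ℝ} {ψ : ℝ → ℝ} {x : E} (hφ : ContDiffAt ℝ 2 φ x) {ψ₁ : ℝ → ℝ} {c : ℝ}
    (hψ : ∀ᶠ t in 𝓝 (φ x), HasDerivAt ψ (ψ₁ t) t) (hψ2 : HasDerivAt ψ₁ c (φ x)) (v w : E) :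
    D2 (fun y => ψ (φ y)) x v w = ψ₁ (φ x) * D2 φ x v w + c * (fderiv ℝ φ x v * fderiv ℝ φ x w) := by
  have : fderiv ℝ (fun y => ψ (φ y)) =ᶠ[𝓝 x] fun y => ψ₁ (φ y) • fderiv ℝ φ y := by
    filter_upwards [cd_ev hφ, (cd_diff hφ).continuousAt.eventually hψ] with y h1 h2
    exact (h2.comp_hasFDerivAt y (cd_diff h1).hasFDerivAt).fderiv
  have h1 := (hψ2.comp_hasFDerivAt x (cd_diff hφ).hasFDerivAt).fun_smul (cd_fderiv hφ).hasFDerivAt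
  rw [D2, this.fderiv_eq]
  simp only [Function.comp_def] at h1
  rw [h1.fderiv]
  simp [D2]
  ring

lemma D2_symm {f : E → ℝ} {x : E} (hf : ContDiffAt ℝ 2 f x) (v w : E) : D2 f x v w = D2 f x w v :=
  (hf.isSymmSndFDerivAt (by simp)) v w

lemma cd_nsq (z x : E) : ContDiffAt ℝ 2 (fun y : E => ‖y - z‖ ^ 2) x :=
  ((contDiff_id.sub contDiff_const).norm_sq ℝ).contDiffAt

lemma fderiv_nsq (z x v : E) : fderiv ℝ (fun y : E => ‖y - z‖ ^ 2) x v = 2 * ⟪x - z, v⟫ := by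
  have h : HasFDerivAt (fun y : E => y - z) (ContinuousLinearMap.id ℝ E) x := (hasFDerivAt_id x).sub_const z
  rw [(h.norm_sq).fderiv]
  simp [inner_sub_left]

lemma D2_nsq (z x v w : E) : D2 (fun y : E => ‖y - z‖ ^ 2) x v w = 2 * ⟪v, w⟫ := by
  rw [D2_apply (cd_nsq z x)]
  simp only [fderiv_nsq]
  have h : HasFDerivAt (fun y : E => y - z) (ContinuousLinearMap.id ℝ E) x := (hasFDerivAt_id x).sub_const z
  have h2 := ((h.inner ℝ (hasFDerivAt_const w x)).const_mul (2:ℝ)).fderiv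
  rw [h2]
  simp [real_inner_comm]

lemma T_sub (p : E) (H H' : E →L[ℝ] E →L[ℝ] ℝ) : T p (H - H') = T p H - T p H' := by
  simp [T, Finset.sum_sub_distrib]; ring

lemma T_add (p : E) (H H' : E →L[ℝ] E →L[ℝ] ℝ) : T p (H + H') = T p H + T p H' := by
  simp [T, Finset.sum_add_distrib]; ring

lemma T_smul (p : E) (c : ℝ) (H : E →L[ℝ] E →L[ℝ] ℝ) : T p (c • H) = c * T p H := by
  simp [T, ← Finset.mul_sum]; ring

lemma T_nonpos (p : E) {H : E →L[ℝ] E →L[ℝ] ℝ} (h : ∀ w, H w w ≤ 0) : T p H ≤ 0 := by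
  rw [T_decomp]
  have h1 : ∑ i, H (ee i) (ee i) ≤ 0 := Finset.sum_nonpos fun i _ => h _
  have h2 : ∑ i, ∑ j, H (qq p i j) (qq p i j) ≤ 0 := Finset.sum_nonpos fun i _ => Finset.sum_nonpos fun j _ => h _
  linarith

lemma T_mono (p : E) {H H' : E →L[ℝ] E →L[ℝ] ℝ} (h : ∀ w, H w w ≤ H' w w) : T p H ≤ T p H' := by
  have := T_nonpos p (H := H - H') (fun w => by simp; exact h w)
  rw [T_sub] at this; linarith

/-- trace -/
noncomputable def tr (H : E →L[ℝ] E →L[ℝ] ℝ) : ℝ := ∑ i, H (ee i) (ee i)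

lemma tr_cont : Continuous tr := by unfold tr; fun_prop

lemma T_cont : Continuous (fun z : E × (E →L[ℝ] E →L[ℝ] ℝ) => T z.1 z.2) := by
  unfold T; fun_prop

lemma ev_tendsto {H : ℕ → E →L[ℝ] E →L[ℝ] ℝ} {H' : E →L[ℝ] E →L[ℝ] ℝ} {p q : ℕ → E} {p' q' : E}
    (hH : Tendsto H atTop (𝓝 H')) (hp : Tendsto p atTop (𝓝 p')) (hq : Tendsto q atTop (𝓝 q')) :
    Tendsto (fun n => H n (p n) (q n)) atTop (𝓝 (H' p' q')) := by
  have hc : Continuous (fun z : (E →L[ℝ] E →L[ℝ] ℝ) × E × E => z.1 z.2.1 z.2.2) := by fun_prop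
  exact (hc.tendsto (H', p', q')).comp (hH.prodMk_nhds (hp.prodMk_nhds hq))

lemma T_shift (p q : E) (h : ℝ) (H : E →L[ℝ] E →L[ℝ] ℝ) :
    T (p + h • q) H - T p H = h * ((2 * ⟪p, q⟫ + h * ‖q‖ ^ 2) * tr H - H p q - H q p - h * H q q) := by
  have : ‖p + h • q‖ ^ 2 = ‖p‖ ^ 2 + h * (2 * ⟪p, q⟫ + h * ‖q‖ ^ 2) := by
    rw [norm_add_sq_real, inner_smul_right, norm_smul, mul_pow, Real.norm_eq_abs, sq_abs]; ring
  simp only [T, this, tr]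
  simp
  ring

lemma max_grad {f : E → ℝ} {x : E} (h : IsLocalMax f x) : ∇ f x = 0 := by
  apply grad_eq_of_fderiv; intro v
  rw [h.fderiv_eq_zero]; simp

lemma max_D2 {f : E → ℝ} {x : E} (hf : ContDiffAt ℝ 2 f x) (h : IsLocalMax f x) (w : E) : D2 f x w w ≤ 0 := by
  apply (two_line hf w).le_of_max
  have hc : ContinuousAt (fun t : ℝ => x + t • w) 0 := by fun_prop
  have : Tendsto (fun t : ℝ => x + t • w) (𝓝 0) (𝓝 x) := by simpa [ContinuousAt] using hc
  filter_upwards [this.eventually h] with t ht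
  simpa using ht

lemma visc_seq {u θ : E → ℝ} {x₀ e : E} (hu : ContDiffAt ℝ 2 u x₀) (hθ : ContDiffAt ℝ 2 θ x₀)
    (hmax : ∀ᶠ x in 𝓝 x₀, fderiv ℝ u x e - θ x ≤ fderiv ℝ u x₀ e - θ x₀ - (‖x - x₀‖ ^ 2) ^ 2) :
    ∃ (y : ℕ → E) (h : ℕ → ℝ), Tendsto y atTop (𝓝 x₀) ∧ Tendsto h atTop (𝓝 0) ∧ (∀ n, 0 < h n) ∧
      ∀ᶠ n in atTop, IsLocalMax (fun x => (h n)⁻¹ * (u (x + h n • e) - u x) - θ x) (y n) := by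
  obtain ⟨r, hr, hball⟩ := Metric.eventually_nhds_iff_ball.1 ((hmax.and (cd_ev hu)).and (cd_ev hθ))
  set s := r / 2 with hs
  have hs0 : 0 < s := by positivity
  have hsub : closedBall x₀ s ⊆ ball x₀ r := closedBall_subset_ball (by linarith)
  obtain ⟨N, hN⟩ := exists_nat_gt ((‖e‖ + 1) / s)
  set h : ℕ → ℝ := fun n => ((n:ℝ) + N + 1)⁻¹ with hh
  have h0 : ∀ n, 0 < h n := fun n => by positivity
  have hl : Tendsto h atTop (𝓝 0) := by
    apply tendsto_inv_atTop_zero.comp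
    have : Tendsto (fun n : ℕ => (n:ℝ) + (N + 1)) atTop atTop :=
      tendsto_atTop_add_const_right _ _ tendsto_natCast_atTop_atTop
    simpa [add_assoc] using this
  have hsm : ∀ n, h n * ‖e‖ < s := by
    intro n
    rw [hh]
    rw [div_lt_iff₀ hs0] at hN
    change ((n:ℝ) + N + 1)⁻¹ * ‖e‖ < s
    rw [inv_mul_lt_iff₀ (by positivity)]
    have : 0 ≤ (n:ℝ) := by positivity
    nlinarith
  have hmem : ∀ n, ∀ x ∈ closedBall x₀ s, x + h n • e ∈ ball x₀ r := by
    intro n x hx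
    rw [mem_ball, dist_eq_norm]
    rw [mem_closedBall, dist_eq_norm] at hx
    have e1 : x + h n • e - x₀ = (x - x₀) + h n • e := by abel
    rw [e1]
    have := norm_add_le (x - x₀) (h n • e)
    rw [norm_smul, Real.norm_of_nonneg (h0 n).le] at this
    have := hsm n
    linarith
  have hcu : ContinuousOn u (ball x₀ r) := fun x hx => (hball x hx).1.2.continuousAt.continuousWithinAt
  have hcθ : ContinuousOn θ (ball x₀ r) := fun x hx => (hball x hx).2.continuousAt.continuousWithinAt
  have hex : ∀ n, ∃ y ∈ closedBall x₀ s, IsMaxOn (fun x => (h n)⁻¹ * (u (x + h n • e) - u x) - θ x) (closedBall x₀ s) y := by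
    intro n
    apply (isCompact_closedBall x₀ s).exists_isMaxOn ⟨x₀, mem_closedBall_self hs0.le⟩
    apply ContinuousOn.sub _ (hcθ.mono hsub)
    apply continuousOn_const.mul
    apply ContinuousOn.sub _ (hcu.mono hsub)
    exact hcu.comp (by fun_prop) (fun x hx => hmem n x hx)
  choose y hy hymax using hex
  obtain ⟨a, ha, φ, hφ, hlim⟩ := (isCompact_closedBall x₀ s).tendsto_subseq hy
  have hlφ : Tendsto (fun n => h (φ n)) atTop (𝓝 0) := hl.comp hφ.tendsto_atTop
  have hw : ∀ {b : ℕ → E} {c : E}, c ∈ ball x₀ r → Tendsto b atTop (𝓝 c) →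
      Tendsto (fun n => (h (φ n))⁻¹ * (u (b n + h (φ n) • e) - u (b n))) atTop (𝓝 (fderiv ℝ u c e)) := by
    intro b c hc hb
    have hst := (hball c hc).1.2.hasStrictFDerivAt (by simp)
    have hpair : Tendsto (fun n => (b n + h (φ n) • e, b n)) atTop (𝓝 (c, c)) := by
      apply Tendsto.prodMk_nhds _ hb
      have := hb.add (hlφ.smul_const e)
      simpa using this
    have ho := hst.isLittleO.comp_tendsto hpair
    rw [tendsto_iff_norm_sub_tendsto_zero]
    have ho2 : (fun n => u (b n + h (φ n) • e) - u (b n) - fderiv ℝ u c (h (φ n) • e)) =o[atTop] fun n => h (φ n) := by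
      have : (fun n => u (b n + h (φ n) • e) - u (b n) - fderiv ℝ u c (h (φ n) • e)) =o[atTop] fun n => h (φ n) • e := by
        simpa [Function.comp_def] using ho
      refine this.trans_isBigO ?_
      apply Asymptotics.IsBigO.of_bound ‖e‖
      filter_upwards with n
      rw [norm_smul, mul_comm]
    have := ho2.tendsto_div_nhds_zero.norm
    rw [norm_zero] at this
    refine this.congr fun n => ?_
    congr 1
    rw [map_smul, smul_eq_mul]
    field_simp [(h0 (φ n)).ne']
  have hx0r : x₀ ∈ ball x₀ r := mem_ball_self hr
  have e1 := hw (hsub ha) hlim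
  have e2 := hw hx0r tendsto_const_nhds
  have e3 : Tendsto (fun n => θ (y (φ n))) atTop (𝓝 (θ a)) := (hball a (hsub ha)).2.continuousAt.tendsto.comp hlim
  have e4 := le_of_tendsto_of_tendsto' (e2.sub (tendsto_const_nhds (x := θ x₀))) (e1.sub e3) (fun n =>
    hymax (φ n) (mem_closedBall_self hs0.le))
  have e5 := (hball a (hsub ha)).1.1
  have ha0 : a = x₀ := by
    have : (‖a - x₀‖ ^ 2) ^ 2 = 0 := le_antisymm (by linarith) (by positivity)
    rw [← sub_eq_zero]; simpa using this
  subst ha0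
  refine ⟨fun n => y (φ n), fun n => h (φ n), hlim, hlφ, fun n => h0 _, ?_⟩
  filter_upwards [hlim.eventually (ball_mem_nhds a hs0)] with n hn
  exact (hymax (φ n)).isLocalMax (closedBall_mem_nhds_of_mem hn)

lemma visc {u θ : E → ℝ} {x₀ e : E} {U : Set E} (hU : IsOpen U) (hx₀ : x₀ ∈ U)
    (hu : ∀ x ∈ U, ContDiffAt ℝ 2 u x) (hT : ∀ x ∈ U, T (∇ u x) (D2 u x) = 0) (hθ : ContDiffAt ℝ 2 θ x₀)
    (hmax : IsLocalMax (fun x => fderiv ℝ u x e - θ x) x₀) :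
    0 ≤ T (∇ u x₀) (D2 θ x₀) + 2 * ⟪∇ u x₀, ∇ θ x₀⟫ * tr (D2 u x₀) - 2 * D2 u x₀ (∇ u x₀) (∇ θ x₀) := by
  set Q : E → ℝ := fun x => (‖x - x₀‖ ^ 2) ^ 2 with hQ
  have hQc : ∀ x, ContDiffAt ℝ 2 Q x := fun x => (cd_nsq x₀ x).pow 2
  have hsq : ∀ t : ℝ, HasDerivAt (fun t : ℝ => t ^ 2) (2 * t) t := fun t => by simpa using hasDerivAt_pow 2 t
  have hQ2 : D2 Q x₀ = 0 := by
    ext v w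
    rw [hQ, D2_comp (ψ := fun t => t ^ 2) (ψ₁ := fun t => 2 * t) (c := 2) (cd_nsq x₀ x₀) (Eventually.of_forall hsq)
      (by simpa only [mul_one, id] using (hasDerivAt_id (‖x₀ - x₀‖ ^ 2)).const_mul (2:ℝ))]
    simp [fderiv_nsq]
  have hQ1 : ∇ Q x₀ = 0 := by
    apply grad_eq_of_fderiv; intro v
    have := (hsq (‖x₀ - x₀‖ ^ 2)).comp_hasFDerivAt x₀ (cd_diff (cd_nsq x₀ x₀)).hasFDerivAt
    have := this.fderiv
    simp only [Function.comp_def] at this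
    rw [hQ, this]; simp
  set θ' : E → ℝ := fun x => θ x + Q x with hθ'
  have hθ'c : ContDiffAt ℝ 2 θ' x₀ := hθ.add (hQc x₀)
  have hD2 : D2 θ' x₀ = D2 θ x₀ := by 
    ext v w
    have h0 : D2 Q x₀ v w = 0 := by rw [hQ2]; rfl
    rw [hθ', D2_add hθ (hQc x₀)]
    change D2 θ x₀ v w + D2 Q x₀ v w = _
    rw [h0, add_zero]
  have hD1 : ∇ θ' x₀ = ∇ θ x₀ := by rw [hθ', grad_add (cd_diff hθ) (cd_diff (hQc x₀)), hQ1, add_zero]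
  obtain ⟨y, h, hy, hh, h0, hmx⟩ := visc_seq (u := u) (θ := θ') (e := e) (hu x₀ hx₀) hθ'c (by
    filter_upwards [hmax] with x hx
    have : Q x₀ = 0 := by simp [hQ]
    simp only [hθ', this]
    simp only [hQ] at *
    linarith)
  have hyh : Tendsto (fun n => y n + h n • e) atTop (𝓝 x₀) := by
    have := hy.add (hh.smul_const e); simpa using this
  have hU' := hU.mem_nhds hx₀
  -- the inequality along the sequence
  have key : ∀ᶠ n in atTop, 0 ≤ T (∇ u (y n) + h n • ∇ θ' (y n)) (D2 θ' (y n)) +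
      ((2 * ⟪∇ u (y n), ∇ θ' (y n)⟫ + h n * ‖∇ θ' (y n)‖ ^ 2) * tr (D2 u (y n)) - D2 u (y n) (∇ u (y n)) (∇ θ' (y n))
        - D2 u (y n) (∇ θ' (y n)) (∇ u (y n)) - h n * D2 u (y n) (∇ θ' (y n)) (∇ θ' (y n))) := by
    filter_upwards [hmx, hyh.eventually hU', hy.eventually hU', hy.eventually (cd_ev hθ'c)] with n h1 h2 h3 h4
    have c2 := hu _ h2
    have c3 := hu _ h3
    have ctr : ContDiffAt ℝ 2 (fun x => u (x + h n • e)) (y n) :=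
      ContDiffAt.comp (y n) (f := fun x => x + h n • e) c2 (by fun_prop)
    have ftr : ∀ x, fderiv ℝ (fun x => u (x + h n • e)) x = fderiv ℝ u (x + h n • e) := fun x => fderiv_comp_add_right _
    have ftr' : fderiv ℝ (fun x => u (x + h n • e)) = fun x => fderiv ℝ u (x + h n • e) := funext ftr
    have dtr : D2 (fun x => u (x + h n • e)) (y n) = D2 u (y n + h n • e) := by
      rw [D2, ftr', D2]
      exact fderiv_comp_add_right _
    have gtr : ∇ (fun x => u (x + h n • e)) (y n) = ∇ u (y n + h n • e) := by
      apply grad_eq_of_fderiv; intro v; rw [ftr, grad_apply]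
    have hloc : IsLocalMax (fun x => u (x + h n • e) - u x - h n * θ' x) (y n) := by
      filter_upwards [h1] with x hx
      have := mul_le_mul_of_nonneg_left hx (h0 n).le
      have e1 : ∀ x, h n * ((h n)⁻¹ * (u (x + h n • e) - u x) - θ' x) = u (x + h n • e) - u x - h n * θ' x := by
        intro x; rw [mul_sub, mul_inv_cancel_left₀ (h0 n).ne']
      rwa [e1, e1] at this
    have cθ : ContDiffAt ℝ 2 (fun x => h n * θ' x) (y n) := contDiffAt_const.mul h4
    have call : ContDiffAt ℝ 2 (fun x => u (x + h n • e) - u x - h n * θ' x) (y n) := (ctr.sub c3).sub cθ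
    have g0 := max_grad hloc
    rw [grad_sub ((cd_diff ctr).fun_sub (cd_diff c3)) (cd_diff cθ), grad_sub (cd_diff ctr) (cd_diff c3),
      grad_const_mul _ (cd_diff h4), gtr] at g0
    have g1 : ∇ u (y n + h n • e) = ∇ u (y n) + h n • ∇ θ' (y n) := by
      rw [sub_sub, sub_eq_zero] at g0; exact g0
    have d0 : ∀ w, (D2 u (y n + h n • e) - D2 u (y n)) w w ≤ (h n • D2 θ' (y n)) w w := by
      intro w
      have m := max_D2 call hloc w
      have q1 : D2 (fun x => u (x + h n • e) - u x - h n * θ' x) (y n) =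
          D2 u (y n + h n • e) + (-1 : ℝ) • D2 u (y n) + (- h n) • D2 θ' (y n) := by
        have : (fun x => u (x + h n • e) - u x - h n * θ' x) = fun x => (u (x + h n • e) + (-1) * u x) + (- h n) * θ' x := by
          funext x; ring
        have l : ∀ (c : ℝ) {f : E → ℝ} (hf : ContDiffAt ℝ 2 f (y n)), D2 (fun x => c * f x) (y n) = c • D2 f (y n) := by
          intro c f hf
          ext v w
          rw [D2_mul contDiffAt_const hf]
          have : D2 (fun _ : E => c) (y n) = 0 := by simp [D2]
          simp [this]
        rw [this, D2_add (ctr.add (contDiffAt_const.mul c3)) (contDiffAt_const.mul h4),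
          D2_add ctr (contDiffAt_const.mul c3), dtr, l _ c3, l _ h4]
      rw [q1] at m
      simp at m ⊢
      linarith
    have t1 := T_mono (∇ u (y n + h n • e)) d0
    rw [T_sub, T_smul, hT _ h2, g1] at t1
    have t2 := T_shift (∇ u (y n)) (∇ θ' (y n)) (h n) (D2 u (y n))
    rw [hT _ h3, sub_zero] at t2
    rw [t2, zero_sub, ← mul_neg] at t1
    have t3 := le_of_mul_le_mul_left t1 (h0 n)
    linarith
  have p1 : Tendsto (fun n => ∇ u (y n)) atTop (𝓝 (∇ u x₀)) := (grad_cont (hu x₀ hx₀)).tendsto.comp hy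
  have p2 : Tendsto (fun n => ∇ θ' (y n)) atTop (𝓝 (∇ θ x₀)) := by
    rw [← hD1]; exact (grad_cont hθ'c).tendsto.comp hy
  have p3 : Tendsto (fun n => D2 u (y n)) atTop (𝓝 (D2 u x₀)) := (D2_cont (hu x₀ hx₀)).tendsto.comp hy
  have p4 : Tendsto (fun n => D2 θ' (y n)) atTop (𝓝 (D2 θ x₀)) := by
    rw [← hD2]; exact (D2_cont hθ'c).tendsto.comp hy
  have p5 : Tendsto (fun n => ∇ u (y n) + h n • ∇ θ' (y n)) atTop (𝓝 (∇ u x₀)) := by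
    have := p1.add (hh.smul p2); simpa using this
  have p6 := (T_cont.tendsto (∇ u x₀, D2 θ x₀)).comp (p5.prodMk_nhds p4)
  have p7 := (tr_cont.tendsto _).comp p3
  have p8 := ((((p1.inner p2).const_mul 2).add (hh.mul (p2.norm.pow 2))).mul p7)
  have p9 := ev_tendsto p3 p1 p2
  have p10 := ev_tendsto p3 p2 p1
  have p11 := hh.mul (ev_tendsto p3 p2 p2)
  have pfin := p6.add (((p8.sub p9).sub p10).sub p11)
  have := ge_of_tendsto pfin key
  rw [D2_symm (hu x₀ hx₀) (∇ θ x₀) (∇ u x₀)] at this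
  simp only [zero_mul, add_zero, sub_zero] at this
  linarith

end BDG

open scoped RealInnerProductSpace
namespace BDG
open MeasureTheory Filter Topology Set Metric
open scoped NNReal ENNReal Gradient ContDiff

/-- algebra at the maximum point of the weighted gradient -/
lemma kor_alg {v k D η S Tp c Y s : ℝ} (hv : 0 < v) (hk : 0 < k) (hη : 0 < η) (hD : D = η + 1)
    (hc : c = s) (hs : 0 ≤ s)
    (hS : v ^ 2 - 2 * v * Y ≤ S) (hTp : -(16 * c) * (1 + v ^ 2) ≤ Tp)
    (hk2 : 128 * c < k)
    (hmain : 2 * v * (-(v * k * D / η)) ^ 2 * S ≤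
      (1 + v ^ 2) * (-(v * k * D / η) * Tp + v * k ^ 2 * D * (D + 1) / η ^ 2 * S)) :
    v < 1 ∨ v < 4 * Y ∨ (1 + v ^ 2) * η < 4 * D := by
  by_contra hcon
  push Not at hcon
  obtain ⟨h1, h2, h3⟩ := hcon
  have hD0 : 0 < D := by linarith
  have e : (1 + v ^ 2) * (-(v * k * D / η) * Tp + v * k ^ 2 * D * (D + 1) / η ^ 2 * S)
      - 2 * v * (-(v * k * D / η)) ^ 2 * S =
      (v * k * D / η ^ 2) * ((1 + v ^ 2) * η * (-Tp) - k * S * ((1 + v ^ 2) * η - 2 * D)) := by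
    field_simp
    rw [hD]; ring
  have hpos : 0 < v * k * D / η ^ 2 := by positivity
  have h4 : 0 ≤ (1 + v ^ 2) * η * (-Tp) - k * S * ((1 + v ^ 2) * η - 2 * D) := by
    by_contra hn
    push Not at hn
    have := mul_neg_of_pos_of_neg hpos hn
    linarith
  have hS2 : (1 + v ^ 2) / 4 ≤ S := by nlinarith
  have hw : 0 < (1 + v ^ 2) * η := by positivity
  have h5 : k * ((1 + v ^ 2) / 4) * ((1 + v ^ 2) * η / 2) ≤ k * S * ((1 + v ^ 2) * η - 2 * D) := by
    have : 0 ≤ S := le_trans (by positivity) hS2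
    gcongr
    linarith
  have h6 : (1 + v ^ 2) * η * (-Tp) ≤ (1 + v ^ 2) * η * (16 * c * (1 + v ^ 2)) :=
    mul_le_mul_of_nonneg_left (by linarith) hw.le
  have h7 : k * ((1 + v ^ 2) / 4) * ((1 + v ^ 2) * η / 2) - (1 + v ^ 2) * η * (16 * c * (1 + v ^ 2))
      = (1 + v ^ 2) ^ 2 * η / 8 * (k - 128 * c) := by ring
  have h8 : 0 < (1 + v ^ 2) ^ 2 * η / 8 * (k - 128 * c) := by
    apply mul_pos (by positivity) (by linarith)
  linarith

lemma psi_deriv {k m t : ℝ} (ht : Real.exp (k * t) - 1 ≠ 0) :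
    HasDerivAt (fun t => m / (Real.exp (k * t) - 1)) (-(m * k * Real.exp (k * t) / (Real.exp (k * t) - 1) ^ 2)) t := by
  have h1 : HasDerivAt (fun t => Real.exp (k * t) - 1) (Real.exp (k * t) * (k * 1)) t :=
    (((hasDerivAt_id t).const_mul k).exp).sub_const 1
  have := (hasDerivAt_const t m).div h1 ht
  refine this.congr_deriv ?_
  field_simp
  ring

lemma psi_deriv2 {k m t : ℝ} (ht : Real.exp (k * t) - 1 ≠ 0) :
    HasDerivAt (fun t => -(m * k * Real.exp (k * t) / (Real.exp (k * t) - 1) ^ 2))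
      (m * k ^ 2 * Real.exp (k * t) * (Real.exp (k * t) + 1) / (Real.exp (k * t) - 1) ^ 3) t := by
  have h0 : HasDerivAt (fun t => Real.exp (k * t)) (Real.exp (k * t) * (k * 1)) t :=
    (((hasDerivAt_id t).const_mul k).exp)
  have h1 := h0.sub_const 1
  have := ((h0.const_mul (m * k)).div (h1.pow 2) (pow_ne_zero 2 ht)).neg
  refine this.congr_deriv ?_
  simp only [Pi.pow_apply]
  field_simp
  push_cast
  ring

lemma S_lower (p Y : E) :
    ‖p‖ ^ 2 - 2 * ‖p‖ * ‖Y‖ ≤ (1 + ‖p‖ ^ 2) * ‖p - Y‖ ^ 2 - ⟪p, p - Y⟫ ^ 2 := by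
  have h2 := real_inner_le_norm p Y
  have h3 : ⟪p, Y⟫ ^ 2 ≤ (‖p‖ * ‖Y‖) ^ 2 := by
    rw [sq_le_sq, abs_of_nonneg (show 0 ≤ ‖p‖ * ‖Y‖ by positivity)]
    exact abs_real_inner_le_norm p Y
  rw [norm_sub_sq_real, inner_sub_right, real_inner_self_eq_norm_sq]
  have := sq_nonneg ‖Y‖
  generalize ⟪p, Y⟫ = i at *
  generalize ‖p‖ = v at *
  generalize ‖Y‖ = y at *
  nlinarith

lemma phi_grad {u : E → ℝ} {z x₀ : E} (d c : ℝ) (hu : ContDiffAt ℝ 2 u x₀) :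
    ∇ (fun x => d + (u x + (-c) * ‖x - z‖ ^ 2)) x₀ = ∇ u x₀ - (2 * c) • (x₀ - z) := by
  apply grad_eq_of_fderiv; intro w
  have d1 : DifferentiableAt ℝ (fun x : E => ‖x - z‖ ^ 2) x₀ := cd_diff (cd_nsq z x₀)
  rw [fderiv_const_add, fderiv_fun_add (cd_diff hu) (d1.const_mul (-c)), fderiv_const_mul d1,
    inner_sub_left, inner_smul_left, grad_apply]
  simp only [ContinuousLinearMap.add_apply, ContinuousLinearMap.smul_apply, fderiv_nsq,
    smul_eq_mul, conj_trivial]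
  ring

lemma phi_D2 {u : E → ℝ} {z x₀ : E} (d c : ℝ) (hu : ContDiffAt ℝ 2 u x₀) (w w' : E) :
    D2 (fun x => d + (u x + (-c) * ‖x - z‖ ^ 2)) x₀ w w' = D2 u x₀ w w' - c * (2 * ⟪w, w'⟫) := by
  have h1 : ContDiffAt ℝ 2 (fun x => (-c) * ‖x - z‖ ^ 2) x₀ := contDiffAt_const.mul (cd_nsq z x₀)
  have h0 : ∀ d : ℝ, D2 (fun _ : E => d) x₀ w w' = 0 := by intro d; simp [D2]
  rw [D2_add contDiffAt_const (hu.add h1), D2_add hu h1]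
  change D2 (fun _ => d) x₀ w w' + (D2 u x₀ w w' + D2 (fun x => (-c) * ‖x - z‖ ^ 2) x₀ w w') = _
  rw [h0, D2_mul contDiffAt_const (cd_nsq z x₀), D2_nsq, h0]
  simp
  ring

set_option maxHeartbeats 2000000 in
/-- Interior gradient bound. -/
theorem grad_bound (M ρ : ℝ) (hM : 0 ≤ M) (hρ : 0 < ρ) : ∃ C, 0 ≤ C ∧ ∀ (u : E → ℝ) (z : E) (U : Set E),
    IsOpen U → closedBall z ρ ⊆ U → (∀ x ∈ U, ContDiffAt ℝ 2 u x) → (∀ x ∈ U, T (∇ u x) (D2 u x) = 0) →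
    (∀ x ∈ U, |u x| ≤ M) → ‖∇ u z‖ ≤ C := by
  set s := 1 + 2 * M with hs
  have hs1 : 1 ≤ s := by linarith
  set c := s / ρ ^ 2 with hc
  have hc0 : 0 < c := by positivity
  set k := 128 * c + 1 with hk
  have hk1 : 1 ≤ k := by linarith
  set Dm := Real.exp (k * s) with hDm
  have hDm0 : 0 < Dm := Real.exp_pos _
  refine ⟨Dm * (1 + 8 * s / ρ + 4), by positivity, ?_⟩
  intro u z U hU hzU hu hT hM'
  have hzc : z ∈ closedBall z ρ := mem_closedBall_self hρ.le
  set φ : E → ℝ := fun x => (1 - u z) + (u x + (-c) * ‖x - z‖ ^ 2) with hφ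
  have hφc : ∀ x ∈ U, ContDiffAt ℝ 2 φ x := fun x hx =>
    contDiffAt_const.add ((hu x hx).add (contDiffAt_const.mul (cd_nsq z x)))
  have hφs : ∀ x ∈ U, φ x ≤ s := by
    intro x hx
    have h1 := abs_le.1 (hM' x hx); have h2 := abs_le.1 (hM' z (hzU hzc))
    have : 0 ≤ c * ‖x - z‖ ^ 2 := by positivity
    simp only [hφ]; linarith [h1.2, h2.1]
  have hφz : φ z = 1 := by simp [hφ]
  set η : E → ℝ := fun x => Real.exp (k * φ x) - 1 with hη
  have hcont : ContinuousOn (fun x => η x * ‖∇ u x‖) (closedBall z ρ) := by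
    intro x hx
    have h1 := (hφc x (hzU hx)).continuousAt
    have h2 := grad_cont (hu x (hzU hx))
    exact ((((Real.continuous_exp.continuousAt).comp (h1.const_mul k)).sub continuousAt_const).mul h2.norm).continuousWithinAt
  obtain ⟨x₀, hx₀, hmax⟩ := (isCompact_closedBall z ρ).exists_isMaxOn ⟨z, hzc⟩ hcont
  have hx₀U := hzU hx₀
  have hz := hmax hzc
  simp only [mem_setOf_eq] at hz
  have hηz : 1 ≤ η z := by
    simp only [hη, hφz, mul_one]
    have := Real.add_one_le_exp k; linarith
  have hv0 := norm_nonneg (∇ u z)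
  have hle : ‖∇ u z‖ ≤ η x₀ * ‖∇ u x₀‖ := by nlinarith
  rcases hv0.eq_or_lt with h0 | hvz
  · rw [← h0]; positivity
  have hpos : 0 < η x₀ * ‖∇ u x₀‖ := hvz.trans_le hle
  have hη0 : 0 < η x₀ := by
    by_contra hn; push Not at hn
    have := mul_nonpos_of_nonpos_of_nonneg hn (norm_nonneg (∇ u x₀)); linarith
  set p := ∇ u x₀ with hp
  have hv : 0 < ‖p‖ := by
    by_contra hn; push Not at hn
    have := mul_nonpos_of_nonneg_of_nonpos hη0.le hn; linarith
  set v := ‖p‖ with hvdef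
  refine hle.trans ?_
  have hηD : η x₀ ≤ Dm := by
    have : Real.exp (k * φ x₀) ≤ Dm := by
      rw [hDm, Real.exp_le_exp]; exact mul_le_mul_of_nonneg_left (hφs x₀ hx₀U) (by linarith)
    simp only [hη]; linarith
  have hDD : Real.exp (k * φ x₀) ≤ Dm := by
    rw [hDm, Real.exp_le_exp]; exact mul_le_mul_of_nonneg_left (hφs x₀ hx₀U) (by linarith)
  -- interior
  have hIntg : x₀ ∈ ball z ρ := by
    rw [mem_ball]
    refine lt_of_le_of_ne hx₀ fun h => ?_
    have h1 : φ x₀ ≤ 0 := by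
      rw [dist_eq_norm] at h
      have h1 := abs_le.1 (hM' x₀ hx₀U); have h2 := abs_le.1 (hM' z (hzU hzc))
      have h3 : c * ρ ^ 2 = s := by rw [hc]; field_simp
      simp only [hφ, h]; linarith [h1.2, h2.1]
    have : Real.exp (k * φ x₀) ≤ 1 := by
      rw [Real.exp_le_one_iff]; exact mul_nonpos_of_nonneg_of_nonpos (by linarith) h1
    simp only [hη] at hη0; linarith
  -- the test function
  set e := v⁻¹ • p with he
  have hpe : p = v • e := by rw [he, smul_inv_smul₀ hv.ne']
  have hen : ‖e‖ = 1 := by rw [he, norm_smul, Real.norm_of_nonneg (by positivity), inv_mul_cancel₀ hv.ne']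
  set m := v * η x₀ with hm
  set ψ : ℝ → ℝ := fun t => m / (Real.exp (k * t) - 1) with hψ
  set θ : E → ℝ := fun x => ψ (φ x) with hθ
  have hφ0 := hφc x₀ hx₀U
  have hηev : ∀ᶠ t in 𝓝 (φ x₀), 0 < Real.exp (k * t) - 1 := by
    have : ContinuousAt (fun t => Real.exp (k * t) - 1) (φ x₀) := by fun_prop
    exact this.eventually (lt_mem_nhds hη0)
  have hψd : ∀ᶠ t in 𝓝 (φ x₀), HasDerivAt ψ (-(m * k * Real.exp (k * t) / (Real.exp (k * t) - 1) ^ 2)) t := by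
    filter_upwards [hηev] with t ht using psi_deriv ht.ne'
  have hψ2 := psi_deriv2 (k := k) (m := m) (t := φ x₀) hη0.ne'
  have hθc : ContDiffAt ℝ 2 θ x₀ := by
    apply contDiffAt_const.div _ hη0.ne'
    exact ((contDiffAt_const.mul hφ0).exp).sub contDiffAt_const
  have hθeq : θ x₀ = v := by
    simp only [hθ, hψ, hm]
    exact mul_div_cancel_right₀ v hη0.ne'
  have hux : fderiv ℝ u x₀ e = v := by
    rw [← grad_apply, ← hp, hpe, inner_smul_left, real_inner_self_eq_norm_sq, hen]; simp
  have hlm : IsLocalMax (fun x => fderiv ℝ u x e - θ x) x₀ := by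
    filter_upwards [isOpen_ball.mem_nhds hIntg, (hφ0.continuousAt).eventually hηev] with x hx hx2
    rw [hθeq, hux, sub_self]
    have h1 := hmax (ball_subset_closedBall hx)
    simp only [mem_setOf_eq] at h1
    have h2 : fderiv ℝ u x e ≤ ‖∇ u x‖ := by
      rw [← grad_apply]; refine (real_inner_le_norm _ _).trans ?_; rw [hen, mul_one]
    have h3 : ‖∇ u x‖ ≤ θ x := by
      simp only [hθ, hψ]
      rw [le_div_iff₀ hx2, hm]
      simp only [hη] at h1 ⊢; linarith
    linarith
  have hvisc := visc hU hx₀U hu hT hθc hlm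
  rw [← hp] at hvisc
  set H := D2 u x₀ with hH
  set q := ∇ θ x₀ with hq
  have hHe : ∀ w, H w e = ⟪q, w⟫ := by
    intro w
    have h1 := hlm.fderiv_eq_zero
    have hd1 : DifferentiableAt ℝ (fun x => fderiv ℝ u x e) x₀ :=
      (cd_fderiv (hu x₀ hx₀U)).clm_apply (differentiableAt_const e)
    rw [fderiv_fun_sub hd1 (cd_diff hθc), sub_eq_zero] at h1
    rw [hH, D2_apply (hu x₀ hx₀U), h1, grad_apply]
  have hHp : H p q = v * ‖q‖ ^ 2 := by
    rw [hH, D2_symm (hu x₀ hx₀U), ← hH]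
    conv_lhs => rw [hpe]
    rw [map_smul, smul_eq_mul, hHe, real_inner_self_eq_norm_sq]
  have hHpp : H p p = v * ⟪p, q⟫ := by
    conv_lhs => rw [hpe]
    rw [map_smul, smul_eq_mul, ← hpe, hHe, real_inner_comm]
  have htr : (1 + v ^ 2) * tr H = v * ⟪p, q⟫ := by
    have := hT x₀ hx₀U
    rw [← hp, ← hH, T, hHpp, ← hvdef, sub_eq_zero] at this
    exact this
  rw [hHp] at hvisc
  -- gradients
  set r := ∇ φ x₀ with hr
  set D := Real.exp (k * φ x₀) with hD
  have hDη : D = η x₀ + 1 := by simp [hη, hD]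
  have hm1 : m * k * D / (η x₀) ^ 2 = v * k * D / η x₀ := by
    rw [hm]; field_simp
  have hm2 : m * k ^ 2 * D * (D + 1) / (η x₀) ^ 3 = v * k ^ 2 * D * (D + 1) / (η x₀) ^ 2 := by
    rw [hm]; field_simp
  set a := -(v * k * D / η x₀) with ha
  set b := v * k ^ 2 * D * (D + 1) / (η x₀) ^ 2 with hb
  have hqr : q = a • r := by
    rw [hq]
    apply grad_eq_of_fderiv; intro w
    have h1 := (hψd.self_of_nhds.comp_hasFDerivAt x₀ (cd_diff hφ0).hasFDerivAt).fderiv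
    simp only [Function.comp_def] at h1
    rw [hθ, h1, hr, ha, ← hm1, inner_smul_left, grad_apply]
    simp [hη, hD]
  have hD2θ : ∀ w w', D2 θ x₀ w w' = a * D2 φ x₀ w w' + b * (⟪r, w⟫ * ⟪r, w'⟫) := by
    intro w w'
    rw [hθ, D2_comp hφ0 hψd hψ2, hr, grad_apply, grad_apply, ha, ← hm1, ← hm2]
  set S := (1 + v ^ 2) * ‖r‖ ^ 2 - ⟪p, r⟫ ^ 2 with hS
  have hTθ : T p (D2 θ x₀) = a * T p (D2 φ x₀) + b * S := by
    simp only [T, hD2θ, ← hvdef, hS]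
    rw [norm_sq_eq r, Finset.sum_add_distrib, ← Finset.mul_sum, ← Finset.mul_sum, real_inner_comm r p]
    simp only [inner_ee, pow_two]
    ring
  have hD2φ : ∀ w w', D2 φ x₀ w w' = H w w' - c * (2 * ⟪w, w'⟫) := by
    intro w w'
    exact phi_D2 _ _ (hu x₀ hx₀U) w w'
  have hTφ : T p (D2 φ x₀) = -(2 * c) * (8 * (1 + v ^ 2) - v ^ 2) := by
    have := hT x₀ hx₀U
    rw [← hp, ← hH] at this
    simp only [T, hD2φ, ← hvdef] at this ⊢
    rw [Finset.sum_sub_distrib, real_inner_self_eq_norm_sq, ← hvdef]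
    simp only [real_inner_self_eq_norm_sq, norm_ee]
    simp
    linarith
  have hrY : r = p - (2 * c) • (x₀ - z) := phi_grad _ _ (hu x₀ hx₀U)
  set Y := (2 * c) • (x₀ - z) with hY
  have hYn : ‖Y‖ ≤ 2 * s / ρ := by
    rw [hY, norm_smul, Real.norm_of_nonneg (by positivity), ← dist_eq_norm]
    calc 2 * c * dist x₀ z ≤ 2 * c * ρ := by gcongr; exact hx₀
      _ = 2 * s / ρ := by rw [hc]; field_simp
  have hSle : v ^ 2 - 2 * v * ‖Y‖ ≤ S := by
    rw [hS, hrY]; exact S_lower p Y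
  have hX : ⟪p, q⟫ = a * ⟪p, r⟫ := by rw [hqr, inner_smul_right]
  have hqn : ‖q‖ ^ 2 = a ^ 2 * ‖r‖ ^ 2 := by rw [hqr, norm_smul, mul_pow, Real.norm_eq_abs, sq_abs]
  have hmain : 2 * v * a ^ 2 * S ≤ (1 + v ^ 2) * (a * T p (D2 φ x₀) + b * S) := by
    have h1 := mul_le_mul_of_nonneg_left hvisc (show 0 ≤ 1 + v ^ 2 by positivity)
    rw [hTθ] at h1
    have h2 : (1 + v ^ 2) * (a * T p (D2 φ x₀) + b * S + 2 * ⟪p, q⟫ * tr H - 2 * (v * ‖q‖ ^ 2)) =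
        (1 + v ^ 2) * (a * T p (D2 φ x₀) + b * S) + 2 * ⟪p, q⟫ * ((1 + v ^ 2) * tr H) - 2 * v * ((1 + v ^ 2) * ‖q‖ ^ 2) := by ring
    rw [h2, htr, hX, hqn] at h1
    have h3 : 2 * (a * ⟪p, r⟫) * (v * (a * ⟪p, r⟫)) - 2 * v * ((1 + v ^ 2) * (a ^ 2 * ‖r‖ ^ 2)) = - (2 * v * a ^ 2 * S) := by
      rw [hS]; ring
    linarith
  have halg := kor_alg (v := v) (k := k) (D := D) (η := η x₀) (S := S) (Tp := T p (D2 φ x₀)) (c := c) (Y := ‖Y‖) (s := c)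
    hv (by linarith) hη0 hDη rfl hc0.le hSle (by rw [hTφ]; nlinarith [mul_pos hc0 hv, sq_nonneg v, mul_nonneg hc0.le (sq_nonneg v)])
    (by linarith) hmain
  have hsr : 0 ≤ 8 * s / ρ := by positivity
  rcases halg with h | h | h
  · calc η x₀ * v ≤ Dm * 1 := by gcongr
      _ ≤ _ := by gcongr; linarith
  · have : v ≤ 8 * s / ρ := by
      have : 4 * (2 * s / ρ) = 8 * s / ρ := by ring
      linarith
    calc η x₀ * v ≤ Dm * (8 * s / ρ) := by gcongr
      _ ≤ _ := by gcongr; linarith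
  · have h1 : v ≤ 1 + v ^ 2 := by nlinarith [sq_nonneg (v - 1)]
    calc η x₀ * v ≤ η x₀ * (1 + v ^ 2) := by gcongr
      _ ≤ Dm * 4 := by linarith
      _ ≤ _ := by gcongr; linarith

end BDG

open scoped RealInnerProductSpace
namespace BDG
open MeasureTheory Filter Topology Set Metric
open scoped NNReal ENNReal Gradient ContDiff

/-- second order jet of a function of `g` and `‖x‖²`, in terms of partial derivatives -/
structure Rep (f : E → ℝ) (x : E) (α β c d e : ℝ) : Prop where
  cd : ContDiffAt ℝ 2 f x
  d1 : ∀ v, fderiv ℝ f x v = α * (2 * ⟪J x, v⟫) + β * (2 * ⟪x, v⟫)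
  d2 : ∀ v w, D2 f x v w = α * (2 * ⟪J v, w⟫) + β * (2 * ⟪v, w⟫) + c * ((2 * ⟪J x, v⟫) * (2 * ⟪J x, w⟫))
    + d * ((2 * ⟪J x, v⟫) * (2 * ⟪x, w⟫) + (2 * ⟪x, v⟫) * (2 * ⟪J x, w⟫)) + e * ((2 * ⟪x, v⟫) * (2 * ⟪x, w⟫))

lemma g_hasFDerivAt (x : E) : HasFDerivAt g ((2 : ℝ) • innerSL ℝ (J x)) x := by
  have h1 : HasFDerivAt (fun y : E => J y) (J.toContinuousLinearEquiv : E →L[ℝ] E) x :=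
    J.toContinuousLinearEquiv.hasFDerivAt
  have h2 := h1.inner ℝ (hasFDerivAt_id x)
  refine h2.congr_fderiv ?_
  ext v
  have h3 := J_symm v x
  have h4 := real_inner_comm v (J x)
  simp [fderivInnerCLM_apply]
  linarith

lemma g_cd (x : E) : ContDiffAt ℝ 2 g x :=
  (J.toContinuousLinearEquiv.contDiff.contDiffAt).inner ℝ contDiffAt_id

lemma rep_g (x : E) : Rep g x 1 0 0 0 0 := by
  refine ⟨g_cd x, ?_, ?_⟩
  · intro v; rw [(g_hasFDerivAt x).fderiv]; simp
  · intro v w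
    rw [D2_apply (g_cd x)]
    have : (fun y => fderiv ℝ g y w) = fun y => 2 * ⟪J w, y⟫ := by
      ext y; rw [(g_hasFDerivAt y).fderiv]
      have h2 : ⟪J y, w⟫ = ⟪J w, y⟫ := by rw [J_symm, real_inner_comm]
      simp [h2]
    rw [this]
    have h : HasFDerivAt (fun y : E => 2 * ⟪J w, y⟫) ((2 : ℝ) • innerSL ℝ (J w)) x :=
      (innerSL ℝ (J w)).hasFDerivAt.const_mul 2
    rw [h.fderiv]
    have h2 : ⟪J v, w⟫ = ⟪J w, v⟫ := by rw [J_symm, real_inner_comm]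
    simp [h2]

lemma rep_P (x : E) : Rep (fun y => ‖y‖ ^ 2) x 0 1 0 0 0 := by
  have h : (fun y : E => ‖y‖ ^ 2) = fun y => ‖y - 0‖ ^ 2 := by simp
  rw [h]
  refine ⟨cd_nsq 0 x, ?_, ?_⟩
  · intro v; rw [fderiv_nsq]; simp
  · intro v w; rw [D2_nsq]; simp

lemma rep_const (a : ℝ) (x : E) : Rep (fun _ => a) x 0 0 0 0 0 := by
  refine ⟨contDiffAt_const, ?_, ?_⟩
  · intro v; simp
  · intro v w; simp [D2]

lemma Rep.congr {f : E → ℝ} {x : E} {α β c d e α' β' c' d' e' : ℝ} (h : Rep f x α β c d e)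
    (h1 : α = α') (h2 : β = β') (h3 : c = c') (h4 : d = d') (h5 : e = e') : Rep f x α' β' c' d' e' := by
  subst h1 h2 h3 h4 h5; exact h

lemma Rep.add {f f' : E → ℝ} {x : E} {α β c d e α' β' c' d' e' : ℝ} (h : Rep f x α β c d e)
    (h' : Rep f' x α' β' c' d' e') :
    Rep (fun y => f y + f' y) x (α + α') (β + β') (c + c') (d + d') (e + e') := by
  refine ⟨h.cd.add h'.cd, ?_, ?_⟩
  · intro v; rw [fderiv_fun_add (cd_diff h.cd) (cd_diff h'.cd)]
    change fderiv ℝ f x v + fderiv ℝ f' x v = _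
    rw [h.d1, h'.d1]; ring
  · intro v w; rw [D2_add h.cd h'.cd]
    change D2 f x v w + D2 f' x v w = _
    rw [h.d2, h'.d2]; ring

lemma Rep.comp {f : E → ℝ} {x : E} {α β c d e : ℝ} (h : Rep f x α β c d e) {ψ ψ₁ : ℝ → ℝ} {k : ℝ}
    (hc : ContDiffAt ℝ 2 ψ (f x))
    (hψ : ∀ᶠ t in 𝓝 (f x), HasDerivAt ψ (ψ₁ t) t) (hψ2 : HasDerivAt ψ₁ k (f x)) :
    Rep (fun y => ψ (f y)) x (ψ₁ (f x) * α) (ψ₁ (f x) * β) (ψ₁ (f x) * c + k * α ^ 2)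
      (ψ₁ (f x) * d + k * α * β) (ψ₁ (f x) * e + k * β ^ 2) := by
  refine ⟨hc.comp x h.cd, ?_, ?_⟩
  · intro v
    have h1 := (hψ.self_of_nhds.comp_hasFDerivAt x (cd_diff h.cd).hasFDerivAt).fderiv
    simp only [Function.comp_def] at h1
    rw [h1]
    change ψ₁ (f x) * fderiv ℝ f x v = _
    rw [h.d1]; ring
  · intro v w
    rw [D2_comp h.cd hψ hψ2, h.d2, h.d1, h.d1]; ring

lemma Rep.const_mul {f : E → ℝ} {x : E} {α β c d e : ℝ} (h : Rep f x α β c d e) (a : ℝ) :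
    Rep (fun y => a * f y) x (a * α) (a * β) (a * c) (a * d) (a * e) := by
  have := h.comp (ψ := fun t => a * t) (ψ₁ := fun _ => a) (k := 0) (by fun_prop)
    (Eventually.of_forall fun t => by simpa using (hasDerivAt_id t).const_mul a) (hasDerivAt_const _ _)
  exact this.congr rfl rfl (by ring) (by ring) (by ring)

lemma Rep.grad {f : E → ℝ} {x : E} {α β c d e : ℝ} (h : Rep f x α β c d e) :
    ∇ f x = (2 * α) • J x + (2 * β) • x := by
  apply grad_eq_of_fderiv; intro v
  rw [h.d1, inner_add_left, inner_smul_left, inner_smul_left]; simp; ring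

lemma Rep.T {f : E → ℝ} {x : E} {α β c d e : ℝ} (h : Rep f x α β c d e) :
    T (∇ f x) (D2 f x) =
      (1 + (4 * ‖x‖ ^ 2 * (α ^ 2 + β ^ 2) + 8 * g x * α * β))
        * (16 * β + 4 * ‖x‖ ^ 2 * (c + e) + 8 * g x * d)
      - (8 * α * ((α ^ 2 + β ^ 2) * g x + 2 * α * β * ‖x‖ ^ 2)
        + 2 * β * (4 * ‖x‖ ^ 2 * (α ^ 2 + β ^ 2) + 8 * g x * α * β)
        + c * (4 * (α * ‖x‖ ^ 2 + β * g x)) ^ 2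
        + 2 * d * (4 * (α * ‖x‖ ^ 2 + β * g x)) * (4 * (α * g x + β * ‖x‖ ^ 2))
        + e * (4 * (α * g x + β * ‖x‖ ^ 2)) ^ 2) := by
  have hJn : ⟪J x, J x⟫ = ‖x‖ ^ 2 := by rw [real_inner_self_eq_norm_sq, LinearIsometryEquiv.norm_map]
  have hxn : ⟪x, x⟫ = ‖x‖ ^ 2 := real_inner_self_eq_norm_sq x
  have hg : ⟪J x, x⟫ = g x := rfl
  have hg' : ⟪x, J x⟫ = g x := by rw [real_inner_comm]; rfl
  have hp1 : ⟪J x, ∇ f x⟫ = 2 * (α * ‖x‖ ^ 2 + β * g x) := by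
    rw [h.grad, inner_add_right, inner_smul_right, inner_smul_right, hJn, hg]; ring
  have hp2 : ⟪x, ∇ f x⟫ = 2 * (α * g x + β * ‖x‖ ^ 2) := by
    rw [h.grad, inner_add_right, inner_smul_right, inner_smul_right, hxn, hg']; ring
  have hpp : ⟪∇ f x, ∇ f x⟫ = 4 * ‖x‖ ^ 2 * (α ^ 2 + β ^ 2) + 8 * g x * α * β := by
    rw [grad_apply, h.d1, hp1, hp2]; ring
  have hJp : ⟪J (∇ f x), ∇ f x⟫ = 4 * ((α ^ 2 + β ^ 2) * g x + 2 * α * β * ‖x‖ ^ 2) := by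
    have : J (∇ f x) = (2 * α) • x + (2 * β) • J x := by
      rw [h.grad, map_add, map_smul, map_smul, J_J]
    rw [this, inner_add_left, inner_smul_left, inner_smul_left, hp1, hp2]; simp; ring
  have hH : D2 f x (∇ f x) (∇ f x) = 8 * α * ((α ^ 2 + β ^ 2) * g x + 2 * α * β * ‖x‖ ^ 2)
        + 2 * β * (4 * ‖x‖ ^ 2 * (α ^ 2 + β ^ 2) + 8 * g x * α * β)
        + c * (4 * (α * ‖x‖ ^ 2 + β * g x)) ^ 2
        + 2 * d * (4 * (α * ‖x‖ ^ 2 + β * g x)) * (4 * (α * g x + β * ‖x‖ ^ 2))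
        + e * (4 * (α * g x + β * ‖x‖ ^ 2)) ^ 2 := by
    rw [h.d2, hJp, hpp, hp1, hp2]; ring
  have htr : ∑ i, D2 f x (ee i) (ee i) = 16 * β + 4 * ‖x‖ ^ 2 * (c + e) + 8 * g x * d := by
    have s1 : ∑ i, ⟪J (ee i), ee i⟫ = 0 := by
      simp only [inner_ee, J_apply]
      simp [Fin.sum_univ_eight, ee, show ((4:Fin 8) < 4) = False by decide]
    have s2 : ∑ i, ⟪ee i, ee i⟫ = (8 : ℝ) := by simp [real_inner_self_eq_norm_sq, norm_ee]
    have s3 : ∑ i, (J x i) * (J x i) = ‖x‖ ^ 2 := by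
      rw [← LinearIsometryEquiv.norm_map J x, norm_sq_eq]; simp only [sq]
    have s4 : ∑ i, x i * x i = ‖x‖ ^ 2 := by rw [norm_sq_eq]; simp only [sq]
    have s5 : ∑ i, (J x i) * x i = g x := by
      rw [g, PiLp.inner_apply]; apply Finset.sum_congr rfl; intro i _; simp [mul_comm]
    have : ∀ i, D2 f x (ee i) (ee i) = 2 * α * ⟪J (ee i), ee i⟫ + 2 * β * ⟪ee i, ee i⟫
        + 4 * c * ((J x i) * (J x i)) + 8 * d * ((J x i) * x i) + 4 * e * (x i * x i) := by
      intro i; rw [h.d2, inner_ee x, inner_ee (J x)]; ring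
    simp only [this, Finset.sum_add_distrib, ← Finset.mul_sum, s1, s2, s3, s4, s5]
    ring
  rw [BDG.T, hH, htr, ← real_inner_self_eq_norm_sq, hpp]

/-- the operator applied to an exponential -/
lemma Rep.T_exp {f : E → ℝ} {x : E} {α β c d e : ℝ} (h : Rep f x α β c d e) :
    BDG.T (∇ (fun y => Real.exp (f y)) x) (D2 (fun y => Real.exp (f y)) x) =
      Real.exp (f x) * ((16 * β + 4 * ‖x‖ ^ 2 * (c + e) + 8 * g x * d +
        (4 * ‖x‖ ^ 2 * (α ^ 2 + β ^ 2) + 8 * g x * α * β)) + Real.exp (f x) ^ 2 *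
        (16 * ((‖x‖ ^ 2) ^ 2 - g x ^ 2) * (β ^ 2 * c - 2 * α * β * d + α ^ 2 * e)
        + 40 * α ^ 2 * β * ‖x‖ ^ 2 + 56 * ‖x‖ ^ 2 * β ^ 3 + 104 * g x * α * β ^ 2 - 8 * g x * α ^ 3)) := by
  have := h.comp (ψ := Real.exp) (ψ₁ := Real.exp) (k := Real.exp (f x)) Real.contDiff_exp.contDiffAt
    (Eventually.of_forall fun t => Real.hasDerivAt_exp t) (Real.hasDerivAt_exp _)
  rw [this.T]
  generalize Real.exp (f x) = y
  ring

lemma Rep.log {f : E → ℝ} {x : E} {α β c d e : ℝ} (h : Rep f x α β c d e) (hx : 0 < f x) :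
    Rep (fun y => Real.log (f y)) x ((f x)⁻¹ * α) ((f x)⁻¹ * β) ((f x)⁻¹ * c + -((f x) ^ 2)⁻¹ * α ^ 2)
      ((f x)⁻¹ * d + -((f x) ^ 2)⁻¹ * α * β) ((f x)⁻¹ * e + -((f x) ^ 2)⁻¹ * β ^ 2) :=
  h.comp (ψ := Real.log) (ψ₁ := fun t => t⁻¹) (Real.contDiffAt_log.2 hx.ne')
    (by filter_upwards [lt_mem_nhds hx] with t ht using Real.hasDerivAt_log (ne_of_gt ht))
    (hasDerivAt_inv hx.ne')

end BDG

open scoped RealInnerProductSpace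
namespace BDG
open MeasureTheory Filter Topology Set Metric
open scoped NNReal ENNReal Gradient ContDiff

lemma poly_neg {X h ε q : ℝ} (hX : 0 ≤ X) (hX1 : X ≤ 1) (hh : 0 ≤ h) (hh1 : h ≤ 1) (hε : 0 ≤ ε)
    (hε1 : ε ≤ X ^ 4) (hq : q = h * X ^ 8) :
    16 * ((1 - ε) ^ 2 - q) * (-(1 - X) ^ 2 * ((1 + X) ^ 2 - X * (1 + X) * h * (1 - 2 * h) - X * h ^ 2 / 4) / 4
      + (1 + X + X * h) * (1 - X) * X * h / 4 - (1 + X + X * h) ^ 2 * (1 - X ^ 2) / 2 + (1 + X + X * h) ^ 2 * X / 4)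
      + 20 * (1 + X + X * h) ^ 2 * (1 - X ^ 2) * (1 - ε) + 7 * (1 - X) ^ 3 * (1 + X) * (1 - ε) * q
      + 26 * (1 + X + X * h) * (1 - X) ^ 2 * (1 + X) * q - 8 * (1 + X + X * h) ^ 3 * (1 + X) ≤ -X := by
  have mon : ∀ i j : ℕ, 0 ≤ X ^ i * h ^ j := fun i j => by positivity
  have monh : ∀ i j : ℕ, X ^ i * h ^ j ≤ h ^ j := fun i j =>
    mul_le_of_le_one_left (by positivity) (pow_le_one₀ hX hX1)
  have mono : ∀ i j : ℕ, X ^ i * h ^ j ≤ 1 := fun i j => (monh i j).trans (pow_le_one₀ hh hh1)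
  have hh2 : h ^ 2 ≤ h := by nlinarith
  have X84 : X ^ 8 ≤ X ^ 4 := pow_le_pow_of_le_one hX hX1 (by norm_num)
  have X42 : X ^ 4 ≤ X ^ 2 := pow_le_pow_of_le_one hX hX1 (by norm_num)
  have X43 : X ^ 4 ≤ X ^ 3 := pow_le_pow_of_le_one hX hX1 (by norm_num)
  have hq0 : 0 ≤ q := by rw [hq]; positivity
  have hq4 : q ≤ h * X ^ 4 := by rw [hq]; gcongr
  have hε2 : ε ^ 2 ≤ X ^ 4 := by
    calc ε ^ 2 ≤ (X ^ 4) ^ 2 := by gcongr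
      _ = X ^ 8 := by ring
      _ ≤ _ := X84
  have hQ : q * (45 + X * (-2 + 34 * h + 7 * h ^ 2) + X ^ 2 * (-68 - 14 * h - 2 * h ^ 2)
      + X ^ 3 * (-6 - 42 * h - 9 * h ^ 2) + X ^ 4 * (15 + 6 * h)) ≤ 107 * (h * X ^ 4) := by
    have : 45 + X * (-2 + 34 * h + 7 * h ^ 2) + X ^ 2 * (-68 - 14 * h - 2 * h ^ 2)
      + X ^ 3 * (-6 - 42 * h - 9 * h ^ 2) + X ^ 4 * (15 + 6 * h) ≤ 107 := by
      linarith [mon 1 0, mono 1 1, mono 1 2, mon 2 0, mon 2 1, mon 2 2, mon 3 0, mon 3 1, mon 3 2, mono 4 0, mono 4 1]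
    calc _ ≤ q * 107 := mul_le_mul_of_nonneg_left this hq0
      _ ≤ _ := by linarith
  have hL : ε * (4 + X * (-16 - 24 * h + 14 * h ^ 2) + X ^ 2 * (-32 - 16 * h - 24 * h ^ 2)
      + X ^ 3 * (8 * h - 18 * h ^ 2) + X ^ 4 * (12 + 20 * h ^ 2)) ≤ X ^ 4 * (16 + 8 * h + 34 * h ^ 2) := by
    have : 4 + X * (-16 - 24 * h + 14 * h ^ 2) + X ^ 2 * (-32 - 16 * h - 24 * h ^ 2)
      + X ^ 3 * (8 * h - 18 * h ^ 2) + X ^ 4 * (12 + 20 * h ^ 2) ≤ 16 + 8 * h + 34 * h ^ 2 := by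
      linarith [mon 1 0, mon 1 1, monh 1 2, mon 2 0, mon 2 1, mon 2 2, monh 3 1, mon 3 2, mono 4 0, monh 4 2]
    calc _ ≤ ε * (16 + 8 * h + 34 * h ^ 2) := mul_le_mul_of_nonneg_left this hε
      _ ≤ _ := by gcongr
  have hM : ε ^ 2 * (-12 + X * (-12 - 8 * h - 7 * h ^ 2) + X ^ 2 * (16 - 12 * h + 2 * h ^ 2)
      + X ^ 3 * (20 + 16 * h + 9 * h ^ 2) + X ^ 4 * (4 + 20 * h)) ≤ X ^ 4 * (40 + 47 * h) := by
    have : -12 + X * (-12 - 8 * h - 7 * h ^ 2) + X ^ 2 * (16 - 12 * h + 2 * h ^ 2)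
      + X ^ 3 * (20 + 16 * h + 9 * h ^ 2) + X ^ 4 * (4 + 20 * h) ≤ 40 + 47 * h := by
      linarith [mon 1 0, mon 1 1, mon 1 2, mono 2 0, mon 2 1, monh 2 2, mono 3 0, monh 3 1, monh 3 2, mono 4 0, monh 4 1]
    calc _ ≤ ε ^ 2 * (40 + 47 * h) := mul_le_mul_of_nonneg_left this (sq_nonneg _)
      _ ≤ _ := by gcongr
  have hεq : 0 ≤ ε * q * (7 * (1 - X) ^ 3 * (1 + X)) := by
    have : 0 ≤ 1 - X := by linarith
    positivity
  have hlast : 0 ≤ X * (3 - 8 * h + 7 * h ^ 2) := by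
    apply mul_nonneg hX; nlinarith [sq_nonneg (7 * h - 4)]
  have a1 : h * X ^ 4 ≤ h * X ^ 2 := by gcongr
  have a2 : h * X ^ 4 ≤ h * X ^ 3 := by gcongr
  have a3 : h ^ 2 * X ^ 4 ≤ h ^ 2 * X ^ 2 := by gcongr
  have a4 : h ^ 2 * X ^ 4 ≤ h ^ 2 * X ^ 3 := by gcongr
  linarith [mon 3 3, mon 4 3, mon 4 0, mon 4 1, mon 4 2]

/-- the algebra of the upper barrier: third order part -/
lemma bar_N {g σ X h : ℝ} (hg : g ≠ 0) (hσ : σ ≠ 0) (hX : 1 + X ≠ 0) {α β c d e b : ℝ} (hb : b = X / (1 + X))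
    (hα : α = (1 + b * h) / g) (hβ : β = (1 - 2 * b) / (2 * σ))
    (hc : c = -(1 - b * h * (1 - 2 * h) - b * (1 - b) * h ^ 2 / 4) / g ^ 2)
    (hd : d = -(b * (1 - b) * h) / (4 * g * σ)) (he : e = (-(1 - 2 * b) / 2 + b * (1 - b) / 4) / σ ^ 2) :
    (g ^ 2 * (1 + X) ^ 4) * (16 * ((σ - 1) ^ 2 - g ^ 2) * (β ^ 2 * c - 2 * α * β * d + α ^ 2 * e)
        + 40 * α ^ 2 * β * (σ - 1) + 56 * (σ - 1) * β ^ 3 + 104 * g * α * β ^ 2 - 8 * g * α ^ 3) =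
    16 * ((1 - 1 / σ) ^ 2 - g ^ 2 / σ ^ 2) * (-(1 - X) ^ 2 * ((1 + X) ^ 2 - X * (1 + X) * h * (1 - 2 * h) - X * h ^ 2 / 4) / 4
      + (1 + X + X * h) * (1 - X) * X * h / 4 - (1 + X + X * h) ^ 2 * (1 - X ^ 2) / 2 + (1 + X + X * h) ^ 2 * X / 4)
      + 20 * (1 + X + X * h) ^ 2 * (1 - X ^ 2) * (1 - 1 / σ) + 7 * (1 - X) ^ 3 * (1 + X) * (1 - 1 / σ) * (g ^ 2 / σ ^ 2)
      + 26 * (1 + X + X * h) * (1 - X) ^ 2 * (1 + X) * (g ^ 2 / σ ^ 2) - 8 * (1 + X + X * h) ^ 3 * (1 + X) := by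
  rw [hα, hβ, hc, hd, he, hb]
  field_simp
  ring

lemma bar_L {g σ X h : ℝ} (hg : 0 < g) (hσ : 1 ≤ σ) (hX : 0 < X) (hX1 : X ≤ 1) (hh : h = g ^ 2 / (1 + g ^ 2))
    (hX8 : X ^ 8 * σ ^ 2 = 1 + g ^ 2) {α β c d e b : ℝ} (hb : b = X / (1 + X))
    (hα : α = (1 + b * h) / g) (hβ : β = (1 - 2 * b) / (2 * σ))
    (hc : c = -(1 - b * h * (1 - 2 * h) - b * (1 - b) * h ^ 2 / 4) / g ^ 2)
    (hd : d = -(b * (1 - b) * h) / (4 * g * σ)) (he : e = (-(1 - 2 * b) / 2 + b * (1 - b) / 4) / σ ^ 2) :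
    16 * β + 4 * (σ - 1) * (c + e) + 8 * g * d +
        (4 * (σ - 1) * (α ^ 2 + β ^ 2) + 8 * g * α * β) ≤ 27 * (σ * X) := by
  have hσ0 : 0 < σ := by linarith
  have hb0 : 0 ≤ b := by rw [hb]; positivity
  have hbX : b ≤ X := by rw [hb]; exact div_le_self hX.le (by linarith)
  have hb2 : b ≤ 1 / 2 := by rw [hb, div_le_iff₀ (by linarith)]; linarith
  have hh0 : 0 ≤ h := by rw [hh]; positivity
  have hh1 : h ≤ 1 := by rw [hh, div_le_one (by positivity)]; linarith
  have hhg : h / g ^ 2 ≤ 1 := by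
    rw [hh, div_div, div_le_one (by positivity)]; nlinarith [sq_nonneg g, sq_nonneg (g ^ 2)]
  have e1 : 16 * β + 4 * (σ - 1) * (c + e) + 8 * g * d +
        (4 * (σ - 1) * (α ^ 2 + β ^ 2) + 8 * g * α * β) =
      4 * (σ - 1) * b * (h / g ^ 2) * (3 - 2 * h + b * h + (1 - b) * h / 4)
      + ((8 + 4 * (1 + b * h)) * (1 - 2 * b) + (1 - 1 / σ) * (3 * b ^ 2 + b - 1) - 2 * b * (1 - b) * h) * (1 / σ) := by
    rw [hα, hβ, hc, hd, he]; field_simp; ring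
  have bh : 0 ≤ b * h := by positivity
  have bh1 : b * h ≤ h / 2 := by nlinarith only [hb2, hh0]
  have e2 : 4 * (σ - 1) * b * (h / g ^ 2) * (3 - 2 * h + b * h + (1 - b) * h / 4) ≤ 4 * σ * X * 1 * 3 := by
    have h3 : 3 - 2 * h + b * h + (1 - b) * h / 4 ≤ 3 := by linarith
    have h4 : 0 ≤ 3 - 2 * h + b * h + (1 - b) * h / 4 := by linarith
    have h5 : 0 ≤ σ - 1 := by linarith
    gcongr
    linarith
  have hi : 0 < 1 / σ := by positivity
  have hi1 : 1 / σ ≤ 1 := by rw [div_le_one hσ0]; exact hσ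
  have hiX : 1 / σ ≤ σ * X := by
    have h8 : X ^ 8 ≤ X := by
      calc X ^ 8 ≤ X ^ 1 := pow_le_pow_of_le_one hX.le hX1 (by norm_num)
        _ = X := pow_one X
    rw [div_le_iff₀ hσ0]
    linarith [mul_le_mul_of_nonneg_right h8 (sq_nonneg σ), sq_nonneg g]
  have e3 : ((8 + 4 * (1 + b * h)) * (1 - 2 * b) + (1 - 1 / σ) * (3 * b ^ 2 + b - 1) - 2 * b * (1 - b) * h) ≤ 15 := by
    have t1 : (8 + 4 * (1 + b * h)) * (1 - 2 * b) ≤ 14 * 1 := by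
      apply mul_le_mul (by linarith) (by linarith) (by linarith) (by norm_num)
    have t2 : (1 - 1 / σ) * (3 * b ^ 2 + b - 1) ≤ 1 := by
      have t4 : b ^ 2 ≤ 1 / 4 := by nlinarith only [hb0, hb2]
      calc (1 - 1 / σ) * (3 * b ^ 2 + b - 1) ≤ (1 - 1 / σ) * 1 :=
            mul_le_mul_of_nonneg_left (by linarith) (by linarith)
        _ ≤ 1 := by linarith
    have t3 : 0 ≤ 2 * b * (1 - b) * h := mul_nonneg (mul_nonneg (by linarith) (by linarith)) hh0
    linarith
  have e4 := mul_le_mul_of_nonneg_right e3 hi.le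
  rw [e1]
  linarith

end BDG

open scoped RealInnerProductSpace
namespace BDG
open MeasureTheory Filter Topology Set Metric
open scoped NNReal ENNReal Gradient ContDiff

/-- lower barrier -/
noncomputable def b1 (x : E) : ℝ := g x * ‖x‖

/-- auxiliary homogeneous quantity -/
noncomputable def XX (x : E) : ℝ :=
  Real.exp (1 / 8 * Real.log (1 + g x ^ 2) + (-(1 / 4)) * Real.log (‖x‖ ^ 2 + 1))

/-- upper barrier -/
noncomputable def b2 (x : E) : ℝ := 6 * g x * Real.sqrt (‖x‖ ^ 2 + 1) * (1 + XX x) ^ 4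

/-- logarithm of the upper barrier -/
noncomputable def L2 (x : E) : ℝ :=
  (Real.log 6 + Real.log (g x)) + (1 / 2 * Real.log (‖x‖ ^ 2 + 1) + 4 * Real.log (1 + XX x))

lemma grad_congr_ev {f f' : E → ℝ} {x : E} (h : f =ᶠ[𝓝 x] f') : ∇ f x = ∇ f' x := by
  apply grad_eq_of_fderiv; intro v; rw [h.fderiv_eq, grad_apply]

lemma g_cont : Continuous g := continuous_iff_continuousAt.2 fun x => (g_cd x).continuousAt

lemma g_open : IsOpen {x | 0 < g x} := isOpen_lt continuous_const g_cont

lemma norm_pos_of_g {x : E} (h : 0 < g x) : 0 < ‖x‖ := by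
  have := (le_abs_self _).trans (abs_g_le x)
  by_contra hn
  have h0 : ‖x‖ = 0 := le_antisymm (not_lt.1 hn) (norm_nonneg x)
  rw [h0] at this; norm_num at this; linarith

lemma b1_eq {x : E} (h : 0 < g x) : b1 x = Real.exp (Real.log (g x) + 1 / 2 * Real.log (‖x‖ ^ 2)) := by
  have := norm_pos_of_g h
  rw [Real.exp_add, Real.exp_log h, Real.log_pow, b1]
  congr 1
  rw [show 1 / 2 * (((2 : ℕ) : ℝ) * Real.log ‖x‖) = Real.log ‖x‖ by push_cast; ring, Real.exp_log this]

lemma b2_eq {x : E} (h : 0 < g x) : b2 x = Real.exp (L2 x) := by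
  have h1 : 0 < 1 + XX x := by have := Real.exp_pos (1 / 8 * Real.log (1 + g x ^ 2) + (-(1 / 4)) * Real.log (‖x‖ ^ 2 + 1)); unfold XX; linarith
  have h2 : 0 < ‖x‖ ^ 2 + 1 := by positivity
  rw [L2, Real.exp_add, Real.exp_add, Real.exp_add, Real.exp_log h, Real.exp_log (by norm_num), b2,
    mul_comm (1 / 2), ← Real.rpow_def_of_pos h2, ← Real.sqrt_eq_rpow, ← Real.log_rpow h1, Real.exp_log (by positivity)]
  norm_cast
  ring

lemma b1_op {x : E} (h : 0 < g x) : ContDiffAt ℝ 2 b1 x ∧ 0 < T (∇ b1 x) (D2 b1 x) := by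
  have hx := norm_pos_of_g h
  have hP : 0 < ‖x‖ ^ 2 := by positivity
  have hr := ((rep_g x).log h).add (((rep_P x).log hP).const_mul (1 / 2))
  have hev : b1 =ᶠ[𝓝 x] fun y => Real.exp (Real.log (g y) + 1 / 2 * Real.log (‖y‖ ^ 2)) := by
    filter_upwards [g_open.mem_nhds h] with y hy using b1_eq hy
  refine ⟨(hr.cd.exp).congr_of_eventuallyEq hev, ?_⟩
  rw [grad_congr_ev hev, D2_congr hev, hr.T_exp]
  have e : Real.exp (Real.log (g x) + 1 / 2 * Real.log (‖x‖ ^ 2)) ^ 2 = g x ^ 2 * ‖x‖ ^ 2 := by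
    rw [← b1_eq h, b1]; ring
  rw [e]
  apply mul_pos (Real.exp_pos _)
  generalize hG : g x = G at *
  generalize hPP : ‖x‖ ^ 2 = Q at *
  have : 0 < 11 / Q + 45 * G ^ 2 / Q := by positivity
  refine this.trans_eq ?_
  field_simp
  ring

lemma XX_pos (x : E) : 0 < XX x := Real.exp_pos _

lemma XX_pow (x : E) : XX x ^ 8 * (‖x‖ ^ 2 + 1) ^ 2 = 1 + g x ^ 2 := by
  have h1 : 0 < 1 + g x ^ 2 := by positivity
  have h2 : 0 < (‖x‖ ^ 2 + 1) := by positivity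
  rw [XX, ← Real.exp_nat_mul]
  have : ((8 : ℕ) : ℝ) * (1 / 8 * Real.log (1 + g x ^ 2) + (-(1 / 4)) * Real.log (‖x‖ ^ 2 + 1)) =
    Real.log (1 + g x ^ 2) - Real.log ((‖x‖ ^ 2 + 1) ^ 2) := by rw [Real.log_pow]; push_cast; ring
  rw [this, Real.exp_sub, Real.exp_log h1, Real.exp_log (by positivity)]
  field_simp

lemma XX_le (x : E) : XX x ≤ 1 := by
  by_contra hn
  push Not at hn
  have h1 : 1 < XX x ^ 8 := one_lt_pow₀ hn (by norm_num)
  have h2 := XX_pow x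
  have h3 : g x ^ 2 ≤ (‖x‖ ^ 2) ^ 2 := sq_le_sq.2 (by rw [abs_of_nonneg (sq_nonneg ‖x‖)]; exact abs_g_le x)
  have h4 : 0 < (‖x‖ ^ 2 + 1) ^ 2 := by positivity
  have h5 := mul_lt_mul_of_pos_right h1 h4
  nlinarith [sq_nonneg ‖x‖]

lemma rep_L2 {x : E} (h : 0 < g x) {hh b : ℝ} (hb : b = XX x / (1 + XX x)) (hhh : hh = g x ^ 2 / (1 + g x ^ 2)) :
    Rep L2 x ((1 + b * hh) / g x) ((1 - 2 * b) / (2 * (‖x‖ ^ 2 + 1)))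
     (-(1 - b * hh * (1 - 2 * hh) - b * (1 - b) * hh ^ 2 / 4) / g x ^ 2)
     (-(b * (1 - b) * hh) / (4 * g x * (‖x‖ ^ 2 + 1)))
     ((-(1 - 2 * b) / 2 + b * (1 - b) / 4) / (‖x‖ ^ 2 + 1) ^ 2) := by
  have r1 := (rep_g x).log h
  have r2 := ((rep_P x).add (rep_const 1 x)).log (show 0 < ‖x‖ ^ 2 + 1 by positivity)
  have r3 := ((rep_g x).comp (ψ := fun t => 1 + t ^ 2) (ψ₁ := fun t => 2 * t) (k := 2) (by fun_prop)
    (Eventually.of_forall fun t => by simpa using ((hasDerivAt_pow 2 t).const_add 1))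
    (by simpa using (hasDerivAt_id (g x)).const_mul 2)).log (show 0 < 1 + g x ^ 2 by positivity)
  have r4 := (r3.const_mul (1 / 8)).add (r2.const_mul (-(1 / 4)))
  have r5 := r4.comp (ψ := Real.exp) (ψ₁ := Real.exp) (k := XX x) Real.contDiff_exp.contDiffAt
    (Eventually.of_forall fun t => Real.hasDerivAt_exp t) (Real.hasDerivAt_exp _)
  have r6 := ((rep_const 1 x).add r5).log (show 0 < 1 + XX x by have := XX_pos x; linarith)
  have r7 := ((rep_const (Real.log 6) x).add r1).add ((r2.const_mul (1 / 2)).add (r6.const_mul 4))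
  change Rep L2 x _ _ _ _ _ at r7
  have hXX : Real.exp (1 / 8 * Real.log (1 + g x ^ 2) + (-(1 / 4)) * Real.log (‖x‖ ^ 2 + 1)) = XX x := rfl
  rw [hXX] at r7
  have hX := XX_pos x
  have hP : 0 < ‖x‖ ^ 2 + 1 := by positivity
  have hX1 : 0 < 1 + XX x := by linarith
  have hG2 : 0 < 1 + g x ^ 2 := by positivity
  subst hb hhh
  generalize g x = G at *
  generalize ‖x‖ ^ 2 + 1 = Q at *
  generalize XX x = Y at *
  refine r7.congr ?_ ?_ ?_ ?_ ?_
  · field_simp; ring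
  · field_simp; ring
  · field_simp; ring
  · field_simp; ring
  · field_simp; ring

lemma b2_op {x : E} (h : 0 < g x) : ContDiffAt ℝ 2 b2 x ∧ T (∇ b2 x) (D2 b2 x) < 0 := by
  have hr := rep_L2 h rfl rfl
  have hev : b2 =ᶠ[𝓝 x] fun y => Real.exp (L2 y) := by
    filter_upwards [g_open.mem_nhds h] with y hy using b2_eq hy
  refine ⟨(hr.cd.exp).congr_of_eventuallyEq hev, ?_⟩
  rw [grad_congr_ev hev, D2_congr hev, hr.T_exp]
  have hX := XX_pos x
  have hX1 := XX_le x
  have hX8 := XX_pow x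
  have hP : 0 < ‖x‖ ^ 2 + 1 := by positivity
  have e : Real.exp (L2 x) ^ 2 = 36 * (‖x‖ ^ 2 + 1) * (1 + XX x) ^ 4 * (g x ^ 2 * (1 + XX x) ^ 4) := by
    rw [← b2_eq h, b2, mul_pow, mul_pow, Real.sq_sqrt hP.le]; ring
  rw [e]
  apply mul_neg_of_pos_of_neg (Real.exp_pos _)
  have hσ1 : 1 ≤ ‖x‖ ^ 2 + 1 := by have := sq_nonneg ‖x‖; linarith
  have hPs : ‖x‖ ^ 2 = (‖x‖ ^ 2 + 1) - 1 := by ring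
  have hL := bar_L h hσ1 hX hX1 rfl hX8 rfl rfl rfl rfl rfl rfl
  have hN := bar_N (h := g x ^ 2 / (1 + g x ^ 2)) h.ne' hP.ne' (show 1 + XX x ≠ 0 by linarith) rfl rfl rfl rfl rfl rfl
  have hp := poly_neg (X := XX x) (h := g x ^ 2 / (1 + g x ^ 2)) (ε := 1 / (‖x‖ ^ 2 + 1))
    (q := g x ^ 2 / (‖x‖ ^ 2 + 1) ^ 2) hX.le hX1 (by positivity)
    (by rw [div_le_one (by positivity)]; linarith) (by positivity) ?_ ?_
  · rw [← hN] at hp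
    rw [← hPs] at hp hL
    generalize (16 * ((‖x‖ ^ 2) ^ 2 - g x ^ 2) * _ + _ + _ + _ - _ : ℝ) = N at *
    rw [mul_assoc (36 * (‖x‖ ^ 2 + 1) * (1 + XX x) ^ 4)]
    have h4 : 1 ≤ (1 + XX x) ^ 4 := one_le_pow₀ (by linarith)
    have h5 : 36 * (‖x‖ ^ 2 + 1) * (1 + XX x) ^ 4 * (g x ^ 2 * (1 + XX x) ^ 4 * N) ≤
        36 * (‖x‖ ^ 2 + 1) * (1 + XX x) ^ 4 * (- XX x) := mul_le_mul_of_nonneg_left hp (by positivity)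
    have h6 : 36 * ((‖x‖ ^ 2 + 1) * XX x) * 1 ≤ 36 * ((‖x‖ ^ 2 + 1) * XX x) * (1 + XX x) ^ 4 :=
      mul_le_mul_of_nonneg_left h4 (by positivity)
    have h7 : 0 < (‖x‖ ^ 2 + 1) * XX x := by positivity
    linarith
  · apply le_of_sq_le_sq _ (by positivity)
    rw [← pow_mul, div_pow, one_pow, div_le_iff₀ (by positivity)]
    norm_num
    linarith [sq_nonneg (g x)]
  · rw [div_eq_iff (by positivity), mul_assoc, hX8]
    field_simp

lemma D2_sub {f f' : E → ℝ} {x : E} (hf : ContDiffAt ℝ 2 f x) (hg : ContDiffAt ℝ 2 f' x) (v w : E) :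
    D2 (fun y => f y - f' y) x v w = D2 f x v w - D2 f' x v w := by
  have : fderiv ℝ (fun y => f y - f' y) =ᶠ[𝓝 x] fun y => fderiv ℝ f y - fderiv ℝ f' y := by
    filter_upwards [cd_ev hf, cd_ev hg] with y h1 h2
    exact fderiv_fun_sub (cd_diff h1) (cd_diff h2)
  rw [D2, this.fderiv_eq, fderiv_fun_sub (cd_fderiv hf) (cd_fderiv hg)]
  rfl

/-- touching comparison principle -/
lemma touch {R : ℝ} {u b : E → ℝ} (hu : Continuous u) (hb : Continuous b)
    (hd : ∀ x ∈ ball (0 : E) R, 0 < g x → ContDiffAt ℝ 2 u x ∧ ContDiffAt ℝ 2 b x ∧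
      T (∇ b x) (D2 b x) < T (∇ u x) (D2 u x))
    (h0 : ∀ x ∈ closedBall (0 : E) R, g x = 0 → u x ≤ b x)
    (h1 : ∀ x ∈ sphere (0 : E) R, 0 < g x → u x ≤ b x) :
    ∀ x ∈ closedBall (0 : E) R, 0 ≤ g x → u x ≤ b x := by
  intro x hx hgx
  have hK : IsCompact (closedBall (0 : E) R ∩ {x | 0 ≤ g x}) :=
    (isCompact_closedBall 0 R).inter_right (isClosed_le continuous_const g_cont)
  obtain ⟨y, ⟨hy, hgy⟩, hmax⟩ := hK.exists_isMaxOn ⟨x, hx, hgx⟩ (hu.sub hb).continuousOn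
  have hxy := hmax ⟨hx, hgx⟩
  simp only [mem_setOf_eq, Pi.sub_apply] at hxy hgy
  suffices u y ≤ b y by linarith
  rcases hgy.eq_or_lt with h | h
  · exact h0 y hy h.symm
  by_cases hyR : y ∈ ball (0 : E) R
  swap
  · refine h1 y ?_ h
    rw [mem_sphere]; rw [mem_ball] at hyR; exact le_antisymm hy (not_lt.1 hyR)
  exfalso
  obtain ⟨c1, c2, c3⟩ := hd y hyR h
  have hlm : IsLocalMax (fun z => u z - b z) y := by
    filter_upwards [isOpen_ball.mem_nhds hyR, g_open.mem_nhds h] with z hz hz2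
    exact hmax ⟨ball_subset_closedBall hz, le_of_lt hz2⟩
  have hg0 := max_grad hlm
  rw [grad_sub (cd_diff c1) (cd_diff c2), sub_eq_zero] at hg0
  rw [hg0] at c3
  refine absurd c3 (not_lt.2 (T_mono _ fun w => ?_))
  have := max_D2 (c1.sub c2) hlm w
  change D2 (fun z => u z - b z) y w w ≤ 0 at this
  rw [D2_sub c1 c2] at this
  linarith

end BDG

open scoped RealInnerProductSpace
namespace BDG
open MeasureTheory Filter Topology Set Metric
open scoped NNReal ENNReal Gradient ContDiff

lemma sw_sw (x : E) : sw (sw x) = x := by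
  ext i
  rw [sw_apply, sw_apply]
  have h : i - 4 - 4 = i := by revert i; decide
  rw [h]

lemma J_sw (x : E) : J (sw x) = - sw (J x) := by
  ext i
  rw [J_apply, PiLp.neg_apply, sw_apply, sw_apply, J_apply]
  have h : (i - 4 < 4) = ¬ (i < 4) := by revert i; decide
  simp only [h]
  by_cases h2 : i < 4
  · simp [h2]
  · simp [h2]

lemma refl_apply (N y : E) : (ℝ ∙ N)ᗮ.reflection y = y - (2 * ⟪N, y⟫ / ‖N‖ ^ 2) • N := by
  rw [Submodule.reflection_orthogonal_apply, Submodule.reflection_singleton_apply]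
  simp only [RCLike.ofReal_real_eq_id, id_eq, neg_sub]
  congr 1
  rw [two_nsmul, ← add_smul]; congr 1; ring

lemma g_refl {N : E} {s : ℝ} (h : J N = s • N) (y : E) : g ((ℝ ∙ N)ᗮ.reflection y) = g y := by
  rw [refl_apply]
  have h1 : ⟪J y, N⟫ = s * ⟪N, y⟫ := by rw [J_symm, h, inner_smul_right, real_inner_comm]
  have h2 : ⟪J N, y⟫ = s * ⟪N, y⟫ := by rw [h, inner_smul_left]; simp
  have h3 : ⟪J N, N⟫ = s * ‖N‖ ^ 2 := by rw [h, inner_smul_left, real_inner_self_eq_norm_sq]; simp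
  simp only [g, map_sub, map_smul, inner_sub_left, inner_sub_right, inner_smul_left, inner_smul_right, h1, h2, h3]
  simp only [conj_trivial]
  by_cases hN : N = 0
  · simp [hN]
  · have : ‖N‖ ≠ 0 := norm_ne_zero_iff.2 hN
    field_simp
    ring

lemma refl_fix {N w : E} (h : ⟪N, w⟫ = 0) : (ℝ ∙ N)ᗮ.reflection w = w := by
  rw [refl_apply, h]; simp

/-- a symmetry fixing a given point of the cone and exchanging both sides -/
lemma exists_sym {x : E} (hx : g x = 0) : ∃ A : E ≃ₗᵢ[ℝ] E, (∀ y, g (A y) = - g y) ∧ A x = x := by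
  set p : E := (1 / 2 : ℝ) • (x + J x) with hp
  set q : E := (1 / 2 : ℝ) • (x - J x) with hq
  have hpq : p + q = x := by
    rw [hp, hq, ← smul_add, add_add_sub_cancel, ← two_smul ℝ x, smul_smul]; norm_num
  have hJp : J p = p := by rw [hp, map_smul, map_add, J_J, add_comm]
  have hJq : J q = - q := by rw [hq, map_smul, map_sub, J_J, ← smul_neg, neg_sub]
  have hn : ‖p‖ = ‖q‖ := by
    have h1 : ‖x + J x‖ ^ 2 = ‖x - J x‖ ^ 2 := by
      have : ⟪x, J x⟫ = 0 := by rw [real_inner_comm]; exact hx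
      rw [norm_add_sq_real, norm_sub_sq_real, this]; ring
    rw [hp, hq, norm_smul, norm_smul]
    congr 1
    exact (pow_left_inj₀ (norm_nonneg _) (norm_nonneg _) two_ne_zero).1 h1
  have hJsq : J (sw q) = sw q := by rw [J_sw, hJq, map_neg, neg_neg]
  have hJsp : J (sw p) = - sw p := by rw [J_sw, hJp]
  set N1 := p - sw q with hN1
  set N2 := q - sw p with hN2
  have hJ1 : J N1 = (1 : ℝ) • N1 := by rw [hN1, map_sub, hJp, hJsq, one_smul]
  have hJ2 : J N2 = (-1 : ℝ) • N2 := by rw [hN2, map_sub, hJq, hJsp, neg_one_smul]; abel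
  have orth : ∀ a b : E, J a = a → J b = -b → ⟪a, b⟫ = 0 := by
    intro a b ha hb
    have := J_symm a b
    rw [ha, hb, inner_neg_right] at this; linarith
  have o1 : ⟪N1, q⟫ = 0 := orth _ _ (by rw [hJ1, one_smul]) hJq
  have o2 : ⟪N2, sw q⟫ = 0 := by rw [real_inner_comm]; exact orth _ _ hJsq (by rw [hJ2, neg_one_smul])
  have r1 : (ℝ ∙ N1)ᗮ.reflection p = sw q := Submodule.reflection_sub (by rw [LinearIsometryEquiv.norm_map, hn])
  have r2 : (ℝ ∙ N2)ᗮ.reflection q = sw p := Submodule.reflection_sub (by rw [LinearIsometryEquiv.norm_map, hn])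
  refine ⟨((ℝ ∙ N1)ᗮ.reflection.trans (ℝ ∙ N2)ᗮ.reflection).trans sw, fun y => ?_, ?_⟩
  · change g (sw ((ℝ ∙ N2)ᗮ.reflection ((ℝ ∙ N1)ᗮ.reflection y))) = _
    rw [g_sw, g_refl hJ2, g_refl hJ1]
  · change sw ((ℝ ∙ N2)ᗮ.reflection ((ℝ ∙ N1)ᗮ.reflection x)) = x
    rw [← hpq, map_add, r1, refl_fix o1, map_add, refl_fix o2, r2, map_add, sw_sw, sw_sw, add_comm]

lemma b1_cont : Continuous b1 := g_cont.mul continuous_norm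

lemma b2_cont : Continuous b2 := by
  have hXX : Continuous XX := by
    unfold XX
    apply Real.continuous_exp.comp
    apply Continuous.add
    · apply continuous_const.mul
      exact (continuous_const.add (g_cont.pow 2)).log fun x => ne_of_gt (by positivity : (0:ℝ) < 1 + g x ^ 2)
    · apply continuous_const.mul
      exact ((continuous_norm.pow 2).add continuous_const).log fun x => ne_of_gt (by positivity : (0:ℝ) < ‖x‖ ^ 2 + 1)
  unfold b2
  exact ((continuous_const.mul g_cont).mul (((continuous_norm.pow 2).add continuous_const).sqrt)).mul
    ((continuous_const.add hXX).pow 4)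

lemma b2_le (x : E) (h : 0 ≤ g x) : b2 x ≤ 96 * (‖x‖ ^ 2 * (‖x‖ ^ 2 + 1)) := by
  have h1 : (1 + XX x) ^ 4 ≤ (1 + 1) ^ 4 := by
    have := XX_pos x; have := XX_le x; gcongr
  have h2 : Real.sqrt (‖x‖ ^ 2 + 1) ≤ ‖x‖ ^ 2 + 1 := by
    rw [Real.sqrt_le_left (by positivity)]; nlinarith [sq_nonneg ‖x‖]
  have h3 := (le_abs_self _).trans (abs_g_le x)
  have : 0 ≤ (1 + XX x) ^ 4 := by have := XX_pos x; positivity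
  calc b2 x ≤ 6 * ‖x‖ ^ 2 * (‖x‖ ^ 2 + 1) * (1 + 1) ^ 4 := by unfold b2; gcongr
    _ = _ := by ring

lemma b1_le_b2 (x : E) (h : 0 ≤ g x) : g x * ‖x‖ ≤ b2 x := by
  have h1 : 1 ≤ (1 + XX x) ^ 4 := one_le_pow₀ (by have := XX_pos x; linarith)
  have h2 : ‖x‖ ≤ Real.sqrt (‖x‖ ^ 2 + 1) := Real.le_sqrt_of_sq_le (by linarith)
  calc g x * ‖x‖ ≤ (6 * g x) * Real.sqrt (‖x‖ ^ 2 + 1) * 1 := by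
        rw [mul_one]; gcongr; linarith
    _ ≤ b2 x := by unfold b2; gcongr

/-- The approximating solutions with uniform barriers. -/
theorem exists_uR2 (R : ℝ) (hR : 0 < R) : ∃ (u : E → ℝ) (K : ℝ≥0), LipschitzWith K u ∧
    WS u (ball 0 R) ∧ (∀ x ∈ ball (0 : E) R, ContDiffAt ℝ 2 u x ∧ T (∇ u x) (D2 u x) = 0) ∧
    (∀ x ∈ ball (0 : E) R, |u x| ≤ 96 * (‖x‖ ^ 2 * (‖x‖ ^ 2 + 1))) ∧
    (∀ x ∈ ball (0 : E) R, 0 ≤ g x → g x * ‖x‖ ≤ u x) := by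
  obtain ⟨u, K, hu, hw, hs, hA⟩ := exists_uR R hR
  have hreg : ∀ x ∈ ball (0 : E) R, ContDiffAt ℝ 2 u x ∧ T (∇ u x) (D2 u x) = 0 := fun x hx =>
    regularity hu isOpen_ball hw hx
  have hcone : ∀ x ∈ closedBall (0 : E) R, g x = 0 → u x = 0 := by
    intro x hx hg
    rcases (mem_closedBall.1 hx).eq_or_lt with h | h
    · rw [hs x h, hg, mul_zero]
    · obtain ⟨A, hA1, hA2⟩ := exists_sym hg
      have := hA A hA1 x h
      rw [hA2] at this; linarith
  have hup : ∀ x ∈ closedBall (0 : E) R, 0 ≤ g x → u x ≤ b2 x := by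
    apply touch hu.continuous b2_cont
    · intro x hx hg
      exact ⟨(hreg x hx).1, (b2_op hg).1, by rw [(hreg x hx).2]; exact (b2_op hg).2⟩
    · intro x hx hg; rw [hcone x hx hg, b2, hg]; simp
    · intro x hx hg
      rw [hs x hx]
      have := b1_le_b2 x hg.le
      rw [mem_sphere_zero_iff_norm.1 hx] at this; linarith
  have hlow : ∀ x ∈ closedBall (0 : E) R, 0 ≤ g x → b1 x ≤ u x := by
    apply touch b1_cont hu.continuous
    · intro x hx hg
      exact ⟨(b1_op hg).1, (hreg x hx).1, by rw [(hreg x hx).2]; exact (b1_op hg).2⟩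
    · intro x hx hg; rw [hcone x hx hg, b1, hg]; simp
    · intro x hx hg
      rw [hs x hx, b1, mem_sphere_zero_iff_norm.1 hx]; linarith
  have hpos : ∀ x ∈ ball (0 : E) R, 0 ≤ g x → |u x| ≤ 96 * (‖x‖ ^ 2 * (‖x‖ ^ 2 + 1)) := by
    intro x hx hg
    have hx' := ball_subset_closedBall hx
    have h1 := hup x hx' hg
    have h2 := hlow x hx' hg
    have h3 : 0 ≤ b1 x := mul_nonneg hg (norm_nonneg x)
    rw [abs_of_nonneg (h3.trans h2)]
    exact h1.trans (b2_le x hg)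
  refine ⟨u, K, hu, hw, hreg, fun x hx => ?_, fun x hx hg => hlow x (ball_subset_closedBall hx) hg⟩
  rcases le_total 0 (g x) with hg | hg
  · exact hpos x hx hg
  · have h1 := hpos (sw x) (by simpa using hx) (by rw [g_sw]; linarith)
    rw [hA sw g_sw x hx, abs_neg, LinearIsometryEquiv.norm_map] at h1
    exact h1

end BDG

open scoped RealInnerProductSpace
namespace BDG
open MeasureTheory Filter Topology Set Metric
open scoped NNReal ENNReal Gradient ContDiff

/-- energy estimate for the difference of two weak solutions -/
lemma diff_energy {K : ℝ≥0} {B r R : ℝ} (hrR : r < R) : ∃ C : ℝ, 0 ≤ C ∧ ∀ v w : E → ℝ,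
    LipschitzWith K v → LipschitzWith K w → (∀ x, |v x| ≤ B) → (∀ x, |w x| ≤ B) →
    WS v (ball 0 R) → WS w (ball 0 R) →
    ∫ x in ball (0:E) r, ‖∇ v x - ∇ w x‖ ^ 2 ≤ C * ∫ x in ball (0:E) R, |v x - w x| := by
  obtain ⟨η, hη, hη0, hη1, hηr, hηR⟩ := cutoff hrR
  set L := (1 / (R - r)).toNNReal
  refine ⟨(1 + K) ^ 3 * (2 * L), by positivity, fun v w hv hw hvB hwB sv sw => ?_⟩
  set f : E → ℝ := fun x => v x - w x with hf
  have hfl : LipschitzWith (K + K) f := hv.sub hw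
  have hfb : ∀ x, |f x| ≤ B + B := fun x => (abs_sub _ _).trans (add_le_add (hvB x) (hwB x))
  have hηb : ∀ x, |η x| ≤ 1 := fun x => by rw [abs_of_nonneg (hη0 x)]; exact hη1 x
  have hψ := lip_mul hη hfl hηb hfb
  have hψ0 : ∀ x, x ∉ ball (0:E) R → η x * f x = 0 := fun x hx => by rw [hηR x hx, zero_mul]
  have e1 := sv _ _ hψ hψ0
  have e2 := sw _ _ hψ hψ0
  set W : E → E := fun x => DF (∇ v x) - DF (∇ w x) with hW
  have hWm : AEStronglyMeasurable W volume := (DF_grad_meas v).sub (DF_grad_meas w)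
  have hWb : ∀ x, ‖W x‖ ≤ 2 := fun x => by
    refine (norm_sub_le _ _).trans ?_
    have := norm_DF_le (∇ v x); have := norm_DF_le (∇ w x); linarith
  have hdz := ae_grad_zero hψ
  have hIntg : ∀ u : E → ℝ, Integrable (fun x => ⟪DF (∇ u x), ∇ (fun x => η x * f x) x⟫) := by
    intro u
    refine integrable_bdd_ae (D := ball (0:E) R) isBounded_ball ((DF_grad_meas u).inner (aesm_grad _))
      (C := 1 * _) (fun x => (norm_inner_le_norm _ _).trans
        (mul_le_mul (norm_DF_le _) (norm_grad_le hψ x) (norm_nonneg _) zero_le_one)) ?_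
    filter_upwards [hdz] with x hx hD
    rw [hx (hψ0 x hD), inner_zero_right]
  have e3 : ∫ x, ⟪W x, ∇ (fun x => η x * f x) x⟫ = 0 := by
    have : ∀ x, ⟪W x, ∇ (fun x => η x * f x) x⟫ = ⟪DF (∇ v x), ∇ (fun x => η x * f x) x⟫
        - ⟪DF (∇ w x), ∇ (fun x => η x * f x) x⟫ := fun x => by rw [hW, inner_sub_left]
    simp_rw [this]
    rw [integral_sub (hIntg v) (hIntg w), e1, e2, sub_zero]
  have hae : ∀ᵐ x, ⟪W x, ∇ (fun x => η x * f x) x⟫ = η x * ⟪W x, ∇ f x⟫ + f x * ⟪W x, ∇ η x⟫ := by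
    filter_upwards [ae_diff hη, ae_diff hfl] with x h1 h2
    rw [grad_mul h1 h2, inner_add_right, inner_smul_right, inner_smul_right]
  have hηz := ae_grad_zero hη
  have i1 : Integrable (fun x => η x * ⟪W x, ∇ f x⟫) := by
    refine integrable_bdd_ae (D := ball (0:E) R) isBounded_ball
      (hη.continuous.aestronglyMeasurable.mul (hWm.inner (aesm_grad _)))
      (C := 1 * (2 * (K + K : ℝ≥0))) (fun x => ?_) (Eventually.of_forall fun x hx => by rw [hηR x hx, zero_mul])
    rw [norm_mul]
    exact mul_le_mul (hηb x) ((norm_inner_le_norm _ _).trans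
        (mul_le_mul (hWb x) (norm_grad_le hfl x) (norm_nonneg _) zero_le_two)) (norm_nonneg _) zero_le_one
  have i2 : Integrable (fun x => f x * ⟪W x, ∇ η x⟫) := by
    refine integrable_bdd_ae (D := ball (0:E) R) isBounded_ball
      (hfl.continuous.aestronglyMeasurable.mul (hWm.inner (aesm_grad _)))
      (C := (B + B) * (2 * L)) (fun x => ?_) ?_
    · rw [norm_mul]
      exact mul_le_mul (hfb x) ((norm_inner_le_norm _ _).trans
        (mul_le_mul (hWb x) (norm_grad_le hη x) (norm_nonneg _) zero_le_two)) (norm_nonneg _)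
        ((abs_nonneg _).trans (hfb x))
    · filter_upwards [hηz] with x hx hD
      rw [hx (hηR x hD), inner_zero_right, mul_zero]
  rw [integral_congr_ae hae, integral_add i1 i2] at e3
  have hfi : IntegrableOn (fun x => |f x|) (ball (0:E) R) :=
    integrableOn_bdd isBounded_ball hfl.continuous.abs.aestronglyMeasurable (C := B + B)
      (fun x => by rw [Real.norm_eq_abs, abs_abs]; exact hfb x)
  have up : - ∫ x, f x * ⟪W x, ∇ η x⟫ ≤ (2 * L) * ∫ x in ball (0:E) R, |f x| := by
    rw [← integral_neg, ← integral_const_mul, ← integral_indicator measurableSet_ball]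
    apply integral_mono_ae i2.neg ((integrable_indicator_iff measurableSet_ball).2 (hfi.const_mul _))
    filter_upwards [hηz] with x hx
    by_cases hD : x ∈ ball (0:E) R
    · rw [indicator_of_mem hD]
      have h1 := norm_inner_le_norm (𝕜 := ℝ) (W x) (∇ η x)
      have h2 : ‖W x‖ * ‖∇ η x‖ ≤ 2 * L := mul_le_mul (hWb x) (norm_grad_le hη x) (norm_nonneg _) zero_le_two
      refine (neg_le_abs _).trans ?_
      rw [abs_mul, mul_comm]
      exact mul_le_mul_of_nonneg_right (h1.trans h2) (abs_nonneg _)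
    · rw [indicator_of_notMem hD]
      change - (f x * ⟪W x, ∇ η x⟫) ≤ 0
      rw [hx (hηR x hD), inner_zero_right, mul_zero, neg_zero]
  have gi : IntegrableOn (fun x => ‖∇ v x - ∇ w x‖ ^ 2) (ball (0:E) r) :=
    integrableOn_bdd isBounded_ball (((aesm_grad v).sub (aesm_grad w)).norm.pow 2) (C := (K + K) ^ 2)
      (fun x => by
        rw [norm_pow, norm_norm]
        gcongr
        exact (norm_sub_le _ _).trans (add_le_add (norm_grad_le hv x) (norm_grad_le hw x)))
  have lo : (1 / (1 + K) ^ 3) * ∫ x in ball (0:E) r, ‖∇ v x - ∇ w x‖ ^ 2 ≤ ∫ x, η x * ⟪W x, ∇ f x⟫ := by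
    rw [← integral_const_mul, ← integral_indicator measurableSet_ball]
    apply integral_mono_ae ((integrable_indicator_iff measurableSet_ball).2 (gi.const_mul _)) i1
    filter_upwards [ae_diff hv, ae_diff hw] with x h1 h2
    have h3 : ∇ f x = ∇ v x - ∇ w x := grad_sub h1 h2
    have h4 := DF_mono (F_grad_le hv x) (F_grad_le hw x)
    by_cases hD : x ∈ ball (0:E) r
    · rw [indicator_of_mem hD, hηr x (mem_ball_zero_iff.1 hD).le, one_mul, h3]
      exact h4
    · rw [indicator_of_notMem hD]
      change 0 ≤ η x * ⟪W x, ∇ f x⟫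
      rw [h3]
      exact mul_nonneg (hη0 x) (le_trans (by positivity) h4)
  have hK : (0:ℝ) < (1 + K) ^ 3 := by positivity
  have fin : (1 / (1 + K : ℝ) ^ 3) * ∫ x in ball (0:E) r, ‖∇ v x - ∇ w x‖ ^ 2
      ≤ (2 * L) * ∫ x in ball (0:E) R, |f x| := by linarith
  rw [one_div, inv_mul_le_iff₀ hK] at fin
  rw [mul_assoc]; exact fin

/-- limits of uniformly Lipschitz weak solutions are weak solutions -/
lemma ws_limit {v : ℕ → E → ℝ} {w : E → ℝ} {K : ℝ≥0} {B r R : ℝ} (hrR : r < R)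
    (hv : ∀ k, LipschitzWith K (v k)) (hB : ∀ k x, |v k x| ≤ B) (hs : ∀ k, WS (v k) (ball 0 R))
    (h : ∀ x, Tendsto (fun k => v k x) atTop (𝓝 (w x))) : WS w (ball 0 r) := by
  obtain ⟨C, hC, hE⟩ := diff_energy (K := K) (B := B) hrR
  have hw := lip_of_tendsto hv h
  have hwB : ∀ x, |w x| ≤ B := fun x => le_of_tendsto (h x).abs (Eventually.of_forall fun k => hB k x)
  have hi : ∀ a b : E → ℝ, LipschitzWith K a → LipschitzWith K b → (∀ x, |a x| ≤ B) → (∀ x, |b x| ≤ B) →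
      IntegrableOn (fun x => |a x - b x|) (ball (0:E) R) := fun a b ha hb ha' hb' =>
    integrableOn_bdd isBounded_ball (ha.continuous.sub hb.continuous).abs.aestronglyMeasurable (C := B + B)
      (fun x => by
        rw [Real.norm_eq_abs, abs_abs]; exact (abs_sub _ _).trans (add_le_add (ha' x) (hb' x)))
  have hI : Tendsto (fun k => ∫ x in ball (0:E) R, |v k x - w x|) atTop (𝓝 0) := by
    have : Tendsto (fun k => ∫ x in ball (0:E) R, |v k x - w x|) atTop (𝓝 (∫ x in ball (0:E) R, (0:ℝ))) := by
      apply tendsto_integral_of_dominated_convergence (fun _ => B + B)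
      · exact fun k => ((hv k).continuous.sub hw.continuous).abs.aestronglyMeasurable
      · exact integrableOn_bdd isBounded_ball aestronglyMeasurable_const (fun x => le_refl _)
      · exact fun k => Eventually.of_forall fun x => by
          rw [Real.norm_eq_abs, abs_abs]; exact (abs_sub _ _).trans (add_le_add (hB k x) (hwB x))
      · exact Eventually.of_forall fun x => by
          have := ((h x).sub_const (w x)).abs
          simpa using this
    simpa using this
  obtain ⟨φ, hφ, hg⟩ := grad_closure hv h 0 r (by
    intro ε hε
    have hI2 : Tendsto (fun k => C * ∫ x in ball (0:E) R, |v k x - w x|) atTop (𝓝 0) := by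
      simpa using hI.const_mul C
    obtain ⟨N, hN⟩ := eventually_atTop.1 (hI2.eventually (gt_mem_nhds (half_pos hε)))
    refine ⟨N, fun j hj k hk => (hE _ _ (hv j) (hv k) (hB j) (hB k) (hs j) (hs k)).trans ?_⟩
    have h1 := hN j hj; have h2 := hN k hk
    have h3 : ∫ x in ball (0:E) R, |v j x - v k x| ≤
        (∫ x in ball (0:E) R, |v j x - w x|) + ∫ x in ball (0:E) R, |v k x - w x| := by
      rw [← integral_add (hi _ _ (hv j) hw (hB j) hwB) (hi _ _ (hv k) hw (hB k) hwB)]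
      apply integral_mono (hi _ _ (hv j) (hv k) (hB j) (hB k))
        ((hi _ _ (hv j) hw (hB j) hwB).add (hi _ _ (hv k) hw (hB k) hwB))
      intro x
      have := abs_sub_le (v j x) (w x) (v k x)
      rw [abs_sub_comm (w x)] at this
      exact this
    have := mul_le_mul_of_nonneg_left h3 hC
    rw [mul_add] at this
    linarith)
  intro ψ M hψ hψ0
  have hψz := ae_grad_zero hψ
  have hlim : Tendsto (fun k => ∫ x, ⟪DF (∇ (v (φ k)) x), ∇ ψ x⟫) atTop (𝓝 (∫ x, ⟪DF (∇ w x), ∇ ψ x⟫)) := by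
    apply tendsto_integral_of_dominated_convergence (fun x => ‖∇ ψ x‖)
    · exact fun k => (DF_grad_meas _).inner (aesm_grad _)
    · refine integrable_bdd_ae (D := ball (0:E) r) isBounded_ball (aesm_grad ψ).norm (C := M)
        (fun x => by rw [norm_norm]; exact norm_grad_le hψ x) ?_
      filter_upwards [hψz] with x hx hD
      rw [hx (hψ0 x hD), norm_zero]
    · exact fun k => Eventually.of_forall fun x => (norm_inner_le_norm _ _).trans
        (mul_le_of_le_one_left (norm_nonneg _) (norm_DF_le _))
    · filter_upwards [hg, hψz] with x hx hz
      by_cases hD : x ∈ ball (0:E) r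
      · exact ((DF_continuous.tendsto _).comp (hx hD)).inner tendsto_const_nhds
      · rw [hz (hψ0 x hD)]; simp
  have hz : ∀ k, ∫ x, ⟪DF (∇ (v (φ k)) x), ∇ ψ x⟫ = 0 := fun k =>
    (hs (φ k)).mono (ball_subset_ball hrR.le) ψ M hψ hψ0
  simp_rw [hz] at hlim
  exact (tendsto_nhds_unique hlim tendsto_const_nhds)

end BDG

open scoped RealInnerProductSpace
namespace BDG
open MeasureTheory Filter Topology Set Metric
open scoped NNReal ENNReal Gradient ContDiff

/-- The entire solution. -/
theorem exists_entire : ∃ w : E → ℝ, (∀ x, ContDiffAt ℝ 2 w x ∧ T (∇ w x) (D2 w x) = 0) ∧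
    ∀ x, 0 ≤ g x → g x * ‖x‖ ≤ w x := by
  choose u K hu hws hreg hbd hlow using fun k : ℕ => exists_uR2 ((k : ℝ) + 1) (by positivity)
  set M : ℕ → ℝ := fun m => 96 * (((m:ℝ) + 2) ^ 2 * (((m:ℝ) + 2) ^ 2 + 1)) with hM
  have hM0 : ∀ m, 0 ≤ M m := fun m => by rw [hM]; positivity
  have hsub : ∀ m k : ℕ, m + 1 ≤ k → ball (0:E) ((m:ℝ) + 2) ⊆ ball 0 ((k:ℝ) + 1) := fun m k h =>
    ball_subset_ball (by have : ((m + 1 : ℕ) : ℝ) ≤ k := by exact_mod_cast h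
                         push_cast at this; linarith)
  have hb : ∀ m k : ℕ, m + 1 ≤ k → ∀ x ∈ ball (0:E) ((m:ℝ) + 2), |u k x| ≤ M m := by
    intro m k h x hx
    refine (hbd k x (hsub m k h hx)).trans ?_
    have : ‖x‖ ≤ (m:ℝ) + 2 := (mem_ball_zero_iff.1 hx).le
    change _ ≤ 96 * (((m:ℝ) + 2) ^ 2 * (((m:ℝ) + 2) ^ 2 + 1))
    gcongr
  have hL : ∀ m : ℕ, ∃ K : ℝ≥0, ∀ k, m + 1 ≤ k → LipschitzOnWith K (u k) (ball 0 m) := by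
    intro m
    obtain ⟨C, hC, hg⟩ := grad_bound (M m) 1 (hM0 m) one_pos
    refine ⟨C.toNNReal, fun k hk => ?_⟩
    apply (convex_ball (0:E) (m:ℝ)).lipschitzOnWith_of_nnnorm_fderiv_le (𝕜 := ℝ)
    · intro x hx
      have hx' := hsub m k hk (ball_subset_ball (by linarith) hx)
      exact ((hreg k x hx').1).differentiableAt (by simp)
    · intro x hx
      have h1 : ‖∇ (u k) x‖ ≤ C := by
        apply hg (u k) x (ball 0 ((m:ℝ) + 2)) isOpen_ball
        · intro y hy
          rw [mem_ball_zero_iff] at *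
          rw [mem_closedBall, dist_eq_norm] at hy
          have := norm_le_norm_add_norm_sub' y x
          linarith
        · exact fun y hy => (hreg k y (hsub m k hk hy)).1
        · exact fun y hy => (hreg k y (hsub m k hk hy)).2
        · exact hb m k hk
      rw [norm_grad] at h1
      rw [← NNReal.coe_le_coe, coe_nnnorm, Real.coe_toNNReal _ hC]
      exact h1
  obtain ⟨φ, w, hφ, hw⟩ := arzela (v := u)
    (fun m => by
      obtain ⟨K, hK⟩ := hL m
      exact ⟨K, eventually_atTop.2 ⟨m + 1, hK⟩⟩)
    (fun m => ⟨M m, eventually_atTop.2 ⟨m + 1, fun k hk x hx =>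
      hb m k hk x (ball_subset_ball (by linarith) hx)⟩⟩)
  refine ⟨w, fun x => ?_, fun x hx => ?_⟩
  · obtain ⟨n, hn⟩ := exists_nat_gt ‖x‖
    obtain ⟨L, hL⟩ := hL (n + 1)
    have hkk : ∀ k, n + 1 + 1 ≤ φ (k + (n + 2)) := fun k => by
      have := hφ.id_le (k + (n + 2)); simp at this; omega
    choose e he1 he2 using fun k => (hL (φ (k + (n + 2))) (hkk k)).extend_real
    set v : ℕ → E → ℝ := fun k x => max (min (e k x) (M (n + 1))) (-(M (n + 1))) with hv
    have vl : ∀ k, LipschitzWith L (v k) := fun k => ((he1 k).min_const _).max_const _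
    have vb : ∀ k y, |v k y| ≤ M (n + 1) := fun k y => by
      have := hM0 (n + 1)
      rw [abs_le]
      exact ⟨le_max_right _ _, max_le (min_le_right _ _) (by linarith)⟩
    have ve : ∀ k, ∀ y ∈ ball (0:E) ((n + 1 : ℕ) : ℝ), u (φ (k + (n + 2))) y = v k y := by
      intro k y hy
      have h1 := hb (n + 1) (φ (k + (n + 2))) (hkk k) y (ball_subset_ball (by linarith) hy)
      rw [abs_le] at h1
      rw [hv]
      simp only
      rw [← he2 k hy, min_eq_left h1.2, max_eq_left h1.1]
    have vs : ∀ k, WS (v k) (ball 0 ((n + 1 : ℕ) : ℝ)) := by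
      intro k
      refine WS.congr isOpen_ball ((hws (φ (k + (n + 2)))).mono ?_) (ve k)
      exact (ball_subset_ball (by linarith)).trans (hsub (n + 1) _ (hkk k))
    obtain ⟨θ, w', hθ, hw'⟩ := arzela (v := v)
      (fun m => ⟨L, Eventually.of_forall fun k => (vl k).lipschitzOnWith⟩)
      (fun m => ⟨M (n + 1), Eventually.of_forall fun k y _ => vb k y⟩)
    have hww : ∀ y ∈ ball (0:E) ((n + 1 : ℕ) : ℝ), w' y = w y := by
      intro y hy
      refine tendsto_nhds_unique (hw' y) ?_
      have h1 : Tendsto (fun k => θ k + (n + 2)) atTop atTop :=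
        tendsto_atTop_mono (fun k => Nat.le_add_right (θ k) (n + 2)) hθ.tendsto_atTop
      refine ((hw y).comp h1).congr fun k => ?_
      exact ve (θ k) y hy
    have hlt : (n : ℝ) < ((n + 1 : ℕ) : ℝ) := by push_cast; linarith
    have hwl := lip_of_tendsto (fun k => vl (θ k)) hw'
    have hws' : WS w' (ball 0 (n:ℝ)) := ws_limit hlt (fun k => vl (θ k)) (fun k => vb (θ k)) (fun k => vs (θ k)) hw'
    have hxn : x ∈ ball (0:E) (n:ℝ) := mem_ball_zero_iff.2 hn
    have hr := regularity hwl isOpen_ball hws' hxn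
    have hev : w' =ᶠ[𝓝 x] w := by
      filter_upwards [isOpen_ball.mem_nhds hxn] with y hy using hww y (ball_subset_ball hlt.le hy)
    rw [← grad_congr_ev hev, ← D2_congr hev]
    exact ⟨hr.1.congr_of_eventuallyEq hev.symm, hr.2⟩
  · obtain ⟨n, hn⟩ := exists_nat_gt ‖x‖
    refine ge_of_tendsto (hw x) (eventually_atTop.2 ⟨n, fun k hk => hlow (φ k) x ?_ hx⟩)
    have h1 : n ≤ φ k := hk.trans (hφ.id_le k)
    have h2 : (n : ℝ) ≤ φ k := by exact_mod_cast h1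
    exact mem_ball_zero_iff.2 (by linarith)

lemma g_ee0 (t : ℝ) : g (t • ee 0) = t ^ 2 := by
  simp [g, PiLp.inner_apply, J_apply, ee, Fin.sum_univ_eight, PiLp.smul_apply, sq]

lemma msp {w : E → ℝ} {x : E} (h : ContDiffAt ℝ 2 w x) (hT : T (∇ w x) (D2 w x) = 0) :
    (1 + ∑ j, pd w x j ^ 2) * (∑ j, pd2 w x j j) - ∑ j, ∑ k, pd w x j * pd w x k * pd2 w x j k = 0 := by
  have e1 : ∀ j, pd w x j = ∇ w x j := fun j => by
    rw [← inner_ee, grad_apply]; rfl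
  have e2 : ∀ j k, pd2 w x j k = D2 w x (ee j) (ee k) := fun j k => by
    rw [D2_symm h, D2_apply h]; rfl
  simp only [e1, e2]
  rw [← hT, T, norm_sq_eq]
  congr 1
  conv_rhs => rw [← sum_ee (∇ w x)]
  simp only [map_sum, map_smul, ContinuousLinearMap.sum_apply, ContinuousLinearMap.smul_apply, smul_eq_mul,
    Finset.mul_sum]
  rw [Finset.sum_comm]
  refine Finset.sum_congr rfl fun j _ => Finset.sum_congr rfl fun k _ => ?_
  ring

end BDG

theorem exists_nonlinear_entire_minimal_surface_dim_eight :
    ∃ u : EuclideanSpace ℝ (Fin 8) → ℝ, ContDiff ℝ 2 u ∧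
      (∀ x : EuclideanSpace ℝ (Fin 8),
        (1 + ∑ j, pd u x j ^ 2) * (∑ j, pd2 u x j j)
          - ∑ j, ∑ k, pd u x j * pd u x k * pd2 u x j k = 0) ∧
      ¬ ∃ (a : EuclideanSpace ℝ (Fin 8)) (c : ℝ),
          ∀ x : EuclideanSpace ℝ (Fin 8), u x = ⟪a, x⟫ + c := by
  obtain ⟨w, hw, hg⟩ := BDG.exists_entire
  refine ⟨w, contDiff_iff_contDiffAt.2 fun x => (hw x).1, fun x => BDG.msp (hw x).1 (hw x).2, ?_⟩
  rintro ⟨a, c, h⟩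
  set s : ℝ := ‖a‖ + |c| + 2 with hs
  have hs2 : 2 ≤ s := by have := norm_nonneg a; have := abs_nonneg c; linarith
  have h1 := hg (s • BDG.ee 0) (by rw [BDG.g_ee0]; positivity)
  rw [BDG.g_ee0, h, norm_smul, BDG.norm_ee, mul_one, Real.norm_of_nonneg (by linarith)] at h1
  have h2 : ⟪a, s • BDG.ee 0⟫ ≤ ‖a‖ * s := by
    refine (real_inner_le_norm _ _).trans ?_
    rw [norm_smul, BDG.norm_ee, mul_one, Real.norm_of_nonneg (by linarith)]
  have h3 := le_abs_self c
  have h4 := norm_nonneg a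
  have h5 := abs_nonneg c
  have h6 : ‖a‖ * s + |c| * s ≤ s * s := by nlinarith
  have h7 : s * s * 2 ≤ s ^ 2 * s := by nlinarith
  nlinarith
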